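/- Let n ≥ 2, Ω ⊂ ℝⁿ a bounded domain, and let f : Ω × ℝⁿ → ℝ be a Carathéodory function, convex in the second variable for a.e. x, satisfying for some 1 ≤ L < ∞, μ ≥ 0 and nonnegative g: |z|^p − g(x)^{p/(p−1)} ≤ f(x,z) ≤ L|z|^q + g(x)^{p/(p−1)} and f(x,2z) ≤ μ + L·f(x,z). Assume 1 ≤ p < n, 1 ≤ p < q < ∞, ε := min{1/q + 1/(n−1), 1} − 1/p > 0, and g^{1/(p−1)} ∈ L^{n,1}(Ω). Then there exists a constant c = c(L,n,p,q,Q) ∈ [1,∞) such that every Q-minimizer u of F[u,A] = ∫_A f(x,∇u) dx satisfies, for every x₀ ∈ Ω and R > 0 with B_R(x₀) ⋐ Ω, the estimate ‖u‖_{L^∞(B_{R/2}(x₀))} ≤ c ( R‖u‖_{\underline{W}^{1,p}(B_R)} + R‖u‖_{\underline{W}^{1,p}(B_R)}^{1 + (1/ε)(1/p − 1/n)(1 − p/q)} + ‖g^{1/(p−1)}‖_{L^{n,1}(B_R)} ). -/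

import Mathlib

open MeasureTheory Metric Set
open scoped ENNReal NNReal Topology

noncomputable section

/-- `du` is the weak gradient of `u` on the open set `Ω ⊆ ℝⁿ`, in the sense of
integration by parts against smooth compactly supported test functions. -/
def IsWeakGradOn (n : ℕ) (Ω : Set (EuclideanSpace ℝ (Fin n)))
    (u : EuclideanSpace ℝ (Fin n) → ℝ)
    (du : EuclideanSpace ℝ (Fin n) → EuclideanSpace ℝ (Fin n)) : Prop :=
  ∀ φ : EuclideanSpace ℝ (Fin n) → ℝ,
    ContDiff ℝ (⊤ : ℕ∞) φ → HasCompactSupport φ → tsupport φ ⊆ Ω →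
    ∀ i : Fin n,
      (∫ x in Ω, u x * (fderiv ℝ φ x (EuclideanSpace.single i (1 : ℝ))))
        = - ∫ x in Ω, du x i * φ x

/-- `u ∈ W^{1,1}_loc(Ω)` (with weak gradient `du`) is a `Q`-minimizer of the functional
`F[v,A] = ∫_A f(x, ∇v(x)) dx`: for every `φ ∈ W^{1,1}(Ω)` (with weak gradient `dφ`)
whose support is compactly contained in `Ω`, `F[u, supp φ] < ∞` (encoded as
integrability of `x ↦ f x (du x)` on `supp φ`) and
`F[u, supp φ] ≤ Q · F[u + φ, supp φ]`. -/
def IsQMinimizer (n : ℕ) (Ω : Set (EuclideanSpace ℝ (Fin n)))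
    (f : EuclideanSpace ℝ (Fin n) → EuclideanSpace ℝ (Fin n) → ℝ) (Q : ℝ)
    (u : EuclideanSpace ℝ (Fin n) → ℝ)
    (du : EuclideanSpace ℝ (Fin n) → EuclideanSpace ℝ (Fin n)) : Prop :=
  IsWeakGradOn n Ω u du ∧ LocallyIntegrableOn u Ω ∧ LocallyIntegrableOn du Ω ∧
  ∀ (φ : EuclideanSpace ℝ (Fin n) → ℝ)
    (dφ : EuclideanSpace ℝ (Fin n) → EuclideanSpace ℝ (Fin n)),
    IsWeakGradOn n Ω φ dφ → IntegrableOn φ Ω → IntegrableOn dφ Ω →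
    IsCompact (tsupport φ) → tsupport φ ⊆ Ω →
    IntegrableOn (fun x => f x (du x)) (tsupport φ) ∧
    (IntegrableOn (fun x => f x (du x + dφ x)) (tsupport φ) →
      (∫ x in tsupport φ, f x (du x)) ≤ Q * ∫ x in tsupport φ, f x (du x + dφ x))

/-- The nonincreasing rearrangement `h*(t) = inf {σ > 0 : |{|h| > σ}| ≤ t}` of a
function `h : ℝⁿ → ℝ`. -/
def rearr (n : ℕ) (h : EuclideanSpace ℝ (Fin n) → ℝ) (t : ℝ) : ℝ :=
  sInf {σ : ℝ | 0 < σ ∧ volume {x | σ < |h x|} ≤ ENNReal.ofReal t}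

/-- The Lorentz `L^{n,1}(Ω)` norm `∫_0^{|Ω|} t^{1/n} (h·χ_Ω)*(t) dt/t`. -/
def lorentzN1 (n : ℕ) (Ω : Set (EuclideanSpace ℝ (Fin n)))
    (h : EuclideanSpace ℝ (Fin n) → ℝ) : ℝ≥0∞ :=
  ∫⁻ t in Ioo (0 : ℝ) (volume Ω).toReal,
    ENNReal.ofReal (t ^ (1 / (n : ℝ)) * rearr n (Ω.indicator h) t / t)

/-- The scale-invariant norm `‖v‖_{\underline{L}^p(A)} := |A|^{−1/p} ‖v‖_{L^p(A)}`. -/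
def uLp (n : ℕ) (p : ℝ) (A : Set (EuclideanSpace ℝ (Fin n)))
    (v : EuclideanSpace ℝ (Fin n) → ℝ) : ℝ :=
  (volume A).toReal ^ (-(1 / p)) * (∫ x in A, |v x| ^ p) ^ (1 / p)

/-- The scale-invariant norm
`‖v‖_{\underline{W}^{1,p}(A)} := |A|^{−1/n} ‖v‖_{\underline{L}^p(A)} + ‖∇v‖_{\underline{L}^p(A)}`,
where `dv` denotes the (weak) gradient of `v`. -/
def uW1p (n : ℕ) (p : ℝ) (A : Set (EuclideanSpace ℝ (Fin n)))
    (v : EuclideanSpace ℝ (Fin n) → ℝ)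
    (dv : EuclideanSpace ℝ (Fin n) → EuclideanSpace ℝ (Fin n)) : ℝ :=
  (volume A).toReal ^ (-(1 / (n : ℝ))) * uLp n p A v +
    (volume A).toReal ^ (-(1 / p)) * (∫ x in A, ‖dv x‖ ^ p) ^ (1 / p)

section LocalBoundedness

open Filter
open scoped Convolution Gradient

set_option linter.unusedSectionVars false

section Mollification

variable {G F : Type*} [NormedAddCommGroup G] [NormedSpace ℝ G] [FiniteDimensional ℝ G]
  [MeasurableSpace G] [BorelSpace G] {μ : Measure G} [μ.IsAddHaarMeasure]
  [NormedAddCommGroup F] [NormedSpace ℝ F] [CompleteSpace F]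

theorem rpow_lintegral_le_of_isProbabilityMeasure {α : Type*} [MeasurableSpace α] {ν : Measure α}
    [IsProbabilityMeasure ν] {p : ℝ} (hp : 1 ≤ p) {k : α → ℝ≥0∞} (hk : AEMeasurable k ν) :
    (∫⁻ a, k a ∂ν) ^ p ≤ ∫⁻ a, k a ^ p ∂ν := by
  have h0 : 0 < p := by linarith
  rcases hp.eq_or_lt with rfl | hp1
  · simp
  have := ENNReal.lintegral_mul_le_Lp_mul_Lq ν (Real.HolderConjugate.conjExponent hp1) hk
    (aemeasurable_const (b := 1))
  simp only [Pi.mul_apply, mul_one, ENNReal.one_rpow, lintegral_const, measure_univ] at this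
  calc _ ≤ ((∫⁻ a, k a ^ p ∂ν) ^ (1 / p)) ^ p := by gcongr
    _ = _ := by rw [← ENNReal.rpow_mul, one_div_mul_cancel h0.ne', ENNReal.rpow_one]

theorem lintegral_rpow_lintegral_le {α β : Type*} [MeasurableSpace α] [MeasurableSpace β]
    {μ : Measure α} {ν : Measure β} [SFinite μ] [IsProbabilityMeasure ν] {p : ℝ} (hp : 1 ≤ p)
    {k : α → β → ℝ≥0∞} (hk : AEMeasurable (Function.uncurry k) (μ.prod ν)) {C : ℝ≥0∞}
    (hC : ∀ᵐ b ∂ν, ∫⁻ a, k a b ^ p ∂μ ≤ C) :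
    ∫⁻ a, (∫⁻ b, k a b ∂ν) ^ p ∂μ ≤ C := by
  calc ∫⁻ a, (∫⁻ b, k a b ∂ν) ^ p ∂μ ≤ ∫⁻ a, ∫⁻ b, k a b ^ p ∂ν ∂μ := by
        refine lintegral_mono_ae ?_
        obtain ⟨g, hg, hkg⟩ := hk
        filter_upwards [Measure.ae_ae_of_ae_prod hkg] with a ha
        exact rpow_lintegral_le_of_isProbabilityMeasure hp
          ⟨fun b => g (a, b), hg.comp measurable_prodMk_left, ha⟩
    _ = ∫⁻ b, ∫⁻ a, k a b ^ p ∂μ ∂ν := lintegral_lintegral_swap (hk.pow_const p)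
    _ ≤ ∫⁻ b, C ∂ν := lintegral_mono_ae hC
    _ = C := by simp

/-- Translation is continuous in `L^p`. -/
theorem MeasureTheory.MemLp.tendsto_translate {p : ℝ≥0∞} (hp1 : 1 ≤ p) (hpt : p ≠ ⊤) {v : G → F}
    (hv : MemLp v p μ) :
    Tendsto (fun t => eLpNorm (fun x => v (x - t) - v x) p μ) (𝓝 0) (𝓝 0) := by
  have : Fact (1 ≤ p) := ⟨hp1⟩
  let g : G → C(G, G) := fun t => ⟨fun x => x - t, by fun_prop⟩
  have hg : Continuous g := by
    refine ContinuousMap.continuous_of_continuous_uncurry _ ?_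
    change Continuous fun x : G × G => x.2 - x.1
    fun_prop
  have hgm : ∀ t, MeasurePreserving (g t) μ μ := fun t => measurePreserving_sub_right μ t
  have hc := Continuous.compMeasurePreservingLp (f := fun _ : G => hv.toLp v) continuous_const hg hgm hpt
  have h1 := (Lp.tendsto_Lp_iff_tendsto_eLpNorm' _ _).1 (hc.tendsto 0)
  refine h1.congr fun t => eLpNorm_congr_ae ?_
  have e1 := Lp.coeFn_compMeasurePreserving (hv.toLp v) (hgm t)
  have e2 := Lp.coeFn_compMeasurePreserving (hv.toLp v) (hgm 0)
  have e3 := (hgm t).quasiMeasurePreserving.ae_eq_comp hv.coeFn_toLp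
  have e4 := (hgm 0).quasiMeasurePreserving.ae_eq_comp hv.coeFn_toLp
  filter_upwards [e1, e2, e3, e4] with x h1 h2 h3 h4
  simp only [Pi.sub_apply, h1, h2, h3, h4]
  simp [g]


/-- The probability measure with density a normalized bump function. -/
def bumpMeasure (μ : Measure G) [μ.IsAddHaarMeasure] (φ : ContDiffBump (0 : G)) : Measure G :=
  μ.withDensity fun t => ENNReal.ofReal (φ.normed μ t)

instance (φ : ContDiffBump (0 : G)) : IsProbabilityMeasure (bumpMeasure μ φ) := by
  constructor
  rw [bumpMeasure, withDensity_apply _ MeasurableSet.univ, setLIntegral_univ,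
    ← ofReal_integral_eq_lintegral_ofReal φ.integrable_normed
      (.of_forall fun x => φ.nonneg_normed x), φ.integral_normed, ENNReal.ofReal_one]

theorem bumpMeasure_ae_mem_ball (φ : ContDiffBump (0 : G)) :
    ∀ᵐ t ∂bumpMeasure μ φ, t ∈ ball (0 : G) φ.rOut := by
  rw [bumpMeasure, ae_withDensity_iff (by have := φ.continuous_normed (μ := μ); fun_prop)]
  refine .of_forall fun t ht => ?_
  have : t ∈ Function.support (φ.normed μ) := fun h => ht (by simp [h])
  rwa [φ.support_normed_eq] at this

theorem integrable_bumpMeasure (φ : ContDiffBump (0 : G)) {v : G → F}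
    (hv : LocallyIntegrable v μ) (x : G) : Integrable (fun t => v (x - t)) (bumpMeasure μ φ) := by
  have hm : Measurable fun t => (φ.normed μ t).toNNReal := by
    have := φ.continuous_normed (μ := μ); fun_prop
  rw [bumpMeasure]
  change Integrable _ (μ.withDensity fun t => ((φ.normed μ t).toNNReal : ℝ≥0∞))
  rw [integrable_withDensity_iff_integrable_smul hm]
  have := (φ.hasCompactSupport_normed (μ := μ)).convolutionExists_left (ContinuousLinearMap.lsmul ℝ ℝ)
    φ.continuous_normed hv x
  refine this.congr (.of_forall fun t => ?_)
  simp [NNReal.smul_def, φ.nonneg_normed]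

theorem convolution_eq_integral_bumpMeasure (φ : ContDiffBump (0 : G)) (v : G → F) (x : G) :
    (φ.normed μ ⋆[ContinuousLinearMap.lsmul ℝ ℝ, μ] v) x = ∫ t, v (x - t) ∂bumpMeasure μ φ := by
  have hm : Measurable fun t => (φ.normed μ t).toNNReal := by
    have := φ.continuous_normed (μ := μ); fun_prop
  rw [bumpMeasure, convolution_lsmul]
  change _ = ∫ t, v (x - t) ∂(μ.withDensity fun t => ((φ.normed μ t).toNNReal : ℝ≥0∞))
  rw [integral_withDensity_eq_integral_smul hm]
  refine integral_congr_ae (.of_forall fun t => ?_)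
  simp [NNReal.smul_def, φ.nonneg_normed]

theorem bumpMeasure_absolutelyContinuous (φ : ContDiffBump (0 : G)) : bumpMeasure μ φ ≪ μ :=
  withDensity_absolutelyContinuous _ _

theorem aestronglyMeasurable_translate (φ : ContDiffBump (0 : G)) {v : G → F}
    (hv : AEStronglyMeasurable v μ) :
    AEStronglyMeasurable (fun z : G × G => v (z.1 - z.2)) (μ.prod (bumpMeasure μ φ)) := by
  have h1 : Measure.QuasiMeasurePreserving (fun z : G × G => z.1 - z.2) (μ.prod μ) μ :=
    quasiMeasurePreserving_sub_of_right_invariant μ μ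
  exact (hv.comp_quasiMeasurePreserving h1).mono_ac
    (Measure.AbsolutelyContinuous.rfl.prod (bumpMeasure_absolutelyContinuous φ))

theorem eLpNorm_le_of_enorm_le_lintegral {α β F' : Type*} [MeasurableSpace α] [MeasurableSpace β]
    [NormedAddCommGroup F'] {μ : Measure α} {ν : Measure β} [SFinite μ] [IsProbabilityMeasure ν]
    {p : ℝ≥0∞} (hp1 : 1 ≤ p) (hpt : p ≠ ⊤) {k : α → β → F} {c : α → F'}
    (hk : AEStronglyMeasurable (Function.uncurry k) (μ.prod ν))
    (hc : ∀ᵐ a ∂μ, ‖c a‖ₑ ≤ ∫⁻ b, ‖k a b‖ₑ ∂ν) {ε : ℝ≥0∞}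
    (hε : ∀ᵐ b ∂ν, eLpNorm (fun a => k a b) p μ ≤ ε) : eLpNorm c p μ ≤ ε := by
  have hp0 : p ≠ 0 := (one_pos.trans_le hp1).ne'
  have hpr : 1 ≤ p.toReal := by rwa [← ENNReal.ofReal_le_iff_le_toReal hpt, ENNReal.ofReal_one]
  have hp : 0 < p.toReal := by linarith
  simp only [eLpNorm_eq_lintegral_rpow_enorm_toReal hp0 hpt, one_div,
    ENNReal.rpow_inv_le_iff hp] at hε ⊢
  refine le_trans (lintegral_mono_ae ?_)
    (lintegral_rpow_lintegral_le hpr (k := fun a b => ‖k a b‖ₑ) hk.enorm hε)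
  filter_upwards [hc] with a ha
  gcongr

theorem eLpNorm_convolution_sub_le {p : ℝ≥0∞} (hp1 : 1 ≤ p) (hpt : p ≠ ⊤) {v : G → F}
    (hv : AEStronglyMeasurable v μ) (hvl : LocallyIntegrable v μ) (φ : ContDiffBump (0 : G))
    {ε : ℝ≥0∞}
    (hε : ∀ t ∈ ball (0 : G) φ.rOut, eLpNorm (fun x => v (x - t) - v x) p μ ≤ ε) :
    eLpNorm (fun x => (φ.normed μ ⋆[ContinuousLinearMap.lsmul ℝ ℝ, μ] v) x - v x) p μ ≤ ε := by
  refine eLpNorm_le_of_enorm_le_lintegral hp1 hpt (ν := bumpMeasure μ φ)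
    (k := fun x t => v (x - t) - v x) ?_ (.of_forall fun x => ?_) ?_
  · exact (aestronglyMeasurable_translate φ hv).sub (hv.comp_fst)
  · rw [convolution_eq_integral_bumpMeasure]
    refine le_trans (le_of_eq ?_) (enorm_integral_le_lintegral_enorm _)
    rw [integral_sub (integrable_bumpMeasure φ hvl x) (integrable_const _)]
    simp
  · filter_upwards [bumpMeasure_ae_mem_ball φ] with t ht using hε t ht

theorem eLpNorm_convolution_le {p : ℝ≥0∞} (hp1 : 1 ≤ p) (hpt : p ≠ ⊤) {v : G → F}
    (hv : AEStronglyMeasurable v μ) (φ : ContDiffBump (0 : G)) :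
    eLpNorm (φ.normed μ ⋆[ContinuousLinearMap.lsmul ℝ ℝ, μ] v) p μ ≤ eLpNorm v p μ := by
  refine eLpNorm_le_of_enorm_le_lintegral hp1 hpt (ν := bumpMeasure μ φ)
    (k := fun x t => v (x - t)) (aestronglyMeasurable_translate φ hv) (.of_forall fun x => ?_)
    (.of_forall fun t => ?_)
  · rw [convolution_eq_integral_bumpMeasure]
    exact enorm_integral_le_lintegral_enorm _
  · exact (eLpNorm_comp_measurePreserving hv (measurePreserving_sub_right μ t)).le

/-- Mollifications of an `L^p` function converge in `L^p`. -/
theorem MeasureTheory.MemLp.exists_forall_eLpNorm_convolution_sub_le {p : ℝ≥0∞} (hp1 : 1 ≤ p)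
    (hpt : p ≠ ⊤) {v : G → F} (hv : MemLp v p μ) {ε : ℝ≥0∞} (hε : ε ≠ 0) :
    ∃ δ > 0, ∀ φ : ContDiffBump (0 : G), φ.rOut ≤ δ →
      eLpNorm (fun x => (φ.normed μ ⋆[ContinuousLinearMap.lsmul ℝ ℝ, μ] v) x - v x) p μ ≤ ε := by
  have h := (hv.tendsto_translate hp1 hpt).eventually_le_const (pos_iff_ne_zero.2 hε)
  obtain ⟨δ, hδ, h⟩ := Metric.eventually_nhds_iff_ball.1 h
  exact ⟨δ, hδ, fun φ hφ => eLpNorm_convolution_sub_le hp1 hpt hv.1 (hv.locallyIntegrable hp1) φ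
    fun t ht => h t (ball_subset_ball hφ ht)⟩

end Mollification

/-- Dominated convergence in `L^p`. -/
theorem tendsto_eLpNorm_sub_of_dominated {α F : Type*} [MeasurableSpace α] [NormedAddCommGroup F]
    {μ : Measure α} {p : ℝ≥0∞} (hp0 : p ≠ 0) (hpt : p ≠ ⊤) {f : ℕ → α → F} {g : α → F}
    {b : α → ℝ} (hf : ∀ j, AEStronglyMeasurable (f j) μ) (hg : AEStronglyMeasurable g μ)
    (hb : MemLp b p μ) (hfb : ∀ j, ∀ᵐ x ∂μ, ‖f j x - g x‖ ≤ b x)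
    (h : ∀ᵐ x ∂μ, Tendsto (fun j => f j x) atTop (𝓝 (g x))) :
    Tendsto (fun j => eLpNorm (fun x => f j x - g x) p μ) atTop (𝓝 0) := by
  have hp : 0 < p.toReal := ENNReal.toReal_pos hp0 hpt
  simp only [eLpNorm_eq_lintegral_rpow_enorm_toReal hp0 hpt]
  have hlim : Tendsto (fun j => ∫⁻ x, ‖f j x - g x‖ₑ ^ p.toReal ∂μ) atTop (𝓝 (∫⁻ _, 0 ∂μ)) := by
    refine tendsto_lintegral_of_dominated_convergence' (fun x => ‖b x‖ₑ ^ p.toReal)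
      (fun j => ((hf j).sub hg).enorm.pow_const _) (fun j => ?_) ?_ ?_
    · filter_upwards [hfb j] with x hx
      gcongr
      rw [← ofReal_norm, ← ofReal_norm]
      exact ENNReal.ofReal_le_ofReal (hx.trans (le_abs_self _))
    · exact (lintegral_rpow_enorm_lt_top_of_eLpNorm_lt_top hp0 hpt hb.2).ne
    · filter_upwards [h] with x hx
      have : Tendsto (fun j => ‖f j x - g x‖ₑ) atTop (𝓝 0) := by
        have := (hx.sub_const (g x)).enorm
        simpa using this
      simpa [ENNReal.zero_rpow_of_pos hp] using this.ennrpow_const p.toReal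
  simp only [lintegral_zero] at hlim
  have := hlim.ennrpow_const (1 / p.toReal)
  rwa [ENNReal.zero_rpow_of_pos (by positivity)] at this

/-- `ℝⁿ` with its Euclidean structure. -/
abbrev Eu (n : ℕ) := EuclideanSpace ℝ (Fin n)

/-- `w` is continuously differentiable with gradient `dw`. -/
def IsC1 {n : ℕ} (w : Eu n → ℝ) (dw : Eu n → Eu n) : Prop :=
  Continuous dw ∧ ∀ x, HasGradientAt w (dw x) x

section C1

variable {n : ℕ} {w v : Eu n → ℝ} {dw dv : Eu n → Eu n}

theorem IsC1.hasFDerivAt (h : IsC1 w dw) (x : Eu n) :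
    HasFDerivAt w (InnerProductSpace.toDual ℝ _ (dw x)) x := h.2 x

theorem IsC1.continuous (h : IsC1 w dw) : Continuous w :=
  continuous_iff_continuousAt.2 fun x => (h.hasFDerivAt x).continuousAt

theorem IsC1.add (h : IsC1 w dw) (h' : IsC1 v dv) : IsC1 (fun x => w x + v x) (fun x => dw x + dv x) := by
  refine ⟨h.1.add h'.1, fun x => ?_⟩
  rw [hasGradientAt_iff_hasFDerivAt, map_add]
  exact (h.hasFDerivAt x).add (h'.hasFDerivAt x)

theorem IsC1.mul (h : IsC1 w dw) (h' : IsC1 v dv) :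
    IsC1 (fun x => w x * v x) (fun x => w x • dv x + v x • dw x) := by
  refine ⟨(h.continuous.smul h'.1).add (h'.continuous.smul h.1), fun x => ?_⟩
  rw [hasGradientAt_iff_hasFDerivAt, map_add]
  convert! (h.hasFDerivAt x).mul (h'.hasFDerivAt x) using 1
  simp

theorem IsC1.comp (h : IsC1 w dw) {g g' : ℝ → ℝ} (hg : Continuous g')
    (hgg : ∀ t, HasDerivAt g (g' t) t) : IsC1 (fun x => g (w x)) (fun x => g' (w x) • dw x) := by
  refine ⟨(hg.comp h.continuous).smul h.1, fun x => ?_⟩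
  rw [hasGradientAt_iff_hasFDerivAt]
  convert! (hgg (w x)).comp_hasFDerivAt x (h.hasFDerivAt x) using 1
  simp

theorem isC1_coord (i : Fin n) : IsC1 (fun x : Eu n => x i) (fun _ => EuclideanSpace.single i 1) := by
  refine ⟨continuous_const, fun x => ?_⟩
  rw [hasGradientAt_iff_hasFDerivAt]
  have := (EuclideanSpace.proj (𝕜 := ℝ) i : Eu n →L[ℝ] ℝ).hasFDerivAt (x := x)
  convert! this using 1
  ext y
  simp [EuclideanSpace.inner_single_left]

theorem isC1_const (c : ℝ) : IsC1 (fun _ : Eu n => c) (fun _ => 0) := by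
  refine ⟨continuous_const, fun x => ?_⟩
  rw [hasGradientAt_iff_hasFDerivAt, map_zero]
  exact hasFDerivAt_const _ _

theorem IsC1.support_grad (h : IsC1 w dw) {x : Eu n} (hx : x ∉ tsupport w) : dw x = 0 := by
  have h1 := h.hasFDerivAt x
  have h2 : HasFDerivAt w (0 : Eu n →L[ℝ] ℝ) x := by
    have : w =ᶠ[𝓝 x] fun _ => 0 := notMem_tsupport_iff_eventuallyEq.1 hx
    exact (hasFDerivAt_const (0 : ℝ) x).congr_of_eventuallyEq this
  simpa using h1.unique h2

theorem IsC1.hasCompactSupport_grad (h : IsC1 w dw) (hw : HasCompactSupport w) :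
    HasCompactSupport dw :=
  hw.mono' fun x hx => by
    by_contra hc
    exact hx (h.support_grad hc)

theorem IsC1.contDiff (h : IsC1 w dw) : ContDiff ℝ 1 w := by
  rw [contDiff_one_iff_fderiv]
  refine ⟨fun x => (h.hasFDerivAt x).differentiableAt, ?_⟩
  have : fderiv ℝ w = fun x => InnerProductSpace.toDual ℝ _ (dw x) :=
    funext fun x => (h.hasFDerivAt x).fderiv
  rw [this]
  exact (InnerProductSpace.toDual ℝ (Eu n)).continuous.comp h.1

theorem IsC1.norm_fderiv (h : IsC1 w dw) (x : Eu n) : ‖fderiv ℝ w x‖ = ‖dw x‖ := by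
  rw [(h.hasFDerivAt x).fderiv, LinearIsometryEquiv.norm_map]

theorem isC1_of_contDiff {w : Eu n → ℝ} (h : ContDiff ℝ 1 w) : IsC1 w (∇ w) := by
  rw [contDiff_one_iff_fderiv] at h
  exact ⟨(InnerProductSpace.toDual ℝ (Eu n)).symm.continuous.comp h.2,
    fun x => (h.1 x).hasGradientAt⟩

theorem IsC1.sum {ι : Type*} {s : Finset ι} {w : ι → Eu n → ℝ} {dw : ι → Eu n → Eu n}
    (h : ∀ i ∈ s, IsC1 (w i) (dw i)) :
    IsC1 (fun x => ∑ i ∈ s, w i x) (fun x => ∑ i ∈ s, dw i x) := by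
  classical
  induction s using Finset.induction_on with
  | empty => simpa using isC1_const 0
  | insert a s ha ih =>
    simp only [Finset.sum_insert ha]
    exact (h a (by simp)).add (ih fun i hi => h i (by simp [hi]))

end C1

/-- `v ∈ W^{1,p}(ℝⁿ)` with gradient `dv`, as the closure of compactly supported `C¹` functions. -/
structure Sob {n : ℕ} (p : ℝ≥0∞) (v : Eu n → ℝ) (dv : Eu n → Eu n) : Prop where
  memLp : MemLp v p volume
  memLp_grad : MemLp dv p volume
  approx : ∀ ε : ℝ≥0∞, ε ≠ 0 → ∃ w dw, IsC1 w dw ∧ HasCompactSupport w ∧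
    eLpNorm (fun x => w x - v x) p volume ≤ ε ∧ eLpNorm (fun x => dw x - dv x) p volume ≤ ε

/-- A bounded multiplier with bounded gradient, as a bounded pointwise limit of `C¹` functions. -/
def IsMult {n : ℕ} (η : Eu n → ℝ) (dη : Eu n → Eu n) : Prop :=
  ∃ M : ℝ, ∃ (e : ℕ → Eu n → ℝ) (de : ℕ → Eu n → Eu n), (∀ j, IsC1 (e j) (de j)) ∧
    (∀ j x, |e j x| ≤ M ∧ ‖de j x‖ ≤ M) ∧
    (∀ᵐ x, Tendsto (fun j => e j x) atTop (𝓝 (η x))) ∧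
    ∀ᵐ x, Tendsto (fun j => de j x) atTop (𝓝 (dη x))

section Sob

variable {n : ℕ} {p : ℝ≥0∞} {v η : Eu n → ℝ} {dv dη : Eu n → Eu n}

theorem IsC1.memLp {w : Eu n → ℝ} {dw : Eu n → Eu n} (h : IsC1 w dw) (hw : HasCompactSupport w) :
    MemLp w p volume ∧ MemLp dw p volume :=
  ⟨h.continuous.memLp_of_hasCompactSupport hw,
    h.1.memLp_of_hasCompactSupport (h.hasCompactSupport_grad hw)⟩

theorem IsC1.sob {w : Eu n → ℝ} {dw : Eu n → Eu n} (h : IsC1 w dw) (hw : HasCompactSupport w) :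
    Sob p w dw :=
  ⟨(h.memLp hw).1, (h.memLp hw).2, fun ε _ => ⟨w, dw, h, hw, by simp, by simp⟩⟩

theorem Sob.exists_seq (h : Sob p v dv) : ∃ (w : ℕ → Eu n → ℝ) (dw : ℕ → Eu n → Eu n),
    (∀ j, IsC1 (w j) (dw j)) ∧ (∀ j, HasCompactSupport (w j)) ∧
    Tendsto (fun j => eLpNorm (fun x => w j x - v x) p volume) atTop (𝓝 0) ∧
    Tendsto (fun j => eLpNorm (fun x => dw j x - dv x) p volume) atTop (𝓝 0) := by
  have hε : ∀ j : ℕ, ((j : ℝ≥0∞) + 1)⁻¹ ≠ 0 := fun j => by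
    simp [ENNReal.add_eq_top]
  choose w dw hw hc h1 h2 using fun j : ℕ => h.approx _ (hε j)
  have hl : Tendsto (fun j : ℕ => ((j : ℝ≥0∞) + 1)⁻¹) atTop (𝓝 0) := by
    have := ENNReal.tendsto_inv_nat_nhds_zero.comp (tendsto_add_atTop_nat 1)
    refine this.congr fun j => ?_
    simp
  exact ⟨w, dw, hw, hc, tendsto_of_tendsto_of_tendsto_of_le_of_le tendsto_const_nhds hl
    (fun _ => zero_le) h1, tendsto_of_tendsto_of_tendsto_of_le_of_le tendsto_const_nhds hl
    (fun _ => zero_le) h2⟩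

theorem Sob.exists_seq_ae (hp0 : p ≠ 0) (h : Sob p v dv) :
    ∃ (w : ℕ → Eu n → ℝ) (dw : ℕ → Eu n → Eu n),
    (∀ j, IsC1 (w j) (dw j)) ∧ (∀ j, HasCompactSupport (w j)) ∧
    Tendsto (fun j => eLpNorm (fun x => w j x - v x) p volume) atTop (𝓝 0) ∧
    Tendsto (fun j => eLpNorm (fun x => dw j x - dv x) p volume) atTop (𝓝 0) ∧
    (∀ᵐ x, Tendsto (fun j => w j x) atTop (𝓝 (v x))) ∧
    ∀ᵐ x, Tendsto (fun j => dw j x) atTop (𝓝 (dv x)) := by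
  obtain ⟨w, dw, hw, hc, h1, h2⟩ := h.exists_seq
  have m1 : TendstoInMeasure volume w atTop v := tendstoInMeasure_of_tendsto_eLpNorm hp0
    (fun j => (hw j).continuous.aestronglyMeasurable) h.memLp.1 h1
  obtain ⟨ns, hns, ha⟩ := m1.exists_seq_tendsto_ae
  have m2 : TendstoInMeasure volume (fun j => dw (ns j)) atTop dv :=
    tendstoInMeasure_of_tendsto_eLpNorm hp0
      (fun j => (hw _).1.aestronglyMeasurable) h.memLp_grad.1 (h2.comp hns.tendsto_atTop)
  obtain ⟨ms, hms, hb⟩ := m2.exists_seq_tendsto_ae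
  refine ⟨fun j => w (ns (ms j)), fun j => dw (ns (ms j)), fun _ => hw _, fun _ => hc _,
    h1.comp (hns.comp hms).tendsto_atTop, h2.comp (hns.comp hms).tendsto_atTop, ?_, hb⟩
  filter_upwards [ha] with x hx using hx.comp hms.tendsto_atTop

theorem Sob.of_seq (hp1 : 1 ≤ p) {f : ℕ → Eu n → ℝ} {df : ℕ → Eu n → Eu n} (hf : ∀ j, Sob p (f j) (df j))
    (hv : MemLp v p volume) (hdv : MemLp dv p volume)
    (h1 : Tendsto (fun j => eLpNorm (fun x => f j x - v x) p volume) atTop (𝓝 0))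
    (h2 : Tendsto (fun j => eLpNorm (fun x => df j x - dv x) p volume) atTop (𝓝 0)) :
    Sob p v dv := by
  refine ⟨hv, hdv, fun ε hε => ?_⟩
  have hε2 : ε / 2 ≠ 0 := (ENNReal.half_pos hε).ne'
  obtain ⟨j, hj1, hj2⟩ := ((h1.eventually_le_const (pos_iff_ne_zero.2 hε2)).and
    (h2.eventually_le_const (pos_iff_ne_zero.2 hε2))).exists
  obtain ⟨w, dw, hw, hc, h1, h2⟩ := (hf j).approx (ε / 2) hε2
  refine ⟨w, dw, hw, hc, ?_, ?_⟩
  · have := eLpNorm_add_le (μ := volume) (f := fun x => w x - f j x) (g := fun x => f j x - v x)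
      (hw.continuous.aestronglyMeasurable.sub (hf j).memLp.1) ((hf j).memLp.1.sub hv.1) hp1
    refine le_trans (le_of_eq ?_) (this.trans ((add_le_add h1 hj1).trans_eq (ENNReal.add_halves ε)))
    congr 1; ext x; simp
  · have := eLpNorm_add_le (μ := volume) (f := fun x => dw x - df j x) (g := fun x => df j x - dv x)
      (hw.1.aestronglyMeasurable.sub (hf j).memLp_grad.1) ((hf j).memLp_grad.1.sub hdv.1) hp1
    refine le_trans (le_of_eq ?_) (this.trans ((add_le_add h2 hj2).trans_eq (ENNReal.add_halves ε)))
    congr 1; ext x; simp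

theorem Sob.congr (h : Sob p v dv) {v' : Eu n → ℝ} {dv' : Eu n → Eu n} (h1 : v =ᵐ[volume] v')
    (h2 : dv =ᵐ[volume] dv') : Sob p v' dv' := by
  refine ⟨h.memLp.ae_eq h1, h.memLp_grad.ae_eq h2, fun ε hε => ?_⟩
  obtain ⟨w, dw, hw, hc, e1, e2⟩ := h.approx ε hε
  refine ⟨w, dw, hw, hc, e1.trans' (eLpNorm_congr_ae ?_).le, e2.trans' (eLpNorm_congr_ae ?_).le⟩
  · filter_upwards [h1] with x hx; rw [hx]
  · filter_upwards [h2] with x hx; rw [hx]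

/-- A sequence whose error is controlled by a vanishing sequence plus a dominated sequence. -/
theorem tendsto_eLpNorm_of_le_add {α F : Type*} [MeasurableSpace α] [NormedAddCommGroup F]
    {μ : Measure α} (hp1 : 1 ≤ p) {f a b : ℕ → α → F}
    (ha : ∀ j, AEStronglyMeasurable (a j) μ) (hb : ∀ j, AEStronglyMeasurable (b j) μ)
    (hf : ∀ j x, f j x = a j x + b j x)
    (h1 : Tendsto (fun j => eLpNorm (a j) p μ) atTop (𝓝 0))
    (h2 : Tendsto (fun j => eLpNorm (b j) p μ) atTop (𝓝 0)) :
    Tendsto (fun j => eLpNorm (f j) p μ) atTop (𝓝 0) := by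
  have := h1.add h2
  rw [add_zero] at this
  refine tendsto_of_tendsto_of_tendsto_of_le_of_le tendsto_const_nhds this (fun _ => zero_le)
    fun j => ?_
  have e : f j = a j + b j := funext fun x => hf j x
  rw [e]
  exact eLpNorm_add_le (ha j) (hb j) hp1

theorem tendsto_eLpNorm_of_norm_le {α F F' : Type*} [MeasurableSpace α] [NormedAddCommGroup F]
    [NormedAddCommGroup F'] {μ : Measure α} {f : ℕ → α → F} {a : ℕ → α → F'} (M : ℝ)
    (hf : ∀ j x, ‖f j x‖ ≤ M * ‖a j x‖)
    (h1 : Tendsto (fun j => eLpNorm (a j) p μ) atTop (𝓝 0)) :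
    Tendsto (fun j => eLpNorm (f j) p μ) atTop (𝓝 0) := by
  have := ENNReal.Tendsto.const_mul (a := ENNReal.ofReal M) h1 (Or.inr ENNReal.ofReal_ne_top)
  rw [mul_zero] at this
  exact tendsto_of_tendsto_of_tendsto_of_le_of_le tendsto_const_nhds this (fun _ => zero_le)
    fun j => eLpNorm_le_mul_eLpNorm_of_ae_le_mul (.of_forall (hf j)) p

theorem IsMult.bound (h : IsMult η dη) :
    AEStronglyMeasurable η volume ∧ AEStronglyMeasurable dη volume ∧
      ∃ M : ℝ, 0 ≤ M ∧ ∀ᵐ x, |η x| ≤ M ∧ ‖dη x‖ ≤ M := by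
  obtain ⟨M, e, de, he, hb, h1, h2⟩ := h
  refine ⟨aestronglyMeasurable_of_tendsto_ae atTop (fun j => (he j).continuous.aestronglyMeasurable)
    h1, aestronglyMeasurable_of_tendsto_ae atTop (fun j => (he j).1.aestronglyMeasurable) h2,
    M, (abs_nonneg _).trans (hb 0 0).1, ?_⟩
  filter_upwards [h1, h2] with x hx1 hx2
  exact ⟨le_of_tendsto hx1.abs (.of_forall fun j => (hb j x).1),
    le_of_tendsto hx2.norm (.of_forall fun j => (hb j x).2)⟩

theorem Sob.mult (hp1 : 1 ≤ p) (hpt : p ≠ ⊤) (h : Sob p v dv) (hη : IsMult η dη) :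
    Sob p (fun x => η x * v x) (fun x => η x • dv x + v x • dη x) := by
  have hp0 : p ≠ 0 := (one_pos.trans_le hp1).ne'
  obtain ⟨mη, mdη, M', hM', hbη⟩ := hη.bound
  obtain ⟨M, e, de, he, hb, h1, h2⟩ := hη
  obtain ⟨w, dw, hw, hc, t1, t2⟩ := h.exists_seq
  have hM : 0 ≤ M := (abs_nonneg _).trans (hb 0 0).1
  have i1 : MemLp (fun x => η x * v x) p volume := by
    refine (h.memLp.norm.const_mul M').mono (mη.mul h.memLp.1) ?_
    filter_upwards [hbη] with x hx
    simp only [norm_mul, Real.norm_eq_abs, abs_abs]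
    rw [abs_of_nonneg hM']; exact mul_le_mul_of_nonneg_right hx.1 (abs_nonneg _)
  have i2 : MemLp (fun x => η x • dv x) p volume := by
    refine (h.memLp_grad.norm.const_mul M').mono (mη.smul h.memLp_grad.1) ?_
    filter_upwards [hbη] with x hx
    rw [norm_smul, norm_mul, norm_norm, Real.norm_eq_abs, Real.norm_eq_abs, abs_of_nonneg hM']
    exact mul_le_mul_of_nonneg_right hx.1 (norm_nonneg _)
  have i3 : MemLp (fun x => v x • dη x) p volume := by
    refine (h.memLp.norm.const_mul M').mono (h.memLp.1.smul mdη) ?_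
    filter_upwards [hbη] with x hx
    rw [norm_smul, norm_mul, norm_norm, Real.norm_eq_abs M', abs_of_nonneg hM', mul_comm M']
    exact mul_le_mul_of_nonneg_left hx.2 (norm_nonneg _)
  have dom : ∀ {F : Type} [NormedAddCommGroup F] {k : ℕ → Eu n → F} {l : Eu n → F} {b : Eu n → ℝ},
      (∀ j, AEStronglyMeasurable (k j) volume) → AEStronglyMeasurable l volume → MemLp b p volume →
      (∀ j, ∀ᵐ x, ‖k j x - l x‖ ≤ (M + M') * ‖b x‖) →
      (∀ᵐ x, Tendsto (fun j => k j x) atTop (𝓝 (l x))) →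
      Tendsto (fun j => eLpNorm (fun x => k j x - l x) p volume) atTop (𝓝 0) :=
    fun hk hl hb hkl hlim =>
      tendsto_eLpNorm_sub_of_dominated hp0 hpt hk hl (hb.norm.const_mul (M + M')) hkl hlim
  have d1 : Tendsto (fun j => eLpNorm (fun x => e j x * v x - η x * v x) p volume) atTop (𝓝 0) := by
    refine dom (fun j => (he j).continuous.aestronglyMeasurable.mul h.memLp.1) i1.1 h.memLp
      (fun j => ?_) ?_
    · filter_upwards [hbη] with x hx
      rw [← sub_mul, norm_mul]
      gcongr
      exact (norm_sub_le _ _).trans (add_le_add (hb j x).1 hx.1)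
    · filter_upwards [h1] with x hx using hx.mul_const _
  have d2 : Tendsto (fun j => eLpNorm (fun x => e j x • dv x - η x • dv x) p volume) atTop (𝓝 0) := by
    refine dom (fun j => (he j).continuous.aestronglyMeasurable.smul h.memLp_grad.1) i2.1
      h.memLp_grad.norm (fun j => ?_) ?_
    · filter_upwards [hbη] with x hx
      rw [← sub_smul, norm_smul, norm_norm]
      gcongr
      exact (norm_sub_le _ _).trans (add_le_add (hb j x).1 hx.1)
    · filter_upwards [h1] with x hx using hx.smul_const _
  have d3 : Tendsto (fun j => eLpNorm (fun x => v x • de j x - v x • dη x) p volume) atTop (𝓝 0) := by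
    refine dom (fun j => h.memLp.1.smul (he j).1.aestronglyMeasurable) i3.1
      h.memLp (fun j => ?_) ?_
    · filter_upwards [hbη] with x hx
      rw [← smul_sub, norm_smul, mul_comm]
      gcongr
      exact (norm_sub_le _ _).trans (add_le_add (hb j x).2 hx.2)
    · filter_upwards [h2] with x hx using hx.const_smul _
  have a1 : Tendsto (fun j => eLpNorm (fun x => e j x * (w j x - v x)) p volume) atTop (𝓝 0) :=
    tendsto_eLpNorm_of_norm_le M (fun j x => by
      rw [norm_mul]; exact mul_le_mul_of_nonneg_right (hb j x).1 (norm_nonneg _)) t1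
  have a2 : Tendsto (fun j => eLpNorm (fun x => e j x • (dw j x - dv x)) p volume) atTop (𝓝 0) :=
    tendsto_eLpNorm_of_norm_le M (fun j x => by
      rw [norm_smul]; exact mul_le_mul_of_nonneg_right (hb j x).1 (norm_nonneg _)) t2
  have a3 : Tendsto (fun j => eLpNorm (fun x => (w j x - v x) • de j x) p volume) atTop (𝓝 0) :=
    tendsto_eLpNorm_of_norm_le M (fun j x => by
      rw [norm_smul, mul_comm]; exact mul_le_mul_of_nonneg_right (hb j x).2 (norm_nonneg _)) t1
  have me := fun j => (he j).continuous.aestronglyMeasurable (μ := volume)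
  have mde := fun j => (he j).1.aestronglyMeasurable (μ := volume)
  have mw := fun j => (hw j).continuous.aestronglyMeasurable (μ := volume)
  have mdw := fun j => (hw j).1.aestronglyMeasurable (μ := volume)
  have mv := h.memLp.1
  have mdv := h.memLp_grad.1
  refine Sob.of_seq hp1 (f := fun j x => e j x * w j x) (fun j => ((he j).mul (hw j)).sob ?_) i1
    (i2.add i3) ?_ ?_
  · exact (hc j).mul_left
  · exact tendsto_eLpNorm_of_le_add hp1 (a := fun j x => e j x * (w j x - v x))
      (b := fun j x => e j x * v x - η x * v x) (fun j => (me j).mul ((mw j).sub mv))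
      (fun j => ((me j).mul mv).sub i1.1) (fun j x => by ring) a1 d1
  · refine tendsto_eLpNorm_of_le_add hp1
      (a := fun j x => e j x • (dw j x - dv x) + (w j x - v x) • de j x)
      (b := fun j x => (e j x • dv x - η x • dv x) + (v x • de j x - v x • dη x))
      (fun j => ((me j).smul ((mdw j).sub mdv)).add (((mw j).sub mv).smul (mde j)))
      (fun j => (((me j).smul mdv).sub i2.1).add ((mv.smul (mde j)).sub i3.1))
      (fun j x => ?_) ?_ ?_
    · simp only [smul_sub, sub_smul]
      abel
    · exact tendsto_eLpNorm_of_le_add hp1 (fun j => (me j).smul ((mdw j).sub mdv))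
        (fun j => ((mw j).sub mv).smul (mde j)) (fun j x => rfl) a2 a3
    · exact tendsto_eLpNorm_of_le_add hp1 (fun j => ((me j).smul mdv).sub i2.1)
        (fun j => (mv.smul (mde j)).sub i3.1) (fun j x => rfl) d2 d3

end Sob

section Chain

variable {n : ℕ} {p : ℝ≥0∞} {v η : Eu n → ℝ} {dv dη : Eu n → Eu n}

theorem Sob.comp (hp1 : 1 ≤ p) (hpt : p ≠ ⊤) (h : Sob p v dv) {g g' : ℝ → ℝ} (hg : Continuous g')
    (hgg : ∀ t, HasDerivAt g (g' t) t) (g0 : g 0 = 0) {M : ℝ} (hM : ∀ t, |g' t| ≤ M) :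
    Sob p (fun x => g (v x)) (fun x => g' (v x) • dv x) := by
  have hp0 : p ≠ 0 := (one_pos.trans_le hp1).ne'
  have hM0 : 0 ≤ M := (abs_nonneg _).trans (hM 0)
  have hgc : Continuous g := continuous_iff_continuousAt.2 fun t => (hgg t).continuousAt
  have lip : ∀ s t, |g s - g t| ≤ M * |s - t| := fun s t => by
    have := Convex.norm_image_sub_le_of_norm_hasDerivWithin_le (f := g) (f' := g') (s := univ)
      (x := t) (y := s) (C := M) (fun x _ => (hgg x).hasDerivWithinAt) (fun x _ => hM x)
      convex_univ trivial trivial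
    simpa using this
  obtain ⟨w, dw, hw, hc, t1, t2, l1, l2⟩ := h.exists_seq_ae hp0
  have mv := h.memLp.1
  have mdv := h.memLp_grad.1
  have mdw := fun j => (hw j).1.aestronglyMeasurable (μ := volume)
  have mgw := fun j => (hg.comp (hw j).continuous).aestronglyMeasurable (μ := volume)
  have mgv := hg.comp_aestronglyMeasurable mv
  have i1 : MemLp (fun x => g (v x)) p volume := by
    refine (h.memLp.norm.const_mul M).mono (hgc.comp_aestronglyMeasurable mv) (.of_forall fun x => ?_)
    have := lip (v x) 0
    rw [g0, sub_zero, sub_zero] at this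
    simpa [abs_of_nonneg hM0] using this
  have i2 : MemLp (fun x => g' (v x) • dv x) p volume := by
    refine (h.memLp_grad.norm.const_mul M).mono (mgv.smul mdv) (.of_forall fun x => ?_)
    rw [norm_smul, norm_mul, norm_norm, Real.norm_eq_abs M, abs_of_nonneg hM0]
    exact mul_le_mul_of_nonneg_right (hM _) (norm_nonneg _)
  refine Sob.of_seq hp1 (f := fun j x => g (w j x)) (fun j => ((hw j).comp hg hgg).sob ?_) i1 i2 ?_ ?_
  · exact (hc j).comp_left g0
  · exact tendsto_eLpNorm_of_norm_le M (fun j x => lip _ _) t1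
  · refine tendsto_eLpNorm_of_le_add hp1 (a := fun j x => g' (w j x) • (dw j x - dv x))
      (b := fun j x => g' (w j x) • dv x - g' (v x) • dv x)
      (fun j => (mgw j).smul ((mdw j).sub mdv)) (fun j => ((mgw j).smul mdv).sub i2.1)
      (fun j x => by rw [smul_sub]; abel) ?_ ?_
    · exact tendsto_eLpNorm_of_norm_le M (fun j x => by
        rw [norm_smul]; exact mul_le_mul_of_nonneg_right (hM _) (norm_nonneg _)) t2
    · refine tendsto_eLpNorm_sub_of_dominated hp0 hpt (fun j => (mgw j).smul mdv) i2.1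
        (h.memLp_grad.norm.const_mul (M + M)) (fun j => .of_forall fun x => ?_) ?_
      · rw [← sub_smul, norm_smul]
        gcongr
        exact (norm_sub_le _ _).trans (add_le_add (hM _) (hM _))
      · filter_upwards [l1] with x hx
        exact ((hg.tendsto _).comp hx).smul_const _

/-- Steklov averages. -/
def steklov (m : ℕ) (Ψ : ℝ → ℝ) (t : ℝ) : ℝ := (m + 1 : ℝ) * ∫ s in (t - 1 / (m + 1 : ℝ))..t, Ψ s

def steklovDeriv (m : ℕ) (Ψ : ℝ → ℝ) (t : ℝ) : ℝ := (m + 1 : ℝ) * (Ψ t - Ψ (t - 1 / (m + 1 : ℝ)))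

theorem hasDerivAt_steklov (m : ℕ) {Ψ : ℝ → ℝ} (h : Continuous Ψ) (t : ℝ) :
    HasDerivAt (steklov m Ψ) (steklovDeriv m Ψ t) t := by
  have key : ∀ t : ℝ, steklov m Ψ t =
      (m + 1 : ℝ) * ((∫ s in (0:ℝ)..t, Ψ s) - ∫ s in (0:ℝ)..(t - 1 / (m + 1 : ℝ)), Ψ s) := fun t => by
    rw [steklov, intervalIntegral.integral_interval_sub_left (h.intervalIntegrable _ _)
      (h.intervalIntegrable _ _)]
  rw [show steklov m Ψ = _ from funext key]
  have h1 : ∀ t, HasDerivAt (fun t => ∫ s in (0:ℝ)..t, Ψ s) (Ψ t) t := fun t =>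
    intervalIntegral.integral_hasDerivAt_right (h.intervalIntegrable _ _)
      h.aestronglyMeasurable.stronglyMeasurableAtFilter h.continuousAt
  refine ((h1 t).sub ?_).const_mul _
  exact (h1 (t - 1 / (m + 1 : ℝ))).comp_sub_const t _

theorem continuous_steklovDeriv (m : ℕ) {Ψ : ℝ → ℝ} (h : Continuous Ψ) :
    Continuous (steklovDeriv m Ψ) := by unfold steklovDeriv; fun_prop

theorem abs_steklov_sub_le (m : ℕ) {Ψ : ℝ → ℝ} {K : ℝ≥0} (h : LipschitzWith K Ψ) (t : ℝ) :
    |steklov m Ψ t - Ψ t| ≤ K / (m + 1) := by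
  have hm : (0:ℝ) < m + 1 := by positivity
  have hi : ∀ a b, IntervalIntegrable Ψ volume a b := fun a b => h.continuous.intervalIntegrable a b
  have e : steklov m Ψ t - Ψ t = (m + 1 : ℝ) * ∫ s in (t - 1 / (m + 1 : ℝ))..t, (Ψ s - Ψ t) := by
    rw [intervalIntegral.integral_sub (hi _ _) (by simp), intervalIntegral.integral_const, steklov]
    simp; field_simp
  rw [e, abs_mul, abs_of_pos hm]
  have := intervalIntegral.norm_integral_le_of_norm_le_const (a := t - 1 / (m + 1 : ℝ)) (b := t)
    (f := fun s => Ψ s - Ψ t) (C := K / (m + 1)) fun s hs => by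
      rw [uIoc_of_le (by simp; positivity)] at hs
      have h1 := h.dist_le_mul s t
      rw [Real.dist_eq, Real.dist_eq] at h1
      refine h1.trans ?_
      rw [div_eq_mul_one_div]
      gcongr
      rw [abs_le]; constructor <;> linarith [hs.1, hs.2, one_div_pos.2 hm]
  rw [Real.norm_eq_abs] at this
  refine (mul_le_mul_of_nonneg_left this hm.le).trans ?_
  rw [sub_sub_cancel, abs_of_pos (by positivity)]
  apply le_of_eq; field_simp

theorem abs_steklovDeriv_le (m : ℕ) {Ψ : ℝ → ℝ} {K : ℝ≥0} (h : LipschitzWith K Ψ) (t : ℝ) :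
    |steklovDeriv m Ψ t| ≤ K := by
  have hm : (0:ℝ) < m + 1 := by positivity
  have h1 := h.dist_le_mul t (t - 1 / (m + 1 : ℝ))
  rw [Real.dist_eq, Real.dist_eq, sub_sub_cancel, abs_of_pos (one_div_pos.2 hm)] at h1
  rw [steklovDeriv, abs_mul, abs_of_pos hm]
  refine (mul_le_mul_of_nonneg_left h1 hm.le).trans (le_of_eq ?_)
  field_simp

theorem tendsto_one_div_add : Tendsto (fun m : ℕ => 1 / ((m : ℝ) + 1)) atTop (𝓝 0) :=
  tendsto_one_div_add_atTop_nhds_zero_nat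

theorem tendsto_steklov {Ψ : ℝ → ℝ} {K : ℝ≥0} (h : LipschitzWith K Ψ) (t : ℝ) :
    Tendsto (fun m => steklov m Ψ t) atTop (𝓝 (Ψ t)) := by
  rw [tendsto_iff_dist_tendsto_zero]
  refine squeeze_zero (fun _ => dist_nonneg) (g := fun m : ℕ => (K : ℝ) * (1 / (m + 1))) (fun m => ?_) ?_
  · have := abs_steklov_sub_le m h t
    rw [Real.dist_eq]; rwa [← div_eq_mul_one_div]
  · simpa using tendsto_one_div_add.const_mul (K : ℝ)

theorem tendsto_steklovDeriv {Ψ : ℝ → ℝ} {t d : ℝ} (h : HasDerivAt Ψ d t) :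
    Tendsto (fun m => steklovDeriv m Ψ t) atTop (𝓝 d) := by
  have h1 : Tendsto (fun m : ℕ => t - 1 / ((m : ℝ) + 1)) atTop (𝓝[≠] t) := by
    refine tendsto_nhdsWithin_iff.2 ⟨?_, .of_forall fun m => ?_⟩
    · simpa using (tendsto_const_nhds (x := t)).sub tendsto_one_div_add
    · have : (0:ℝ) < 1 / ((m : ℝ) + 1) := by positivity
      simp only [mem_compl_iff, mem_singleton_iff]; linarith
  refine (h.tendsto_slope.comp h1).congr fun m => ?_
  have hm : (m + 1 : ℝ) ≠ 0 := by positivity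
  simp only [Function.comp, slope, vsub_eq_sub, smul_eq_mul, steklovDeriv]
  field_simp
  ring

/-- Truncation of Sobolev functions. -/
theorem Sob.trunc (hp1 : 1 ≤ p) (hpt : p ≠ ⊤) (h : Sob p v dv) {k : ℝ} (hk : 0 ≤ k) :
    Sob p (fun x => max (v x - k) 0) ({x | k < v x}.indicator dv) := by
  have hp0 : p ≠ 0 := (one_pos.trans_le hp1).ne'
  set Ψ : ℝ → ℝ := fun t => max (t - k) 0 with hΨ
  have hL : LipschitzWith 1 Ψ := by
    refine LipschitzWith.max_const ?_ 0
    exact LipschitzWith.of_dist_le_mul fun x y => by simp [Real.dist_eq]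
  have mv := h.memLp.1
  have mdv := h.memLp_grad.1
  have hz : ∀ m : ℕ, steklov m Ψ 0 = 0 := fun m => by
    have : ∫ s in (0 - 1 / (m + 1 : ℝ))..0, Ψ s = 0 := by
      refine intervalIntegral.integral_zero_ae (.of_forall fun s hs => ?_)
      rw [uIoc_of_le (by simp; positivity)] at hs
      exact max_eq_right (by linarith [hs.2])
    rw [steklov, this, mul_zero]
  have hS : ∀ m : ℕ, Sob p (fun x => steklov m Ψ (v x)) (fun x => steklovDeriv m Ψ (v x) • dv x) :=
    fun m => h.comp hp1 hpt (continuous_steklovDeriv m hL.continuous)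
      (hasDerivAt_steklov m hL.continuous) (hz m) (M := 1) fun t => by
        simpa using abs_steklovDeriv_le m hL t
  have b1 : ∀ (m : ℕ) t, |steklov m Ψ t| ≤ |t| := fun m t => by
    have := Convex.norm_image_sub_le_of_norm_hasDerivWithin_le (f := steklov m Ψ)
      (f' := steklovDeriv m Ψ) (s := univ) (x := 0) (y := t) (C := 1)
      (fun x _ => (hasDerivAt_steklov m hL.continuous x).hasDerivWithinAt)
      (fun x _ => by simpa using abs_steklovDeriv_le m hL x) convex_univ trivial trivial
    simpa [hz m] using this
  have b2 : ∀ t, |Ψ t| ≤ |t| := fun t => by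
    simp only [hΨ]
    rw [abs_of_nonneg (le_max_right _ _)]
    exact max_le (by linarith [le_abs_self t]) (abs_nonneg _)
  have i1 : MemLp (fun x => Ψ (v x)) p volume := by
    refine h.memLp.mono (hL.continuous.comp_aestronglyMeasurable mv) (.of_forall fun x => b2 _)
  have hlim : ∀ t, Tendsto (fun m => steklovDeriv m Ψ t) atTop (𝓝 (if k < t then 1 else 0)) := by
    intro t
    split_ifs with ht
    · refine tendsto_steklovDeriv ?_
      have : (fun t => t - k) =ᶠ[𝓝 t] Ψ := by
        filter_upwards [lt_mem_nhds ht] with s hs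
        simp only [hΨ]; rw [max_eq_left]; linarith
      exact ((hasDerivAt_id t).sub_const k).congr_of_eventuallyEq this.symm
    · refine tendsto_const_nhds.congr fun m => ?_
      have : (0:ℝ) < 1 / ((m : ℝ) + 1) := by positivity
      simp only [steklovDeriv, hΨ]
      rw [max_eq_right (by linarith), max_eq_right (by linarith)]; simp
  have hind : ∀ x, {x | k < v x}.indicator dv x = (if k < v x then (1:ℝ) else 0) • dv x := fun x => by
    by_cases hx : k < v x <;> simp [indicator, hx]
  have i2 : MemLp ({x | k < v x}.indicator dv) p volume := by
    refine h.memLp_grad.mono ?_ (.of_forall fun x => norm_indicator_le_norm_self _ _)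
    exact aestronglyMeasurable_of_tendsto_ae atTop (fun m => (hS m).memLp_grad.1)
      (.of_forall fun x => by rw [hind]; exact (hlim _).smul_const _)
  refine Sob.of_seq hp1 hS i1 i2 ?_ ?_
  · refine tendsto_eLpNorm_sub_of_dominated hp0 hpt (fun j => (hS j).memLp.1) i1.1
      (h.memLp.norm.const_mul 2) (fun j => .of_forall fun x => ?_)
      (.of_forall fun x => tendsto_steklov hL _)
    have := (norm_sub_le (steklov j Ψ (v x)) (Ψ (v x))).trans (add_le_add (b1 j _) (b2 _))
    rw [Real.norm_eq_abs (v x)]; linarith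
  · refine tendsto_eLpNorm_sub_of_dominated hp0 hpt (fun j => (hS j).memLp_grad.1) i2.1
      (h.memLp_grad.norm.const_mul 2) (fun j => .of_forall fun x => ?_)
      (.of_forall fun x => by rw [hind]; exact (hlim _).smul_const _)
    rw [hind, ← sub_smul, norm_smul]
    gcongr
    refine (norm_sub_le _ _).trans ?_
    have h1 := abs_steklovDeriv_le j hL (v x)
    have h2 : ‖(if k < v x then (1:ℝ) else 0)‖ ≤ 1 := by split_ifs <;> simp
    simp only [NNReal.coe_one] at h1
    rw [Real.norm_eq_abs]; linarith

end Chain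

section Mult

variable {n : ℕ} {η ξ : Eu n → ℝ} {dη dξ : Eu n → Eu n}

theorem IsMult.add (h : IsMult η dη) (h' : IsMult ξ dξ) :
    IsMult (fun x => η x + ξ x) (fun x => dη x + dξ x) := by
  obtain ⟨M, e, de, he, hb, h1, h2⟩ := h
  obtain ⟨M', e', de', he', hb', h1', h2'⟩ := h'
  refine ⟨M + M', _, _, fun j => (he j).add (he' j), fun j x => ⟨?_, ?_⟩, ?_, ?_⟩
  · exact (abs_add_le _ _).trans (add_le_add (hb j x).1 (hb' j x).1)
  · exact (norm_add_le _ _).trans (add_le_add (hb j x).2 (hb' j x).2)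
  · filter_upwards [h1, h1'] with x a b using a.add b
  · filter_upwards [h2, h2'] with x a b using a.add b

theorem IsMult.mul (h : IsMult η dη) (h' : IsMult ξ dξ) :
    IsMult (fun x => η x * ξ x) (fun x => η x • dξ x + ξ x • dη x) := by
  obtain ⟨M, e, de, he, hb, h1, h2⟩ := h
  obtain ⟨M', e', de', he', hb', h1', h2'⟩ := h'
  have hM : 0 ≤ M := (abs_nonneg _).trans (hb 0 0).1
  have hM' : 0 ≤ M' := (abs_nonneg _).trans (hb' 0 0).1
  refine ⟨M * M' + M' * M, _, _, fun j => (he j).mul (he' j), fun j x => ⟨?_, ?_⟩, ?_, ?_⟩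
  · rw [abs_mul]
    have := mul_le_mul (hb j x).1 (hb' j x).1 (abs_nonneg _) hM
    nlinarith [mul_nonneg hM' hM]
  · refine (norm_add_le _ _).trans (add_le_add ?_ ?_)
    · rw [norm_smul]
      exact mul_le_mul (hb j x).1 (hb' j x).2 (norm_nonneg _) hM
    · rw [norm_smul]
      exact mul_le_mul (hb' j x).1 (hb j x).2 (norm_nonneg _) hM'
  · filter_upwards [h1, h1'] with x a b using a.mul b
  · filter_upwards [h2, h2', h1, h1'] with x a b c d using (c.smul b).add (d.smul a)

theorem IsMult.comp (h : IsMult η dη) {g g' : ℝ → ℝ} (hg : Continuous g')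
    (hgg : ∀ t, HasDerivAt g (g' t) t) : IsMult (fun x => g (η x)) (fun x => g' (η x) • dη x) := by
  obtain ⟨M, e, de, he, hb, h1, h2⟩ := h
  have hgc : Continuous g := continuous_iff_continuousAt.2 fun t => (hgg t).continuousAt
  have hM : 0 ≤ M := (abs_nonneg _).trans (hb 0 0).1
  obtain ⟨A, hA⟩ := (isCompact_Icc (a := -M) (b := M)).exists_bound_of_continuousOn hgc.continuousOn
  obtain ⟨B, hB⟩ := (isCompact_Icc (a := -M) (b := M)).exists_bound_of_continuousOn hg.continuousOn
  have hin : ∀ j x, e j x ∈ Icc (-M) M := fun j x => abs_le.1 (hb j x).1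
  have hB0 : 0 ≤ B := (norm_nonneg _).trans (hB _ (hin 0 0))
  refine ⟨max A (B * M), _, _, fun j => (he j).comp hg hgg, fun j x => ⟨?_, ?_⟩, ?_, ?_⟩
  · exact (hA _ (hin j x)).trans (le_max_left _ _)
  · rw [norm_smul]
    exact (mul_le_mul (hB _ (hin j x)) (hb j x).2 (norm_nonneg _) hB0).trans (le_max_right _ _)
  · filter_upwards [h1] with x a using (hgc.tendsto _).comp a
  · filter_upwards [h1, h2] with x a b using ((hg.tendsto _).comp a).smul b

theorem IsC1.isMult {w : Eu n → ℝ} {dw : Eu n → Eu n} (h : IsC1 w dw) {M : ℝ}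
    (hM : ∀ x, |w x| ≤ M ∧ ‖dw x‖ ≤ M) : IsMult w dw :=
  ⟨M, fun _ => w, fun _ => dw, fun _ => h, fun _ => hM, .of_forall fun _ => tendsto_const_nhds,
    .of_forall fun _ => tendsto_const_nhds⟩

theorem isMult_const (c : ℝ) : IsMult (fun _ : Eu n => c) (fun _ => 0) :=
  (isC1_const c).isMult (M := |c|) fun x => by simp

theorem IsMult.sum {ι : Type*} {s : Finset ι} {w : ι → Eu n → ℝ} {dw : ι → Eu n → Eu n}
    (h : ∀ i ∈ s, IsMult (w i) (dw i)) :
    IsMult (fun x => ∑ i ∈ s, w i x) (fun x => ∑ i ∈ s, dw i x) := by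
  classical
  induction s using Finset.induction_on with
  | empty => simpa using isMult_const 0
  | insert a s ha ih =>
    simp only [Finset.sum_insert ha]
    exact (h a (by simp)).add (ih fun i hi => h i (by simp [hi]))

theorem IsMult.exists_prod {ι : Type*} {s : Finset ι} {w : ι → Eu n → ℝ} {dw : ι → Eu n → Eu n}
    (h : ∀ i ∈ s, IsMult (w i) (dw i)) (h0 : ∀ i ∈ s, ∀ x, 0 ≤ w i x ∧ w i x ≤ 1) :
    ∃ d, IsMult (fun x => ∏ i ∈ s, w i x) d ∧ (∀ x, ‖d x‖ ≤ ∑ i ∈ s, ‖dw i x‖) ∧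
      ∀ x, (∃ i ∈ s, w i x = 0 ∧ dw i x = 0) → d x = 0 := by
  classical
  induction s using Finset.induction_on with
  | empty => exact ⟨fun _ => 0, by simpa using isMult_const 1, by simp, by simp⟩
  | insert a s ha ih =>
    simp only [Finset.prod_insert ha, Finset.sum_insert ha]
    obtain ⟨d, hd, hd1, hd2⟩ := ih (fun i hi => h i (by simp [hi])) (fun i hi => h0 i (by simp [hi]))
    refine ⟨_, (h a (by simp)).mul hd, fun x => ?_, fun x hx => ?_⟩
    · have ha := h0 a (by simp) x
      have hs0 : 0 ≤ ∏ i ∈ s, w i x := Finset.prod_nonneg fun i hi => (h0 i (by simp [hi]) x).1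
      have hs1 : ∏ i ∈ s, w i x ≤ 1 := Finset.prod_le_one
        (fun i hi => (h0 i (by simp [hi]) x).1) fun i hi => (h0 i (by simp [hi]) x).2
      refine (norm_add_le _ _).trans ?_
      rw [norm_smul, norm_smul, add_comm, Real.norm_of_nonneg ha.1, Real.norm_of_nonneg hs0]
      refine add_le_add (mul_le_of_le_one_left (norm_nonneg _) hs1) ?_
      exact (mul_le_of_le_one_left (norm_nonneg _) ha.2).trans (hd1 x)
    · obtain ⟨i, hi, h1, h2⟩ := hx
      rw [Finset.mem_insert] at hi
      rcases hi with rfl | hi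
      · simp [h1, h2]
      · have : ∏ i ∈ s, w i x = 0 := Finset.prod_eq_zero hi h1
        simp [hd2 x ⟨i, hi, h1, h2⟩, this]

theorem ae_coord {P : ℝ → Prop} (h : ∀ᵐ t, P t) (i : Fin n) : ∀ᵐ x : Eu n, P (x i) := by
  have h1 : Measure.QuasiMeasurePreserving (fun y : Fin n → ℝ => y i) volume volume :=
    Measure.quasiMeasurePreserving_eval (μ := fun _ : Fin n => (volume : Measure ℝ)) i
  have h2 := (PiLp.volume_preserving_ofLp (Fin n)).quasiMeasurePreserving
  exact (h1.comp h2).ae h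

theorem isMult_coord {Ψ ψ : ℝ → ℝ} {K : ℝ≥0} {M : ℝ} (h : LipschitzWith K Ψ) (hM : ∀ t, |Ψ t| ≤ M)
    (hd : ∀ᵐ t, HasDerivAt Ψ (ψ t) t) (i : Fin n) :
    IsMult (fun x : Eu n => Ψ (x i)) (fun x => ψ (x i) • EuclideanSpace.single i (1:ℝ)) := by
  refine ⟨M + K, fun m x => steklov m Ψ (x i),
    fun m x => steklovDeriv m Ψ (x i) • EuclideanSpace.single i (1:ℝ),
    fun m => (isC1_coord i).comp (continuous_steklovDeriv m h.continuous)
      (hasDerivAt_steklov m h.continuous), fun m x => ⟨?_, ?_⟩, ?_, ?_⟩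
  · have h1 := abs_steklov_sub_le m h (x i)
    have h2 := abs_sub_abs_le_abs_sub (steklov m Ψ (x i)) (Ψ (x i))
    have h3 : (K:ℝ) / (m + 1) ≤ K := div_le_self K.2 (by linarith [(m.cast_nonneg : (0:ℝ) ≤ m)])
    linarith [hM (x i)]
  · rw [norm_smul]
    have := abs_steklovDeriv_le m h (x i)
    have h0 : 0 ≤ M := (abs_nonneg _).trans (hM 0)
    simp only [Real.norm_eq_abs, PiLp.norm_single, abs_one, mul_one]
    linarith
  · exact .of_forall fun x => tendsto_steklov h _
  · filter_upwards [ae_coord hd i] with x hx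
    exact (tendsto_steklovDeriv hx).smul_const _

end Mult

theorem lintegral_le_of_tendsto_ae {α : Type*} [MeasurableSpace α] {μ : Measure α}
    {f : ℕ → α → ℝ≥0∞} {g : α → ℝ≥0∞} {b : ℕ → ℝ≥0∞} {B : ℝ≥0∞} (hf : ∀ j, AEMeasurable (f j) μ)
    (h : ∀ᵐ x ∂μ, Tendsto (fun j => f j x) atTop (𝓝 (g x))) (hb : ∀ j, ∫⁻ x, f j x ∂μ ≤ b j)
    (hB : Tendsto b atTop (𝓝 B)) : ∫⁻ x, g x ∂μ ≤ B := by
  calc ∫⁻ x, g x ∂μ = ∫⁻ x, liminf (fun j => f j x) atTop ∂μ :=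
        lintegral_congr_ae (h.mono fun x hx => hx.liminf_eq.symm)
    _ ≤ liminf (fun j => ∫⁻ x, f j x ∂μ) atTop := lintegral_liminf_le' hf
    _ ≤ liminf b atTop := liminf_le_liminf (.of_forall hb)
    _ = B := hB.liminf_eq

section Poincare

variable {n : ℕ} {w v : Eu n → ℝ} {dw dv : Eu n → Eu n}

instance : IsProbabilityMeasure ((volume : Measure ℝ).restrict (Ioc 0 1)) := ⟨by simp⟩

theorem IsC1.enorm_sub_rpow_le (h : IsC1 w dw) {p : ℝ} (hp : 1 ≤ p) (x v : Eu n) :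
    ‖w (x + v) - w x‖ₑ ^ p ≤ ∫⁻ t in Ioc (0:ℝ) 1, (‖v‖ₑ ^ p * ‖dw (x + t • v)‖ₑ ^ p) := by
  have hd : ∀ t ∈ uIcc (0:ℝ) 1, HasDerivAt (fun t : ℝ => w (x + t • v)) (inner ℝ (dw (x + t • v)) v) t := by
    intro t _
    have h1 : HasDerivAt (fun t : ℝ => x + t • v) v t := by
      simpa using ((hasDerivAt_id t).smul_const v).const_add x
    have := (h.hasFDerivAt (x + t • v)).comp_hasDerivAt t h1
    rw [InnerProductSpace.toDual_apply_apply] at this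
    exact this
  have hc : Continuous fun t : ℝ => dw (x + t • v) := h.1.comp (by fun_prop)
  have hi := intervalIntegral.integral_eq_sub_of_hasDerivAt hd
    (Continuous.intervalIntegrable (hc.inner continuous_const) _ _)
  simp only [one_smul, zero_smul, add_zero] at hi
  rw [← hi, intervalIntegral.integral_of_le zero_le_one]
  have hp0 : 0 ≤ p := by linarith
  calc _ ≤ (∫⁻ t in Ioc (0:ℝ) 1, ‖v‖ₑ * ‖dw (x + t • v)‖ₑ) ^ p := by
        gcongr
        refine (enorm_integral_le_lintegral_enorm _).trans (lintegral_mono fun t => ?_)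
        rw [← ofReal_norm, ← ofReal_norm, ← ofReal_norm, ← ENNReal.ofReal_mul (norm_nonneg _)]
        refine ENNReal.ofReal_le_ofReal ((norm_inner_le_norm _ _).trans (mul_comm _ _).le)
    _ ≤ ∫⁻ t in Ioc (0:ℝ) 1, (‖v‖ₑ * ‖dw (x + t • v)‖ₑ) ^ p :=
        rpow_lintegral_le_of_isProbabilityMeasure hp
          (hc.enorm.measurable.const_mul _).aemeasurable
    _ = _ := by simp_rw [ENNReal.mul_rpow_of_nonneg _ _ hp0]

theorem IsC1.lintegral_lintegral_sub_le (h : IsC1 w dw) {p : ℝ} (hp : 1 ≤ p) {P V : Set (Eu n)}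
    (hP : Convex ℝ P) (mP : MeasurableSet P) (mV : MeasurableSet V) {D : ℝ≥0∞}
    (hV : ∀ x ∈ P, ∀ y ∈ P, y - x ∈ V) (hD : ∀ v ∈ V, ‖v‖ₑ ≤ D) :
    ∫⁻ x in P, ∫⁻ y in P, ‖w y - w x‖ₑ ^ p ≤ volume V * D ^ p * ∫⁻ x in P, ‖dw x‖ₑ ^ p := by
  have hp0 : 0 ≤ p := by linarith
  set k : Eu n → ℝ≥0∞ := P.indicator fun x => ‖dw x‖ₑ ^ p with hk
  have mk : Measurable k := by
    have := h.1
    exact Measurable.indicator (by fun_prop) mP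
  set J : Eu n → Eu n → ℝ → ℝ≥0∞ := fun x v t => V.indicator (fun _ => D ^ p) v * k (x + t • v) with hJ
  have mJ : Measurable fun z : (Eu n × Eu n) × ℝ => J z.1.1 z.1.2 z.2 := by
    have m1 : Measurable (V.indicator fun _ : Eu n => D ^ p) := measurable_const.indicator mV
    exact (m1.comp (by fun_prop)).mul (mk.comp (by fun_prop))
  calc ∫⁻ x in P, ∫⁻ y in P, ‖w y - w x‖ₑ ^ p
      ≤ ∫⁻ x, ∫⁻ v, ∫⁻ t in Ioc (0:ℝ) 1, J x v t := by
        rw [← lintegral_indicator mP]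
        refine lintegral_mono fun x => ?_
        by_cases hx : x ∈ P
        swap
        · simp [hx]
        rw [indicator_of_mem hx, ← lintegral_indicator mP, ← lintegral_add_left_eq_self _ x]
        refine lintegral_mono fun v => ?_
        by_cases hv : x + v ∈ P
        swap
        · simp [hv]
        have hvV : v ∈ V := by simpa using hV x hx _ hv
        rw [indicator_of_mem hv]
        refine (h.enorm_sub_rpow_le hp x v).trans (setLIntegral_mono' measurableSet_Ioc fun t ht => ?_)
        have hm : x + t • v ∈ P := hP.add_smul_mem hx hv ⟨ht.1.le, ht.2⟩
        simp only [hJ, hk, indicator_of_mem hvV, indicator_of_mem hm]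
        have := hD v hvV
        gcongr
    _ = ∫⁻ v, ∫⁻ t in Ioc (0:ℝ) 1, ∫⁻ x, J x v t := by
        rw [lintegral_lintegral_swap]
        · refine lintegral_congr fun v => ?_
          rw [lintegral_lintegral_swap]
          exact (mJ.comp (show Measurable fun z : Eu n × ℝ => ((z.1, v), z.2) by fun_prop)).aemeasurable
        · exact (Measurable.lintegral_prod_right' (ν := volume.restrict (Ioc (0:ℝ) 1)) mJ).aemeasurable
    _ = ∫⁻ v, V.indicator (fun _ => D ^ p) v * ∫⁻ x, k x := by
        refine lintegral_congr fun v => ?_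
        have : ∀ t : ℝ, ∫⁻ x, J x v t = V.indicator (fun _ => D ^ p) v * ∫⁻ x, k x := fun t => by
          simp only [hJ]
          rw [lintegral_const_mul _ (show Measurable fun x => k (x + t • v) from mk.comp (by fun_prop)),
            lintegral_add_right_eq_self]
        simp [this]
    _ = _ := by
        rw [lintegral_mul_const _ (measurable_const.indicator mV), lintegral_indicator mV, hk,
          lintegral_indicator mP]
        simp [mul_comm]

theorem lintegral_lintegral_sub_le_of_tendsto {p : ℝ} (hp : 1 ≤ p) {P V : Set (Eu n)}
    (hP : Convex ℝ P) (mP : MeasurableSet P) (mV : MeasurableSet V) {D : ℝ≥0∞}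
    (hV : ∀ x ∈ P, ∀ y ∈ P, y - x ∈ V) (hD : ∀ v ∈ V, ‖v‖ₑ ≤ D) (hVD : volume V * D ^ p ≠ ⊤)
    {w : ℕ → Eu n → ℝ} {dw : ℕ → Eu n → Eu n} (hw : ∀ j, IsC1 (w j) (dw j)) {u : Eu n → ℝ}
    (hu : ∀ᵐ x ∂volume.restrict P, Tendsto (fun j => w j x) atTop (𝓝 (u x))) {b : ℕ → ℝ≥0∞}
    {B : ℝ≥0∞} (hb : ∀ j, ∫⁻ x in P, ‖dw j x‖ₑ ^ p ≤ b j) (hB : Tendsto b atTop (𝓝 B)) :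
    ∫⁻ x in P, ∫⁻ y in P, ‖u y - u x‖ₑ ^ p ≤ volume V * D ^ p * B := by
  have cont : ∀ j, Continuous (w j) := fun j => (hw j).continuous
  have mw : ∀ j, Measurable fun z : Eu n × Eu n => ‖w j z.2 - w j z.1‖ₑ ^ p := fun j => by
    have := cont j; fun_prop
  set ν := (volume.restrict P : Measure (Eu n)) with hν
  have ht : ∀ᵐ z ∂ν.prod ν, Tendsto (fun j => ‖w j z.2 - w j z.1‖ₑ ^ p) atTop
      (𝓝 (‖u z.2 - u z.1‖ₑ ^ p)) := by
    filter_upwards [Measure.quasiMeasurePreserving_fst.ae hu, Measure.quasiMeasurePreserving_snd.ae hu]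
      with z h1 h2
    exact ((ENNReal.continuous_rpow_const (y := p)).tendsto _).comp ((h2.sub h1).enorm)
  have mu : AEMeasurable (fun z : Eu n × Eu n => ‖u z.2 - u z.1‖ₑ ^ p) (ν.prod ν) :=
    aemeasurable_of_tendsto_metrizable_ae atTop (fun j => (mw j).aemeasurable) ht
  have e1 := lintegral_prod _ mu
  rw [← e1]
  refine lintegral_le_of_tendsto_ae (b := fun j => volume V * D ^ p * b j)
    (fun j => (mw j).aemeasurable) ht (fun j => ?_) (ENNReal.Tendsto.const_mul hB (Or.inr hVD))
  have e2 := lintegral_prod (μ := ν) (ν := ν) _ (mw j).aemeasurable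
  rw [e2]
  refine ((hw j).lintegral_lintegral_sub_le hp hP mP mV hV hD).trans ?_
  gcongr
  exact hb j

end Poincare

section WeakGrad

variable {n : ℕ} {u v : Eu n → ℝ} {du dv : Eu n → Eu n} {Ω : Set (Eu n)}

theorem tendsto_integral_mul_of_tendsto_eLpNorm {α : Type*} [MeasurableSpace α] {μ : Measure α}
    {p q : ℝ≥0∞} [hpq : ENNReal.HolderTriple p q 1] {f : ℕ → α → ℝ} {g G : α → ℝ}
    (hf : ∀ j, MemLp (f j) p μ) (hg : MemLp g p μ) (hG : MemLp G q μ)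
    (h : Tendsto (fun j => eLpNorm (fun x => f j x - g x) p μ) atTop (𝓝 0)) :
    Tendsto (fun j => ∫ x, f j x * G x ∂μ) atTop (𝓝 (∫ x, g x * G x ∂μ)) := by
  refine tendsto_integral_of_L1 _ (memLp_one_iff_integrable.1 (hG.mul' hg (r := 1))).1
    (.of_forall fun j => memLp_one_iff_integrable.1 (hG.mul' (hf j) (r := 1))) ?_
  have h2 : Tendsto (fun j => eLpNorm (fun x => f j x - g x) p μ * eLpNorm G q μ) atTop (𝓝 0) := by
    simpa using ENNReal.Tendsto.mul_const (b := eLpNorm G q μ) h (Or.inr hG.2.ne)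
  refine tendsto_of_tendsto_of_tendsto_of_le_of_le tendsto_const_nhds h2 (fun _ => zero_le) fun j => ?_
  have := eLpNorm_smul_le_mul_eLpNorm (p := p) (q := q) (r := 1) hG.1 ((hf j).sub hg).1
  rw [eLpNorm_one_eq_lintegral_enorm] at this
  refine le_trans (le_of_eq ?_) this
  refine lintegral_congr fun x => ?_
  simp [sub_mul]

theorem IsC1.fderiv_single {w : Eu n → ℝ} {dw : Eu n → Eu n} (h : IsC1 w dw) (x : Eu n) (i : Fin n) :
    fderiv ℝ w x (EuclideanSpace.single i 1) = dw x i := by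
  rw [(h.hasFDerivAt x).fderiv]
  simp [EuclideanSpace.inner_single_right]

theorem Sob.isWeakGradOn {p : ℝ≥0∞} (hp1 : 1 ≤ p) (h : Sob p v dv) (Ω : Set (Eu n)) :
    IsWeakGradOn n Ω v dv := by
  intro φ hφ hc hs i
  obtain ⟨w, dw, hw, hwc, t1, t2⟩ := h.exists_seq
  have hφ1 : ContDiff ℝ 1 φ := hφ.of_le (by exact_mod_cast le_top)
  have cφ := isC1_of_contDiff hφ1
  have z1 : ∀ x ∉ Ω, v x * fderiv ℝ φ x (EuclideanSpace.single i 1) = 0 := fun x hx => by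
    rw [cφ.fderiv_single, cφ.support_grad fun h => hx (hs h)]; simp
  have z2 : ∀ x ∉ Ω, dv x i * φ x = 0 := fun x hx => by
    rw [image_eq_zero_of_notMem_tsupport fun h => hx (hs h), mul_zero]
  rw [setIntegral_eq_integral_of_forall_compl_eq_zero z1,
    setIntegral_eq_integral_of_forall_compl_eq_zero z2]
  set q := ENNReal.conjExponent p
  have : ENNReal.HolderConjugate p q := ENNReal.HolderConjugate.conjExponent hp1
  have g1 : MemLp (fun x => fderiv ℝ φ x (EuclideanSpace.single i 1)) q volume := by
    refine Continuous.memLp_of_hasCompactSupport ((hφ1.continuous_fderiv one_ne_zero).clm_apply continuous_const) ?_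
    exact hc.fderiv_apply ℝ _
  have g2 : MemLp φ q volume := hφ.continuous.memLp_of_hasCompactSupport hc
  have l1 := tendsto_integral_mul_of_tendsto_eLpNorm (fun j => ((hw j).memLp (hwc j)).1) h.memLp g1 t1
  have mi : ∀ {f : Eu n → Eu n}, MemLp f p volume → MemLp (fun x => f x i) p volume := fun hf =>
    hf.of_le ((EuclideanSpace.proj (𝕜 := ℝ) i).continuous.comp_aestronglyMeasurable hf.1)
      (.of_forall fun x => PiLp.norm_apply_le _ _)
  have t3 : Tendsto (fun j => eLpNorm (fun x => dw j x i - dv x i) p volume) atTop (𝓝 0) :=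
    tendsto_of_tendsto_of_tendsto_of_le_of_le tendsto_const_nhds t2 (fun _ => zero_le) fun j =>
      eLpNorm_mono fun x => PiLp.norm_apply_le (dw j x - dv x) i
  have l2 := tendsto_integral_mul_of_tendsto_eLpNorm (fun j => mi ((hw j).memLp (hwc j)).2)
    (mi h.memLp_grad) g2 t3
  refine tendsto_nhds_unique l1 (l2.neg.congr fun j => ?_)
  have wc := (hw j).continuous
  have wdc := (hw j).1
  have fc : Continuous fun x => fderiv ℝ φ x (EuclideanSpace.single i (1:ℝ)) :=
    (hφ1.continuous_fderiv one_ne_zero).clm_apply continuous_const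
  have dwi : Continuous fun x => dw j x i := (EuclideanSpace.proj (𝕜 := ℝ) i).continuous.comp wdc
  have := integral_mul_fderiv_eq_neg_fderiv_mul_of_integrable (μ := volume) (𝕜 := ℝ)
    (f := w j) (g := φ) (v := EuclideanSpace.single i (1:ℝ)) ?_ ?_ ?_
    (fun x _ => ((hw j).hasFDerivAt x).differentiableAt) (fun x _ => (hφ1.differentiable one_ne_zero) x)
  · rw [this]
    simp_rw [(hw j).fderiv_single]
  · simp_rw [(hw j).fderiv_single]
    exact (dwi.mul hφ.continuous).integrable_of_hasCompactSupport hc.mul_left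
  · exact (wc.mul fc).integrable_of_hasCompactSupport (hwc j).mul_right
  · exact (wc.mul hφ.continuous).integrable_of_hasCompactSupport (hwc j).mul_right

theorem isC1_convolution {U : Eu n → ℝ} {dU : Eu n → Eu n} (h : IsWeakGradOn n univ U dU)
    (hU : LocallyIntegrable U) (hdU : LocallyIntegrable dU) (ρ : ContDiffBump (0 : Eu n)) :
    IsC1 (ρ.normed volume ⋆[ContinuousLinearMap.lsmul ℝ ℝ, volume] U)
      (ρ.normed volume ⋆[ContinuousLinearMap.lsmul ℝ ℝ, volume] dU) := by
  have cs := ρ.hasCompactSupport_normed (μ := volume)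
  refine ⟨cs.continuous_convolution_left _ ρ.continuous_normed hdU, fun x => ?_⟩
  rw [hasGradientAt_iff_hasFDerivAt]
  have cd : ContDiff ℝ (1 : ℕ∞) (ρ.normed (volume : Measure (Eu n))) := ρ.contDiff_normed
  have cd' : ContDiff ℝ (⊤ : ℕ∞) (ρ.normed (volume : Measure (Eu n))) := ρ.contDiff_normed
  have h1 := cs.hasFDerivAt_convolution_left (ContinuousLinearMap.lsmul ℝ ℝ) (μ := volume)
    (by exact_mod_cast cd) hU x
  convert! h1 using 1
  refine ContinuousLinearMap.coe_injective ((EuclideanSpace.basisFun (Fin n) ℝ).toBasis.ext fun i => ?_)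
  have ex1 : Integrable (fun t => (ρ.normed volume t) • dU (x - t)) volume :=
    cs.convolutionExists_left (ContinuousLinearMap.lsmul ℝ ℝ) ρ.continuous_normed hdU x
  have ex2 := (cs.fderiv ℝ).convolutionExists_left ((ContinuousLinearMap.lsmul ℝ ℝ (E := ℝ)).precompL (Eu n))
    (μ := volume) (cd.continuous_fderiv (by simp)) hU x
  have e1 : (ρ.normed volume ⋆[ContinuousLinearMap.lsmul ℝ ℝ, volume] dU) x i
      = ∫ s, dU s i * ρ.normed volume (x - s) := by
    rw [convolution_lsmul]
    have := ContinuousLinearMap.integral_comp_comm (EuclideanSpace.proj (𝕜 := ℝ) i) ex1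
    simp only [PiLp.proj_apply, PiLp.smul_apply, smul_eq_mul] at this
    rw [← this, ← integral_sub_left_eq_self _ volume x]
    simp [mul_comm]
  have e2 : (fderiv ℝ (ρ.normed volume) ⋆[(ContinuousLinearMap.lsmul ℝ ℝ).precompL (Eu n), volume] U) x
      (EuclideanSpace.single i 1)
      = ∫ s, U s * fderiv ℝ (ρ.normed volume) (x - s) (EuclideanSpace.single i 1) := by
    rw [convolution, ContinuousLinearMap.integral_apply ex2, ← integral_sub_left_eq_self _ volume x]
    simp [ContinuousLinearMap.precompL_apply, mul_comm]
  have h3 := h (fun s => ρ.normed volume (x - s)) (cd'.comp (by fun_prop)) ?_ (subset_univ _) i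
  · simp only [ContinuousLinearMap.coe_coe, OrthonormalBasis.coe_toBasis, EuclideanSpace.basisFun_apply]
    rw [e2, InnerProductSpace.toDual_apply_apply, EuclideanSpace.inner_single_right]
    simp only [Measure.restrict_univ] at h3
    have h4 : ∀ s, fderiv ℝ (fun s => ρ.normed volume (x - s)) s (EuclideanSpace.single i (1:ℝ)) =
        - fderiv ℝ (ρ.normed volume) (x - s) (EuclideanSpace.single i (1:ℝ)) := fun s => by
      have h5 : HasFDerivAt (fun s : Eu n => x - s) (-ContinuousLinearMap.id ℝ (Eu n)) s :=
        (hasFDerivAt_id s).const_sub x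
      have h6 := ((cd.differentiable (by simp)) (x - s)).hasFDerivAt.comp s h5
      have h7 : HasFDerivAt (fun s => ρ.normed volume (x - s)) _ s := h6
      rw [h7.fderiv]
      simp
    simp_rw [h4, mul_neg, integral_neg, neg_inj] at h3
    rw [h3, e1]
    simp
  · exact cs.comp_homeomorph (Homeomorph.subLeft x)

/-- Cutting off a function with a weak gradient. -/
theorem IsWeakGradOn.cutoff (h : IsWeakGradOn n Ω u du) (hu : LocallyIntegrableOn u Ω)
    (hdu : LocallyIntegrableOn du Ω) {ζ : Eu n → ℝ} (hζ : ContDiff ℝ (⊤ : ℕ∞) ζ)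
    (hc : HasCompactSupport ζ) (hs : tsupport ζ ⊆ Ω) :
    IsWeakGradOn n univ (fun x => ζ x * u x) (fun x => ζ x • du x + u x • ∇ ζ x) := by
  intro ψ hψ hψc _ i
  have iu := hu.integrableOn_compact_subset hs hc
  have idu := hdu.integrableOn_compact_subset hs hc
  have z1 := isC1_of_contDiff (hζ.of_le (by exact_mod_cast le_top) : ContDiff ℝ 1 ζ)
  have p1 := isC1_of_contDiff (hψ.of_le (by exact_mod_cast le_top) : ContDiff ℝ 1 ψ)
  have h1 := h (fun x => ζ x * ψ x) (hζ.mul hψ) hc.mul_right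
    ((tsupport_mul_subset_left).trans hs) i
  have zm := z1.mul p1
  simp_rw [zm.fderiv_single] at h1
  simp_rw [p1.fderiv_single]
  set S := tsupport ζ with hS
  have off : ∀ x ∉ S, ζ x = 0 ∧ ∇ ζ x = 0 := fun x hx =>
    ⟨image_eq_zero_of_notMem_tsupport hx, z1.support_grad hx⟩
  have toS : ∀ (A : Set (Eu n)) (F : Eu n → ℝ), S ⊆ A → (∀ x ∉ S, F x = 0) →
      ∫ x in A, F x = ∫ x in S, F x := fun A F hA hF => by
    rw [setIntegral_eq_integral_of_forall_compl_eq_zero hF,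
      setIntegral_eq_integral_of_forall_compl_eq_zero fun x hx => hF x fun h => hx (hA h)]
  have ci : ∀ {f : Eu n → Eu n}, Continuous f → Continuous fun x => f x i := fun hf =>
    (EuclideanSpace.proj (𝕜 := ℝ) i).continuous.comp hf
  have c1 := ci p1.1
  have c2 := ci z1.1
  have iA : IntegrableOn (fun x => u x * (ζ x * (∇ ψ x) i)) S :=
    iu.mul_continuousOn (z1.continuous.mul c1).continuousOn hc
  have iB : IntegrableOn (fun x => u x * (ψ x * (∇ ζ x) i)) S :=
    iu.mul_continuousOn (p1.continuous.mul c2).continuousOn hc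
  have idi : IntegrableOn (fun x => du x i) S := (EuclideanSpace.proj (𝕜 := ℝ) i).integrable_comp idu
  have iC : IntegrableOn (fun x => du x i * (ζ x * ψ x)) S :=
    idi.mul_continuousOn (z1.continuous.mul p1.continuous).continuousOn hc
  rw [toS Ω _ hs (fun x hx => by simp [off x hx]), toS Ω _ hs (fun x hx => by simp [off x hx])] at h1
  rw [toS univ _ (subset_univ _) (fun x hx => by simp [off x hx]),
    toS univ _ (subset_univ _) (fun x hx => by simp [off x hx])]
  have e1 : ∫ x in S, u x * (ζ x • ∇ ψ x + ψ x • ∇ ζ x) i =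
      (∫ x in S, u x * (ζ x * (∇ ψ x) i)) + ∫ x in S, u x * (ψ x * (∇ ζ x) i) := by
    rw [← integral_add iA iB]
    refine integral_congr_ae (.of_forall fun x => ?_)
    simp [mul_add]
  have e2 : ∫ x in S, (ζ x • du x + u x • ∇ ζ x) i * ψ x =
      (∫ x in S, du x i * (ζ x * ψ x)) + ∫ x in S, u x * (ψ x * (∇ ζ x) i) := by
    rw [← integral_add iC iB]
    refine integral_congr_ae (.of_forall fun x => ?_)
    simp; ring
  have e3 : ∫ x in S, ζ x * u x * (∇ ψ x) i = ∫ x in S, u x * (ζ x * (∇ ψ x) i) :=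
    integral_congr_ae (.of_forall fun x => by simp; ring)
  rw [e1] at h1
  rw [e2, e3]
  linarith

theorem cutoff_memLp {p : ℝ≥0∞} {ζ : Eu n → ℝ} (hζ : ContDiff ℝ (⊤ : ℕ∞) ζ)
    (hc : HasCompactSupport ζ) (hu : MemLp u p (volume.restrict (tsupport ζ)))
    (hdu : MemLp du p (volume.restrict (tsupport ζ))) :
    MemLp (fun x => ζ x * u x) p volume ∧ MemLp (fun x => ζ x • du x + u x • ∇ ζ x) p volume := by
  have z1 := isC1_of_contDiff (hζ.of_le (by exact_mod_cast le_top) : ContDiff ℝ 1 ζ)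
  set S := tsupport ζ with hS
  have mS : MeasurableSet S := (isClosed_tsupport ζ).measurableSet
  rw [← memLp_indicator_iff_restrict mS] at hu hdu
  obtain ⟨A, hA⟩ := hc.exists_bound_of_continuous z1.continuous
  obtain ⟨B, hB⟩ := (z1.hasCompactSupport_grad hc).exists_bound_of_continuous z1.1
  have off : ∀ x ∉ S, ζ x = 0 ∧ ∇ ζ x = 0 := fun x hx =>
    ⟨image_eq_zero_of_notMem_tsupport hx, z1.support_grad hx⟩
  have e1 : (fun x => ζ x * u x) = fun x => ζ x * S.indicator u x := funext fun x => by
    by_cases hx : x ∈ S <;> simp [hx, off x]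
  have e2 : (fun x => ζ x • du x + u x • ∇ ζ x) =
      fun x => ζ x • S.indicator du x + S.indicator u x • ∇ ζ x := funext fun x => by
    by_cases hx : x ∈ S <;> simp [hx, off x]
  rw [e1, e2]
  have mz := z1.continuous.aestronglyMeasurable (μ := (volume : Measure (Eu n)))
  have mdz := z1.1.aestronglyMeasurable (μ := (volume : Measure (Eu n)))
  refine ⟨hu.of_le_mul (c := A) (mz.mul hu.1) (.of_forall fun x => ?_),
    (hdu.of_le_mul (c := A) (f := fun x => ζ x • S.indicator du x) (mz.smul hdu.1) (.of_forall fun x => ?_)).add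
    (hu.of_le_mul (c := B) (f := fun x => S.indicator u x • ∇ ζ x) (hu.1.smul mdz) (.of_forall fun x => ?_))⟩
  · rw [norm_mul]; exact mul_le_mul_of_nonneg_right (hA x) (norm_nonneg _)
  · rw [norm_smul]; exact mul_le_mul_of_nonneg_right (hA x) (norm_nonneg _)
  · rw [norm_smul, mul_comm]; exact mul_le_mul_of_nonneg_right (hB x) (norm_nonneg _)

theorem IsWeakGradOn.sob {p : ℝ≥0∞} (hp1 : 1 ≤ p) (hpt : p ≠ ⊤) (h : IsWeakGradOn n univ u du)
    (hu : MemLp u p volume) (hdu : MemLp du p volume) (hc : HasCompactSupport u) : Sob p u du := by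
  refine ⟨hu, hdu, fun ε hε => ?_⟩
  obtain ⟨δ, hδ, h1⟩ := hu.exists_forall_eLpNorm_convolution_sub_le hp1 hpt hε
  obtain ⟨δ', hδ', h2⟩ := hdu.exists_forall_eLpNorm_convolution_sub_le hp1 hpt hε
  have hm : 0 < min δ δ' := lt_min hδ hδ'
  let ρ : ContDiffBump (0 : Eu n) := ⟨min δ δ' / 2, min δ δ', by linarith, by linarith⟩
  exact ⟨_, _, isC1_convolution h (hu.locallyIntegrable hp1) (hdu.locallyIntegrable hp1) ρ,
    (ρ.hasCompactSupport_normed).convolution _ hc, h1 ρ (min_le_left _ _), h2 ρ (min_le_right _ _)⟩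

theorem exists_cutoff (x₀ : Eu n) {r s : ℝ} (hr : 0 < r) (hrs : r < s) :
    ∃ ζ : Eu n → ℝ, ContDiff ℝ (⊤ : ℕ∞) ζ ∧ HasCompactSupport ζ ∧ tsupport ζ = closedBall x₀ s ∧
      ∀ x ∈ ball x₀ r, ζ x = 1 ∧ ∇ ζ x = 0 := by
  let ζ : ContDiffBump x₀ := ⟨r, s, hr, hrs⟩
  refine ⟨ζ, ζ.contDiff, ζ.hasCompactSupport, ζ.tsupport_eq, fun x hx => ?_⟩
  refine ⟨ζ.one_of_mem_closedBall (ball_subset_closedBall hx), ?_⟩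
  have h1 : (ζ : Eu n → ℝ) =ᶠ[𝓝 x] fun _ => 1 := ζ.eventuallyEq_one_of_mem_ball hx
  have h2 : HasGradientAt ζ (0 : Eu n) x := by
    rw [hasGradientAt_iff_hasFDerivAt, map_zero]
    exact (hasFDerivAt_const (1:ℝ) x).congr_of_eventuallyEq h1
  exact h2.gradient

theorem memLp_of_isWeakGradOn {p : ℝ} (hp : 1 ≤ p)
    (h : IsWeakGradOn n Ω u du) (hu : LocallyIntegrableOn u Ω) (hdu : LocallyIntegrableOn du Ω)
    {x₀ : Eu n} {r s : ℝ} (hr : 0 < r) (hrs : r < s) (hs : closedBall x₀ s ⊆ Ω)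
    (hp' : MemLp du (ENNReal.ofReal p) (volume.restrict (closedBall x₀ s))) :
    MemLp u (ENNReal.ofReal p) (volume.restrict (ball x₀ r)) := by
  have hp0 : 0 < p := by linarith
  obtain ⟨r₂, hr2, hs2⟩ := exists_between hrs
  obtain ⟨ζ, hζ, hc, ht, h1⟩ := exists_cutoff x₀ (hr.trans hr2) hs2
  set U : Eu n → ℝ := fun x => ζ x * u x with hU
  set dU : Eu n → Eu n := fun x => ζ x • du x + u x • ∇ ζ x with hdU
  have cK : IsCompact (closedBall x₀ s) := isCompact_closedBall _ _
  have hw : IsWeakGradOn n univ U dU := h.cutoff hu hdu hζ hc (ht.trans_subset hs)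
  obtain ⟨mU, mdU⟩ := cutoff_memLp (p := 1) (u := u) (du := du) hζ hc
    (by rw [ht]; exact memLp_one_iff_integrable.2 (hu.integrableOn_compact_subset hs cK))
    (by rw [ht]; exact memLp_one_iff_integrable.2 (hdu.integrableOn_compact_subset hs cK))
  set V : Eu n → Eu n := (ball x₀ r₂).indicator du with hV
  have mV : MemLp V (ENNReal.ofReal p) volume := by
    rw [hV, memLp_indicator_iff_restrict measurableSet_ball]
    exact hp'.mono_measure (Measure.restrict_mono
      (ball_subset_closedBall.trans (closedBall_subset_closedBall hs2.le)) le_rfl)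
  have hε : ∀ j : ℕ, ((j : ℝ≥0∞) + 1)⁻¹ ≠ 0 := fun j => by simp [ENNReal.add_eq_top]
  choose δ hδ hδ' using fun j : ℕ => mU.exists_forall_eLpNorm_convolution_sub_le le_rfl
    ENNReal.one_ne_top (hε j)
  have hm : ∀ j, 0 < min (δ j) (r₂ - r) := fun j => lt_min (hδ j) (by linarith)
  let ρ : ℕ → ContDiffBump (0 : Eu n) := fun j =>
    ⟨min (δ j) (r₂ - r) / 2, min (δ j) (r₂ - r), by have := hm j; linarith, by have := hm j; linarith⟩
  have hC1 := fun j => isC1_convolution hw (mU.locallyIntegrable le_rfl) (mdU.locallyIntegrable le_rfl) (ρ j)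
  have hl : Tendsto (fun j : ℕ => ((j : ℝ≥0∞) + 1)⁻¹) atTop (𝓝 0) := by
    have := ENNReal.tendsto_inv_nat_nhds_zero.comp (tendsto_add_atTop_nat 1)
    exact this.congr fun j => by simp
  have l1 := tendsto_of_tendsto_of_tendsto_of_le_of_le tendsto_const_nhds hl (fun _ => zero_le)
    fun j => hδ' j (ρ j) (min_le_left _ _)
  obtain ⟨ns, -, hns⟩ := (tendstoInMeasure_of_tendsto_eLpNorm one_ne_zero
    (fun j => (hC1 j).continuous.aestronglyMeasurable) mU.1 l1).exists_seq_tendsto_ae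
  have hbd : ∀ j, ∫⁻ x in ball x₀ r, ‖((ρ j).normed volume ⋆[ContinuousLinearMap.lsmul ℝ ℝ, volume] dU) x‖ₑ ^ p
      ≤ eLpNorm V (ENNReal.ofReal p) volume ^ p := fun j => by
    have e1 : ∀ x ∈ ball x₀ r, ((ρ j).normed volume ⋆[ContinuousLinearMap.lsmul ℝ ℝ, volume] dU) x =
        ((ρ j).normed volume ⋆[ContinuousLinearMap.lsmul ℝ ℝ, volume] V) x := fun x hx => by
      rw [convolution_eq_integral_bumpMeasure, convolution_eq_integral_bumpMeasure]
      refine integral_congr_ae ?_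
      filter_upwards [bumpMeasure_ae_mem_ball (ρ j)] with t ht
      have hm : x - t ∈ ball x₀ r₂ := by
        rw [mem_ball_zero_iff] at ht
        have : (ρ j).rOut ≤ r₂ - r := min_le_right _ _
        rw [mem_ball, dist_eq_norm] at hx ⊢
        calc ‖x - t - x₀‖ = ‖(x - x₀) - t‖ := by congr 1; abel
          _ ≤ ‖x - x₀‖ + ‖t‖ := norm_sub_le _ _
          _ < r₂ := by linarith
      simp [hV, hdU, hm, h1 _ hm]
    calc _ = ∫⁻ x in ball x₀ r, ‖((ρ j).normed volume ⋆[ContinuousLinearMap.lsmul ℝ ℝ, volume] V) x‖ₑ ^ p :=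
          setLIntegral_congr_fun measurableSet_ball fun x hx => by simp only [e1 x hx]
      _ ≤ ∫⁻ x, ‖((ρ j).normed volume ⋆[ContinuousLinearMap.lsmul ℝ ℝ, volume] V) x‖ₑ ^ p :=
          setLIntegral_le_lintegral _ _
      _ = eLpNorm ((ρ j).normed volume ⋆[ContinuousLinearMap.lsmul ℝ ℝ, volume] V) (ENNReal.ofReal p) volume ^ p := by
          rw [eLpNorm_eq_lintegral_rpow_enorm_toReal (by simpa using hp0) ENNReal.ofReal_ne_top,
            ENNReal.toReal_ofReal hp0.le, ← ENNReal.rpow_mul, one_div_mul_cancel hp0.ne', ENNReal.rpow_one]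
      _ ≤ _ := by
          gcongr
          exact eLpNorm_convolution_le (by simpa using hp) ENNReal.ofReal_ne_top mV.1 (ρ j)
  have hP := lintegral_lintegral_sub_le_of_tendsto hp (convex_ball x₀ r) measurableSet_ball
    (measurableSet_ball (x := (0 : Eu n)) (ε := 2 * r)) (D := ENNReal.ofReal (2 * r))
    (fun x hx y hy => by
      rw [mem_ball_zero_iff]; rw [mem_ball] at hx hy
      rw [← dist_eq_norm]
      calc dist y x ≤ dist y x₀ + dist x x₀ := dist_triangle_right _ _ _
        _ < _ := by linarith)
    (fun v hv => by
      rw [mem_ball_zero_iff] at hv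
      rw [← ofReal_norm]; exact ENNReal.ofReal_le_ofReal hv.le)
    (ENNReal.mul_ne_top measure_ball_lt_top.ne (ENNReal.rpow_ne_top_of_nonneg hp0.le ENNReal.ofReal_ne_top))
    (fun j => hC1 (ns j)) (ae_restrict_of_ae hns) (fun j => hbd (ns j)) tendsto_const_nhds
  have hfin : ∫⁻ x in ball x₀ r, ∫⁻ y in ball x₀ r, ‖U y - U x‖ₑ ^ p ≠ ⊤ :=
    ne_top_of_le_ne_top (ENNReal.mul_ne_top (ENNReal.mul_ne_top measure_ball_lt_top.ne
      (ENNReal.rpow_ne_top_of_nonneg hp0.le ENNReal.ofReal_ne_top))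
      (ENNReal.rpow_ne_top_of_nonneg hp0.le mV.2.ne)) hP
  have mm : AEMeasurable (fun x => ∫⁻ y in ball x₀ r, ‖U y - U x‖ₑ ^ p) (volume.restrict (ball x₀ r)) := by
    have := mU.1.aemeasurable
    have m1 : AEMeasurable (fun z : Eu n × Eu n => ‖U z.2 - U z.1‖ₑ ^ p)
        ((volume.restrict (ball x₀ r)).prod (volume.restrict (ball x₀ r))) :=
      ((((mU.1.restrict (s := ball x₀ r)).comp_snd).sub ((mU.1.restrict (s := ball x₀ r)).comp_fst)).enorm).pow_const p
    exact m1.lintegral_prod_right'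
  have hae := ae_lt_top' mm hfin
  have hne : (ae (volume.restrict (ball x₀ r))).NeBot := by
    rw [ae_neBot, Ne, Measure.restrict_eq_zero]
    exact (measure_ball_pos volume x₀ hr).ne'
  obtain ⟨x, hx⟩ := hae.exists
  have m3 : MemLp (fun y => U y - U x) (ENNReal.ofReal p) (volume.restrict (ball x₀ r)) := by
    refine ⟨mU.1.restrict.sub aestronglyMeasurable_const, ?_⟩
    rw [eLpNorm_lt_top_iff_lintegral_rpow_enorm_lt_top (by simpa using hp0) ENNReal.ofReal_ne_top,
      ENNReal.toReal_ofReal hp0.le]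
    exact hx
  have m4 : MemLp U (ENNReal.ofReal p) (volume.restrict (ball x₀ r)) := by
    have : IsFiniteMeasure (volume.restrict (ball x₀ r)) := ⟨by simp [measure_ball_lt_top]⟩
    have := m3.add (memLp_const (U x))
    refine (memLp_congr_ae (.of_forall fun y => ?_)).1 this
    simp
  refine m4.ae_eq ?_
  filter_upwards [ae_restrict_mem measurableSet_ball] with y hy
  simp [hU, (h1 y (ball_subset_ball hr2.le hy)).1]

theorem exists_sob_eqOn {p : ℝ} (hp : 1 ≤ p)
    (h : IsWeakGradOn n Ω u du) (hu : LocallyIntegrableOn u Ω) (hdu : LocallyIntegrableOn du Ω)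
    {x₀ : Eu n} {r s : ℝ} (hr : 0 < r) (hrs : r < s) (hs : closedBall x₀ s ⊆ Ω)
    (hp' : MemLp du (ENNReal.ofReal p) (volume.restrict (closedBall x₀ s))) :
    ∃ U dU, Sob (ENNReal.ofReal p) U dU ∧ ∀ x ∈ ball x₀ r, U x = u x ∧ dU x = du x := by
  obtain ⟨r₁, h1, h1s⟩ := exists_between hrs
  obtain ⟨r₂, h2, h2s⟩ := exists_between h1s
  obtain ⟨ζ, hζ, hc, ht, hone⟩ := exists_cutoff x₀ hr h1
  have hsub : closedBall x₀ r₁ ⊆ ball x₀ r₂ := closedBall_subset_ball h2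
  have mu := memLp_of_isWeakGradOn hp h hu hdu ((hr.trans h1).trans h2) h2s hs hp'
  obtain ⟨mU, mdU⟩ := cutoff_memLp (p := ENNReal.ofReal p) (u := u) (du := du) hζ hc
    (by rw [ht]; exact mu.mono_measure (Measure.restrict_mono hsub le_rfl))
    (by rw [ht]; exact hp'.mono_measure (Measure.restrict_mono (closedBall_subset_closedBall h1s.le) le_rfl))
  have hts : tsupport ζ ⊆ Ω := ht.trans_subset ((closedBall_subset_closedBall h1s.le).trans hs)
  refine ⟨_, _, (h.cutoff hu hdu hζ hc hts).sob (by simpa using hp) ENNReal.ofReal_ne_top mU mdU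
    hc.mul_right, fun x hx => ?_⟩
  simp [hone x hx]

end WeakGrad

section Caratheodory

theorem aemeasurable_caratheodory {α E : Type*} [MeasurableSpace α] [NormedAddCommGroup E]
    [MeasurableSpace E] [BorelSpace E] [SecondCountableTopology E] {μ : Measure α} {F : α → E → ℝ}
    (hF : ∀ z, AEMeasurable (fun x => F x z) μ) (hc : ∀ᵐ x ∂μ, Continuous (F x)) {w : α → E}
    (hw : AEStronglyMeasurable w μ) : AEMeasurable (fun x => F x (w x)) μ := by
  classical
  obtain ⟨w', hw', hww⟩ := hw
  have hs := hw'.tendsto_approx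
  have key : ∀ j, AEMeasurable (fun x => F x (hw'.approx j x)) μ := fun j => by
    have e : (fun x => F x (hw'.approx j x)) =
        fun x => ∑ z ∈ (hw'.approx j).range, ((hw'.approx j) ⁻¹' {z}).indicator (fun x => F x z) x := by
      funext x
      rw [Finset.sum_eq_single (hw'.approx j x)]
      · simp
      · intro z _ hz
        exact indicator_of_notMem (fun h => hz (by simpa using h.symm)) _
      · intro h
        exact (h (SimpleFunc.mem_range_self _ _)).elim
    rw [e]
    refine Finset.aemeasurable_fun_sum _ fun z _ => ?_
    exact (hF z).indicator ((hw'.approx j).measurableSet_preimage _)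
  have h2 : AEMeasurable (fun x => F x (w' x)) μ := by
    refine aemeasurable_of_tendsto_metrizable_ae atTop key ?_
    filter_upwards [hc] with x hx
    exact (hx.tendsto _).comp (hs x)
  refine h2.congr ?_
  filter_upwards [hww] with x hx
  rw [hx]

end Caratheodory

/-- Pointwise structure of the normalized integrand: `‖z‖^p ≤ F z ≤ L‖z‖^q + 2h^p`, convexity and
the doubling property. -/
structure GoodAt {n : ℕ} (p q L μ : ℝ) (h : ℝ) (F : Eu n → ℝ) : Prop where
  cont : Continuous F
  conv : ConvexOn ℝ univ F
  lower : ∀ z, ‖z‖ ^ p ≤ F z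
  upper : ∀ z, F z ≤ L * ‖z‖ ^ q + 2 * h ^ p
  doubling : ∀ z, F ((2:ℝ) • z) ≤ μ + L * F z
  h_nonneg : 0 ≤ h

theorem GoodAt.nonneg {n : ℕ} {p q L μ h : ℝ} {F : Eu n → ℝ} (H : GoodAt p q L μ h F) (z : Eu n) :
    0 ≤ F z := (by positivity : 0 ≤ ‖z‖ ^ p).trans (H.lower z)

/-- The minimality property used throughout, for a normalized integrand. -/
structure StrongQMin {n : ℕ} (Ω : Set (Eu n)) (p q L μ Q : ℝ) (h : Eu n → ℝ)
    (F : Eu n → Eu n → ℝ) (du : Eu n → Eu n) : Prop where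
  good : ∀ᵐ x ∂volume.restrict Ω, GoodAt p q L μ (h x) (F x)
  meas : ∀ z, AEMeasurable (fun x => F x z) (volume.restrict Ω)
  meas_h : AEMeasurable h (volume.restrict Ω)
  h_int : ∫⁻ x in Ω, ENNReal.ofReal (h x) ^ p < ⊤
  meas_du : ∀ S, IsCompact S → S ⊆ Ω → AEStronglyMeasurable du (volume.restrict S)
  fin : ∀ S, IsCompact S → S ⊆ Ω → ∫⁻ x in S, ENNReal.ofReal (F x (du x)) < ⊤
  min : ∀ S, IsCompact S → S ⊆ Ω → ∀ φ dφ, Sob (ENNReal.ofReal p) φ dφ →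
    (∀ᵐ x, x ∉ S → φ x = 0 ∧ dφ x = 0) → ∫⁻ x in S, ENNReal.ofReal (F x (du x)) ≤
      ENNReal.ofReal Q * ∫⁻ x in S, ENNReal.ofReal (F x (du x + dφ x))

section QMin

variable {n : ℕ} {Ω : Set (Eu n)} {p q L μ Q : ℝ} {g : Eu n → ℝ} {f : Eu n → Eu n → ℝ}
  {u : Eu n → ℝ} {du : Eu n → Eu n}

theorem exists_tsupport_eq (hn : 2 ≤ n) {S : Set (Eu n)} (hS : IsCompact S) {φ : Eu n → ℝ}
    (h0 : ∀ᵐ x, x ∉ S → φ x = 0) : ∃ ψ : Eu n → ℝ, ψ =ᵐ[volume] φ ∧ tsupport ψ = S := by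
  classical
  have : Nontrivial (Eu n) := by
    have : Nonempty (Fin n) := ⟨⟨0, by omega⟩⟩
    infer_instance
  obtain ⟨D, hDS, hDc, hD⟩ := (TopologicalSpace.IsSeparable.of_separableSpace S).exists_countable_dense_subset
  refine ⟨fun x => if x ∈ D then 1 else S.indicator φ x, ?_, ?_⟩
  · filter_upwards [h0, compl_mem_ae_iff.2 (hDc.measure_zero volume)] with x hx hxD
    simp only [mem_compl_iff] at hxD
    by_cases hxS : x ∈ S <;> simp [hxD, hxS]
    exact (hx hxS).symm
  · refine Subset.antisymm (closure_minimal (fun x hx => ?_) hS.isClosed) (hD.trans (closure_mono fun x hx => ?_))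
    · by_contra hc
      have : x ∉ D := fun h => hc (hDS h)
      simp [this, hc] at hx
    · simp [hx]

theorem IsQMinimizer.strongQMin (hn : 2 ≤ n) (hp : 1 < p) (hL : 1 ≤ L) (hQ : 1 ≤ Q)
    (hΩb : Bornology.IsBounded Ω)
    (hg0 : ∀ᵐ x ∂volume.restrict Ω, 0 ≤ g x) (hgm : AEMeasurable g (volume.restrict Ω))
    (hgi : IntegrableOn (fun x => g x ^ (p / (p - 1))) Ω)
    (hfm : ∀ z : Eu n, AEMeasurable (fun x => f x z) (volume.restrict Ω))
    (hfc : ∀ᵐ x ∂volume.restrict Ω, Continuous fun z => f x z)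
    (hfx : ∀ᵐ x ∂volume.restrict Ω, ConvexOn ℝ univ fun z => f x z)
    (hb : ∀ᵐ x ∂volume.restrict Ω, ∀ z : Eu n,
      ‖z‖ ^ p - g x ^ (p / (p - 1)) ≤ f x z ∧ f x z ≤ L * ‖z‖ ^ q + g x ^ (p / (p - 1)))
    (hd : ∀ᵐ x ∂volume.restrict Ω, ∀ z : Eu n, f x (2 • z) ≤ μ + L * f x z)
    (H : IsQMinimizer n Ω f Q u du) :
    StrongQMin Ω p q L μ Q (fun x => g x ^ (1 / (p - 1)))
      (fun x z => f x z + g x ^ (p / (p - 1))) du := by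
  obtain ⟨hw, hu, hdu, hmin⟩ := H
  have hp0 : 0 < p := by linarith
  have hp1 : 0 < p - 1 := by linarith
  have ehp : ∀ x, 0 ≤ g x → (g x ^ (1 / (p - 1))) ^ p = g x ^ (p / (p - 1)) := fun x hx => by
    rw [← Real.rpow_mul hx]; congr 1; field_simp
  have hgood : ∀ᵐ x ∂volume.restrict Ω, GoodAt p q L μ (g x ^ (1 / (p - 1)))
      (fun z => f x z + g x ^ (p / (p - 1))) := by
    filter_upwards [hg0, hfc, hfx, hb, hd] with x h1 h2 h3 h4 h5
    have hpos : 0 ≤ g x ^ (p / (p - 1)) := Real.rpow_nonneg h1 _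
    refine ⟨h2.add continuous_const, h3.add_const _, fun z => by linarith [(h4 z).1], fun z => ?_,
      fun z => ?_, Real.rpow_nonneg h1 _⟩
    · rw [ehp x h1]; linarith [(h4 z).2]
    · have := h5 z
      rw [show (2 : ℕ) • z = (2:ℝ) • z by rw [two_smul, two_smul]] at this
      nlinarith
  have gm : AEMeasurable (fun x => g x ^ (p / (p - 1))) (volume.restrict Ω) := hgm.pow_const _
  have hsub : ∀ S, S ⊆ Ω → volume.restrict S ≤ volume.restrict Ω := fun S hS =>
    Measure.restrict_mono hS le_rfl
  have hfF : ∀ S, S ⊆ Ω → ∀ w : Eu n → Eu n,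
      (∀ᵐ x ∂volume.restrict S, 0 ≤ f x (w x) + g x ^ (p / (p - 1))) := fun S hS w =>
    (ae_restrict_of_ae_restrict_of_subset hS hgood).mono fun x hx => hx.nonneg _
  have hgS : ∀ S, S ⊆ Ω → IntegrableOn (fun x => g x ^ (p / (p - 1))) S := fun S hS => hgi.mono_set hS
  have hmdu : ∀ S, IsCompact S → S ⊆ Ω → AEStronglyMeasurable du (volume.restrict S) := fun S hS h =>
    (hdu.integrableOn_compact_subset h hS).1
  have main : ∀ S, IsCompact S → S ⊆ Ω → ∀ φ dφ, Sob (ENNReal.ofReal p) φ dφ →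
      (∀ᵐ x, x ∉ S → φ x = 0 ∧ dφ x = 0) →
      IntegrableOn (fun x => f x (du x)) S ∧ (IntegrableOn (fun x => f x (du x + dφ x)) S →
        (∫ x in S, f x (du x)) ≤ Q * ∫ x in S, f x (du x + dφ x)) := by
    intro S hS hSΩ φ dφ hφ h0
    obtain ⟨ψ, hψ, hsupp⟩ := exists_tsupport_eq hn hS (h0.mono fun x hx h => (hx h).1)
    have hp1' : 1 ≤ ENNReal.ofReal p := by simpa using hp.le
    have hS' := hφ.congr hψ.symm (ae_eq_refl _)
    have : IsFiniteMeasure (volume.restrict Ω) := ⟨by simpa using hΩb.measure_lt_top⟩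
    have := hmin ψ dφ (hS'.isWeakGradOn hp1' Ω) ((hS'.memLp.restrict Ω).integrable hp1')
      ((hS'.memLp_grad.restrict Ω).integrable hp1') (by rwa [hsupp]) (by rwa [hsupp])
    rwa [hsupp] at this
  have hl : ∀ S, S ⊆ Ω → ∀ w : Eu n → Eu n, IntegrableOn (fun x => f x (w x)) S →
      ∫⁻ x in S, ENNReal.ofReal (f x (w x) + g x ^ (p / (p - 1))) =
        ENNReal.ofReal ((∫ x in S, f x (w x)) + ∫ x in S, g x ^ (p / (p - 1))) := by
    intro S hS w hi
    rw [← integral_add hi (hgS S hS)]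
    exact (ofReal_integral_eq_lintegral_ofReal (hi.add (hgS S hS)) (hfF S hS w)).symm
  refine ⟨hgood, fun z => (hfm z).add gm, hgm.pow_const _, ?_, hmdu, fun S hS hSΩ => ?_,
    fun S hS hSΩ φ dφ hφ h0 => ?_⟩
  · have : ∫⁻ x in Ω, ENNReal.ofReal (g x ^ (1 / (p - 1))) ^ p =
        ∫⁻ x in Ω, ENNReal.ofReal (g x ^ (p / (p - 1))) := by
      refine lintegral_congr_ae ?_
      filter_upwards [hg0] with x hx
      rw [ENNReal.ofReal_rpow_of_nonneg (Real.rpow_nonneg hx _) hp0.le, ehp x hx]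
    rw [this]
    exact hgi.lintegral_lt_top
  · have z : Sob (ENNReal.ofReal p) (fun _ : Eu n => (0:ℝ)) (fun _ => 0) :=
      (isC1_const 0).sob (HasCompactSupport.zero)
    rw [hl S hSΩ du (main S hS hSΩ _ _ z (by simp)).1]
    exact ENNReal.ofReal_lt_top
  · obtain ⟨m1, m2⟩ := main S hS hSΩ φ dφ hφ h0
    by_cases hfin : ∫⁻ x in S, ENNReal.ofReal (f x (du x + dφ x) + g x ^ (p / (p - 1))) = ⊤
    · rw [hfin, ENNReal.mul_top (by simp; linarith)]; exact le_top
    have mw : AEStronglyMeasurable (fun x => du x + dφ x) (volume.restrict S) :=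
      (hmdu S hS hSΩ).add hφ.memLp_grad.1.restrict
    have mf : AEMeasurable (fun x => f x (du x + dφ x)) (volume.restrict S) :=
      aemeasurable_caratheodory (fun z => (hfm z).mono_measure (hsub S hSΩ))
        (ae_mono (hsub S hSΩ) hfc) mw
    have iF : IntegrableOn (fun x => f x (du x + dφ x) + g x ^ (p / (p - 1))) S := by
      refine ⟨(mf.add (gm.mono_measure (hsub S hSΩ))).aestronglyMeasurable, ?_⟩
      rw [hasFiniteIntegral_iff_ofReal (hfF S hSΩ _)]
      exact Ne.lt_top hfin
    have i2 : IntegrableOn (fun x => f x (du x + dφ x)) S := by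
      have := iF.sub (hgS S hSΩ)
      refine this.congr (.of_forall fun x => ?_)
      simp
    have m3 := m2 i2
    rw [hl S hSΩ du m1, hl S hSΩ (fun x => du x + dφ x) i2, ← ENNReal.ofReal_mul (by linarith)]
    refine ENNReal.ofReal_le_ofReal ?_
    have : 0 ≤ ∫ x in S, g x ^ (p / (p - 1)) := by
      refine integral_nonneg_of_ae ?_
      filter_upwards [ae_mono (hsub S hSΩ) hg0] with x hx using Real.rpow_nonneg hx _
    nlinarith

theorem StrongQMin.memLp {h : Eu n → ℝ} {F : Eu n → Eu n → ℝ} (hp : 1 < p)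
    (H : StrongQMin Ω p q L μ Q h F du) {S : Set (Eu n)} (hS : IsCompact S) (hSΩ : S ⊆ Ω) :
    MemLp du (ENNReal.ofReal p) (volume.restrict S) := by
  have hp0 : 0 < p := by linarith
  refine ⟨H.meas_du S hS hSΩ, ?_⟩
  rw [eLpNorm_lt_top_iff_lintegral_rpow_enorm_lt_top (by simpa using hp0) ENNReal.ofReal_ne_top,
    ENNReal.toReal_ofReal hp0.le]
  refine (H.fin S hS hSΩ).trans_le' (lintegral_mono_ae ?_)
  filter_upwards [ae_mono (Measure.restrict_mono hSΩ le_rfl) H.good] with x hx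
  rw [← ofReal_norm, ENNReal.ofReal_rpow_of_nonneg (norm_nonneg _) hp0.le]
  exact ENNReal.ofReal_le_ofReal (hx.lower _)

end QMin

theorem lintegral_enorm_rpow_eq {α F : Type*} [MeasurableSpace α] [NormedAddCommGroup F]
    {μ : Measure α} {p : ℝ} (hp : 0 < p) (f : α → F) :
    ∫⁻ x, ‖f x‖ₑ ^ p ∂μ = eLpNorm f (ENNReal.ofReal p) μ ^ p := by
  rw [eLpNorm_eq_lintegral_rpow_enorm_toReal (by simpa using hp) (by simp),
    ENNReal.toReal_ofReal hp.le, ← ENNReal.rpow_mul, one_div, inv_mul_cancel₀ hp.ne',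
    ENNReal.rpow_one]

theorem eLpNorm_le_of_tendsto_ae {α F : Type*} [MeasurableSpace α] [NormedAddCommGroup F]
    {μ : Measure α} {p : ℝ≥0∞} {f : ℕ → α → F} {g : α → F} {b : ℕ → ℝ≥0∞} {B : ℝ≥0∞}
    (hf : ∀ j, AEStronglyMeasurable (f j) μ)
    (h : ∀ᵐ x ∂μ, Tendsto (fun j => f j x) atTop (𝓝 (g x)))
    (hb : ∀ j, eLpNorm (f j) p μ ≤ b j) (hB : Tendsto b atTop (𝓝 B)) : eLpNorm g p μ ≤ B := by
  calc eLpNorm g p μ ≤ atTop.liminf fun j => eLpNorm (f j) p μ :=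
        Lp.eLpNorm_lim_le_liminf_eLpNorm hf g h
    _ ≤ atTop.liminf b := liminf_le_liminf (Eventually.of_forall hb)
    _ = B := hB.liminf_eq

theorem eLpNorm_le_add_sub {α F : Type*} [MeasurableSpace α] [NormedAddCommGroup F]
    {μ : Measure α} {p : ℝ≥0∞} (hp1 : 1 ≤ p) {f g : α → F}
    (hf : AEStronglyMeasurable f μ) (hg : AEStronglyMeasurable g μ) :
    eLpNorm f p μ ≤ eLpNorm g p μ + eLpNorm (fun x => f x - g x) p μ := by
  calc eLpNorm f p μ = eLpNorm (g + fun x => f x - g x) p μ := by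
        congr 1; ext x; simp
    _ ≤ _ := eLpNorm_add_le hg (hf.sub hg) hp1

section Cube

variable {n : ℕ}

/-- The open axis-parallel cube with centre `y` and half side `r`. -/
def cube (y : Eu n) (r : ℝ) : Set (Eu n) := {x | ∀ i, |x i - y i| < r}

theorem isOpen_cube (y : Eu n) (r : ℝ) : IsOpen (cube y r) := by
  have : cube y r = ⋂ i, {x : Eu n | |x i - y i| < r} := by ext x; simp [cube]
  rw [this]
  exact isOpen_iInter_of_finite fun i => isOpen_lt (by fun_prop) continuous_const

theorem measurableSet_cube (y : Eu n) (r : ℝ) : MeasurableSet (cube y r) :=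
  (isOpen_cube y r).measurableSet

theorem cube_mono {y : Eu n} {r s : ℝ} (h : r ≤ s) : cube y r ⊆ cube y s :=
  fun _ hx i => (hx i).trans_le h

theorem convex_cube (y : Eu n) (r : ℝ) : Convex ℝ (cube y r) := by
  intro x hx z hz a b ha hb hab i
  have h1 := abs_lt.1 (hx i)
  have h2 := abs_lt.1 (hz i)
  have e : (a • x + b • z) i - y i = a * (x i - y i) + b * (z i - y i) := by
    simp only [PiLp.add_apply, PiLp.smul_apply, smul_eq_mul]
    linear_combination (y i) * hab
  rw [e, abs_lt]
  rcases eq_or_lt_of_le ha with rfl | ha'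
  · have : b = 1 := by linarith
    subst this; constructor <;> linarith
  · have hb' : b = 1 - a := by linarith
    subst hb'
    constructor <;> nlinarith

theorem norm_le_of_coord {x : Eu n} {r : ℝ} (hr : 0 ≤ r) (h : ∀ i, |x i| ≤ r) :
    ‖x‖ ≤ √n * r := by
  rw [EuclideanSpace.norm_eq, ← Real.sqrt_sq hr, ← Real.sqrt_mul (by positivity)]
  apply Real.sqrt_le_sqrt
  calc ∑ i, ‖x i‖ ^ 2 ≤ ∑ _i : Fin n, r ^ 2 := by
        gcongr with i; exact h i
    _ = n * r ^ 2 := by simp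

theorem dist_lt_of_mem_cube {x y : Eu n} {r : ℝ} (hr : 0 ≤ r) (h : x ∈ cube y r) :
    dist x y ≤ √n * r := by
  rw [dist_eq_norm]
  exact norm_le_of_coord hr fun i => (h i).le

theorem ball_subset_cube (y : Eu n) (r : ℝ) : ball y r ⊆ cube y r := by
  intro x hx i
  rw [mem_ball, dist_eq_norm] at hx
  exact (PiLp.norm_apply_le (x - y) i).trans_lt hx

theorem cube_eq_preimage (y : Eu n) {r : ℝ} :
    cube y r = WithLp.ofLp ⁻¹' (Set.univ.pi fun i => ball (y i) r) := by
  ext x; simp [cube, Real.dist_eq]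

theorem volume_cube (y : Eu n) (r : ℝ) : volume (cube y r) = ENNReal.ofReal (2 * r) ^ n := by
  rw [cube_eq_preimage, (PiLp.volume_preserving_ofLp (Fin n)).measure_preimage
    (MeasurableSet.univ_pi fun i => measurableSet_ball).nullMeasurableSet, volume_pi_pi]
  simp

theorem volume_cube_ne_top (y : Eu n) (r : ℝ) : volume (cube y r) ≠ ⊤ := by
  rw [volume_cube]; exact ENNReal.pow_ne_top ENNReal.ofReal_ne_top

theorem Sob.lintegral_lintegral_sub_le {p : ℝ} (hp : 1 ≤ p) {v : Eu n → ℝ} {dv : Eu n → Eu n}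
    (h : Sob (ENNReal.ofReal p) v dv) {P V : Set (Eu n)}
    (hP : Convex ℝ P) (mP : MeasurableSet P) (mV : MeasurableSet V) {D : ℝ≥0∞}
    (hV : ∀ x ∈ P, ∀ y ∈ P, y - x ∈ V) (hD : ∀ v ∈ V, ‖v‖ₑ ≤ D) (hVD : volume V * D ^ p ≠ ⊤) :
    ∫⁻ x in P, ∫⁻ y in P, ‖v y - v x‖ₑ ^ p ≤ volume V * D ^ p * ∫⁻ x in P, ‖dv x‖ₑ ^ p := by
  have hp0 : 0 < p := by linarith
  have hp1 : 1 ≤ ENNReal.ofReal p := by simpa using hp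
  obtain ⟨w, dw, hw, hc, h1, h2, h3, h4⟩ := h.exists_seq_ae (by simpa using hp0)
  have mw : ∀ j, AEStronglyMeasurable (dw j) (volume.restrict P) := fun j =>
    (hw j).1.aestronglyMeasurable
  have mv : AEStronglyMeasurable dv (volume.restrict P) := h.memLp_grad.1.restrict
  refine lintegral_lintegral_sub_le_of_tendsto hp hP mP mV hV hD hVD hw
    (ae_restrict_of_ae h3) (b := fun j => (eLpNorm dv (ENNReal.ofReal p) (volume.restrict P) +
      eLpNorm (fun x => dw j x - dv x) (ENNReal.ofReal p) volume) ^ p) (fun j => ?_) ?_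
  · rw [lintegral_enorm_rpow_eq hp0]
    gcongr
    refine (eLpNorm_le_add_sub hp1 (mw j) mv).trans ?_
    gcongr
    exact Measure.restrict_le_self
  · rw [lintegral_enorm_rpow_eq hp0]
    refine ((ENNReal.continuous_rpow_const (y := p)).tendsto _).comp ?_
    simpa using tendsto_const_nhds.add h2

theorem Sob.poincare_cube {p : ℝ} (hp : 1 ≤ p) {v : Eu n → ℝ} {dv : Eu n → Eu n}
    (h : Sob (ENNReal.ofReal p) v dv) (y : Eu n) {r : ℝ} (hr : 0 < r) {Z : Set (Eu n)}
    (mZ : MeasurableSet Z) (hZ : Z ⊆ cube y r) (hv : ∀ x ∈ Z, v x = 0)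
    (hZv : volume (cube y r) ≤ 2 * volume Z) :
    ∫⁻ x in cube y r, ‖v x‖ₑ ^ p ≤
      2 ^ (n + 1) * ENNReal.ofReal (√n * (2 * r)) ^ p * ∫⁻ x in cube y r, ‖dv x‖ₑ ^ p := by
  have hp0 : 0 < p := by linarith
  set D : ℝ≥0∞ := ENNReal.ofReal (√n * (2 * r)) with hDdef
  have hDt : D ^ p ≠ ⊤ := ENNReal.rpow_ne_top_of_nonneg hp0.le ENNReal.ofReal_ne_top
  have key := h.lintegral_lintegral_sub_le hp (convex_cube y r) (measurableSet_cube y r)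
    (measurableSet_cube (0 : Eu n) (2 * r)) (D := D)
    (fun x hx z hz i => by
      have h1 := abs_lt.1 (hx i)
      have h2 := abs_lt.1 (hz i)
      simp only [PiLp.sub_apply, PiLp.zero_apply]
      rw [abs_lt]; constructor <;> linarith)
    (fun x hx => by
      rw [← ofReal_norm]
      refine ENNReal.ofReal_le_ofReal (norm_le_of_coord (by positivity) fun i => ?_)
      simpa using (hx i).le)
    (ENNReal.mul_ne_top (volume_cube_ne_top _ _) hDt)
  have hZ0 : volume Z ≠ 0 := by
    intro h0
    rw [h0, mul_zero, volume_cube] at hZv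
    have : ENNReal.ofReal (2 * r) ^ n ≠ 0 := pow_ne_zero _ (by simp [hr])
    exact this (le_antisymm hZv zero_le)
  have hZt : volume Z ≠ ⊤ := ne_top_of_le_ne_top (volume_cube_ne_top y r) (measure_mono hZ)
  have e1 : volume Z * ∫⁻ x in cube y r, ‖v x‖ₑ ^ p ≤
      ∫⁻ x in cube y r, ∫⁻ z in cube y r, ‖v z - v x‖ₑ ^ p := by
    calc volume Z * ∫⁻ x in cube y r, ‖v x‖ₑ ^ p
        = ∫⁻ x in Z, ∫⁻ z in cube y r, ‖v z‖ₑ ^ p := by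
          rw [setLIntegral_const, mul_comm]
      _ = ∫⁻ x in Z, ∫⁻ z in cube y r, ‖v z - v x‖ₑ ^ p := by
          refine setLIntegral_congr_fun mZ fun x hx => ?_
          simp [hv x hx]
      _ ≤ _ := lintegral_mono_set hZ
  have e2 : volume (cube (0 : Eu n) (2 * r)) ≤ 2 ^ (n + 1) * volume Z := by
    calc volume (cube (0 : Eu n) (2 * r)) = 2 ^ n * volume (cube y r) := by
          rw [volume_cube, volume_cube, ENNReal.ofReal_mul (p := 2) (q := 2 * r) (by norm_num),
            mul_pow]
          simp
      _ ≤ 2 ^ n * (2 * volume Z) := by gcongr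
      _ = _ := by ring
  have e3 : volume Z * ∫⁻ x in cube y r, ‖v x‖ₑ ^ p ≤
      volume Z * (2 ^ (n + 1) * D ^ p * ∫⁻ x in cube y r, ‖dv x‖ₑ ^ p) := by
    refine e1.trans (key.trans ?_)
    calc volume (cube (0 : Eu n) (2 * r)) * D ^ p * ∫⁻ x in cube y r, ‖dv x‖ₑ ^ p
        ≤ 2 ^ (n + 1) * volume Z * D ^ p * ∫⁻ x in cube y r, ‖dv x‖ₑ ^ p := by gcongr
      _ = _ := by ring
  exact (ENNReal.mul_le_mul_iff_right hZ0 hZt).1 e3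

theorem exists_sobolev_const (hn : 0 < n) {p r : ℝ} (hp : 1 ≤ p) (hr : 0 < r)
    (hpr : 1 / r = 1 / p - 1 / n) :
    ∃ C : ℝ≥0, ∀ (v : Eu n → ℝ) (dv : Eu n → Eu n), Sob (ENNReal.ofReal p) v dv →
      eLpNorm v (ENNReal.ofReal r) volume ≤ C * eLpNorm dv (ENNReal.ofReal p) volume := by
  have hp0 : 0 < p := by linarith
  have hp1 : 1 ≤ ENNReal.ofReal p := by simpa using hp
  refine ⟨SNormLESNormFDerivOfEqConst ℝ (volume : Measure (Eu n)) (p.toNNReal : ℝ≥0),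
    fun v dv h => ?_⟩
  obtain ⟨w, dw, hw, hc, h1, h2, h3, h4⟩ := h.exists_seq_ae (by simpa using hp0)
  set C : ℝ≥0 := SNormLESNormFDerivOfEqConst ℝ (volume : Measure (Eu n)) (p.toNNReal : ℝ≥0)
  refine eLpNorm_le_of_tendsto_ae (f := w)
    (b := fun j => C * (eLpNorm dv (ENNReal.ofReal p) volume +
      eLpNorm (fun x => dw j x - dv x) (ENNReal.ofReal p) volume))
    (fun j => (hw j).continuous.aestronglyMeasurable) h3 (fun j => ?_) ?_
  · have := eLpNorm_le_eLpNorm_fderiv_of_eq (volume : Measure (Eu n)) (hw j).contDiff (hc j)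
      (p := p.toNNReal) (p' := r.toNNReal) (by simpa using hp) (by simpa using hn)
      (by rw [NNReal.coe_inv, Real.coe_toNNReal _ hr.le, Real.coe_toNNReal _ hp0.le]; simpa using hpr)
    refine this.trans ?_
    gcongr
    rw [eLpNorm_congr_norm_ae (g := dw j) (Eventually.of_forall (hw j).norm_fderiv)]
    exact eLpNorm_le_add_sub hp1 (hw j).1.aestronglyMeasurable h.memLp_grad.1
  · refine ENNReal.Tendsto.const_mul ?_ (Or.inr ENNReal.coe_ne_top)
    simpa using tendsto_const_nhds.add h2

end Cube

section Slice

variable {m : ℕ}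

/-- The parametrisation of the hyperplane `{x | x i = t}` by `ℝᵐ`. -/
def slice (i : Fin (m + 1)) (t : ℝ) (y : Fin m → ℝ) : Eu (m + 1) :=
  WithLp.toLp 2 (i.insertNth t y)

theorem slice_apply_self (i : Fin (m + 1)) (t : ℝ) (y : Fin m → ℝ) : slice i t y i = t := by
  simp [slice]

theorem slice_apply_succAbove (i : Fin (m + 1)) (t : ℝ) (y : Fin m → ℝ) (j : Fin m) :
    slice i t y (i.succAbove j) = y j := by
  simp [slice]

theorem measurePreserving_slice (i : Fin (m + 1)) :
    MeasurePreserving (fun z : ℝ × (Fin m → ℝ) => slice i z.1 z.2) := by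
  have h1 := (volume_preserving_piFinSuccAbove (fun _ : Fin (m + 1) => ℝ) i).symm
  exact (PiLp.volume_preserving_toLp (Fin (m + 1))).comp h1

theorem lintegral_slice (i : Fin (m + 1)) {f : Eu (m + 1) → ℝ≥0∞} (hf : AEMeasurable f) :
    ∫⁻ x, f x = ∫⁻ t, ∫⁻ y, f (slice i t y) := by
  have h := measurePreserving_slice i
  rw [← h.map_eq, lintegral_map' (by rwa [h.map_eq]) h.aemeasurable]
  exact lintegral_prod _ (by rw [← h.map_eq] at hf; exact hf.comp_aemeasurable h.aemeasurable)

theorem aemeasurable_lintegral_slice (i : Fin (m + 1)) {f : Eu (m + 1) → ℝ≥0∞}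
    (hf : AEMeasurable f) : AEMeasurable (fun t => ∫⁻ y, f (slice i t y)) := by
  have h := measurePreserving_slice i
  rw [← h.map_eq] at hf
  exact (hf.comp_aemeasurable h.aemeasurable).lintegral_prod_right'

theorem ae_slice (i : Fin (m + 1)) {P : Eu (m + 1) → Prop} (h : ∀ᵐ x, P x) :
    ∀ᵐ t, ∀ᵐ y, P (slice i t y) :=
  Measure.ae_ae_of_ae_prod ((measurePreserving_slice i).quasiMeasurePreserving.ae h)

/-- The linear part of `slice`. -/
def sliceLin (i : Fin (m + 1)) : (Fin m → ℝ) →L[ℝ] Eu (m + 1) :=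
  LinearMap.toContinuousLinearMap
    { toFun := fun y => slice i 0 y
      map_add' := fun x y => by
        ext j
        refine i.succAboveCases ?_ (fun k => ?_) j <;> simp [slice]
      map_smul' := fun c y => by
        ext j
        refine i.succAboveCases ?_ (fun k => ?_) j <;> simp [slice] }

theorem slice_eq (i : Fin (m + 1)) (t : ℝ) (y : Fin m → ℝ) :
    slice i t y = sliceLin i y + EuclideanSpace.single i t := by
  ext j
  refine i.succAboveCases ?_ (fun k => ?_) j <;> simp [slice, sliceLin]

theorem hasFDerivAt_slice (i : Fin (m + 1)) (t : ℝ) (y : Fin m → ℝ) :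
    HasFDerivAt (slice i t) (sliceLin i) y := by
  have : slice i t = fun y => sliceLin i y + EuclideanSpace.single i t := by
    ext1 y; exact slice_eq i t y
  rw [this]
  exact (sliceLin i).hasFDerivAt.add_const _

theorem contDiff_slice (i : Fin (m + 1)) (t : ℝ) : ContDiff ℝ 1 (slice i t) := by
  have : slice i t = fun y => sliceLin i y + EuclideanSpace.single i t := by
    ext1 y; exact slice_eq i t y
  rw [this]
  exact (sliceLin i).contDiff.add contDiff_const

theorem dist_le_dist_slice (i : Fin (m + 1)) (t : ℝ) (y : Fin m → ℝ) (c : Eu (m + 1)) :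
    dist y (fun j => c (i.succAbove j)) ≤ dist (slice i t y) c := by
  rw [dist_pi_le_iff dist_nonneg]
  intro j
  rw [Real.dist_eq, dist_eq_norm, ← slice_apply_succAbove i t y j]
  exact PiLp.norm_apply_le (slice i t y - c) (i.succAbove j)

theorem IsC1.norm_fderiv_slice_le {w : Eu (m + 1) → ℝ} {dw : Eu (m + 1) → Eu (m + 1)}
    (h : IsC1 w dw) (i : Fin (m + 1)) (t : ℝ) (y : Fin m → ℝ) :
    ‖fderiv ℝ (fun y => w (slice i t y)) y‖ ≤ ‖sliceLin i‖ * ‖dw (slice i t y)‖ := by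
  have h1 : HasFDerivAt (fun y => w (slice i t y)) _ y :=
    (h.hasFDerivAt (slice i t y)).comp y (hasFDerivAt_slice i t y)
  rw [h1.fderiv, mul_comm]
  refine (ContinuousLinearMap.opNorm_comp_le _ _).trans ?_
  simp

end Slice

theorem eLpNorm_le_of_support_subset {α F : Type*} [MeasurableSpace α] [NormedAddCommGroup F]
    {μ : Measure α} {a b : ℝ} (ha : 0 < a) (hab : a ≤ b) {f : α → F}
    (hf : AEStronglyMeasurable f μ) {A : Set α} (mA : MeasurableSet A)
    (hA : ∀ x, x ∉ A → f x = 0) :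
    eLpNorm f (ENNReal.ofReal a) μ ≤
      eLpNorm f (ENNReal.ofReal b) μ * μ A ^ (1 / a - 1 / b) := by
  have e : ∀ r : ℝ≥0∞, eLpNorm f r μ = eLpNorm f r (μ.restrict A) := fun r => by
    rw [← eLpNorm_indicator_eq_eLpNorm_restrict mA]
    congr 1
    ext x
    by_cases hx : x ∈ A <;> simp [hx, hA]
  rw [e (ENNReal.ofReal a), e (ENNReal.ofReal b)]
  have := eLpNorm_le_eLpNorm_mul_rpow_measure_univ (μ := μ.restrict A)
    (ENNReal.ofReal_le_ofReal hab) hf.restrict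
  rwa [ENNReal.toReal_ofReal ha.le, ENNReal.toReal_ofReal (ha.le.trans hab),
    Measure.restrict_apply_univ] at this

/-- On `ℝ¹` the sup norm is controlled by the `L¹` norm of the derivative. -/
theorem enorm_le_lintegral_fderiv_one {W : (Fin 1 → ℝ) → ℝ} (hW : ContDiff ℝ 1 W)
    (hc : HasCompactSupport W) (y : Fin 1 → ℝ) : ‖W y‖ₑ ≤ ∫⁻ z, ‖fderiv ℝ W z‖ₑ := by
  let e : ℝ →L[ℝ] (Fin 1 → ℝ) := ContinuousLinearMap.pi fun _ => ContinuousLinearMap.id ℝ ℝ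
  have he : ∀ t, e t = fun _ => t := fun t => by ext; simp [e]
  have hcl : Topology.IsClosedEmbedding e := by
    refine Isometry.isClosedEmbedding (Isometry.of_dist_eq fun s t => ?_)
    simp [he, dist_pi_const]
  have hd : ∀ t, HasFDerivAt (fun t => W (e t)) ((fderiv ℝ W (e t)).comp e) t := fun t =>
    ((hW.differentiable (by norm_num)) (e t)).hasFDerivAt.comp t e.hasFDerivAt
  have h1 := (hc.comp_isClosedEmbedding hcl).enorm_le_lintegral_Ici_deriv
    (hW.comp e.contDiff) (y 0)
  have hy : e (y 0) = y := by
    rw [he]; ext j; rw [Subsingleton.elim j 0]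
  rw [Function.comp_apply, hy] at h1
  refine h1.trans ((setLIntegral_le_lintegral _ _).trans ?_)
  have mp := (volume_preserving_funUnique (Fin 1) ℝ).symm
  have hmp : ∫⁻ z, ‖fderiv ℝ W z‖ₑ = ∫⁻ t, ‖fderiv ℝ W (e t)‖ₑ := by
    exact (mp.lintegral_comp_emb (MeasurableEquiv.measurableEmbedding _) _).symm
  rw [hmp]
  refine lintegral_mono fun t => ?_
  have h2 : HasDerivAt (W ∘ e) (fderiv ℝ W (e t) (e 1)) t := by
    have := (hd t).hasDerivAt
    simpa [Function.comp_def] using this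
  rw [h2.deriv]
  refine (ContinuousLinearMap.le_opENorm _ _).trans ?_
  have : ‖e 1‖ₑ = 1 := by
    rw [← ofReal_norm, he, pi_norm_const]; simp
  rw [this, mul_one]

/-- The Sobolev embedding in `ℝᵐ` from `W^{1,s}` to `L^q`, `1/s = min(1/q+1/m, 1)`, with the
deficit expressed through the measure of the support. -/
theorem exists_slice_sobolev {m : ℕ} (hm : 1 ≤ m) {q s : ℝ} (hq : 1 ≤ q) (hs : 0 < s)
    (hsq : 1 / s = min (1 / q + 1 / m) 1) :
    ∃ C : ℝ≥0, ∀ W : (Fin m → ℝ) → ℝ, ContDiff ℝ 1 W → HasCompactSupport W →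
      ∀ B : Set (Fin m → ℝ), MeasurableSet B → (∀ y, y ∉ B → W y = 0) →
      eLpNorm W (ENNReal.ofReal q) volume ≤ C * volume B ^ (1 / q - 1 / s + 1 / m) *
        eLpNorm (fderiv ℝ W) (ENNReal.ofReal s) volume := by
  have hm0 : (0:ℝ) < m := by exact_mod_cast hm
  have hq0 : 0 < q := by linarith
  rcases le_or_gt (1 / q + 1 / (m:ℝ)) 1 with hcase | hcase
  · rw [min_eq_left hcase] at hsq
    refine ⟨SNormLESNormFDerivOfEqConst ℝ (volume : Measure (Fin m → ℝ)) (s.toNNReal : ℝ≥0),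
      fun W hW hc B mB hB => ?_⟩
    have e0 : 1 / q - 1 / s + 1 / (m:ℝ) = 0 := by rw [hsq]; ring
    rw [e0, ENNReal.rpow_zero, mul_one]
    have hs1 : 1 ≤ s := by
      rw [← hsq, div_le_one hs] at hcase; exact hcase
    exact eLpNorm_le_eLpNorm_fderiv_of_eq (volume : Measure (Fin m → ℝ)) hW hc
      (p := s.toNNReal) (p' := q.toNNReal) (by simpa using hs1) (by simpa using (by omega : 0 < m))
      (by rw [NNReal.coe_inv, Real.coe_toNNReal _ hs.le, Real.coe_toNNReal _ hq0.le]
          simp only [Module.finrank_fintype_fun_eq_card, Fintype.card_fin]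
          simp only [one_div] at hsq
          rw [hsq]; ring)
  · rw [min_eq_right hcase.le] at hsq
    have hs1 : s = 1 := by
      field_simp at hsq; linarith
    subst hs1
    rcases eq_or_lt_of_le hm with rfl | hm2
    · refine ⟨1, fun W hW hc B mB hB => ?_⟩
      have e0 : 1 / q - 1 / 1 + 1 / ((1:ℕ):ℝ) = 1 / q := by norm_num
      rw [e0, ENNReal.ofReal_one, eLpNorm_one_eq_lintegral_enorm,
        eLpNorm_eq_lintegral_rpow_enorm_toReal (by simpa using hq0) (by simp),
        ENNReal.toReal_ofReal hq0.le]
      set K : ℝ≥0∞ := ∫⁻ z, ‖fderiv ℝ W z‖ₑ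
      calc (∫⁻ y, ‖W y‖ₑ ^ q) ^ (1 / q) ≤ (∫⁻ y, B.indicator (fun _ => K ^ q) y) ^ (1 / q) := by
            gcongr with y
            by_cases hy : y ∈ B
            · simp only [hy, indicator_of_mem]
              gcongr
              exact enorm_le_lintegral_fderiv_one hW hc y
            · simp [hy, hB, hq0]
        _ = (K ^ q * volume B) ^ (1 / q) := by rw [lintegral_indicator_const mB]
        _ = K * volume B ^ (1 / q) := by
            rw [ENNReal.mul_rpow_of_nonneg _ _ (by positivity), ← ENNReal.rpow_mul,
              mul_one_div_cancel hq0.ne', ENNReal.rpow_one]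
        _ = _ := by rw [ENNReal.coe_one, one_mul, mul_comm]
    · have hm2' : (2:ℝ) ≤ m := by exact_mod_cast hm2
      have hpos : 0 < 1 - 1 / (m:ℝ) := by
        rw [sub_pos, div_lt_one hm0]; linarith
      set b : ℝ := 1 / (1 - 1 / (m:ℝ)) with hb
      have hb0 : 0 < b := by positivity
      have hb1 : 1 / b = 1 - 1 / (m:ℝ) := by rw [hb, one_div_one_div]
      have hqb : q ≤ b := by
        rw [← one_div_le_one_div hb0 hq0, hb1]; linarith
      refine ⟨SNormLESNormFDerivOfEqConst ℝ (volume : Measure (Fin m → ℝ)) ((1:ℝ≥0) : ℝ≥0),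
        fun W hW hc B mB hB => ?_⟩
      have h1 := eLpNorm_le_eLpNorm_fderiv_of_eq (volume : Measure (Fin m → ℝ)) hW hc
        (p := 1) (p' := b.toNNReal) le_rfl (by simpa using (by omega : 0 < m))
        (by rw [Real.coe_toNNReal _ hb0.le]
            simp only [Module.finrank_fintype_fun_eq_card, Fintype.card_fin]
            simp only [one_div] at hb1
            rw [hb1]; simp)
      have h2 := eLpNorm_le_of_support_subset hq0 hqb
        (hW.continuous.aestronglyMeasurable (μ := volume)) mB hB
      have e0 : 1 / q - 1 / 1 + 1 / (m:ℝ) = 1 / q - 1 / b := by rw [hb1]; ring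
      rw [e0, ENNReal.ofReal_one]
      refine h2.trans ?_
      calc _ ≤ _ := mul_le_mul_left h1 _
        _ = _ := by
          push_cast
          ring

theorem exists_subseq_ae_tendsto_zero {α : Type*} [MeasurableSpace α] {μ : Measure α}
    {F : ℕ → α → ℝ≥0∞} (hF : ∀ j, AEMeasurable (F j) μ)
    (h : Tendsto (fun j => ∫⁻ x, F j x ∂μ) atTop (𝓝 0)) :
    ∃ ns : ℕ → ℕ, StrictMono ns ∧ ∀ᵐ x ∂μ, Tendsto (fun j => F (ns j) x) atTop (𝓝 0) := by
  obtain ⟨ns, hns, hle⟩ := extraction_forall_of_eventually (P := fun k j =>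
    ∫⁻ x, F j x ∂μ ≤ (2:ℝ≥0∞)⁻¹ ^ k) fun k =>
      (h.eventually_lt_const (show (0:ℝ≥0∞) < (2:ℝ≥0∞)⁻¹ ^ k from
        ENNReal.pow_pos (by simp) _)).mono fun _ h => h.le
  refine ⟨ns, hns, ?_⟩
  have hsum : ∫⁻ x, ∑' j, F (ns j) x ∂μ ≠ ⊤ := by
    rw [lintegral_tsum fun j => hF _]
    refine ne_top_of_le_ne_top ?_ (ENNReal.tsum_le_tsum hle)
    rw [ENNReal.tsum_geometric]
    simp
  have := ae_lt_top' (AEMeasurable.tsum fun j => hF (ns j)) hsum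
  filter_upwards [this] with x hx
  exact ENNReal.tendsto_atTop_zero_of_tsum_ne_top hx.ne

theorem ae_aestronglyMeasurable_slice {m : ℕ} {F : Type*} [TopologicalSpace F]
    [TopologicalSpace.PseudoMetrizableSpace F] {f : Eu (m + 1) → F}
    (hf : AEStronglyMeasurable f volume) (i : Fin (m + 1)) :
    ∀ᵐ t, AEStronglyMeasurable (fun y => f (slice i t y)) volume := by
  filter_upwards [ae_slice i hf.ae_eq_mk] with t ht
  refine ⟨fun y => hf.mk f (slice i t y), ?_, ht⟩
  exact hf.stronglyMeasurable_mk.comp_measurable (contDiff_slice i t).continuous.measurable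

theorem exists_slice_sobolev_sob {m : ℕ} (hm : 1 ≤ m) {p q s : ℝ} (hq : 1 ≤ q) (hs : 1 ≤ s)
    (hsp : s ≤ p) (hsq : 1 / s = min (1 / q + 1 / m) 1) :
    ∃ C : ℝ≥0, ∀ (y₀ : Eu (m + 1)) (r : ℝ), 0 < r →
      ∀ (V : Eu (m + 1) → ℝ) (dV : Eu (m + 1) → Eu (m + 1)), Sob (ENNReal.ofReal p) V dV →
      (∀ x, x ∉ ball y₀ r → V x = 0 ∧ dV x = 0) → ∀ i, ∀ᵐ t,
      eLpNorm (fun y => V (slice i t y)) (ENNReal.ofReal q) volume ≤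
        C * ENNReal.ofReal ((4 * r) ^ (m * (1 / q - 1 / s) + 1)) *
          eLpNorm (fun y => dV (slice i t y)) (ENNReal.ofReal s) volume := by
  have hm0 : (0:ℝ) < m := by exact_mod_cast hm
  have hs0 : 0 < s := by linarith
  have hq0 : 0 < q := by linarith
  have hp0 : 0 < p := by linarith
  have hp1 : 1 ≤ ENNReal.ofReal p := by simpa using hs.trans hsp
  have hs1 : 1 ≤ ENNReal.ofReal s := by simpa using hs
  obtain ⟨C, hC⟩ := exists_slice_sobolev hm hq hs0 hsq
  refine ⟨C * ∑ i : Fin (m + 1), ‖sliceLin (m := m) i‖₊, fun y₀ r hr V dV hV hsupp i => ?_⟩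
  have hθ : 0 ≤ m * (1 / q - 1 / s) + 1 := by
    have : 1 / s ≤ 1 / q + 1 / m := by rw [hsq]; exact min_le_left _ _
    have h2 : m * (1 / s) ≤ m * (1 / q + 1 / m) := by gcongr
    have h3 : (m:ℝ) * (1 / m) = 1 := by field_simp
    nlinarith
  obtain ⟨ζ, hζ, hζc, hζs, hζ1⟩ := exists_cutoff y₀ hr (show r < 2 * r by linarith)
  have hζC : IsC1 ζ (∇ ζ) := isC1_of_contDiff (hζ.of_le (by simp))
  obtain ⟨M₁, hM₁⟩ := hζc.exists_bound_of_continuous hζC.continuous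
  obtain ⟨M₂, hM₂⟩ := (hζC.hasCompactSupport_grad hζc).exists_bound_of_continuous hζC.1
  have eV : ∀ x, V x = ζ x * V x ∧ dV x = ζ x • dV x ∧ V x • ∇ ζ x = 0 := fun x => by
    by_cases hx : x ∈ ball y₀ r
    · simp [hζ1 x hx]
    · simp [hsupp x hx]
  have hζ0 : ∀ x, x ∉ closedBall y₀ (2 * r) → ζ x = 0 ∧ ∇ ζ x = 0 := fun x hx => by
    rw [← hζs] at hx
    exact ⟨image_eq_zero_of_notMem_tsupport hx, hζC.support_grad hx⟩
  obtain ⟨w, dw, hw, -, h1, h2, h3, -⟩ := hV.exists_seq_ae (by simpa using hp0)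
  set f : ℕ → Eu (m + 1) → ℝ := fun j x => ζ x * w j x with hf
  set df : ℕ → Eu (m + 1) → Eu (m + 1) := fun j x => ζ x • dw j x + w j x • ∇ ζ x with hdf
  have hfC : ∀ j, IsC1 (f j) (df j) := fun j => hζC.mul (hw j)
  have hd : ∀ j x, df j x - dV x = ζ x • (dw j x - dV x) + (w j x - V x) • ∇ ζ x := fun j x => by
    rw [sub_smul, (eV x).2.2, sub_zero, smul_sub, ← (eV x).2.1, hdf]
    exact (sub_add_eq_add_sub _ _ _).symm
  have mdV : AEStronglyMeasurable dV volume := hV.memLp_grad.1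
  have mV : AEStronglyMeasurable V volume := hV.memLp.1
  have md : ∀ j, AEStronglyMeasurable (fun x => df j x - dV x) volume := fun j =>
    (hfC j).1.aestronglyMeasurable.sub mdV
  have hLp : Tendsto (fun j => eLpNorm (fun x => df j x - dV x) (ENNReal.ofReal p) volume)
      atTop (𝓝 0) := by
    refine tendsto_eLpNorm_of_le_add hp1 (a := fun j x => ζ x • (dw j x - dV x))
      (b := fun j x => (w j x - V x) • ∇ ζ x)
      (fun j => hζC.continuous.aestronglyMeasurable.smul ((hw j).1.aestronglyMeasurable.sub mdV))
      (fun j => ((hw j).continuous.aestronglyMeasurable.sub mV).smul hζC.1.aestronglyMeasurable)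
      hd ?_ ?_
    · exact tendsto_eLpNorm_of_norm_le M₁ (fun j x => by
        rw [norm_smul]; gcongr; exact hM₁ x) h2
    · exact tendsto_eLpNorm_of_norm_le M₂ (fun j x => by
        rw [norm_smul, mul_comm]; gcongr; exact hM₂ x) h1
  have hLs : Tendsto (fun j => eLpNorm (fun x => df j x - dV x) (ENNReal.ofReal s) volume)
      atTop (𝓝 0) := by
    have hb : volume (closedBall y₀ (2 * r)) ^ (1 / s - 1 / p) ≠ ⊤ :=
      ENNReal.rpow_ne_top_of_nonneg
        (sub_nonneg.2 (one_div_le_one_div_of_le hs0 hsp)) measure_closedBall_lt_top.ne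
    refine tendsto_of_tendsto_of_tendsto_of_le_of_le tendsto_const_nhds
      (by simpa using ENNReal.Tendsto.mul_const hLp (Or.inr hb)) (fun _ => zero_le)
      fun j => eLpNorm_le_of_support_subset hs0 hsp (md j) measurableSet_closedBall
        fun x hx => ?_
    have hx' : x ∉ ball y₀ r := fun h => hx (ball_subset_closedBall (ball_subset_ball (by linarith) h))
    simp [hdf, hζ0 x hx, hsupp x hx']
  obtain ⟨ns, hns, hae⟩ := exists_subseq_ae_tendsto_zero (μ := (volume : Measure ℝ))
    (F := fun j t => ∫⁻ y, ‖df j (slice i t y) - dV (slice i t y)‖ₑ ^ s)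
    (fun j => aemeasurable_lintegral_slice i ((md j).enorm.pow_const s)) (by
      have : ∀ j, ∫⁻ t, ∫⁻ y, ‖df j (slice i t y) - dV (slice i t y)‖ₑ ^ s =
          eLpNorm (fun x => df j x - dV x) (ENNReal.ofReal s) volume ^ s := fun j => by
        rw [← lintegral_enorm_rpow_eq hs0]
        exact (lintegral_slice i ((md j).enorm.pow_const s)).symm
      simp_rw [this]
      have h0 := ((ENNReal.continuous_rpow_const (y := s)).tendsto 0).comp hLs
      rwa [ENNReal.zero_rpow_of_pos hs0] at h0)
  filter_upwards [hae, ae_slice i h3, ae_aestronglyMeasurable_slice mdV i] with t ht1 ht2 mdVt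
  set K : ℝ≥0∞ := (C * ∑ i : Fin (m + 1), ‖sliceLin (m := m) i‖₊ : ℝ≥0) *
    ENNReal.ofReal ((4 * r) ^ (m * (1 / q - 1 / s) + 1)) with hK
  have cs : Continuous (slice i t) := (contDiff_slice i t).continuous
  have ht1' : Tendsto (fun j => eLpNorm (fun y => df (ns j) (slice i t y) - dV (slice i t y))
      (ENNReal.ofReal s) volume) atTop (𝓝 0) := by
    have h0 := ((ENNReal.continuous_rpow_const (y := 1 / s)).tendsto 0).comp ht1
    rw [ENNReal.zero_rpow_of_pos (by positivity)] at h0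
    refine h0.congr fun j => ?_
    rw [Function.comp_apply, lintegral_enorm_rpow_eq hs0, ← ENNReal.rpow_mul,
      mul_one_div_cancel hs0.ne', ENNReal.rpow_one]
  refine eLpNorm_le_of_tendsto_ae (f := fun j y => f (ns j) (slice i t y))
    (b := fun j => K * (eLpNorm (fun y => dV (slice i t y)) (ENNReal.ofReal s) volume +
      eLpNorm (fun y => df (ns j) (slice i t y) - dV (slice i t y)) (ENNReal.ofReal s) volume))
    (fun j => ((hfC _).continuous.comp cs).aestronglyMeasurable) ?_ (fun j => ?_) ?_
  · filter_upwards [ht2] with y hy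
    rw [(eV (slice i t y)).1]
    exact (hy.const_mul _).comp hns.tendsto_atTop
  · set c : Fin m → ℝ := fun j => y₀ (i.succAbove j)
    have hB : ∀ y, y ∉ closedBall c (2 * r) → f (ns j) (slice i t y) = 0 := fun y hy => by
      have : slice i t y ∉ closedBall y₀ (2 * r) := fun h =>
        hy ((dist_le_dist_slice i t y y₀).trans h)
      simp [hf, hζ0 _ this]
    have h := hC (fun y => f (ns j) (slice i t y)) ((hfC _).contDiff.comp (contDiff_slice i t))
      (HasCompactSupport.intro (isCompact_closedBall c (2 * r)) hB) _ measurableSet_closedBall hB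
    refine h.trans ?_
    have hv : volume (closedBall c (2 * r)) ^ (1 / q - 1 / s + 1 / (m:ℝ)) =
        ENNReal.ofReal ((4 * r) ^ (m * (1 / q - 1 / s) + 1)) := by
      rw [Real.volume_pi_closedBall c (by linarith), ENNReal.ofReal_rpow_of_pos (by positivity),
        Fintype.card_fin, ← Real.rpow_natCast, ← Real.rpow_mul (by positivity)]
      congr 2
      · ring
      · field_simp
    have hfd : eLpNorm (fderiv ℝ fun y => f (ns j) (slice i t y)) (ENNReal.ofReal s) volume ≤
        ‖sliceLin (m := m) i‖₊ • eLpNorm (fun y => df (ns j) (slice i t y)) (ENNReal.ofReal s) volume :=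
      eLpNorm_le_nnreal_smul_eLpNorm_of_ae_le_mul (Eventually.of_forall fun y => by
        have := (hfC (ns j)).norm_fderiv_slice_le i t y
        exact_mod_cast this) _
    rw [hv]
    have hi : ‖sliceLin (m := m) i‖₊ ≤ ∑ i : Fin (m + 1), ‖sliceLin (m := m) i‖₊ :=
      Finset.single_le_sum (f := fun i => ‖sliceLin (m := m) i‖₊) (fun _ _ => zero_le)
        (Finset.mem_univ i)
    calc _ ≤ C * ENNReal.ofReal ((4 * r) ^ (m * (1 / q - 1 / s) + 1)) *
          (((∑ i : Fin (m + 1), ‖sliceLin (m := m) i‖₊ : ℝ≥0) : ℝ≥0∞) *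
          (eLpNorm (fun y => dV (slice i t y)) (ENNReal.ofReal s) volume +
      eLpNorm (fun y => df (ns j) (slice i t y) - dV (slice i t y)) (ENNReal.ofReal s) volume)) := by
          gcongr
          refine hfd.trans ?_
          rw [ENNReal.smul_def, smul_eq_mul]
          gcongr
          exact eLpNorm_le_add_sub hs1 ((hfC _).1.comp cs).aestronglyMeasurable mdVt
      _ = _ := by rw [hK]; push_cast; ring
  · refine ENNReal.Tendsto.const_mul ?_ (Or.inr (ENNReal.mul_ne_top ENNReal.coe_ne_top
      ENNReal.ofReal_ne_top))
    simpa using tendsto_const_nhds.add ht1'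

theorem exists_cutoff_line {α β : ℝ} (hαβ : α < β) {G : Set ℝ} (mG : MeasurableSet G)
    (hG : G ⊆ Ioo α β) (hv : ENNReal.ofReal ((β - α) / 2) ≤ volume G) :
    ∃ Ψ ψ : ℝ → ℝ, ∃ K : ℝ≥0, LipschitzWith K Ψ ∧ (∀ t, 0 ≤ Ψ t ∧ Ψ t ≤ 1) ∧
      (∀ t ≤ α, Ψ t = 0) ∧ (∀ t ≥ β, Ψ t = 1) ∧ (∀ᵐ t, HasDerivAt Ψ (ψ t) t) ∧
      (∀ t, |ψ t| ≤ 2 / (β - α)) ∧ ∀ t, t ∉ G → ψ t = 0 := by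
  have hd : 0 < β - α := sub_pos.2 hαβ
  have hGt : volume G ≠ ⊤ := ne_top_of_le_ne_top (by simp) (measure_mono hG)
  set g : ℝ := volume.real G with hg
  have hg1 : (β - α) / 2 ≤ g := by
    rw [hg, measureReal_def]
    exact (ENNReal.ofReal_le_iff_le_toReal hGt).1 hv
  have hg0 : 0 < g := by linarith
  have hgi : g⁻¹ ≤ 2 / (β - α) := by
    rw [← inv_div]; exact inv_anti₀ (by linarith) hg1
  set χ : ℝ → ℝ := G.indicator fun _ => 1 with hχ
  have hχi : Integrable χ := (integrable_indicator_iff mG).2 (by simp [integrableOn_const_iff, hGt.lt_top])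
  have hχ0 : ∀ t, 0 ≤ χ t := fun t => indicator_nonneg (fun _ _ => zero_le_one) t
  have hχ1 : ∀ t, χ t ≤ 1 := fun t => indicator_le_self' (fun _ _ => zero_le_one) t
  have hint : ∀ a b, IntervalIntegrable χ volume a b := fun a b => hχi.intervalIntegrable
  have htot : ∫ t, χ t = g := by
    rw [hχ, integral_indicator mG]; simp [hg]
  have hzero : ∀ t ≤ α, ∫ s in α..t, χ s = 0 := fun t ht => by
    rw [intervalIntegral.integral_symm, intervalIntegral.integral_of_le ht, neg_eq_zero]
    refine setIntegral_eq_zero_of_forall_eq_zero fun s hs => ?_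
    exact indicator_of_notMem (fun h => (hG h).1.not_ge hs.2) _
  have hpos : ∀ t, 0 ≤ ∫ s in α..t, χ s := fun t => by
    rcases le_total t α with h | h
    · rw [hzero t h]
    · exact intervalIntegral.integral_nonneg h fun s _ => hχ0 s
  have hle : ∀ t, ∫ s in α..t, χ s ≤ g := fun t => by
    rcases le_total t α with h | h
    · rw [hzero t h]; exact hg0.le
    · rw [intervalIntegral.integral_of_le h, ← htot]
      exact setIntegral_le_integral hχi (Eventually.of_forall hχ0)
  have hfull : ∀ t ≥ β, ∫ s in α..t, χ s = g := fun t ht => by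
    rw [intervalIntegral.integral_of_le (hαβ.le.trans ht), ← htot]
    refine setIntegral_eq_integral_of_forall_compl_eq_zero fun s hs => ?_
    exact indicator_of_notMem (fun h => hs ⟨(hG h).1, (hG h).2.le.trans ht⟩) _
  refine ⟨fun t => g⁻¹ * ∫ s in α..t, χ s, fun t => g⁻¹ * χ t, (g⁻¹).toNNReal, ?_, ?_, ?_, ?_,
    ?_, ?_, ?_⟩
  · refine LipschitzWith.of_dist_le_mul fun s t => ?_
    rw [Real.coe_toNNReal _ (by positivity), Real.dist_eq, Real.dist_eq, ← mul_sub, abs_mul,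
      abs_of_pos (inv_pos.2 hg0)]
    refine mul_le_mul_of_nonneg_left ?_ (by positivity)
    rw [intervalIntegral.integral_interval_sub_left (hint _ _) (hint _ _)]
    have := intervalIntegral.norm_integral_le_of_norm_le_const (a := t) (b := s) (f := χ) (C := 1)
      fun x _ => by rw [Real.norm_of_nonneg (hχ0 x)]; exact hχ1 x
    simpa using this
  · intro t
    refine ⟨mul_nonneg (by positivity) (hpos t), ?_⟩
    calc g⁻¹ * _ ≤ g⁻¹ * g := by gcongr; exact hle t
      _ = 1 := inv_mul_cancel₀ hg0.ne'
  · intro t ht; simp only [hzero t ht, mul_zero]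
  · intro t ht; simp only [hfull t ht]; exact inv_mul_cancel₀ hg0.ne'
  · filter_upwards [LocallyIntegrable.ae_hasDerivAt_integral hχi.locallyIntegrable] with t ht
    exact (ht α).const_mul _
  · intro t
    rw [abs_of_nonneg (mul_nonneg (by positivity) (hχ0 t))]
    calc g⁻¹ * χ t ≤ g⁻¹ * 1 := by gcongr; exact hχ1 t
      _ ≤ _ := by rw [mul_one]; exact hgi
  · intro t ht; simp [hχ, ht]

/-- The two collars of a slab, on either side of the centre `c`. -/
def collar (c ρ σ : ℝ) : Bool → Set ℝ
  | true => Ioo (c + ρ) (c + σ)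
  | false => Ioo (c - σ) (c - ρ)

theorem measurableSet_collar (c ρ σ : ℝ) (b : Bool) : MeasurableSet (collar c ρ σ b) := by
  cases b <;> exact measurableSet_Ioo

theorem volume_collar (c ρ σ : ℝ) (b : Bool) :
    volume (collar c ρ σ b) = ENNReal.ofReal (σ - ρ) := by
  cases b <;> simp only [collar, Real.volume_Ioo] <;> congr 1 <;> ring

theorem abs_gt_of_mem_collar {c ρ σ t : ℝ} {b : Bool} (h : t ∈ collar c ρ σ b) :
    ρ < |t - c| := by
  cases b
  · have := h.2; rw [lt_abs]; right; linarith
  · have := h.1; rw [lt_abs]; left; linarith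

theorem exists_cutoff_collar {c ρ σ : ℝ} (hρσ : ρ < σ) (b : Bool) {G : Set ℝ}
    (mG : MeasurableSet G) (hv : ENNReal.ofReal ((σ - ρ) / 2) ≤ volume (collar c ρ σ b ∩ G)) :
    ∃ Ψ ψ : ℝ → ℝ, ∃ K : ℝ≥0, LipschitzWith K Ψ ∧ (∀ t, 0 ≤ Ψ t ∧ Ψ t ≤ 1) ∧
      (∀ t, |t - c| ≤ ρ → Ψ t = 1) ∧
      (∀ t, (if b then c + σ ≤ t else t ≤ c - σ) → Ψ t = 0) ∧
      (∀ᵐ t, HasDerivAt Ψ (ψ t) t) ∧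
      (∀ t, |ψ t| ≤ (collar c ρ σ b ∩ G).indicator (fun _ => 2 / (σ - ρ)) t) := by
  have mG' := (measurableSet_collar c ρ σ b).inter mG
  cases b
  · obtain ⟨Ψ, ψ, K, h1, h2, h3, h4, h5, h6, h7⟩ := exists_cutoff_line
      (α := c - σ) (β := c - ρ) (by linarith) mG' inter_subset_left
      (by rwa [show c - ρ - (c - σ) = σ - ρ by ring])
    rw [show c - ρ - (c - σ) = σ - ρ by ring] at h6
    refine ⟨Ψ, ψ, K, h1, h2, fun t ht => h4 t ?_, fun t ht => h3 t (by simpa using ht), h5,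
      fun t => ?_⟩
    · have := (abs_le.1 ht).1; show c - ρ ≤ t; linarith
    · by_cases ht : t ∈ collar c ρ σ false ∩ G
      · rw [indicator_of_mem ht]; exact h6 t
      · rw [indicator_of_notMem ht, h7 t ht, abs_zero]
  · obtain ⟨Ψ, ψ, K, h1, h2, h3, h4, h5, h6, h7⟩ := exists_cutoff_line
      (α := c + ρ) (β := c + σ) (by linarith) mG' inter_subset_left
      (by rwa [show c + σ - (c + ρ) = σ - ρ by ring])
    rw [show c + σ - (c + ρ) = σ - ρ by ring] at h6
    refine ⟨fun t => 1 - Ψ t, fun t => - ψ t, K, ?_, fun t => ?_, fun t ht => ?_,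
      fun t ht => ?_, ?_, fun t => ?_⟩
    · refine LipschitzWith.of_dist_le_mul fun s t => ?_
      rw [dist_sub_left]; exact h1.dist_le_mul s t
    · have := h2 t; constructor <;> linarith [this.1, this.2]
    · have := (abs_le.1 ht).2
      simp only; rw [h3 t (by linarith), sub_zero]
    · simp only; rw [h4 t (by simpa using ht), sub_self]
    · filter_upwards [h5] with t ht
      exact ht.const_sub 1
    · rw [abs_neg]
      by_cases ht : t ∈ collar c ρ σ true ∩ G
      · rw [indicator_of_mem ht]; exact h6 t
      · rw [indicator_of_notMem ht, h7 t ht, abs_zero]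

theorem exists_cube_cutoff {n : ℕ} (y : Eu n) {ρ σ : ℝ} (hρσ : ρ < σ)
    {G : Fin n × Bool → Set ℝ} (mG : ∀ k, MeasurableSet (G k))
    (hv : ∀ k, ENNReal.ofReal ((σ - ρ) / 2) ≤ volume (collar (y k.1) ρ σ k.2 ∩ G k)) :
    ∃ ψ dψ, IsMult ψ dψ ∧ (∀ x, 0 ≤ ψ x ∧ ψ x ≤ 1) ∧
      (∀ x ∈ cube y ρ, ψ x = 1 ∧ dψ x = 0) ∧ (∀ x, x ∉ cube y σ → ψ x = 0 ∧ dψ x = 0) ∧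
      ∀ x, ‖dψ x‖ ≤ ∑ k : Fin n × Bool,
        (collar (y k.1) ρ σ k.2 ∩ G k).indicator (fun _ => 2 / (σ - ρ)) (x k.1) := by
  choose Ψ ψ K h1 h2 h3 h4 h5 h6 using fun k : Fin n × Bool =>
    exists_cutoff_collar (c := y k.1) hρσ k.2 (mG k) (hv k)
  have hM : ∀ k, IsMult (fun x : Eu n => Ψ k (x k.1))
      (fun x => ψ k (x k.1) • EuclideanSpace.single k.1 (1:ℝ)) := fun k =>
    isMult_coord (h1 k) (M := 1) (fun t => by rw [abs_of_nonneg (h2 k t).1]; exact (h2 k t).2)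
      (h5 k) k.1
  obtain ⟨d, hd, hd1, hd2⟩ := IsMult.exists_prod (s := Finset.univ) (fun k _ => hM k)
    (fun k _ x => h2 k (x k.1))
  have hb : ∀ x, ‖d x‖ ≤ ∑ k : Fin n × Bool,
      (collar (y k.1) ρ σ k.2 ∩ G k).indicator (fun _ => 2 / (σ - ρ)) (x k.1) := fun x => by
    refine (hd1 x).trans (Finset.sum_le_sum fun k _ => ?_)
    rw [norm_smul, PiLp.norm_single, norm_one, mul_one]
    exact h6 k _
  refine ⟨_, d, hd, fun x => ⟨Finset.prod_nonneg fun k _ => (h2 k _).1,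
    Finset.prod_le_one (fun k _ => (h2 k _).1) fun k _ => (h2 k _).2⟩, fun x hx => ⟨?_, ?_⟩,
    fun x hx => ?_, hb⟩
  · exact Finset.prod_eq_one fun k _ => h3 k _ (hx k.1).le
  · rw [← norm_le_zero_iff]
    refine (hb x).trans (Finset.sum_nonpos fun k _ => ?_)
    rw [indicator_of_notMem]
    exact fun h => (abs_gt_of_mem_collar h.1).not_ge (hx k.1).le
  · simp only [cube, mem_ofPred_eq, not_forall, not_lt] at hx
    obtain ⟨i, hi⟩ := hx
    obtain ⟨b, hb'⟩ : ∃ b : Bool, if b then y i + σ ≤ x i else x i ≤ y i - σ := by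
      rcases le_abs.1 hi with h | h
      · exact ⟨true, by simp; linarith⟩
      · exact ⟨false, by simp; linarith⟩
    have e1 : Ψ (i, b) (x i) = 0 := h4 (i, b) _ hb'
    have e2 : ψ (i, b) (x i) = 0 := by
      have := h6 (i, b) (x i)
      rw [indicator_of_notMem] at this
      · exact abs_nonpos_iff.1 this
      · rintro ⟨h, -⟩
        cases b
        · have := h.1; simp at hb'; simp at this; linarith
        · have := h.2; simp at hb'; simp at this; linarith
    exact ⟨Finset.prod_eq_zero (Finset.mem_univ (i, b)) e1,
      hd2 x ⟨(i, b), Finset.mem_univ _, e1, by simp [e2]⟩⟩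

/-- The Lipschitz cutoff between two concentric cubes. -/
theorem exists_cube_cutoff_lipschitz {n : ℕ} (y : Eu n) {ρ σ : ℝ} (hρσ : ρ < σ) :
    ∃ ψ dψ, IsMult ψ dψ ∧ (∀ x, 0 ≤ ψ x ∧ ψ x ≤ 1) ∧
      (∀ x ∈ cube y ρ, ψ x = 1 ∧ dψ x = 0) ∧ (∀ x, x ∉ cube y σ → ψ x = 0 ∧ dψ x = 0) ∧
      ∀ x, ‖dψ x‖ ≤ 4 * n / (σ - ρ) := by
  have hd : 0 < σ - ρ := sub_pos.2 hρσ
  obtain ⟨ψ, dψ, h1, h2, h3, h4, h5⟩ := exists_cube_cutoff y hρσ (G := fun _ => univ)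
    (fun _ => MeasurableSet.univ) (fun k => by
      rw [inter_univ, volume_collar]; exact ENNReal.ofReal_le_ofReal (by linarith))
  refine ⟨ψ, dψ, h1, h2, h3, h4, fun x => (h5 x).trans ?_⟩
  calc _ ≤ ∑ k : Fin n × Bool, 2 / (σ - ρ) := by
        gcongr with k
        exact indicator_le_self' (fun _ _ => by positivity) _
    _ = 4 * n / (σ - ρ) := by simp; ring

theorem good_cutoff_arith {N c₁ c₂ k two h d r a M θ p q s : ℝ} (hN : 0 < N) (h1 : 0 < c₁)
    (h2 : 0 < c₂) (hk : 0 < k) (ht : 0 < two) (hh : 0 < h) (hd : 0 < d) (hr : 0 < r) (ha : 0 < a)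
    (hM : 0 < M) (hp : 0 < p) (hs : 0 < s) :
    N * (d * r * h * ((two * N / (d * r * h)) ^ q *
      (c₁ * (c₂ * r) ^ θ * (two * (k / d * M ^ (1 / p) * a ^ (1 / s - 1 / p)) ^ s / (d * r * h))
        ^ (1 / s)) ^ q)) =
    (N * (h * ((two * N / h) ^ q * (c₁ * c₂ ^ θ * (two * k ^ s / h) ^ (1 / s)) ^ q))) *
      (d ^ (-(2 * q + q / s - 1)) * r ^ (1 - q - q / s + θ * q) * a ^ (q * (1 / s - 1 / p)) *
        M ^ (q / p)) := by
  obtain ⟨N, rfl⟩ : ∃ x, Real.exp x = N := ⟨_, Real.exp_log hN⟩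
  obtain ⟨c₁, rfl⟩ : ∃ x, Real.exp x = c₁ := ⟨_, Real.exp_log h1⟩
  obtain ⟨c₂, rfl⟩ : ∃ x, Real.exp x = c₂ := ⟨_, Real.exp_log h2⟩
  obtain ⟨k, rfl⟩ : ∃ x, Real.exp x = k := ⟨_, Real.exp_log hk⟩
  obtain ⟨two, rfl⟩ : ∃ x, Real.exp x = two := ⟨_, Real.exp_log ht⟩
  obtain ⟨h, rfl⟩ : ∃ x, Real.exp x = h := ⟨_, Real.exp_log hh⟩
  obtain ⟨d, rfl⟩ : ∃ x, Real.exp x = d := ⟨_, Real.exp_log hd⟩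
  obtain ⟨r, rfl⟩ : ∃ x, Real.exp x = r := ⟨_, Real.exp_log hr⟩
  obtain ⟨a, rfl⟩ : ∃ x, Real.exp x = a := ⟨_, Real.exp_log ha⟩
  obtain ⟨M, rfl⟩ : ∃ x, Real.exp x = M := ⟨_, Real.exp_log hM⟩
  simp only [← Real.exp_mul, ← Real.exp_add, ← Real.exp_sub]
  congr 1
  field_simp
  ring

theorem exists_good_cutoff {m : ℕ} (hm : 1 ≤ m) {p q s : ℝ} (hs : 1 ≤ s) (hsp : s < p)
    (hpq : p < q) (hsq : 1 / s = min (1 / q + 1 / m) 1) :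
    ∃ C : ℝ, 0 < C ∧ ∀ (y : Eu (m + 1)) (r : ℝ), 0 < r →
      ∀ (v : Eu (m + 1) → ℝ) (dv : Eu (m + 1) → Eu (m + 1)), Sob (ENNReal.ofReal p) v dv →
      ∀ A : Set (Eu (m + 1)), MeasurableSet A → (∀ x, x ∉ A → v x = 0 ∧ dv x = 0) →
      ∀ a : ℝ, 0 < a → volume (A ∩ cube y r) ≤ ENNReal.ofReal a →
      ∀ d : ℝ, 0 < d → d < 1 → ∀ M : ℝ, 0 < M →
      (∫⁻ x in cube y r, (‖dv x‖ₑ ^ p + ENNReal.ofReal r⁻¹ ^ p * ‖v x‖ₑ ^ p)) ≤ ENNReal.ofReal M →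
      ∃ ψ dψ, IsMult ψ dψ ∧ (∀ x, 0 ≤ ψ x ∧ ψ x ≤ 1) ∧
        (∀ x ∈ cube y ((1 - d) * r), ψ x = 1 ∧ dψ x = 0) ∧
        (∀ x, x ∉ cube y ((1 - d / 2) * r) → ψ x = 0 ∧ dψ x = 0) ∧
        ∫⁻ x, ‖dψ x‖ₑ ^ q * ‖v x‖ₑ ^ q ≤ ENNReal.ofReal
          (C * (d ^ (-(2 * q + q / s - 1)) * r ^ (-((m + 1) * q * (1 / s - 1 / q))) *
            a ^ (q * (1 / s - 1 / p)) * M ^ (q / p))) := by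
  have hs0 : 0 < s := by linarith
  have hp0 : 0 < p := by linarith
  have hp1 : 1 ≤ p := by linarith
  have hq0 : 0 < q := by linarith
  have hm0 : (0:ℝ) < m := by exact_mod_cast hm
  have hpE : 1 ≤ ENNReal.ofReal p := by simpa using hp1
  obtain ⟨C₀, hC₀⟩ := exists_slice_sobolev_sob hm (q := q) (by linarith) hs hsp.le hsq
  set n : ℝ := ((m + 1 : ℕ) : ℝ) with hn
  have hn1 : 1 ≤ n := by simp [hn]
  set θ : ℝ := m * (1 / q - 1 / s) + 1 with hθ
  set N : ℝ := 2 * n with hN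
  set k : ℝ := 16 * n with hk
  set c₂ : ℝ := 4 * (√n + 1) with hc₂
  have hk0 : 0 < k := by positivity
  have hN0 : 0 < N := by positivity
  have hc₂0 : 0 < c₂ := by positivity
  have hc₁0 : (0:ℝ) < C₀ + 1 := by positivity
  refine ⟨N * (1 / 2 * ((2 * N / (1 / 2)) ^ q *
    ((C₀ + 1) * c₂ ^ θ * (2 * k ^ s / (1 / 2)) ^ (1 / s)) ^ q)), by positivity, ?_⟩
  intro y r hr v dv hv A mA hA a ha haA d hd hd1 M hM hint
  have hdr : 0 < d * r := by positivity
  have e1 : -((m + 1) * q * (1 / s - 1 / q)) = 1 - q - q / s + θ * q := by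
    rw [hθ]; field_simp; ring
  rw [e1, ← good_cutoff_arith hN0 hc₁0 hc₂0 hk0 two_pos (by norm_num) hd hr ha hM hp0 hs0]
  set ℓ : ℝ := d * r * (1 / 2) with hℓ
  have hℓ0 : 0 < ℓ := by positivity
  set B : ℝ := k / d * M ^ (1 / p) * a ^ (1 / s - 1 / p) with hB
  have hB0 : 0 < B := by positivity
  -- the localised function
  obtain ⟨ζ, dζ, hζM, hζ01, hζ1, hζ0, hζb⟩ := exists_cube_cutoff_lipschitz y
    (ρ := (1 - d / 2) * r) (σ := r) (by nlinarith)
  have hζb' : ∀ x, ‖dζ x‖ ≤ (k / (2 * d)) * r⁻¹ := fun x => by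
    refine (hζb x).trans (le_of_eq ?_)
    rw [show r - (1 - d / 2) * r = d * r / 2 by ring, hk, hn]
    field_simp
    norm_num
  set V : Eu (m + 1) → ℝ := fun x => ζ x * v x with hV
  set dV : Eu (m + 1) → Eu (m + 1) := fun x => ζ x • dv x + v x • dζ x with hdV
  have hVS : Sob (ENNReal.ofReal p) V dV := hv.mult hpE (by simp) hζM
  have hV0 : ∀ x, x ∉ A ∩ cube y r → V x = 0 ∧ dV x = 0 := fun x hx => by
    by_cases h : x ∈ cube y r
    · have := hA x fun h' => hx ⟨h', h⟩
      simp [hV, hdV, this]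
    · simp [hV, hdV, hζ0 x h]
  have hk2 : 1 ≤ k / (2 * d) := by
    rw [le_div_iff₀ (by positivity)]; linarith
  have hpt : ∀ x, ‖dV x‖ₑ ^ p ≤ ENNReal.ofReal (k / d) ^ p * (cube y r).indicator
      (fun x => ‖dv x‖ₑ ^ p + ENNReal.ofReal r⁻¹ ^ p * ‖v x‖ₑ ^ p) x := fun x => by
    by_cases hx : x ∈ cube y r
    · rw [indicator_of_mem hx]
      have h1 : ‖dV x‖ₑ ≤ ENNReal.ofReal (k / (2 * d)) * (‖dv x‖ₑ + ENNReal.ofReal r⁻¹ * ‖v x‖ₑ) := by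
        have : ‖dV x‖ ≤ k / (2 * d) * (‖dv x‖ + r⁻¹ * ‖v x‖) := by
          calc ‖dV x‖ ≤ ‖ζ x • dv x‖ + ‖v x • dζ x‖ := norm_add_le _ _
            _ ≤ 1 * ‖dv x‖ + ‖v x‖ * (k / (2 * d) * r⁻¹) := by
                rw [norm_smul, norm_smul]
                gcongr
                · rw [Real.norm_of_nonneg (hζ01 x).1]; exact (hζ01 x).2
                · exact hζb' x
            _ ≤ k / (2 * d) * ‖dv x‖ + ‖v x‖ * (k / (2 * d) * r⁻¹) := by gcongr
            _ = _ := by ring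
        rw [← ofReal_norm, ← ofReal_norm (dv x), ← ofReal_norm (v x),
          ← ENNReal.ofReal_mul (by positivity), ← ENNReal.ofReal_add (by positivity) (by positivity),
          ← ENNReal.ofReal_mul (by positivity)]
        exact ENNReal.ofReal_le_ofReal this
      calc ‖dV x‖ₑ ^ p ≤ (ENNReal.ofReal (k / (2 * d)) *
            (‖dv x‖ₑ + ENNReal.ofReal r⁻¹ * ‖v x‖ₑ)) ^ p := by gcongr
        _ ≤ ENNReal.ofReal (k / (2 * d)) ^ p * (2 ^ p * (‖dv x‖ₑ ^ p +
            (ENNReal.ofReal r⁻¹ * ‖v x‖ₑ) ^ p)) := by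
            rw [ENNReal.mul_rpow_of_nonneg _ _ hp0.le]
            gcongr
            refine (ENNReal.rpow_add_le_mul_rpow_add_rpow _ _ hp1).trans ?_
            gcongr
            · norm_num
            · linarith
        _ = _ := by
            rw [← mul_assoc, ← ENNReal.mul_rpow_of_nonneg _ _ hp0.le,
              ENNReal.mul_rpow_of_nonneg (ENNReal.ofReal r⁻¹) ‖v x‖ₑ hp0.le]
            congr 2
            rw [← ENNReal.ofReal_ofNat, ← ENNReal.ofReal_mul (by positivity)]
            congr 1
            field_simp
    · have : dV x = 0 := (hV0 x fun h => hx h.2).2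
      simp [this, hp0]
  have mdV : AEStronglyMeasurable dV volume := hVS.memLp_grad.1
  have mV : AEStronglyMeasurable V volume := hVS.memLp.1
  have hLp : eLpNorm dV (ENNReal.ofReal p) volume ≤ ENNReal.ofReal (k / d * M ^ (1 / p)) := by
    rw [← ENNReal.rpow_le_rpow_iff hp0, ← lintegral_enorm_rpow_eq hp0]
    calc ∫⁻ x, ‖dV x‖ₑ ^ p ≤ _ := lintegral_mono hpt
      _ = ENNReal.ofReal (k / d) ^ p * ∫⁻ x in cube y r,
          (‖dv x‖ₑ ^ p + ENNReal.ofReal r⁻¹ ^ p * ‖v x‖ₑ ^ p) := by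
          rw [lintegral_const_mul' _ _ (ENNReal.rpow_ne_top_of_nonneg hp0.le ENNReal.ofReal_ne_top),
            lintegral_indicator (measurableSet_cube y r)]
      _ ≤ ENNReal.ofReal (k / d) ^ p * ENNReal.ofReal M := by gcongr
      _ = _ := by
          rw [ENNReal.ofReal_mul (by positivity), ENNReal.mul_rpow_of_nonneg _ _ hp0.le,
            ENNReal.ofReal_rpow_of_pos (x := M ^ (1 / p)) (by positivity), ← Real.rpow_mul hM.le,
            one_div_mul_cancel hp0.ne', Real.rpow_one]
  have hLs : eLpNorm dV (ENNReal.ofReal s) volume ≤ ENNReal.ofReal B := by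
    refine (eLpNorm_le_of_support_subset hs0 hsp.le mdV (mA.inter (measurableSet_cube y r))
      fun x hx => (hV0 x hx).2).trans ?_
    have hexp : 0 ≤ 1 / s - 1 / p := sub_nonneg.2 (one_div_le_one_div_of_le hs0 hsp.le)
    rw [hB, ENNReal.ofReal_mul (by positivity), ← ENNReal.ofReal_rpow_of_pos ha]
    gcongr
  have hT : ∫⁻ x, ‖dV x‖ₑ ^ s ≤ ENNReal.ofReal (B ^ s) := by
    rw [lintegral_enorm_rpow_eq hs0, ← ENNReal.ofReal_rpow_of_pos hB0]
    gcongr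
  -- good slices
  set S : Fin (m + 1) → ℝ → ℝ≥0∞ := fun i t => ∫⁻ z, ‖dV (slice i t z)‖ₑ ^ s with hS
  set e : ℝ := 2 * B ^ s / ℓ with he
  have he0 : 0 < e := by positivity
  set bad : Fin (m + 1) → Set ℝ := fun i => toMeasurable volume {t | ENNReal.ofReal e ≤ S i t}
    with hbad
  have hbadv : ∀ i, volume (bad i) ≤ ENNReal.ofReal (ℓ / 2) := fun i => by
    have h1 := mul_meas_ge_le_lintegral₀ (μ := (volume : Measure ℝ))
      (aemeasurable_lintegral_slice i (mdV.enorm.pow_const s)) (ENNReal.ofReal e)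
    rw [← lintegral_slice i (mdV.enorm.pow_const s)] at h1
    have h2 : ENNReal.ofReal e * volume (bad i) ≤ ENNReal.ofReal e * ENNReal.ofReal (ℓ / 2) := by
      rw [hbad, measure_toMeasurable, ← ENNReal.ofReal_mul he0.le]
      refine (h1.trans hT).trans (ENNReal.ofReal_le_ofReal (le_of_eq ?_))
      rw [he]; field_simp
    exact (ENNReal.mul_le_mul_iff_right (by simpa using he0) ENNReal.ofReal_ne_top).1 h2
  have hℓ' : (1 - d / 2) * r - (1 - d) * r = ℓ := by rw [hℓ]; ring
  obtain ⟨ψ, dψ, hψM, hψ01, hψ1, hψ0, hψb⟩ := exists_cube_cutoff y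
    (ρ := (1 - d) * r) (σ := (1 - d / 2) * r) (by nlinarith)
    (G := fun k => (bad k.1)ᶜ) (fun k => (measurableSet_toMeasurable _ _).compl) (fun k => by
      rw [hℓ', ← sdiff_eq]
      refine le_trans ?_ (le_measure_sdiff (μ := volume))
      rw [volume_collar, hℓ']
      calc ENNReal.ofReal (ℓ / 2) = ENNReal.ofReal ℓ - ENNReal.ofReal (ℓ / 2) := by
            rw [← ENNReal.ofReal_sub _ (by positivity)]; congr 1; ring
        _ ≤ _ := by gcongr; exact hbadv _)
  rw [hℓ'] at hψb
  refine ⟨ψ, dψ, hψM, hψ01, hψ1, hψ0, ?_⟩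
  set col : Fin (m + 1) × Bool → Set ℝ := fun k =>
    collar (y k.1) ((1 - d) * r) ((1 - d / 2) * r) k.2 ∩ (bad k.1)ᶜ with hcol
  have mcol : ∀ k, MeasurableSet (col k) := fun k =>
    (measurableSet_collar _ _ _ _).inter (measurableSet_toMeasurable _ _).compl
  have hcolv : ∀ k, volume (col k) ≤ ENNReal.ofReal ℓ := fun k => by
    refine (measure_mono inter_subset_left).trans ?_
    rw [volume_collar, hℓ']
  set D : ℝ≥0∞ := ENNReal.ofReal (2 * N / ℓ) ^ q with hD
  have hcard : ∑ _k : Fin (m + 1) × Bool, 2 / ℓ = 2 * N / ℓ := by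
    simp [hN, hn]; ring
  have hψpt : ∀ x, ‖dψ x‖ₑ ^ q * ‖v x‖ₑ ^ q ≤
      ∑ k : Fin (m + 1) × Bool, (col k).indicator (fun _ => D) (x k.1) * ‖V x‖ₑ ^ q := fun x => by
    by_cases hx : x ∈ cube y ((1 - d / 2) * r)
    · rw [← Finset.sum_mul, hV]
      simp only [(hζ1 x hx).1, one_mul]
      gcongr
      by_cases hk : ∃ k, x k.1 ∈ col k
      · obtain ⟨k, hk⟩ := hk
        refine le_trans ?_ (Finset.single_le_sum
          (f := fun k : Fin (m + 1) × Bool => (col k).indicator (fun _ => D) (x k.1))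
          (fun _ _ => zero_le) (Finset.mem_univ k))
        simp only [indicator_of_mem hk]
        rw [hD, ← ofReal_norm]
        gcongr
        refine (hψb x).trans ?_
        rw [← hcard]
        gcongr
        exact indicator_le_self' (fun _ _ => by positivity) _
      · push Not at hk
        have : ‖dψ x‖ ≤ 0 := (hψb x).trans
          (Finset.sum_nonpos fun k _ => by rw [indicator_of_notMem (hk k)])
        rw [norm_le_zero_iff.1 this]
        simp [hq0]
    · simp [hψ0 x hx, hq0]
  have hr' : ∀ x, x ∉ ball y ((√n + 1) * r) → V x = 0 ∧ dV x = 0 := fun x hx => hV0 x fun h =>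
    hx (by
      have := dist_lt_of_mem_cube hr.le h.2
      rw [mem_ball]; rw [← hn] at this; nlinarith)
  have hsl := hC₀ y ((√n + 1) * r) (by positivity) V dV hVS hr'
  set K : ℝ := (C₀ + 1) * (c₂ * r) ^ θ * e ^ (1 / s) with hK
  have hK0 : 0 < K := by positivity
  have hK' : (C₀ : ℝ≥0∞) * ENNReal.ofReal ((4 * ((√n + 1) * r)) ^ θ) * ENNReal.ofReal (e ^ (1 / s))
      ≤ ENNReal.ofReal K := by
    rw [hK, ENNReal.ofReal_mul (by positivity), ENNReal.ofReal_mul (by positivity)]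
    rw [show 4 * ((√n + 1) * r) = c₂ * r by rw [hc₂, ← mul_assoc]]
    gcongr
    rw [ENNReal.ofReal_add (by positivity) (by positivity), ENNReal.ofReal_coe_nnreal]
    exact le_self_add
  clear_value K
  have hone : ∀ k : Fin (m + 1) × Bool,
      ∫⁻ x, (col k).indicator (fun _ => D) (x k.1) * ‖V x‖ₑ ^ q ≤
        ENNReal.ofReal (ℓ * ((2 * N / ℓ) ^ q * K ^ q)) := fun k => by
    have mI : Measurable fun x : Eu (m + 1) => (col k).indicator (fun _ => D) (x k.1) :=
      (measurable_const.indicator (mcol k)).comp (by fun_prop)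
    rw [lintegral_slice k.1 (f := fun x => (col k).indicator (fun _ => D) (x k.1) * ‖V x‖ₑ ^ q)
      (mI.aemeasurable.mul (mV.enorm.pow_const q))]
    calc _ ≤ ∫⁻ t, (col k).indicator (fun _ => D * ENNReal.ofReal K ^ q) t := by
          refine lintegral_mono_ae ?_
          filter_upwards [hsl k.1] with t ht
          simp only [slice_apply_self]
          by_cases htc : t ∈ col k
          · simp only [indicator_of_mem htc]
            rw [lintegral_const_mul' _ _ (ENNReal.rpow_ne_top_of_nonneg hq0.le ENNReal.ofReal_ne_top)]
            gcongr
            rw [lintegral_enorm_rpow_eq hq0]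
            gcongr
            refine ht.trans ?_
            have hSt : S k.1 t ≤ ENNReal.ofReal e := by
              have : t ∉ {t | ENNReal.ofReal e ≤ S k.1 t} := fun h =>
                htc.2 (subset_toMeasurable _ _ h)
              exact (not_le.1 this).le
            have h3 : eLpNorm (fun z => dV (slice k.1 t z)) (ENNReal.ofReal s) volume ≤
                ENNReal.ofReal (e ^ (1 / s)) := by
              rw [← ENNReal.rpow_le_rpow_iff hs0, ← lintegral_enorm_rpow_eq hs0,
                ENNReal.ofReal_rpow_of_pos (x := e ^ (1 / s)) (by positivity), ← Real.rpow_mul he0.le,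
                one_div_mul_cancel hs0.ne', Real.rpow_one]
              exact hSt
            refine le_trans ?_ hK'
            gcongr
          · simp [htc]
      _ = D * ENNReal.ofReal K ^ q * volume (col k) := lintegral_indicator_const (mcol k) _
      _ ≤ D * ENNReal.ofReal K ^ q * ENNReal.ofReal ℓ := by gcongr; exact hcolv k
      _ = _ := by
          rw [hD, ENNReal.ofReal_rpow_of_pos (by positivity), ENNReal.ofReal_rpow_of_pos hK0,
            ← ENNReal.ofReal_mul (by positivity), ← ENNReal.ofReal_mul (by positivity)]
          congr 1
          ring
  calc ∫⁻ x, ‖dψ x‖ₑ ^ q * ‖v x‖ₑ ^ q ≤ _ := lintegral_mono hψpt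
    _ = ∑ k : Fin (m + 1) × Bool,
        ∫⁻ x, (col k).indicator (fun _ => D) (x k.1) * ‖V x‖ₑ ^ q := by
        refine lintegral_finsetSum' _ fun k _ => ?_
        have mI : Measurable fun x : Eu (m + 1) => (col k).indicator (fun _ => D) (x k.1) :=
          (measurable_const.indicator (mcol k)).comp (by fun_prop)
        exact mI.aemeasurable.mul (mV.enorm.pow_const q)
    _ ≤ ∑ _k : Fin (m + 1) × Bool, ENNReal.ofReal (ℓ * ((2 * N / ℓ) ^ q * K ^ q)) :=
        Finset.sum_le_sum fun k _ => hone k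
    _ = ENNReal.ofReal (N * (ℓ * ((2 * N / ℓ) ^ q * K ^ q))) := by
        rw [Finset.sum_const, nsmul_eq_mul, ENNReal.ofReal_mul hN0.le]
        congr 1
        rw [hN, hn, Finset.card_univ, Fintype.card_prod, Fintype.card_fin, Fintype.card_bool,
          mul_comm, ENNReal.ofReal_mul (by norm_num), ENNReal.ofReal_natCast]
        push_cast
        simp

section Grid

variable {n : ℕ}

/-- The centre with integer coordinates `k` of the grid of mesh `2r`. -/
def gridCenter (r : ℝ) (k : Fin n → ℤ) : Eu n := WithLp.toLp 2 fun i => 2 * r * k i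

theorem disjoint_grid {r : ℝ} (hr : 0 < r) {k l : Fin n → ℤ} (h : k ≠ l) :
    Disjoint (cube (gridCenter r k) r) (cube (gridCenter r l) r) := by
  obtain ⟨i, hi⟩ := Function.ne_iff.1 h
  refine Set.disjoint_left.2 fun x hx hx' => hi ?_
  have h1 := abs_lt.1 (hx i)
  have h2 := abs_lt.1 (hx' i)
  simp only [gridCenter] at h1 h2
  have h3 : ((k i : ℝ) - l i) < 1 := by
    by_contra hc; push Not at hc; nlinarith
  have h4 : ((l i : ℝ) - k i) < 1 := by
    by_contra hc; push Not at hc; nlinarith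
  have h5 : k i - l i < 1 := by exact_mod_cast h3
  have h6 : l i - k i < 1 := by exact_mod_cast h4
  omega

/-- The cubes of the grid covering `(2N+1)` cubes in each direction. -/
def gridIdx (n N : ℕ) : Finset (Fin n → ℤ) :=
  Fintype.piFinset fun _ : Fin n => Finset.Icc (-(N : ℤ)) N

theorem card_gridIdx (n N : ℕ) : (gridIdx n N).card = (2 * N + 1) ^ n := by
  rw [gridIdx, Fintype.card_piFinset]
  simp only [Int.card_Icc, Finset.prod_const, Finset.card_univ, Fintype.card_fin]
  congr 1
  omega

theorem exists_grid_mem {r : ℝ} (hr : 0 < r) {N : ℕ} {x : Eu n}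
    (hx : x ∈ cube 0 ((2 * N + 1) * r)) (hx' : ∀ i (k : ℤ), x i ≠ 2 * r * k - r) :
    ∃ k ∈ gridIdx n N, x ∈ cube (gridCenter r k) r := by
  have key : ∀ i, -(N : ℤ) ≤ ⌊(x i + r) / (2 * r)⌋ ∧ ⌊(x i + r) / (2 * r)⌋ ≤ N ∧
      |x i - 2 * r * ⌊(x i + r) / (2 * r)⌋| < r := fun i => by
    have h1 := abs_lt.1 (hx i)
    simp only [PiLp.zero_apply, sub_zero] at h1
    have h2 := Int.floor_le ((x i + r) / (2 * r))
    have h3 := Int.lt_floor_add_one ((x i + r) / (2 * r))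
    rw [le_div_iff₀ (by positivity)] at h2
    rw [div_lt_iff₀ (by positivity)] at h3
    refine ⟨?_, ?_, ?_⟩
    · rw [Int.le_floor, le_div_iff₀ (by positivity)]
      push_cast
      nlinarith
    · refine Int.lt_add_one_iff.1 (Int.floor_lt.2 ?_)
      rw [div_lt_iff₀ (by positivity)]
      push_cast
      nlinarith
    · have h4 := hx' i ⌊(x i + r) / (2 * r)⌋
      rw [abs_lt]
      refine ⟨lt_of_le_of_ne (by nlinarith) fun h => h4 (by linarith), by nlinarith⟩
  exact ⟨fun i => ⌊(x i + r) / (2 * r)⌋,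
    Fintype.mem_piFinset.2 fun i => Finset.mem_Icc.2 ⟨(key i).1, (key i).2.1⟩,
    fun i => (key i).2.2⟩

theorem ae_forall_grid_ne (n : ℕ) (r : ℕ → ℝ) :
    ∀ᵐ x : Eu n, ∀ N i (k : ℤ), x i ≠ 2 * r N * k - r N := by
  rw [ae_all_iff]; intro N
  rw [ae_all_iff]; intro i
  rw [ae_all_iff]; intro k
  exact ae_coord (P := fun t => t ≠ 2 * r N * k - r N) (Measure.ae_ne volume _) i

/-- Almost all of a set where `w` vanishes is covered by grid cubes on which `w` is small in
average, if the grid is fine enough. -/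
theorem exists_grid_cover {w : Eu n → ℝ≥0∞} (mw : AEMeasurable w) (hw : ∫⁻ x, w x ≠ ⊤)
    {Z : Set (Eu n)} (mZ : MeasurableSet Z) {ρ : ℝ} (hρ : 0 < ρ) (hZ : Z ⊆ cube 0 ρ)
    (hwZ : ∀ x ∈ Z, w x = 0) {δ : ℝ} (hδ : 0 < δ) {ω : ℝ≥0∞} (hω : 0 < ω) :
    ∃ N : ℕ, volume (Z \ ⋃ k ∈ {k | k ∈ gridIdx n N ∧
      ∫⁻ x in cube (gridCenter (ρ / (2 * N + 1)) k) (ρ / (2 * N + 1)), w x ≤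
        ENNReal.ofReal δ * volume (cube (gridCenter (ρ / (2 * N + 1)) k) (ρ / (2 * N + 1)))},
      cube (gridCenter (ρ / (2 * N + 1)) k) (ρ / (2 * N + 1))) ≤ ω := by
  set r : ℕ → ℝ := fun N => ρ / (2 * N + 1) with hr
  have hr0 : ∀ N, 0 < r N := fun N => by positivity
  have hrl : Tendsto r atTop (𝓝 0) := by
    refine Tendsto.div_atTop tendsto_const_nhds ?_
    exact tendsto_atTop_add_const_right _ _
      (tendsto_natCast_atTop_atTop.const_mul_atTop (by norm_num))
  set G : ℕ → Set (Fin n → ℤ) := fun N => {k | k ∈ gridIdx n N ∧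
      ∫⁻ x in cube (gridCenter (r N) k) (r N), w x ≤
        ENNReal.ofReal δ * volume (cube (gridCenter (r N) k) (r N))} with hG
  set B : ℕ → Set (Eu n) := fun N => Z \ ⋃ k ∈ G N, cube (gridCenter (r N) k) (r N) with hB
  suffices h : Tendsto (fun N => volume (B N)) atTop (𝓝 (volume (∅ : Set (Eu n)))) by
    rw [measure_empty] at h
    exact (h.eventually (ge_mem_nhds hω)).exists
  have mB : ∀ N, MeasurableSet (B N) := fun N => mZ.diff
    ((isOpen_biUnion fun k _ => isOpen_cube _ _).measurableSet)
  refine tendsto_measure_of_ae_tendsto_indicator atTop MeasurableSet.empty mB mZ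
    (((measure_mono hZ).trans_lt (lt_top_iff_ne_top.2 (volume_cube_ne_top _ _))).ne)
    (.of_forall fun N => sdiff_subset) ?_
  have hint : Integrable (fun x => (w x).toReal) := integrable_toReal_of_lintegral_ne_top mw hw
  have hfin : ∀ᵐ x, w x < ⊤ := ae_lt_top' mw hw
  filter_upwards [ae_forall_grid_ne n r,
    IsUnifLocDoublingMeasure.ae_tendsto_average volume hint.locallyIntegrable 1] with x hx hav
  by_cases hxZ : x ∈ Z
  swap
  · exact .of_forall fun N => ⟨fun h => absurd h.1 hxZ, fun h => absurd h (notMem_empty _)⟩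
  have hxc : ∀ N : ℕ, x ∈ cube 0 ((2 * N + 1) * r N) := fun N => by
    have : (2 * N + 1) * r N = ρ := by simp only [hr]; field_simp
    rw [this]; exact hZ hxZ
  choose k hk hxk using fun N => exists_grid_mem (hr0 N) (hxc N) (hx N)
  set c : ℝ := √n + 1 with hc
  have hc0 : 0 < c := by positivity
  have hcl : Tendsto (fun N => c * r N) atTop (𝓝[>] 0) := by
    refine tendsto_nhdsWithin_iff.2 ⟨by simpa using hrl.const_mul c,
      .of_forall fun N => mul_pos hc0 (hr0 N)⟩
  have hsub : ∀ N, cube (gridCenter (r N) (k N)) (r N) ⊆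
      closedBall (gridCenter (r N) (k N)) (c * r N) := fun N z hz => by
    rw [mem_closedBall]
    refine (dist_lt_of_mem_cube (hr0 N).le hz).trans ?_
    have := hr0 N
    rw [hc]; nlinarith
  have hlim := hav (fun N => gridCenter (r N) (k N)) (fun N => c * r N) hcl
    (.of_forall fun N => by rw [one_mul]; exact hsub N (hxk N))
  rw [hwZ x hxZ, ENNReal.toReal_zero] at hlim
  set V : ℝ≥0∞ := volume (ball (0 : Eu n) 1) with hV
  have hVt : V ≠ ⊤ := measure_ball_lt_top.ne
  have hV0 : 0 < V.toReal := ENNReal.toReal_pos (measure_ball_pos volume 0 one_pos).ne' hVt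
  have hev : ∀ᶠ N in atTop, ⨍ y in closedBall (gridCenter (r N) (k N)) (c * r N), (w y).toReal <
      δ * 2 ^ n / (c ^ n * V.toReal) := hlim.eventually (gt_mem_nhds (by positivity))
  filter_upwards [hev] with N hN
  refine ⟨fun h => absurd (mem_biUnion (show k N ∈ G N from ⟨hk N, ?_⟩) (hxk N)) h.2,
    fun h => absurd h (notMem_empty _)⟩
  have hvol : volume (closedBall (gridCenter (r N) (k N)) (c * r N)) =
      ENNReal.ofReal ((c * r N) ^ n * V.toReal) := by
    rw [Measure.addHaar_closedBall _ _ (mul_pos hc0 (hr0 N)).le,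
      ENNReal.ofReal_mul (by have := hr0 N; positivity), ENNReal.ofReal_toReal hVt]
    simp [hV]
  have hballr : (volume.real (closedBall (gridCenter (r N) (k N)) (c * r N))) =
      (c * r N) ^ n * V.toReal := by
    rw [measureReal_def, hvol, ENNReal.toReal_ofReal (by have := hr0 N; positivity)]
  calc ∫⁻ x in cube (gridCenter (r N) (k N)) (r N), w x
      ≤ ∫⁻ x in closedBall (gridCenter (r N) (k N)) (c * r N), w x :=
        lintegral_mono_set (hsub N)
    _ = ENNReal.ofReal (∫ x in closedBall (gridCenter (r N) (k N)) (c * r N), (w x).toReal) := by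
        rw [integral_toReal mw.restrict (ae_restrict_of_ae hfin), ENNReal.ofReal_toReal]
        exact ((setLIntegral_le_lintegral _ _).trans_lt (lt_top_iff_ne_top.2 hw)).ne
    _ ≤ ENNReal.ofReal (δ * (2 * r N) ^ n) := by
        refine ENNReal.ofReal_le_ofReal ?_
        rw [setAverage_eq, hballr, smul_eq_mul, inv_mul_lt_iff₀ (by have := hr0 N; positivity)] at hN
        refine hN.le.trans (le_of_eq ?_)
        rw [mul_pow, mul_pow]
        field_simp
    _ = _ := by
        rw [volume_cube, ENNReal.ofReal_mul hδ.le, ENNReal.ofReal_pow (by have := hr0 N; positivity)]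

end Grid

theorem grid_cutoff_arith {C d κ K two δ r ν p q s : ℝ} (hd : 0 < d)
    (hK : 0 < K) (ht : 0 < two) (hδ : 0 < δ) (hr : 0 < r) (hp : 0 < p) (hq : 0 < q) (hs : 0 < s) :
    C * (d ^ (-κ) * r ^ (-(ν * q * (1 / s - 1 / q))) * (δ * (two * r) ^ ν) ^ (q * (1 / s - 1 / p)) *
      (K * (δ * (two * r) ^ ν)) ^ (q / p)) =
    C * (d ^ (-κ) * K ^ (q / p) * two ^ (ν * q / s - ν)) * δ ^ (q / s) * (two * r) ^ ν := by
  obtain ⟨d, rfl⟩ : ∃ x, Real.exp x = d := ⟨_, Real.exp_log hd⟩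
  obtain ⟨K, rfl⟩ : ∃ x, Real.exp x = K := ⟨_, Real.exp_log hK⟩
  obtain ⟨two, rfl⟩ : ∃ x, Real.exp x = two := ⟨_, Real.exp_log ht⟩
  obtain ⟨δ, rfl⟩ : ∃ x, Real.exp x = δ := ⟨_, Real.exp_log hδ⟩
  obtain ⟨r, rfl⟩ : ∃ x, Real.exp x = r := ⟨_, Real.exp_log hr⟩
  rw [mul_assoc C, mul_assoc C]
  congr 1
  simp only [← Real.exp_mul, ← Real.exp_add]
  congr 1
  field_simp
  ring

theorem exists_good_cutoff_of_eq {n m : ℕ} (hn : n = m + 1) (hm : 1 ≤ m) {p q s : ℝ} (hs : 1 ≤ s) (hsp : s < p)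
    (hpq : p < q) (hsq : 1 / s = min (1 / q + 1 / m) 1) :
    ∃ C : ℝ, 0 < C ∧ ∀ (y : Eu n) (r : ℝ), 0 < r →
      ∀ (v : Eu n → ℝ) (dv : Eu n → Eu n), Sob (ENNReal.ofReal p) v dv →
      ∀ A : Set (Eu n), MeasurableSet A → (∀ x, x ∉ A → v x = 0 ∧ dv x = 0) →
      ∀ a : ℝ, 0 < a → volume (A ∩ cube y r) ≤ ENNReal.ofReal a →
      ∀ d : ℝ, 0 < d → d < 1 → ∀ M : ℝ, 0 < M →
      (∫⁻ x in cube y r, (‖dv x‖ₑ ^ p + ENNReal.ofReal r⁻¹ ^ p * ‖v x‖ₑ ^ p)) ≤ ENNReal.ofReal M →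
      ∃ ψ dψ, IsMult ψ dψ ∧ (∀ x, 0 ≤ ψ x ∧ ψ x ≤ 1) ∧
        (∀ x ∈ cube y ((1 - d) * r), ψ x = 1 ∧ dψ x = 0) ∧
        (∀ x, x ∉ cube y ((1 - d / 2) * r) → ψ x = 0 ∧ dψ x = 0) ∧
        ∫⁻ x, ‖dψ x‖ₑ ^ q * ‖v x‖ₑ ^ q ≤ ENNReal.ofReal
          (C * (d ^ (-(2 * q + q / s - 1)) * r ^ (-((m + 1) * q * (1 / s - 1 / q))) *
            a ^ (q * (1 / s - 1 / p)) * M ^ (q / p))) := by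
  subst hn
  exact exists_good_cutoff hm hs hsp hpq hsq

theorem exists_grid_cutoff {n m : ℕ} (hn : n = m + 1) (hm : 1 ≤ m) {p q s : ℝ} (hs : 1 ≤ s) (hsp : s < p)
    (hpq : p < q) (hsq : 1 / s = min (1 / q + 1 / m) 1) {φ : Eu n → ℝ}
    {dφ : Eu n → Eu n} (hφ : Sob (ENNReal.ofReal p) φ dφ) {A : Set (Eu n)}
    (mA : MeasurableSet A) (h0 : ∀ x, x ∉ A → φ x = 0 ∧ dφ x = 0) {ρ : ℝ} (hρ : 0 < ρ)
    (hA : A ⊆ cube 0 ρ) {ω : ℝ} (hω : 0 < ω) :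
    ∃ ψ dψ, ∃ G V : Set (Eu n), IsMult ψ dψ ∧ (∀ x, 0 ≤ ψ x ∧ ψ x ≤ 1) ∧ IsOpen V ∧ V ⊆ G ∧
      MeasurableSet G ∧ (∀ x ∈ V, ψ x = 1 ∧ dψ x = 0) ∧ (∀ x, x ∉ G → ψ x = 0 ∧ dψ x = 0) ∧
      volume (A ∩ G) ≤ ENNReal.ofReal ω ∧ volume ((cube 0 ρ \ A) \ V) ≤ ENNReal.ofReal ω ∧
      ∫⁻ x, ‖dψ x‖ₑ ^ q * ‖φ x‖ₑ ^ q ≤ ENNReal.ofReal ω := by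
  classical
  have hn0 : (0:ℝ) < n := by rw [hn]; positivity
  have hs0 : 0 < s := by linarith
  have hp0 : 0 < p := by linarith
  have hp1 : 1 ≤ p := by linarith
  have hq0 : 0 < q := by linarith
  have hpE : 1 ≤ ENNReal.ofReal p := by simpa using hp1
  obtain ⟨C, hC, hcut⟩ := exists_good_cutoff_of_eq hn hm hs hsp hpq hsq
  set W : ℝ := (2 * ρ) ^ n with hW
  have hW0 : 0 < W := by positivity
  set d : ℝ := min (1 / 2) (ω / (2 * n * W)) with hd
  have hd0 : 0 < d := by positivity
  have hd1 : d < 1 := (min_le_left _ _).trans_lt (by norm_num)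
  have hdω : n * d * W ≤ ω / 2 := by
    have : d ≤ ω / (2 * n * W) := min_le_right _ _
    rw [le_div_iff₀ (by positivity)] at this
    linarith
  set K : ℝ := 1 + 2 ^ (n + 1) * (2 * √n) ^ p with hK
  have hK0 : 0 < K := by positivity
  set κ : ℝ := 2 * q + q / s - 1 with hκ
  set C' : ℝ := C * (d ^ (-κ) * K ^ (q / p) * 2 ^ ((n : ℝ) * q / s - n)) with hC'
  have hC'0 : 0 < C' := by positivity
  obtain ⟨δ, hδ0, hδ2, hδω, hδC⟩ : ∃ δ : ℝ, 0 < δ ∧ δ ≤ 1 / 2 ∧ δ * W ≤ ω ∧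
      C' * δ ^ (q / s) * W ≤ ω := by
    refine ⟨min (1 / 2) (min (ω / W) ((ω / (C' * W)) ^ (s / q))), by positivity,
      min_le_left _ _, ?_, ?_⟩
    · rw [← le_div_iff₀ hW0]
      exact (min_le_right _ _).trans (min_le_left _ _)
    · calc C' * (min (1 / 2) (min (ω / W) ((ω / (C' * W)) ^ (s / q)))) ^ (q / s) * W
          ≤ C' * ((ω / (C' * W)) ^ (s / q)) ^ (q / s) * W := by
            gcongr
            exact (min_le_right _ _).trans (min_le_right _ _)
        _ = ω := by
            rw [← Real.rpow_mul (by positivity), show s / q * (q / s) = 1 by field_simp,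
              Real.rpow_one]
            field_simp
  clear_value d
  have mdφ : AEMeasurable (fun x => ‖dφ x‖ₑ ^ p) := (hφ.memLp_grad.1.enorm.pow_const p)
  have hvA : volume A ≠ ⊤ :=
    ((measure_mono hA).trans_lt (lt_top_iff_ne_top.2 (volume_cube_ne_top _ _))).ne
  have hdφt : ∫⁻ x, ‖dφ x‖ₑ ^ p ≠ ⊤ := by
    rw [lintegral_enorm_rpow_eq hp0]
    exact ENNReal.rpow_ne_top_of_nonneg hp0.le hφ.memLp_grad.eLpNorm_ne_top
  obtain ⟨N, hN⟩ := exists_grid_cover (n := n) (w := fun x => A.indicator 1 x + ‖dφ x‖ₑ ^ p)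
    ((measurable_one.indicator mA).aemeasurable.add mdφ)
    (by
      rw [lintegral_add_left' (measurable_one.indicator mA).aemeasurable,
        lintegral_indicator_one mA]
      exact ENNReal.add_ne_top.2 ⟨hvA, hdφt⟩)
    (Z := cube 0 ρ \ A) ((measurableSet_cube _ _).diff mA) hρ sdiff_subset
    (fun x hx => by simp [indicator_of_notMem hx.2, (h0 x hx.2).2, hp0]) hδ0
    (ω := ENNReal.ofReal (ω / 2)) (by simpa using hω)
  set r : ℝ := ρ / (2 * N + 1) with hr
  have hr0 : 0 < r := by positivity
  set c : (Fin n → ℤ) → Eu n := gridCenter r with hc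
  set I : Finset (Fin n → ℤ) := (gridIdx n N).filter fun k =>
    ∫⁻ x in cube (c k) r, (A.indicator 1 x + ‖dφ x‖ₑ ^ p) ≤
      ENNReal.ofReal δ * volume (cube (c k) r) with hI
  have hvol : ∀ k, volume (cube (c k) r) = ENNReal.ofReal ((2 * r) ^ n) := fun k => by
    rw [volume_cube, ENNReal.ofReal_pow (by positivity)]
  have hsum : ∀ t : ℝ, 0 ≤ t → ∑ _k ∈ I, ENNReal.ofReal (t * (2 * r) ^ n) ≤
      ENNReal.ofReal (t * W) := fun t ht => by
    rw [Finset.sum_const, nsmul_eq_mul, ← ENNReal.ofReal_natCast, ← ENNReal.ofReal_mul (by positivity)]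
    refine ENNReal.ofReal_le_ofReal ?_
    have h1 : (I.card : ℝ) ≤ (2 * N + 1) ^ n := by
      exact_mod_cast (Finset.card_filter_le _ _).trans_eq (card_gridIdx n N)
    calc (I.card : ℝ) * (t * (2 * r) ^ n) ≤ (2 * N + 1) ^ n * (t * (2 * r) ^ n) := by gcongr
      _ = t * W := by
          rw [mul_left_comm, ← mul_pow, hW, hr]
          congr 2
          field_simp
  have hgoodA : ∀ k ∈ I, volume (A ∩ cube (c k) r) ≤ ENNReal.ofReal (δ * (2 * r) ^ n) :=
    fun k hk => by
      rw [ENNReal.ofReal_mul hδ0.le, ← hvol k]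
      refine le_trans ?_ (Finset.mem_filter.1 hk).2
      rw [← lintegral_indicator_one (mA.inter (measurableSet_cube _ _)), ← lintegral_indicator
        (measurableSet_cube _ _)]
      refine lintegral_mono fun x => ?_
      by_cases hx : x ∈ cube (c k) r <;> by_cases hxA : x ∈ A <;> simp [hx, hxA]
  have hgoodφ : ∀ k ∈ I, ∫⁻ x in cube (c k) r, ‖dφ x‖ₑ ^ p ≤ ENNReal.ofReal (δ * (2 * r) ^ n) :=
    fun k hk => by
      rw [ENNReal.ofReal_mul hδ0.le, ← hvol k]
      refine le_trans (lintegral_mono fun x => ?_) (Finset.mem_filter.1 hk).2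
      exact le_add_self
  have hgoodM : ∀ k ∈ I, (∫⁻ x in cube (c k) r,
      (‖dφ x‖ₑ ^ p + ENNReal.ofReal r⁻¹ ^ p * ‖φ x‖ₑ ^ p)) ≤
        ENNReal.ofReal (K * (δ * (2 * r) ^ n)) := fun k hk => by
    have hhalf : volume (cube (c k) r) ≤ 2 * volume (cube (c k) r \ A) := by
      have h1 : volume (cube (c k) r) ≤ volume (A ∩ cube (c k) r) + volume (cube (c k) r \ A) := by
        rw [inter_comm]; exact measure_le_inter_add_sdiff _ _ _
      have h2 : volume (A ∩ cube (c k) r) ≤ volume (cube (c k) r) / 2 := by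
        refine (hgoodA k hk).trans ?_
        rw [hvol, ← ENNReal.ofReal_ofNat, ← ENNReal.ofReal_div_of_pos (by norm_num)]
        refine ENNReal.ofReal_le_ofReal ?_
        have : 0 < (2 * r) ^ n := by positivity
        nlinarith
      have h3 : volume (cube (c k) r) / 2 ≤ volume (cube (c k) r \ A) := by
        by_contra hcon
        push Not at hcon
        have h4 := ENNReal.add_lt_add_of_le_of_lt
          ((h2.trans_lt (ENNReal.div_lt_top (volume_cube_ne_top _ _) (by norm_num))).ne) h2 hcon
        rw [ENNReal.add_halves] at h4
        exact absurd (h1.trans_lt h4) (lt_irrefl _)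
      calc volume (cube (c k) r) = 2 * (volume (cube (c k) r) / 2) := by
            rw [ENNReal.mul_div_cancel (by norm_num) (by norm_num)]
        _ ≤ _ := by gcongr
    have hP := hφ.poincare_cube hp1 (c k) hr0 (Z := cube (c k) r \ A)
      ((measurableSet_cube _ _).diff mA) sdiff_subset (fun x hx => (h0 x hx.2).1) hhalf
    rw [lintegral_add_left' mdφ.restrict, lintegral_const_mul' _ _
      (ENNReal.rpow_ne_top_of_nonneg hp0.le ENNReal.ofReal_ne_top)]
    calc _ ≤ ENNReal.ofReal (δ * (2 * r) ^ n) + ENNReal.ofReal r⁻¹ ^ p *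
          (2 ^ (n + 1) * ENNReal.ofReal (√n * (2 * r)) ^ p * ENNReal.ofReal (δ * (2 * r) ^ n)) := by
          gcongr
          · exact hgoodφ k hk
          · exact hP.trans (by gcongr; exact hgoodφ k hk)
      _ = _ := by
          rw [ENNReal.ofReal_rpow_of_pos (by positivity), ENNReal.ofReal_rpow_of_pos (by positivity),
            ← ENNReal.ofReal_ofNat 2, ← ENNReal.ofReal_pow (by norm_num),
            ← ENNReal.ofReal_mul (by positivity), ← ENNReal.ofReal_mul (by positivity),
            ← ENNReal.ofReal_mul (by positivity), ← ENNReal.ofReal_add (by positivity) (by positivity)]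
          congr 1
          rw [hK, show √(n:ℝ) * (2 * r) = (2 * √n) * r by ring,
            Real.mul_rpow (x := 2 * √(n:ℝ)) (y := r) (by positivity) hr0.le, Real.inv_rpow hr0.le]
          have : r ^ p ≠ 0 := by positivity
          field_simp
  have hex := fun k (hk : k ∈ I) => hcut (c k) r hr0 φ dφ hφ A mA h0 (δ * (2 * r) ^ n)
    (by positivity) (hgoodA k hk) d hd0 hd1 (K * (δ * (2 * r) ^ n)) (by positivity) (hgoodM k hk)
  choose! ψk dψk hψM hψ01 hψ1 hψ0 hψi using hex
  have hsubP : ∀ k, cube (c k) ((1 - d / 2) * r) ⊆ cube (c k) r := fun k =>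
    cube_mono (by nlinarith)
  have hsubV : ∀ k, cube (c k) ((1 - d) * r) ⊆ cube (c k) r := fun k =>
    cube_mono (by nlinarith)
  have hother : ∀ k x, x ∈ cube (c k) r → ∀ l ∈ I, l ≠ k → ψk l x = 0 ∧ dψk l x = 0 :=
    fun k x hx l hl hlk => hψ0 l hl x fun h =>
      (Set.disjoint_left.1 (disjoint_grid hr0 hlk) (hsubP l h)) hx
  have hloc : ∀ k ∈ I, ∀ x ∈ cube (c k) r, ∑ l ∈ I, ψk l x = ψk k x ∧
      ∑ l ∈ I, dψk l x = dψk k x := fun k hk x hx =>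
    ⟨Finset.sum_eq_single_of_mem k hk fun l hl hlk => (hother k x hx l hl hlk).1,
      Finset.sum_eq_single_of_mem k hk fun l hl hlk => (hother k x hx l hl hlk).2⟩
  have hout : ∀ x, x ∉ ⋃ k ∈ I, cube (c k) r → ∑ l ∈ I, ψk l x = 0 ∧ ∑ l ∈ I, dψk l x = 0 :=
    fun x hx => by
      have : ∀ l ∈ I, ψk l x = 0 ∧ dψk l x = 0 := fun l hl => hψ0 l hl x fun h =>
        hx (mem_biUnion hl (hsubP l h))
      exact ⟨Finset.sum_eq_zero fun l hl => (this l hl).1,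
        Finset.sum_eq_zero fun l hl => (this l hl).2⟩
  refine ⟨fun x => ∑ k ∈ I, ψk k x, fun x => ∑ k ∈ I, dψk k x, ⋃ k ∈ I, cube (c k) r,
    ⋃ k ∈ I, cube (c k) ((1 - d) * r), IsMult.sum fun k hk => hψM k hk, fun x => ?_,
    isOpen_biUnion fun k _ => isOpen_cube _ _, iUnion₂_mono fun k _ => hsubV k,
    (isOpen_biUnion fun k _ => isOpen_cube _ _).measurableSet, fun x hx => ?_, hout, ?_, ?_, ?_⟩
  · by_cases hx : x ∈ ⋃ k ∈ I, cube (c k) r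
    · obtain ⟨k, hk, hxk⟩ := mem_iUnion₂.1 hx
      simp only [(hloc k hk x hxk).1]
      exact hψ01 k hk x
    · simp only [(hout x hx).1]; norm_num
  · obtain ⟨k, hk, hxk⟩ := mem_iUnion₂.1 hx
    have h1 := hloc k hk x (hsubV k hxk)
    exact ⟨h1.1.trans (hψ1 k hk x hxk).1, h1.2.trans (hψ1 k hk x hxk).2⟩
  · rw [inter_iUnion₂]
    refine (measure_biUnion_finset_le _ _).trans ((Finset.sum_le_sum hgoodA).trans ?_)
    exact (hsum δ hδ0.le).trans (ENNReal.ofReal_le_ofReal hδω)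
  · have hsub : (cube 0 ρ \ A) \ ⋃ k ∈ I, cube (c k) ((1 - d) * r) ⊆
        ((cube 0 ρ \ A) \ ⋃ k ∈ I, cube (c k) r) ∪
          ⋃ k ∈ I, (cube (c k) r \ cube (c k) ((1 - d) * r)) := by
      intro x hx
      by_cases hxG : x ∈ ⋃ k ∈ I, cube (c k) r
      · right
        obtain ⟨k, hk, hxk⟩ := mem_iUnion₂.1 hxG
        exact mem_biUnion hk ⟨hxk, fun h => hx.2 (mem_biUnion hk h)⟩
      · exact Or.inl ⟨hx.1, hxG⟩
    have hN' : volume ((cube 0 ρ \ A) \ ⋃ k ∈ I, cube (c k) r) ≤ ENNReal.ofReal (ω / 2) := by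
      refine (measure_mono ?_).trans hN
      refine sdiff_subset_sdiff_right ?_
      refine iUnion₂_mono' fun k hk => ⟨k, ?_, subset_rfl⟩
      exact Finset.mem_filter.2 hk
    have hcol : ∀ k ∈ I, volume (cube (c k) r \ cube (c k) ((1 - d) * r)) ≤
        ENNReal.ofReal (n * d * (2 * r) ^ n) := fun k _ => by
      rw [measure_sdiff (hsubV k) (measurableSet_cube _ _).nullMeasurableSet
        (volume_cube_ne_top _ _), hvol, volume_cube, ← ENNReal.ofReal_pow (by nlinarith),
        ← ENNReal.ofReal_sub _ (by have : 0 ≤ 1 - d := by linarith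
                                   positivity)]
      refine ENNReal.ofReal_le_ofReal ?_
      have h1 := one_add_mul_le_pow (a := -d) (by linarith) n
      have h2 : (2 * ((1 - d) * r)) ^ n = (1 + -d) ^ n * (2 * r) ^ n := by
        rw [← mul_pow]; congr 1; ring
      rw [h2]
      have : 0 < (2 * r) ^ n := by positivity
      nlinarith
    refine (measure_mono hsub).trans ((measure_union_le _ _).trans ?_)
    calc _ ≤ ENNReal.ofReal (ω / 2) + ENNReal.ofReal (ω / 2) := by
          gcongr
          refine (measure_biUnion_finset_le _ _).trans ((Finset.sum_le_sum hcol).trans ?_)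
          exact (hsum (n * d) (by positivity)).trans (ENNReal.ofReal_le_ofReal hdω)
      _ = ENNReal.ofReal ω := by
          rw [← ENNReal.ofReal_add (by positivity) (by positivity), add_halves]
  · have hpt : ∀ x, ‖∑ k ∈ I, dψk k x‖ₑ ^ q * ‖φ x‖ₑ ^ q ≤
        ∑ k ∈ I, ‖dψk k x‖ₑ ^ q * ‖φ x‖ₑ ^ q := fun x => by
      by_cases hx : x ∈ ⋃ k ∈ I, cube (c k) r
      · obtain ⟨k, hk, hxk⟩ := mem_iUnion₂.1 hx
        rw [(hloc k hk x hxk).2]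
        exact Finset.single_le_sum (f := fun k => ‖dψk k x‖ₑ ^ q * ‖φ x‖ₑ ^ q)
          (fun _ _ => zero_le) hk
      · simp [(hout x hx).2, hq0]
    have mφ := hφ.memLp.1
    calc _ ≤ ∫⁻ x, ∑ k ∈ I, ‖dψk k x‖ₑ ^ q * ‖φ x‖ₑ ^ q := lintegral_mono hpt
      _ = ∑ k ∈ I, ∫⁻ x, ‖dψk k x‖ₑ ^ q * ‖φ x‖ₑ ^ q :=
          lintegral_finsetSum' _ fun k hk =>
            ((hψM k hk).bound.2.1.enorm.pow_const q).mul (mφ.enorm.pow_const q)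
      _ ≤ ∑ k ∈ I, ENNReal.ofReal (C' * δ ^ (q / s) * (2 * r) ^ n) := by
          refine Finset.sum_le_sum fun k hk => (hψi k hk).trans (ENNReal.ofReal_le_ofReal ?_)
          have h1 := grid_cutoff_arith (C := C) (κ := κ) (ν := n) hd0 hK0 two_pos hδ0 hr0 hp0 hq0 hs0
          rw [Real.rpow_natCast] at h1
          have h2 : ((m : ℝ) + 1) = n := by simp [hn]
          rw [h2]
          exact h1.le
      _ ≤ ENNReal.ofReal (C' * δ ^ (q / s) * W) := hsum _ (by positivity)
      _ ≤ _ := ENNReal.ofReal_le_ofReal hδC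

section Cutoff

variable {n : ℕ} {p q L μ Q h : ℝ} {F : Eu n → ℝ}

theorem GoodAt.cutoff_le (H : GoodAt p q L μ h F) (hL : 0 ≤ L) (hq : 1 < q) {t : ℝ} (ht0 : 0 ≤ t)
    (ht1 : t ≤ 1) (a b : Eu n) :
    F ((1 - t ^ q) • a + t ^ (q - 1) • b) ≤
      (1 - t ^ q) * F a + (L * ‖b‖ ^ q + 2 * h ^ p) := by
  have hh : 0 ≤ h ^ p := Real.rpow_nonneg H.h_nonneg _
  rcases ht0.eq_or_lt with rfl | ht
  · rw [Real.zero_rpow (by linarith), Real.zero_rpow (by linarith)]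
    simp only [sub_zero, one_smul, zero_smul, add_zero, one_mul]
    have : 0 ≤ ‖b‖ ^ q := by positivity
    nlinarith [mul_nonneg hL this]
  have htq1 : t ^ q ≤ 1 := Real.rpow_le_one ht0 ht1 (by linarith)
  have htq0 : 0 < t ^ q := Real.rpow_pos_of_pos ht q
  have e1 : t ^ (q - 1) • b = t ^ q • (t⁻¹ • b) := by
    rw [smul_smul, Real.rpow_sub_one ht.ne', div_eq_mul_inv]
  have h1 := H.conv.2 (mem_univ a) (mem_univ (t⁻¹ • b)) (sub_nonneg.2 htq1) htq0.le (by ring)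
  have h2 := H.upper (t⁻¹ • b)
  rw [norm_smul, Real.norm_of_nonneg (inv_nonneg.2 ht0), Real.mul_rpow (by positivity)
    (norm_nonneg _), Real.inv_rpow ht0] at h2
  rw [e1]
  refine h1.trans ?_
  simp only [smul_eq_mul]
  have h3 : t ^ q * F (t⁻¹ • b) ≤ t ^ q * (L * ((t ^ q)⁻¹ * ‖b‖ ^ q) + 2 * h ^ p) := by gcongr
  have h4 : t ^ q * (L * ((t ^ q)⁻¹ * ‖b‖ ^ q) + 2 * h ^ p) =
      L * ‖b‖ ^ q + t ^ q * (2 * h ^ p) := by field_simp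
  nlinarith

theorem GoodAt.cutoff_add_le (H : GoodAt p q L μ h F) (hL : 0 ≤ L) (hq : 1 < q) {t : ℝ}
    (ht0 : 0 ≤ t) (ht1 : t ≤ 1) (a b c : Eu n) :
    F ((1 - t ^ q) • a + t ^ q • c + t ^ (q - 1) • b) ≤
      F a + (F ((2:ℝ) • c) + 2 * h ^ p) + L * 2 ^ q * ‖b‖ ^ q := by
  have hh : 0 ≤ h ^ p := Real.rpow_nonneg H.h_nonneg _
  have hF := H.nonneg ((2:ℝ) • c)
  have hFa := H.nonneg a
  have hb0 : 0 ≤ ‖b‖ ^ q := by positivity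
  have h2q : (0:ℝ) < 2 ^ q := by positivity
  rcases ht0.eq_or_lt with rfl | ht
  · rw [Real.zero_rpow (by linarith), Real.zero_rpow (by linarith)]
    simp only [sub_zero, one_smul, zero_smul, add_zero]
    nlinarith [mul_nonneg (mul_nonneg hL h2q.le) hb0]
  have htq1 : t ^ q ≤ 1 := Real.rpow_le_one ht0 ht1 (by linarith)
  have htq0 : 0 < t ^ q := Real.rpow_pos_of_pos ht q
  have e1 : t ^ q • c + t ^ (q - 1) • b =
      t ^ q • ((1 / 2 : ℝ) • ((2:ℝ) • c) + (1 / 2 : ℝ) • ((2 * t⁻¹) • b)) := by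
    rw [smul_smul, smul_smul, smul_add, smul_smul, smul_smul, Real.rpow_sub_one ht.ne',
      div_eq_mul_inv]
    congr 1
    · norm_num
    · congr 1; ring
  have h1 := H.conv.2 (mem_univ a) (mem_univ ((1 / 2 : ℝ) • ((2:ℝ) • c) +
    (1 / 2 : ℝ) • ((2 * t⁻¹) • b))) (sub_nonneg.2 htq1) htq0.le (by ring)
  have h1' := H.conv.2 (mem_univ ((2:ℝ) • c)) (mem_univ ((2 * t⁻¹) • b))
    (by norm_num : (0:ℝ) ≤ 1 / 2) (by norm_num : (0:ℝ) ≤ 1 / 2) (by norm_num)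
  have h2 := H.upper ((2 * t⁻¹) • b)
  rw [norm_smul, Real.norm_of_nonneg (by positivity), Real.mul_rpow (by positivity)
    (norm_nonneg _), Real.mul_rpow (by norm_num) (by positivity), Real.inv_rpow ht0] at h2
  rw [add_assoc, e1]
  refine h1.trans ?_
  simp only [smul_eq_mul] at h1' ⊢
  have h3 : t ^ q * F ((1 / 2 : ℝ) • ((2:ℝ) • c) + (1 / 2 : ℝ) • ((2 * t⁻¹) • b)) ≤
      t ^ q * (F ((2:ℝ) • c) + (L * (2 ^ q * (t ^ q)⁻¹ * ‖b‖ ^ q) + 2 * h ^ p)) := by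
    gcongr
    have := H.nonneg ((2 * t⁻¹) • b)
    linarith
  have h4 : t ^ q * (F ((2:ℝ) • c) + (L * (2 ^ q * (t ^ q)⁻¹ * ‖b‖ ^ q) + 2 * h ^ p)) =
      L * 2 ^ q * ‖b‖ ^ q + t ^ q * (F ((2:ℝ) • c) + 2 * h ^ p) := by field_simp; ring
  nlinarith [mul_nonneg htq0.le hFa]

end Cutoff

theorem IsMult.one_sub_rpow {n : ℕ} {η : Eu n → ℝ} {dη : Eu n → Eu n} (h : IsMult η dη) {q : ℝ}
    (hq : 1 < q) :
    IsMult (fun x => 1 - η x ^ q) (fun x => (-(q * η x ^ (q - 1))) • dη x) :=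
  h.comp (g := fun t => 1 - t ^ q) (g' := fun t => -(q * t ^ (q - 1)))
    ((continuous_const.mul (Real.continuous_rpow_const (by linarith))).neg) fun t => by
      simpa using (Real.hasDerivAt_rpow_const (Or.inr hq.le)).const_sub 1

section Weak

variable {n m : ℕ} {Ω : Set (Eu n)} {p q s L μ Q : ℝ} {h : Eu n → ℝ} {F : Eu n → Eu n → ℝ}
  {du : Eu n → Eu n}

/-- Minimality may be tested on the set where the perturbation lives, instead of a compact
neighbourhood of it. -/
theorem StrongQMin.le_of_eq_zero (hn : n = m + 1) (hm : 1 ≤ m) (hs : 1 ≤ s) (hsp : s < p)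
    (hpq : p < q) (hsq : 1 / s = Min.min (1 / q + 1 / m) 1) (hL : 1 ≤ L) (hQ : 1 ≤ Q)
    (H : StrongQMin Ω p q L μ Q h F du) {S : Set (Eu n)} (hS : IsCompact S) (hSΩ : S ⊆ Ω)
    {A : Set (Eu n)} (mA : MeasurableSet A) (hAS : A ⊆ S) {φ : Eu n → ℝ} {dφ : Eu n → Eu n}
    (hφ : Sob (ENNReal.ofReal p) φ dφ) (h0 : ∀ x, x ∉ A → φ x = 0 ∧ dφ x = 0) :
    ∫⁻ x in A, ENNReal.ofReal (F x (du x)) ≤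
      ENNReal.ofReal Q * ∫⁻ x in A, ENNReal.ofReal (F x (du x + dφ x)) := by
  have hp1 : 1 < p := by linarith
  have hp0 : 0 < p := by linarith
  have hq1 : 1 < q := by linarith
  have hq0 : 0 < q := by linarith
  have hL0 : 0 < L := by linarith
  have hQ0 : 0 < Q := by linarith
  have hpE : 1 ≤ ENNReal.ofReal p := by simpa using hp1.le
  have hSm := hS.measurableSet
  have hle : volume.restrict S ≤ volume.restrict Ω := Measure.restrict_mono hSΩ le_rfl
  have hgoodS : ∀ᵐ x ∂volume.restrict S, GoodAt p q L μ (h x) (F x) :=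
    ae_restrict_of_ae_restrict_of_subset hSΩ H.good
  have mF : ∀ w : Eu n → Eu n, AEStronglyMeasurable w (volume.restrict S) →
      AEMeasurable (fun x => F x (w x)) (volume.restrict S) := fun w hw =>
    aemeasurable_caratheodory (fun z => (H.meas z).mono_measure hle)
      (hgoodS.mono fun x hx => hx.cont) hw
  have mdu := H.meas_du S hS hSΩ
  have m1 := (mF du mdu).ennreal_ofReal
  have m2 := (mF (fun x => (2:ℝ) • du x) ((mdu.const_smul (2:ℝ) : _))).ennreal_ofReal
  have m3 : AEMeasurable (fun x => ENNReal.ofReal (2 * h x ^ p)) (volume.restrict S) :=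
    (((H.meas_h.mono_measure hle).pow_const p).const_mul 2).ennreal_ofReal
  set w : Eu n → ℝ≥0∞ := fun x => ENNReal.ofReal (F x (du x)) +
    (ENNReal.ofReal (F x ((2:ℝ) • du x)) + ENNReal.ofReal (2 * h x ^ p)) with hw
  have mw : AEMeasurable w (volume.restrict S) := m1.add (m2.add m3)
  have hwt : ∫⁻ x in S, w x ≠ ⊤ := by
    rw [hw, lintegral_add_left' m1, lintegral_add_left' m2]
    refine ENNReal.add_ne_top.2 ⟨(H.fin S hS hSΩ).ne, ENNReal.add_ne_top.2 ⟨?_, ?_⟩⟩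
    · refine ne_top_of_le_ne_top (b := ENNReal.ofReal μ * volume S + ENNReal.ofReal L *
        ∫⁻ x in S, ENNReal.ofReal (F x (du x))) ?_ ?_
      · exact ENNReal.add_ne_top.2 ⟨ENNReal.mul_ne_top ENNReal.ofReal_ne_top hS.measure_ne_top,
          ENNReal.mul_ne_top ENNReal.ofReal_ne_top (H.fin S hS hSΩ).ne⟩
      · rw [← setLIntegral_const, ← lintegral_const_mul' _ _ ENNReal.ofReal_ne_top,
          ← lintegral_add_left' aemeasurable_const]
        refine lintegral_mono_ae ?_
        filter_upwards [hgoodS] with x hx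
        refine (ENNReal.ofReal_le_ofReal (hx.doubling _)).trans (ENNReal.ofReal_add_le.trans ?_)
        rw [ENNReal.ofReal_mul hL0.le]
    · refine ne_top_of_le_ne_top (b := 2 * ∫⁻ x in Ω, ENNReal.ofReal (h x) ^ p)
        (ENNReal.mul_ne_top (by norm_num) H.h_int.ne) ?_
      refine le_trans ?_ (mul_le_mul_right (lintegral_mono_set hSΩ) 2)
      rw [← lintegral_const_mul' _ _ (by norm_num)]
      refine lintegral_mono_ae ?_
      filter_upwards [hgoodS] with x hx
      rw [ENNReal.ofReal_mul (by norm_num), ENNReal.ofReal_rpow_of_nonneg hx.h_nonneg hp0.le]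
      simp
  obtain ⟨ρ, hρ, hSρ⟩ : ∃ ρ, 0 < ρ ∧ S ⊆ cube 0 ρ := by
    obtain ⟨ρ, hρ, hb⟩ := hS.isBounded.subset_ball_lt 0 (0 : Eu n)
    exact ⟨ρ, hρ, hb.trans (ball_subset_cube _ _)⟩
  refine ENNReal.le_of_forall_pos_le_add fun ε hε _ => ?_
  set e : ℝ := ε / (3 * Q + 1) with he
  have hε' : (0:ℝ) < ε := by exact_mod_cast hε
  have he0 : 0 < e := by positivity
  set D : ℝ := L * 2 ^ q * q ^ q with hD
  have hD0 : 0 < D := by positivity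
  obtain ⟨δ, hδ, hδw⟩ := exists_pos_setLIntegral_lt_of_measure_lt hwt
    (ε := ENNReal.ofReal e) (by simpa using he0)
  obtain ⟨ω, hω, hωδ, hωD⟩ : ∃ ω : ℝ, 0 < ω ∧ ENNReal.ofReal ω < δ ∧ D * ω ≤ e := by
    obtain ⟨δ', hδ'0, hδ'⟩ := ENNReal.lt_iff_exists_nnreal_btwn.1 hδ
    refine ⟨Min.min δ' (e / D), lt_min (by exact_mod_cast hδ'0) (by positivity), ?_, ?_⟩
    · refine (ENNReal.ofReal_le_ofReal (min_le_left _ _)).trans_lt ?_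
      rwa [ENNReal.ofReal_coe_nnreal]
    · calc D * Min.min (δ' : ℝ) (e / D) ≤ D * (e / D) := by gcongr; exact min_le_right _ _
        _ = e := by field_simp
  have hsmall : ∀ B, MeasurableSet B → B ⊆ S → volume B ≤ ENNReal.ofReal ω →
      ∫⁻ x in B, w x ≤ ENNReal.ofReal e := fun B mB hB hv => by
    have := hδw B (by rw [Measure.restrict_apply mB]
                      exact ((measure_mono inter_subset_left).trans hv).trans_lt hωδ)
    rw [Measure.restrict_restrict mB, inter_eq_left.2 hB] at this
    exact this.le
  obtain ⟨ψ, dψ, G, V, hψM, hψ01, hVo, hVG, mG, hψ1, hψ0, hAG, hZV, hint⟩ :=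
    exists_grid_cutoff hn hm hs hsp hpq hsq hφ mA h0 hρ (hAS.trans hSρ) hω
  set S' : Set (Eu n) := S \ V with hS'
  have hS'c : IsCompact S' := hS.diff hVo
  have hS'S : S' ⊆ S := sdiff_subset
  have mS' := hS'c.measurableSet
  have hSob := hφ.mult hpE ENNReal.ofReal_ne_top (hψM.one_sub_rpow hq1)
  have hmin := H.min S' hS'c (hS'S.trans hSΩ) _ _ hSob (.of_forall fun x hx => by
    by_cases hxA : x ∈ A
    · have hxV : x ∈ V := by
        by_contra hxV
        exact hx ⟨hAS hxA, hxV⟩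
      simp [(hψ1 x hxV).1, (hψ1 x hxV).2]
    · simp [(h0 x hxA).1, (h0 x hxA).2])
  have hup : ∫⁻ x in S', ENNReal.ofReal (F x (du x + ((1 - ψ x ^ q) • dφ x +
      φ x • (-(q * ψ x ^ (q - 1))) • dψ x))) ≤
      (∫⁻ x in A, ENNReal.ofReal (F x (du x + dφ x))) + ENNReal.ofReal (3 * e) := by
    have hpt : ∀ᵐ x ∂volume.restrict S', ENNReal.ofReal (F x (du x + ((1 - ψ x ^ q) • dφ x +
        φ x • (-(q * ψ x ^ (q - 1))) • dψ x))) ≤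
        A.indicator (fun x => ENNReal.ofReal (F x (du x + dφ x))) x +
          ((A ∩ G).indicator w x + ((S' \ A).indicator w x +
            ENNReal.ofReal D * (‖dψ x‖ₑ ^ q * ‖φ x‖ₑ ^ q))) := by
      filter_upwards [ae_restrict_of_ae_restrict_of_subset hS'S hgoodS, ae_restrict_mem mS']
        with x hx hxS'
      by_cases hxA : x ∈ A
      · rw [indicator_of_mem hxA]
        by_cases hxG : x ∈ G
        · rw [indicator_of_mem (show x ∈ A ∩ G from ⟨hxA, hxG⟩)]
          have h1 := hx.cutoff_add_le hL0.le hq1 (hψ01 x).1 (hψ01 x).2 (du x + dφ x)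
            ((-(q * φ x)) • dψ x) (du x)
          have e1 : (1 - ψ x ^ q) • (du x + dφ x) + ψ x ^ q • du x +
              ψ x ^ (q - 1) • (-(q * φ x)) • dψ x = du x + ((1 - ψ x ^ q) • dφ x +
                φ x • (-(q * ψ x ^ (q - 1))) • dψ x) := by
            module
          rw [e1] at h1
          have e2 : L * 2 ^ q * ‖(-(q * φ x)) • dψ x‖ ^ q = D * (‖dψ x‖ ^ q * ‖φ x‖ ^ q) := by
            rw [norm_smul, norm_neg, norm_mul, Real.norm_of_nonneg hq0.le,
              Real.mul_rpow (by positivity) (by positivity), Real.mul_rpow hq0.le (by positivity), hD]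
            ring
          rw [e2] at h1
          refine (ENNReal.ofReal_le_ofReal h1).trans (ENNReal.ofReal_add_le.trans ?_)
          rw [indicator_of_notMem (fun hh => hh.2 hxA : x ∉ S' \ A), zero_add,
            ← add_assoc (ENNReal.ofReal (F x (du x + dφ x)))]
          refine add_le_add ?_ (le_of_eq ?_)
          · refine ENNReal.ofReal_add_le.trans ?_
            refine add_le_add le_rfl (ENNReal.ofReal_add_le.trans ?_)
            exact le_add_self
          · rw [ENNReal.ofReal_mul hD0.le, ENNReal.ofReal_mul (p := ‖dψ x‖ ^ q) (by positivity),
              ← ENNReal.ofReal_rpow_of_nonneg (norm_nonneg _) hq0.le,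
              ← ENNReal.ofReal_rpow_of_nonneg (norm_nonneg _) hq0.le, ofReal_norm, ofReal_norm]
        · simp only [(hψ0 x hxG).1, (hψ0 x hxG).2, Real.zero_rpow hq0.ne', sub_zero, one_smul,
            smul_zero, add_zero]
          exact le_self_add
      · rw [(h0 x hxA).1, (h0 x hxA).2, indicator_of_mem (show x ∈ S' \ A from ⟨hxS', hxA⟩)]
        simp only [smul_zero, zero_smul, add_zero]
        calc ENNReal.ofReal (F x (du x)) ≤ w x := le_self_add
          _ ≤ w x + _ := le_self_add
          _ ≤ (A ∩ G).indicator w x + _ := le_add_self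
          _ ≤ _ := le_add_self
    have mw' : AEMeasurable w (volume.restrict S') := mw.mono_measure (Measure.restrict_mono hS'S le_rfl)
    have mψ : AEMeasurable (fun x => ENNReal.ofReal D * (‖dψ x‖ₑ ^ q * ‖φ x‖ₑ ^ q)) volume :=
      ((hψM.bound.2.1.enorm.pow_const q).mul (hφ.memLp.1.enorm.pow_const q)).const_mul _
    refine (lintegral_mono_ae hpt).trans ?_
    have mT : AEMeasurable (fun x => (A ∩ G).indicator w x + ((S' \ A).indicator w x +
        ENNReal.ofReal D * (‖dψ x‖ₑ ^ q * ‖φ x‖ₑ ^ q))) (volume.restrict S') :=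
      (mw'.indicator (mA.inter mG)).add ((mw'.indicator (mS'.diff mA)).add mψ.restrict)
    rw [lintegral_add_right' _ mT, lintegral_add_left' (mw'.indicator (mA.inter mG)),
      lintegral_add_left' (mw'.indicator (mS'.diff mA)),
      lintegral_const_mul' _ _ ENNReal.ofReal_ne_top]
    have t1 : ∫⁻ x in S', A.indicator (fun x => ENNReal.ofReal (F x (du x + dφ x))) x ≤
        ∫⁻ x in A, ENNReal.ofReal (F x (du x + dφ x)) :=
      (setLIntegral_le_lintegral _ _).trans (lintegral_indicator mA _).le
    have t2 : ∫⁻ x in S', (A ∩ G).indicator w x ≤ ENNReal.ofReal e :=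
      ((setLIntegral_le_lintegral _ _).trans (lintegral_indicator (mA.inter mG) _).le).trans
        (hsmall _ (mA.inter mG) (inter_subset_left.trans hAS) hAG)
    have t3 : ∫⁻ x in S', (S' \ A).indicator w x ≤ ENNReal.ofReal e :=
      ((setLIntegral_le_lintegral _ _).trans (lintegral_indicator (mS'.diff mA) _).le).trans
        (hsmall _ (mS'.diff mA) (sdiff_subset.trans hS'S) ((measure_mono
          (show S' \ A ⊆ (cube 0 ρ \ A) \ V from
            fun x hx => ⟨⟨hSρ hx.1.1, hx.2⟩, hx.1.2⟩)).trans hZV))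
    have t4 : ENNReal.ofReal D * ∫⁻ x in S', ‖dψ x‖ₑ ^ q * ‖φ x‖ₑ ^ q ≤ ENNReal.ofReal e :=
      calc _ ≤ ENNReal.ofReal D * ENNReal.ofReal ω := by
            gcongr; exact (setLIntegral_le_lintegral _ _).trans hint
        _ ≤ _ := by
            rw [← ENNReal.ofReal_mul hD0.le]; exact ENNReal.ofReal_le_ofReal hωD
    refine (add_le_add t1 (add_le_add t2 (add_le_add t3 t4))).trans (le_of_eq ?_)
    rw [← ENNReal.ofReal_add he0.le he0.le, ← ENNReal.ofReal_add he0.le (by positivity)]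
    congr 2; ring
  have hlow : ∫⁻ x in A, ENNReal.ofReal (F x (du x)) ≤
      (∫⁻ x in S', ENNReal.ofReal (F x (du x))) + ENNReal.ofReal e := by
    calc _ ≤ ∫⁻ x in S' ∪ (A ∩ G), ENNReal.ofReal (F x (du x)) := by
          refine lintegral_mono_set fun x hx => ?_
          by_cases hxV : x ∈ V
          · exact Or.inr ⟨hx, hVG hxV⟩
          · exact Or.inl ⟨hAS hx, hxV⟩
      _ ≤ _ := lintegral_union_le _ _ _
      _ ≤ _ := by
          gcongr
          exact (lintegral_mono fun x => le_self_add).trans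
            (hsmall _ (mA.inter mG) (inter_subset_left.trans hAS) hAG)
  calc _ ≤ _ := hlow
    _ ≤ ENNReal.ofReal Q * ((∫⁻ x in A, ENNReal.ofReal (F x (du x + dφ x))) +
        ENNReal.ofReal (3 * e)) + ENNReal.ofReal e := by
        gcongr
        exact hmin.trans (by gcongr)
    _ = _ := by
        rw [mul_add, ← ENNReal.ofReal_mul hQ0.le, add_assoc, ← ENNReal.ofReal_add (by positivity)
          he0.le, show Q * (3 * e) + e = ε by rw [he]; field_simp, ENNReal.ofReal_coe_nnreal]

end Weak

theorem le_div_of_forall_le_mul_succ {Ψ : ℕ → ℝ} {θ D B : ℝ} (h0 : 0 ≤ θ) (h1 : θ < 1)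
    (hB : ∀ i, Ψ i ≤ B) (h : ∀ i, Ψ i ≤ θ * Ψ (i + 1) + D) : Ψ 0 ≤ D / (1 - θ) := by
  have hbdd : BddAbove (range Ψ) := ⟨B, by rintro _ ⟨i, rfl⟩; exact hB i⟩
  have h2 : (⨆ i, Ψ i) ≤ θ * (⨆ i, Ψ i) + D :=
    ciSup_le fun i => (h i).trans (by gcongr; exact le_ciSup hbdd _)
  refine (le_ciSup hbdd 0).trans ?_
  rw [le_div_iff₀ (by linarith)]
  linarith

/-- The hole-filling iteration lemma. -/
theorem exists_hole_filling {Θ κ : ℝ} (hΘ0 : 0 ≤ Θ) (hΘ1 : Θ < 1) (hκ : 0 < κ) :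
    ∃ C : ℝ, 0 < C ∧ ∀ (Φ : ℝ → ℝ) (ρ σ A B T : ℝ), ρ < σ → 0 ≤ A → 0 ≤ B → 0 ≤ T →
      (∀ t, ρ ≤ t → t ≤ σ → Φ t ≤ T) →
      (∀ s t, ρ ≤ s → s < t → t ≤ σ → Φ s ≤ Θ * Φ t + A * (t - s) ^ (-κ) + B) →
      Φ ρ ≤ C * (A * (σ - ρ) ^ (-κ) + B) := by
  set w : ℝ := (1 + Θ) / 2 with hw
  have hw0 : 0 < w := by rw [hw]; linarith
  have hw1 : w < 1 := by rw [hw]; linarith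
  have hΘw : Θ < w := by rw [hw]; linarith
  set l : ℝ := w ^ κ⁻¹ with hl
  have hl0 : 0 < l := Real.rpow_pos_of_pos hw0 _
  have hl1 : l < 1 := Real.rpow_lt_one hw0.le hw1 (inv_pos.2 hκ)
  have hlw : l ^ κ = w := Real.rpow_inv_rpow hw0.le hκ.ne'
  have hθ1 : Θ / w < 1 := (div_lt_one hw0).2 hΘw
  have hcl : 1 ≤ (1 - l) ^ (-κ) :=
    Real.one_le_rpow_of_pos_of_le_one_of_nonpos (by linarith) (by linarith) (by linarith)
  refine ⟨(1 - l) ^ (-κ) / (1 - Θ / w), div_pos (by linarith) (by linarith), ?_⟩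
  intro Φ ρ σ A B T hρσ hA hB hT hΦT hstep
  have hd : 0 < σ - ρ := by linarith
  set t : ℕ → ℝ := fun i => ρ + (1 - l ^ i) * (σ - ρ) with ht
  have hli : ∀ i : ℕ, 0 < l ^ i ∧ l ^ i ≤ 1 := fun i => ⟨by positivity, pow_le_one₀ hl0.le hl1.le⟩
  have ht0 : t 0 = ρ := by simp [ht]
  have hρt : ∀ i, ρ ≤ t i := fun i => by
    have := mul_nonneg (sub_nonneg.2 (hli i).2) hd.le
    simp only [ht]; linarith
  have htσ : ∀ i, t i ≤ σ := fun i => by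
    have := mul_pos (hli i).1 hd
    simp only [ht]; linarith
  have hsub : ∀ i, t (i + 1) - t i = l ^ i * ((1 - l) * (σ - ρ)) := fun i => by
    simp only [ht, pow_succ]; ring
  have key := le_div_of_forall_le_mul_succ (Ψ := fun i => Φ (t i) * w ^ i) (θ := Θ / w)
    (D := (1 - l) ^ (-κ) * (A * (σ - ρ) ^ (-κ) + B)) (B := T) (by positivity) hθ1
    (fun i => by
      have hwi : w ^ i ≤ 1 := pow_le_one₀ hw0.le hw1.le
      calc Φ (t i) * w ^ i ≤ T * w ^ i := by gcongr; exact hΦT _ (hρt i) (htσ i)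
        _ ≤ T * 1 := by gcongr
        _ = T := mul_one T)
    (fun i => by
      have hpos : 0 < t (i + 1) - t i := by
        rw [hsub]; exact mul_pos (hli i).1 (mul_pos (by linarith) hd)
      have h1 := hstep (t i) (t (i + 1)) (hρt i) (by linarith) (htσ _)
      have hwi0 : 0 < w ^ i := by positivity
      have hwi : w ^ i ≤ 1 := pow_le_one₀ hw0.le hw1.le
      have h2 : (t (i + 1) - t i) ^ (-κ) * w ^ i = (1 - l) ^ (-κ) * (σ - ρ) ^ (-κ) := by
        rw [hsub, Real.mul_rpow (hli i).1.le (by nlinarith), Real.mul_rpow (by linarith) hd.le,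
          Real.rpow_neg (hli i).1.le, ← Real.rpow_natCast l i, ← Real.rpow_mul hl0.le,
          mul_comm (i : ℝ) κ, Real.rpow_mul hl0.le, hlw, Real.rpow_natCast]
        field_simp
      calc Φ (t i) * w ^ i ≤ (Θ * Φ (t (i + 1)) + A * (t (i + 1) - t i) ^ (-κ) + B) * w ^ i := by
            gcongr
        _ = Θ / w * (Φ (t (i + 1)) * w ^ (i + 1)) + (A * ((t (i + 1) - t i) ^ (-κ) * w ^ i) +
              B * w ^ i) := by
            rw [pow_succ]; field_simp; ring
        _ ≤ Θ / w * (Φ (t (i + 1)) * w ^ (i + 1)) + (1 - l) ^ (-κ) * (A * (σ - ρ) ^ (-κ) + B) := by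
            rw [h2]
            have : B * w ^ i ≤ B * (1 - l) ^ (-κ) := by
              gcongr; linarith
            nlinarith)
  simp only [ht0, pow_zero, mul_one] at key
  calc Φ ρ ≤ _ := key
    _ = _ := by ring

theorem IsMult.neg_rpow {n : ℕ} {η : Eu n → ℝ} {dη : Eu n → Eu n} (h : IsMult η dη) {q : ℝ}
    (hq : 1 < q) :
    IsMult (fun x => -(η x ^ q)) (fun x => (-(q * η x ^ (q - 1))) • dη x) :=
  h.comp (g := fun t => -(t ^ q)) (g' := fun t => -(q * t ^ (q - 1)))
    ((continuous_const.mul (Real.continuous_rpow_const (by linarith))).neg) fun t => by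
      simpa using (Real.hasDerivAt_rpow_const (x := t) (Or.inr hq.le)).fun_neg

theorem caccioppoli_arith {p q κ e α C r t s a M : ℝ} (hp : 0 < p) (hq : 0 < q) (hκ : 0 < κ)
    (he : 0 ≤ e) (hC : 0 ≤ C) (hr : 0 < r) (hs : 0 < s) (hst : s < t) (hrt : r / 2 ≤ t)
    (htr : t ≤ r) (ha : 0 < a) (hM : 0 < M) :
    C * (((t - s) / t) ^ (-κ) * t ^ (-e) * a ^ α * (2 ^ p * M) ^ (q / p)) ≤
      (C * 2 ^ e * 2 ^ q) * (r ^ κ * r ^ (-e) * a ^ α * M ^ (q / p)) * (t - s) ^ (-κ) := by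
  have ht : 0 < t := hs.trans hst
  have hd : 0 < t - s := by linarith
  have e1 : ((t - s) / t) ^ (-κ) ≤ r ^ κ * (t - s) ^ (-κ) := by
    rw [Real.div_rpow hd.le ht.le, Real.rpow_neg ht.le, div_inv_eq_mul, mul_comm]
    gcongr
  have e2 : t ^ (-e) ≤ 2 ^ e * r ^ (-e) := by
    calc t ^ (-e) ≤ (r / 2) ^ (-e) :=
          Real.rpow_le_rpow_of_nonpos (by positivity) hrt (by linarith)
      _ = _ := by
          rw [Real.div_rpow hr.le (by norm_num), Real.rpow_neg (by norm_num : (0:ℝ) ≤ 2),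
            div_inv_eq_mul, mul_comm]
  have e3 : ((2:ℝ) ^ p * M) ^ (q / p) = 2 ^ q * M ^ (q / p) := by
    rw [Real.mul_rpow (by positivity) hM.le, ← Real.rpow_mul (by norm_num)]
    congr 2; field_simp
  rw [e3]
  calc C * (((t - s) / t) ^ (-κ) * t ^ (-e) * a ^ α * (2 ^ q * M ^ (q / p)))
      ≤ C * ((r ^ κ * (t - s) ^ (-κ)) * (2 ^ e * r ^ (-e)) * a ^ α * (2 ^ q * M ^ (q / p))) := by
        gcongr
    _ = _ := by ring

theorem exists_caccioppoli {n m : ℕ} (hn : n = m + 1) (hm : 1 ≤ m) {p q s L Q : ℝ} (hs : 1 ≤ s)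
    (hsp : s < p) (hpq : p < q) (hsq : 1 / s = min (1 / q + 1 / m) 1) (hL : 1 ≤ L) (hQ : 1 ≤ Q) :
    ∃ C : ℝ, 0 < C ∧ ∀ (Ω : Set (Eu n)) (μ : ℝ) (h : Eu n → ℝ) (F : Eu n → Eu n → ℝ)
      (du : Eu n → Eu n), StrongQMin Ω p q L μ Q h F du → ∀ S, IsCompact S → S ⊆ Ω →
      ∀ (U : Eu n → ℝ) (dU : Eu n → Eu n), Sob (ENNReal.ofReal p) U dU → Measurable U →
      ∀ (y : Eu n) (r : ℝ), 0 < r → cube y r ⊆ S → (∀ x ∈ cube y r, dU x = du x) →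
      ∀ k, 0 ≤ k → ∀ ρ σ, r / 2 ≤ ρ → ρ < σ → σ ≤ r →
      ∀ a, 0 < a → volume ({x | k < U x} ∩ cube y σ) ≤ ENNReal.ofReal a →
      ∀ M, 0 < M → (∫⁻ x in {x | k < U x} ∩ cube y σ,
        (‖dU x‖ₑ ^ p + ENNReal.ofReal r⁻¹ ^ p * ‖U x - k‖ₑ ^ p)) ≤ ENNReal.ofReal M →
      ∀ H, 0 ≤ H → (∫⁻ x in {x | k < U x} ∩ cube y σ, ENNReal.ofReal (h x) ^ p) ≤
        ENNReal.ofReal H →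
      ∫⁻ x in {x | k < U x} ∩ cube y ρ, ‖dU x‖ₑ ^ p ≤ ENNReal.ofReal
        (C * ((r / (σ - ρ)) ^ (2 * q + q / s - 1) * r ^ (-((m + 1) * q * (1 / s - 1 / q))) *
          a ^ (q * (1 / s - 1 / p)) * M ^ (q / p) + H)) := by
  have hp1 : 1 < p := by linarith
  have hp0 : 0 < p := by linarith
  have hq1 : 1 < q := by linarith
  have hq0 : 0 < q := by linarith
  have hs0 : 0 < s := by linarith
  have hL0 : 0 < L := by linarith
  have hQ0 : 0 < Q := by linarith
  have hpE : 1 ≤ ENNReal.ofReal p := by simpa using hp1.le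
  set κ : ℝ := 2 * q + q / s - 1 with hκ
  set e : ℝ := (m + 1) * q * (1 / s - 1 / q) with he
  set α : ℝ := q * (1 / s - 1 / p) with hα
  have hκ0 : 0 < κ := by
    have : 0 < q / s := by positivity
    rw [hκ]; linarith
  have he0 : 0 ≤ e := by
    have : 1 / q ≤ 1 / s := one_div_le_one_div_of_le hs0 (by linarith)
    rw [he]
    have := sub_nonneg.2 this
    positivity
  obtain ⟨C₀, hC₀, hcut⟩ := exists_good_cutoff_of_eq hn hm hs hsp hpq hsq
  simp only [← hκ, ← he, ← hα] at hcut
  obtain ⟨C₁, hC₁, hfill⟩ := exists_hole_filling (Θ := (Q - 1) / Q) (κ := κ)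
    (div_nonneg (by linarith) hQ0.le) ((div_lt_one hQ0).2 (by linarith)) hκ0
  set D : ℝ := L * q ^ q * C₀ with hD
  have hD0 : 0 < D := by positivity
  refine ⟨C₁ * (D * 2 ^ e * 2 ^ q + 2), by positivity, ?_⟩
  intro Ω μ h F du HQ S hS hSΩ U dU hU mU y r hr hrS hdU k hk ρ σ hρ hρσ hσ a ha haσ M hM hMσ
    H hH hHσ
  set P : Set (Eu n) := {x | k < U x} with hP
  have mP : MeasurableSet P := measurableSet_lt measurable_const mU
  have mc : ∀ t, MeasurableSet (cube y t) := fun t => measurableSet_cube y t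
  set E : ℝ → ℝ≥0∞ := fun t => ∫⁻ x in P ∩ cube y t, ENNReal.ofReal (F x (du x)) with hE
  have hPS : ∀ t, t ≤ σ → P ∩ cube y t ⊆ S := fun t ht x hx =>
    hrS (cube_mono (ht.trans hσ) hx.2)
  have hgoodS : ∀ᵐ x ∂volume.restrict S, GoodAt p q L μ (h x) (F x) :=
    ae_restrict_of_ae_restrict_of_subset hSΩ HQ.good
  have hEfin : ∀ t, t ≤ σ → E t < ⊤ := fun t ht =>
    (lintegral_mono_set (hPS t ht)).trans_lt (HQ.fin S hS hSΩ)
  have hEmono : ∀ t, t ≤ σ → E t ≤ E σ := fun t ht =>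
    lintegral_mono_set (inter_subset_inter_right _ (cube_mono ht))
  set v : Eu n → ℝ := fun x => max (U x - k) 0 with hv
  set dv : Eu n → Eu n := P.indicator dU with hdv
  have hvS : Sob (ENNReal.ofReal p) v dv := hU.trunc hpE ENNReal.ofReal_ne_top hk
  have hv0 : ∀ x, x ∉ P → v x = 0 ∧ dv x = 0 := fun x hx =>
    ⟨max_eq_right (by simpa [hP] using hx), indicator_of_notMem hx _⟩
  have hvP : ∀ x ∈ P, v x = U x - k := fun x hx => max_eq_left (sub_nonneg.2 (le_of_lt hx))
  have hbig := hfill (fun t => (E t).toReal) ρ σ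
    ((D * 2 ^ e * 2 ^ q) * (r ^ κ * r ^ (-e) * a ^ α * M ^ (q / p))) (2 * H) (E σ).toReal hρσ
    (by positivity) (by positivity) ENNReal.toReal_nonneg
    (fun t _ ht => ENNReal.toReal_mono (hEfin σ le_rfl).ne (hEmono t ht)) ?_
  · have h1 : ∫⁻ x in P ∩ cube y ρ, ‖dU x‖ₑ ^ p ≤ E ρ := by
      refine lintegral_mono_ae ?_
      filter_upwards [ae_restrict_of_ae_restrict_of_subset (hPS ρ hρσ.le) hgoodS,
        ae_restrict_mem (mP.inter (mc ρ))] with x hx hxm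
      rw [hdU x (cube_mono (hρσ.le.trans hσ) hxm.2), ← ofReal_norm,
        ENNReal.ofReal_rpow_of_nonneg (norm_nonneg _) hp0.le]
      exact ENNReal.ofReal_le_ofReal (hx.lower _)
    refine h1.trans ?_
    rw [← ENNReal.ofReal_toReal (hEfin ρ hρσ.le).ne]
    refine ENNReal.ofReal_le_ofReal (hbig.trans ?_)
    have hd : 0 < σ - ρ := by linarith
    have e1 : (r / (σ - ρ)) ^ κ = r ^ κ * (σ - ρ) ^ (-κ) := by
      rw [Real.div_rpow hr.le hd.le, Real.rpow_neg hd.le, div_eq_mul_inv]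
    rw [e1, mul_assoc C₁]
    refine mul_le_mul_of_nonneg_left ?_ hC₁.le
    have : 0 ≤ r ^ κ * (σ - ρ) ^ (-κ) * r ^ (-e) * a ^ α * M ^ (q / p) := by positivity
    have h3 : 0 ≤ D * 2 ^ e * 2 ^ q := by positivity
    nlinarith [mul_nonneg h3 hH]
  intro t₁ t₂ ht₁ ht₁₂ ht₂
  have ht₁0 : 0 < t₁ := by linarith
  have ht₂0 : 0 < t₂ := by linarith
  have hd0 : 0 < (t₂ - t₁) / t₂ := div_pos (by linarith) ht₂0
  have hd1 : (t₂ - t₁) / t₂ < 1 := (div_lt_one ht₂0).2 (by linarith)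
  obtain ⟨ψ, dψ, hψM, hψ01, hψ1, hψ0, hψint⟩ := hcut y t₂ ht₂0 v dv hvS P mP hv0 a ha
    ((measure_mono (inter_subset_inter_right _ (cube_mono ht₂))).trans haσ)
    ((t₂ - t₁) / t₂) hd0 hd1 (2 ^ p * M) (by positivity) (by
      calc ∫⁻ x in cube y t₂, (‖dv x‖ₑ ^ p + ENNReal.ofReal t₂⁻¹ ^ p * ‖v x‖ₑ ^ p)
          ≤ ∫⁻ x in cube y σ, P.indicator (fun x => ENNReal.ofReal (2 ^ p) *
            (‖dU x‖ₑ ^ p + ENNReal.ofReal r⁻¹ ^ p * ‖U x - k‖ₑ ^ p)) x := by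
            refine (lintegral_mono_set (cube_mono ht₂)).trans (lintegral_mono fun x => ?_)
            by_cases hx : x ∈ P
            · rw [indicator_of_mem hx, hvP x hx, hdv, indicator_of_mem hx, mul_add, ← mul_assoc,
                ← ENNReal.ofReal_rpow_of_pos (by norm_num : (0:ℝ) < 2),
                ← ENNReal.mul_rpow_of_nonneg (ENNReal.ofReal 2) (ENNReal.ofReal r⁻¹) hp0.le,
                ← ENNReal.ofReal_mul (p := 2) (by norm_num)]
              gcongr
              · refine le_mul_of_one_le_left' (ENNReal.one_le_rpow (by norm_num) hp0)
              · rw [← div_eq_mul_inv, inv_eq_one_div, div_le_div_iff₀ ht₂0 hr]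
                linarith
            · rw [indicator_of_notMem hx, (hv0 x hx).1, (hv0 x hx).2]
              simp [hp0]
        _ = ENNReal.ofReal (2 ^ p) * ∫⁻ x in P ∩ cube y σ,
            (‖dU x‖ₑ ^ p + ENNReal.ofReal r⁻¹ ^ p * ‖U x - k‖ₑ ^ p) := by
            rw [lintegral_indicator mP, Measure.restrict_restrict mP,
              lintegral_const_mul' _ _ ENNReal.ofReal_ne_top]
        _ ≤ _ := by
            rw [ENNReal.ofReal_mul (by positivity)]; gcongr)
  have e1 : (1 - (t₂ - t₁) / t₂) * t₂ = t₁ := by field_simp; ring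
  have e2 : (1 - (t₂ - t₁) / t₂ / 2) * t₂ ≤ t₂ := by nlinarith
  rw [e1] at hψ1
  have hψ0' : ∀ x, x ∉ cube y t₂ → ψ x = 0 ∧ dψ x = 0 := fun x hx =>
    hψ0 x fun hx' => hx (cube_mono e2 hx')
  set A : Set (Eu n) := P ∩ cube y t₂ with hA
  have mA : MeasurableSet A := mP.inter (mc _)
  have hAS : A ⊆ S := hPS t₂ ht₂
  have hmin := HQ.le_of_eq_zero hn hm hs hsp hpq hsq hL hQ hS hSΩ mA hAS
    (hvS.mult hpE ENNReal.ofReal_ne_top (hψM.neg_rpow hq1)) (fun x hx => by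
      by_cases hxP : x ∈ P
      · have := hψ0' x fun hx' => hx ⟨hxP, hx'⟩
        simp [this.1, this.2, hq0.ne']
      · simp [(hv0 x hxP).1, (hv0 x hxP).2])
  have mψ : AEMeasurable (fun x => ENNReal.ofReal (L * q ^ q) * (‖dψ x‖ₑ ^ q * ‖v x‖ₑ ^ q))
      volume :=
    ((hψM.bound.2.1.enorm.pow_const q).mul (hvS.memLp.1.enorm.pow_const q)).const_mul _
  have hup : ∫⁻ x in A, ENNReal.ofReal (F x (du x + (-(ψ x ^ q) • dv x +
      v x • (-(q * ψ x ^ (q - 1))) • dψ x))) ≤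
      (∫⁻ x in P ∩ (cube y t₂ \ cube y t₁), ENNReal.ofReal (F x (du x))) +
        ENNReal.ofReal (D * (((t₂ - t₁) / t₂) ^ (-κ) * t₂ ^ (-e) * a ^ α * (2 ^ p * M) ^ (q / p))
          + 2 * H) := by
    have hpt : ∀ᵐ x ∂volume.restrict A, ENNReal.ofReal (F x (du x + (-(ψ x ^ q) • dv x +
        v x • (-(q * ψ x ^ (q - 1))) • dψ x))) ≤
        (cube y t₁)ᶜ.indicator (fun x => ENNReal.ofReal (F x (du x))) x +
          ENNReal.ofReal (L * q ^ q) * (‖dψ x‖ₑ ^ q * ‖v x‖ₑ ^ q) +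
            2 * ENNReal.ofReal (h x) ^ p := by
      filter_upwards [ae_restrict_of_ae_restrict_of_subset hAS hgoodS, ae_restrict_mem mA]
        with x hx hxA
      have h1 := hx.cutoff_le hL0.le hq1 (hψ01 x).1 (hψ01 x).2 (du x) ((-(q * v x)) • dψ x)
      have e3 : (1 - ψ x ^ q) • du x + ψ x ^ (q - 1) • (-(q * v x)) • dψ x =
          du x + (-(ψ x ^ q) • dv x + v x • (-(q * ψ x ^ (q - 1))) • dψ x) := by
        rw [hdv, indicator_of_mem hxA.1, hdU x (cube_mono (ht₂.trans hσ) hxA.2)]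
        module
      rw [e3] at h1
      have e4 : L * ‖(-(q * v x)) • dψ x‖ ^ q = L * q ^ q * (‖dψ x‖ ^ q * ‖v x‖ ^ q) := by
        rw [norm_smul, norm_neg, norm_mul, Real.norm_of_nonneg hq0.le,
          Real.mul_rpow (by positivity) (by positivity), Real.mul_rpow hq0.le (by positivity)]
        ring
      rw [e4, ← add_assoc ((1 - ψ x ^ q) * F x (du x))] at h1
      refine (ENNReal.ofReal_le_ofReal h1).trans (ENNReal.ofReal_add_le.trans ?_)
      refine add_le_add (ENNReal.ofReal_add_le.trans (add_le_add ?_ (le_of_eq ?_))) (le_of_eq ?_)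
      · by_cases hx1 : x ∈ cube y t₁
        · rw [(hψ1 x hx1).1]; simp
        · rw [indicator_of_mem (show x ∈ (cube y t₁)ᶜ from hx1)]
          refine ENNReal.ofReal_le_ofReal (mul_le_of_le_one_left (hx.nonneg _) ?_)
          have := Real.rpow_nonneg (hψ01 x).1 q
          linarith
      · rw [ENNReal.ofReal_mul (p := L * q ^ q) (by positivity),
          ENNReal.ofReal_mul (p := ‖dψ x‖ ^ q) (by positivity),
          ← ENNReal.ofReal_rpow_of_nonneg (norm_nonneg _) hq0.le,
          ← ENNReal.ofReal_rpow_of_nonneg (norm_nonneg _) hq0.le, ofReal_norm, ofReal_norm]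
      · rw [ENNReal.ofReal_mul (by norm_num), ENNReal.ofReal_rpow_of_nonneg hx.h_nonneg hp0.le]
        simp
    have mh : AEMeasurable (fun x => 2 * ENNReal.ofReal (h x) ^ p) (volume.restrict A) :=
      ((HQ.meas_h.mono_measure (Measure.restrict_mono (hAS.trans hSΩ) le_rfl)).ennreal_ofReal.pow_const
        p).const_mul _
    refine (lintegral_mono_ae hpt).trans ?_
    rw [lintegral_add_right' _ mh, lintegral_add_right' _ mψ.restrict,
      lintegral_indicator (mc t₁).compl, Measure.restrict_restrict (mc t₁).compl,
      lintegral_const_mul' _ _ ENNReal.ofReal_ne_top, lintegral_const_mul' _ _ (by norm_num),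
      add_assoc]
    refine add_le_add (lintegral_mono_set fun x hx => ⟨hx.2.1, hx.2.2, hx.1⟩) ?_
    refine (add_le_add (mul_le_mul_right ((setLIntegral_le_lintegral _ _).trans hψint) _)
      (mul_le_mul_right ((lintegral_mono_set (inter_subset_inter_right _ (cube_mono ht₂))).trans
        hHσ) 2)).trans (le_of_eq ?_)
    rw [ENNReal.ofReal_add (by positivity) (by positivity), ENNReal.ofReal_mul (p := 2) (by norm_num),
      ← ENNReal.ofReal_mul (p := L * q ^ q) (by positivity)]
    congr 2
    · rw [hD]; ring
    · simp
  set G : ℝ≥0∞ := ∫⁻ x in P ∩ (cube y t₂ \ cube y t₁), ENNReal.ofReal (F x (du x)) with hG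
  have hsplit : E t₂ = E t₁ + G := by
    rw [hE, hG]
    simp only
    rw [← lintegral_inter_add_sdiff (μ := volume) (fun x => ENNReal.ofReal (F x (du x)))
      (P ∩ cube y t₂) (mc t₁)]
    congr 2
    · congr 1
      ext x
      exact ⟨fun hx => ⟨hx.1.1, hx.2⟩, fun hx => ⟨⟨hx.1, cube_mono ht₁₂.le hx.2⟩, hx.2⟩⟩
    · congr 1
      ext x
      exact ⟨fun hx => ⟨hx.1.1, hx.1.2, hx.2⟩, fun hx => ⟨⟨hx.1, hx.2.1⟩, hx.2.2⟩⟩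
  have hGfin : G ≠ ⊤ := ne_top_of_le_ne_top (hEfin t₂ ht₂).ne (hsplit ▸ le_add_self)
  set R : ℝ := D * (((t₂ - t₁) / t₂) ^ (-κ) * t₂ ^ (-e) * a ^ α * (2 ^ p * M) ^ (q / p)) + 2 * H
    with hR
  have hR0 : 0 ≤ R := by positivity
  have h5 : (E t₂).toReal ≤ Q * (G.toReal + R) := by
    have := ENNReal.toReal_mono (ENNReal.mul_ne_top ENNReal.ofReal_ne_top
      (ENNReal.add_ne_top.2 ⟨hGfin, ENNReal.ofReal_ne_top⟩)) (hmin.trans (mul_le_mul_right hup _))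
    rwa [ENNReal.toReal_mul, ENNReal.toReal_add hGfin ENNReal.ofReal_ne_top,
      ENNReal.toReal_ofReal hQ0.le, ENNReal.toReal_ofReal hR0] at this
  have h6 : (E t₂).toReal = (E t₁).toReal + G.toReal := by
    rw [hsplit, ENNReal.toReal_add (hEfin t₁ (ht₁₂.le.trans ht₂)).ne hGfin]
  have h7 : R ≤ (D * 2 ^ e * 2 ^ q) * (r ^ κ * r ^ (-e) * a ^ α * M ^ (q / p)) *
      (t₂ - t₁) ^ (-κ) + 2 * H := by
    have := caccioppoli_arith (p := p) (α := α) hp0 hq0 hκ0 he0 hD0.le hr ht₁0 ht₁₂ (by linarith)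
      (ht₂.trans hσ) ha hM
    rw [hR]
    linarith
  have h8 : (E t₁).toReal ≤ (Q - 1) / Q * (E t₂).toReal + R := by
    have e5 : (Q - 1) / Q * (E t₂).toReal = (E t₂).toReal - (E t₂).toReal / Q := by field_simp
    have e6 : (E t₂).toReal / Q ≤ G.toReal + R := by
      rw [div_le_iff₀ hQ0]; linarith
    rw [e5]; linarith
  linarith

section Rearrangement

variable {n : ℕ} {f : Eu n → ℝ} {s t : ℝ}

theorem rearr_nonneg (f : Eu n → ℝ) (t : ℝ) : 0 ≤ rearr n f t :=
  Real.sInf_nonneg fun _ h => h.1.le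

theorem bddBelow_rearr (f : Eu n → ℝ) (t : ℝ) :
    BddBelow {σ : ℝ | 0 < σ ∧ volume {x | σ < |f x|} ≤ ENNReal.ofReal t} :=
  ⟨0, fun _ h => h.1.le⟩

theorem nonempty_rearr {p : ℝ} (hp : 0 < p) (hf : AEMeasurable f) (hfp : ∫⁻ x, ‖f x‖ₑ ^ p < ⊤)
    (ht : 0 < t) : {σ : ℝ | 0 < σ ∧ volume {x | σ < |f x|} ≤ ENNReal.ofReal t}.Nonempty := by
  set I := (∫⁻ x, ‖f x‖ₑ ^ p).toReal with hI
  have hI0 : 0 ≤ I := ENNReal.toReal_nonneg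
  refine ⟨((I + 1) / t) ^ p⁻¹, by positivity, ?_⟩
  have h0 : 0 < (I + 1) / t := by positivity
  have h1 : volume {x | ((I + 1) / t) ^ p⁻¹ < |f x|} ≤
      volume {x | ENNReal.ofReal ((I + 1) / t) ≤ ‖f x‖ₑ ^ p} := by
    refine measure_mono fun x hx => ?_
    have hx' : ((I + 1) / t) ^ p⁻¹ < |f x| := hx
    have h2 : (I + 1) / t ≤ |f x| ^ p := by
      calc (I + 1) / t = (((I + 1) / t) ^ p⁻¹) ^ p := (Real.rpow_inv_rpow h0.le hp.ne').symm
        _ ≤ _ := by gcongr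
    change ENNReal.ofReal ((I + 1) / t) ≤ ‖f x‖ₑ ^ p
    rw [← ofReal_norm, ENNReal.ofReal_rpow_of_nonneg (norm_nonneg _) hp.le, Real.norm_eq_abs]
    exact ENNReal.ofReal_le_ofReal h2
  refine h1.trans ?_
  refine (meas_ge_le_lintegral_div (hf.enorm.pow_const p) (by simpa using h0)
    ENNReal.ofReal_ne_top).trans ?_
  rw [ENNReal.div_le_iff (by simpa using h0) ENNReal.ofReal_ne_top, ← ENNReal.ofReal_mul ht.le,
    ← ENNReal.ofReal_toReal hfp.ne]
  refine ENNReal.ofReal_le_ofReal ?_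
  rw [mul_div_cancel₀ _ ht.ne']
  linarith

theorem rearr_anti (hst : s ≤ t)
    (hs : {σ : ℝ | 0 < σ ∧ volume {x | σ < |f x|} ≤ ENNReal.ofReal s}.Nonempty) :
    rearr n f t ≤ rearr n f s :=
  csInf_le_csInf (bddBelow_rearr f t) hs fun _ h => ⟨h.1, h.2.trans (ENNReal.ofReal_le_ofReal hst)⟩

theorem measure_rearr_lt_le
    (ht : {σ : ℝ | 0 < σ ∧ volume {x | σ < |f x|} ≤ ENNReal.ofReal t}.Nonempty) :
    volume {x | rearr n f t < |f x|} ≤ ENNReal.ofReal t := by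
  have hmono : Monotone fun k : ℕ => {x | rearr n f t + 1 / ((k : ℝ) + 1) < |f x|} := by
    intro i j hij x hx
    have hx' : rearr n f t + 1 / ((i : ℝ) + 1) < |f x| := hx
    have : 1 / ((j : ℝ) + 1) ≤ 1 / ((i : ℝ) + 1) := Nat.one_div_le_one_div hij
    change rearr n f t + 1 / ((j : ℝ) + 1) < |f x|
    linarith
  have hU : {x | rearr n f t < |f x|} =
      ⋃ k : ℕ, {x | rearr n f t + 1 / ((k : ℝ) + 1) < |f x|} := by
    ext x
    simp only [mem_iUnion]
    constructor
    · intro hx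
      have hx' : rearr n f t < |f x| := hx
      obtain ⟨k, hk⟩ := exists_nat_one_div_lt (sub_pos.2 hx')
      refine ⟨k, ?_⟩
      change rearr n f t + 1 / ((k : ℝ) + 1) < |f x|
      linarith
    · rintro ⟨k, hk⟩
      have hk' : rearr n f t + 1 / ((k : ℝ) + 1) < |f x| := hk
      have : 0 < 1 / ((k : ℝ) + 1) := Nat.one_div_pos_of_nat
      change rearr n f t < |f x|
      linarith
  rw [hU, hmono.measure_iUnion]
  refine iSup_le fun k => ?_
  have hlt : rearr n f t < rearr n f t + 1 / ((k : ℝ) + 1) := by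
    have : 0 < 1 / ((k : ℝ) + 1) := Nat.one_div_pos_of_nat
    linarith
  obtain ⟨σ, hσ, hσlt⟩ := exists_lt_of_csInf_lt ht hlt
  exact (measure_mono fun x (hx : _ < |f x|) => (hσlt.trans hx : σ < |f x|)).trans hσ.2

theorem ENNReal.sum_rpow_le_rpow_sum {ι : Type*} (S : Finset ι) (a : ι → ℝ≥0∞) {p : ℝ}
    (hp : 1 ≤ p) : ∑ i ∈ S, a i ^ p ≤ (∑ i ∈ S, a i) ^ p := by
  classical
  induction S using Finset.induction_on with
  | empty => simp
  | insert i S hi ih =>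
    rw [Finset.sum_insert hi, Finset.sum_insert hi]
    exact (add_le_add_right ih _).trans (ENNReal.add_rpow_le_rpow_add _ _ hp)

theorem ENNReal.tsum_rpow_le_rpow_tsum {ι : Type*} (a : ι → ℝ≥0∞) {p : ℝ} (hp : 1 ≤ p) :
    ∑' i, a i ^ p ≤ (∑' i, a i) ^ p := by
  rw [ENNReal.tsum_eq_iSup_sum]
  exact iSup_le fun S => (ENNReal.sum_rpow_le_rpow_sum S a hp).trans
    (ENNReal.rpow_le_rpow (ENNReal.sum_le_tsum S) (by linarith))

/-- The `L^p` norm over a set of prescribed measure is controlled by the rearrangement along a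
geometric sequence. -/
theorem lintegral_rpow_le_tsum_rearr {p : ℝ} (hp : 1 ≤ p) (hf : AEMeasurable f)
    (hfp : ∫⁻ x, ‖f x‖ₑ ^ p < ⊤) {t₀ l : ℝ} (ht₀ : 0 < t₀) (hl0 : 0 < l) (hl1 : l < 1) (j : ℕ)
    {A : Set (Eu n)} (hA : volume A ≤ ENNReal.ofReal (t₀ * l ^ j)) :
    ∫⁻ x in A, ‖f x‖ₑ ^ p ≤ (∑' i : ℕ, ENNReal.ofReal
      ((t₀ * l ^ (j + i)) ^ (1 / p) * rearr n f (t₀ * l ^ (j + i + 1)))) ^ p := by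
  have hp0 : 0 < p := by linarith
  set T : ℕ → ℝ := fun i => t₀ * l ^ i with hT
  have hT0 : ∀ i, 0 < T i := fun i => by positivity
  set R : ℕ → ℝ := fun i => rearr n f (T i) with hR
  have hR0 : ∀ i, 0 ≤ R i := fun i => rearr_nonneg _ _
  have hvol : ∀ i, volume {x | R i < |f x|} ≤ ENNReal.ofReal (T i) := fun i =>
    measure_rearr_lt_le (nonempty_rearr hp0 hf hfp (hT0 i))
  set S : ℕ → Set (Eu n) := fun i => {x | i = 0 ∨ R (j + i) < |f x|} with hS
  have mS : ∀ i, NullMeasurableSet (S i) (volume.restrict A) := fun i => by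
    rcases Nat.eq_zero_or_pos i with rfl | hi
    · simp [hS]
    · have : S i = {x | R (j + i) < |f x|} := by
        ext x; simp only [hS, mem_ofPred_eq]; constructor
        · rintro (h | h)
          · omega
          · exact h
        · exact Or.inr
      rw [this]
      exact (nullMeasurableSet_lt aemeasurable_const
        (continuous_abs.measurable.comp_aemeasurable hf)).mono_ac Measure.restrict_le_self.absolutelyContinuous
  have hvS : ∀ i, volume.restrict A (S i) ≤ ENNReal.ofReal (T (j + i)) := fun i => by
    rcases Nat.eq_zero_or_pos i with rfl | hi
    · refine (measure_mono (subset_univ _)).trans ?_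
      rw [Measure.restrict_apply_univ]
      exact hA
    · have : S i ⊆ {x | R (j + i) < |f x|} := by
        rintro x (h | h)
        · omega
        · exact h
      exact (measure_mono this).trans ((Measure.restrict_apply_le _ _).trans (hvol _))
  have hnull : ∀ᵐ x ∂volume.restrict A, ∃ i, |f x| ≤ R (j + i + 1) := by
    refine ae_restrict_of_ae ?_
    rw [ae_iff]
    have hlim : Tendsto (fun i : ℕ => ENNReal.ofReal (T (j + i + 1))) atTop (𝓝 0) := by
      have h1 : Tendsto T atTop (𝓝 0) := by
        simpa using (tendsto_pow_atTop_nhds_zero_of_lt_one hl0.le hl1).const_mul t₀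
      have h2 : Tendsto (fun i : ℕ => j + i + 1) atTop atTop :=
        tendsto_atTop_mono (fun i => by omega : ∀ i, i ≤ j + i + 1) tendsto_id
      simpa using ENNReal.tendsto_ofReal (h1.comp h2)
    refine le_antisymm (ge_of_tendsto' hlim fun i => ?_) zero_le
    refine (measure_mono fun x hx => ?_).trans (hvol (j + i + 1))
    by_contra hc
    exact hx ⟨i, not_lt.1 hc⟩
  have hpt : ∀ᵐ x ∂volume.restrict A, ‖f x‖ₑ ^ p ≤
      ∑' i, (S i).indicator (fun _ => ENNReal.ofReal (R (j + i + 1)) ^ p) x := by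
    filter_upwards [hnull] with x hx
    classical
    refine le_trans ?_ (ENNReal.le_tsum (Nat.find hx))
    have hxS : x ∈ S (Nat.find hx) := by
      rcases Nat.eq_zero_or_pos (Nat.find hx) with h0 | h0
      · exact Or.inl h0
      · refine Or.inr ?_
        have := Nat.find_min hx (Nat.sub_one_lt_of_lt h0)
        rw [not_le, show j + (Nat.find hx - 1) + 1 = j + Nat.find hx by omega] at this
        exact this
    rw [indicator_of_mem hxS]
    refine ENNReal.rpow_le_rpow ?_ hp0.le
    rw [← ofReal_norm, Real.norm_eq_abs]
    exact ENNReal.ofReal_le_ofReal (Nat.find_spec hx)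
  calc ∫⁻ x in A, ‖f x‖ₑ ^ p
      ≤ ∫⁻ x in A, ∑' i, (S i).indicator (fun _ => ENNReal.ofReal (R (j + i + 1)) ^ p) x :=
        lintegral_mono_ae hpt
    _ = ∑' i, ∫⁻ x in A, (S i).indicator (fun _ => ENNReal.ofReal (R (j + i + 1)) ^ p) x :=
        lintegral_tsum fun i => aemeasurable_const.indicator₀ (mS i)
    _ ≤ ∑' i, (ENNReal.ofReal ((T (j + i)) ^ (1 / p) * R (j + i + 1))) ^ p := by
        refine ENNReal.tsum_le_tsum fun i => ?_
        rw [lintegral_indicator_const₀ (mS i), ENNReal.ofReal_mul (by have := hT0 (j + i); positivity),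
          ENNReal.mul_rpow_of_nonneg _ _ hp0.le, mul_comm,
          ENNReal.ofReal_rpow_of_nonneg (Real.rpow_nonneg (hT0 (j + i)).le (1 / p)) hp0.le,
          ← Real.rpow_mul (hT0 _).le, one_div_mul_cancel hp0.ne', Real.rpow_one]
        exact mul_le_mul_left (hvS i) _
    _ ≤ _ := ENNReal.tsum_rpow_le_rpow_tsum _ hp

theorem tsum_rearr_le_lorentz {p : ℝ} (hn : 1 ≤ n) (hp : 0 < p) {B : Set (Eu n)} {h : Eu n → ℝ}
    (hf : AEMeasurable (B.indicator h)) (hfp : ∫⁻ x, ‖B.indicator h x‖ₑ ^ p < ⊤) {t₀ l : ℝ}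
    (ht₀ : 0 < t₀) (htB : t₀ ≤ (volume B).toReal) (hl0 : 0 < l) (hl1 : l < 1) :
    ∑' k : ℕ, ENNReal.ofReal ((t₀ * l ^ k) ^ (1 / (n : ℝ)) *
      rearr n (B.indicator h) (t₀ * l ^ (k + 1))) ≤
      ENNReal.ofReal (l ^ (-(1 / (n : ℝ))) / (1 - l)) * lorentzN1 n B h := by
  set f := B.indicator h with hfdef
  set T : ℕ → ℝ := fun i => t₀ * l ^ i with hT
  have hT0 : ∀ i, 0 < T i := fun i => by positivity
  have hTs : ∀ i, T (i + 1) = l * T i := fun i => by simp only [hT, pow_succ]; ring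
  have hTlt : ∀ i, T (i + 1) < T i := fun i => by
    rw [hTs]; exact mul_lt_of_lt_one_left (hT0 i) hl1
  have hTanti : Antitone T := antitone_nat_of_succ_le fun i => (hTlt i).le
  have hn0 : (0:ℝ) < n := by exact_mod_cast hn
  have hn1 : 1 / (n : ℝ) ≤ 1 := by
    rw [div_le_one hn0]; exact_mod_cast hn
  set c : ℝ := l ^ (-(1 / (n : ℝ))) / (1 - l) with hc
  have hc0 : 0 < c := div_pos (Real.rpow_pos_of_pos hl0 _) (by linarith)
  have hne : ∀ s : ℝ, 0 < s → _ := fun s hs => nonempty_rearr (t := s) hp hf hfp hs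
  set G : ℝ → ℝ≥0∞ := fun t => ENNReal.ofReal (t ^ (1 / (n : ℝ)) * rearr n f t / t) with hG
  have hk : ∀ k, ENNReal.ofReal ((T k) ^ (1 / (n : ℝ)) * rearr n f (T (k + 1))) ≤
      ENNReal.ofReal c * ∫⁻ t in Ioc (T (k + 2)) (T (k + 1)), G t := fun k => by
    have h1 : ENNReal.ofReal ((T (k + 1)) ^ (1 / (n : ℝ) - 1) * rearr n f (T (k + 1))) *
        volume (Ioc (T (k + 2)) (T (k + 1))) ≤ ∫⁻ t in Ioc (T (k + 2)) (T (k + 1)), G t := by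
      rw [← setLIntegral_const]
      refine setLIntegral_mono' measurableSet_Ioc fun t ht => ENNReal.ofReal_le_ofReal ?_
      have ht0 : 0 < t := (hT0 _).trans ht.1
      have h2 : rearr n f (T (k + 1)) ≤ rearr n f t := rearr_anti ht.2 (hne t ht0)
      have h3 : T (k + 1) ^ (1 / (n : ℝ) - 1) ≤ t ^ (1 / (n : ℝ) - 1) :=
        Real.rpow_le_rpow_of_nonpos ht0 ht.2 (by linarith)
      calc _ ≤ t ^ (1 / (n : ℝ) - 1) * rearr n f t := by
            have := rearr_nonneg f (T (k + 1)); gcongr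
        _ = _ := by rw [Real.rpow_sub_one ht0.ne']; ring
    refine le_trans ?_ (mul_le_mul_right h1 _)
    rw [Real.volume_Ioc, ← ENNReal.ofReal_mul (by
      have := rearr_nonneg f (T (k + 1)); have := hT0 (k + 1); positivity),
      ← ENNReal.ofReal_mul hc0.le]
    refine ENNReal.ofReal_le_ofReal (le_of_eq ?_)
    have e1 : T (k + 1) ^ (1 / (n : ℝ) - 1) * (T (k + 1) - T (k + 2)) =
        (1 - l) * T (k + 1) ^ (1 / (n : ℝ)) := by
      rw [hTs (k + 1), Real.rpow_sub_one (hT0 _).ne']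
      have := (hT0 (k + 1)).ne'
      field_simp
    have e2 : l ^ (-(1 / (n : ℝ))) * T (k + 1) ^ (1 / (n : ℝ)) = T k ^ (1 / (n : ℝ)) := by
      rw [hTs k, Real.mul_rpow hl0.le (hT0 k).le, ← mul_assoc, ← Real.rpow_add hl0]
      simp
    have hl' : 1 - l ≠ 0 := by linarith
    calc T k ^ (1 / (n : ℝ)) * rearr n f (T (k + 1))
        = c * ((1 - l) * T (k + 1) ^ (1 / (n : ℝ))) * rearr n f (T (k + 1)) := by
          rw [← e2, hc]; field_simp
      _ = _ := by rw [← e1]; ring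
  calc ∑' k, ENNReal.ofReal ((T k) ^ (1 / (n : ℝ)) * rearr n f (T (k + 1)))
      ≤ ∑' k, ENNReal.ofReal c * ∫⁻ t in Ioc (T (k + 2)) (T (k + 1)), G t :=
        ENNReal.tsum_le_tsum hk
    _ = ENNReal.ofReal c * ∫⁻ t in ⋃ k : ℕ, Ioc (T (k + 2)) (T (k + 1)), G t := by
        rw [ENNReal.tsum_mul_left, lintegral_iUnion (fun _ => measurableSet_Ioc)]
        intro i j hij
        rw [Function.onFun, Set.disjoint_left]
        intro t h1 h2
        rcases lt_or_gt_of_ne hij with h3 | h3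
        · exact absurd (h1.1.trans_le (h2.2.trans (hTanti (by omega : i + 2 ≤ j + 1)))) (lt_irrefl _)
        · exact absurd (h2.1.trans_le (h1.2.trans (hTanti (by omega : j + 2 ≤ i + 1)))) (lt_irrefl _)
    _ ≤ _ := by
        refine mul_le_mul_right (lintegral_mono_set (iUnion_subset fun k t ht => ?_)) _
        refine ⟨(hT0 _).trans ht.1, ?_⟩
        have h4 : T (k + 1) ≤ T 1 := hTanti (by omega)
        have h5 : T 0 = t₀ := by simp [hT]
        have h6 : T 1 < T 0 := hTlt 0
        have h7 : t ≤ T (k + 1) := ht.2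
        change t < (volume B).toReal
        linarith

/-- A sequence controlling the `L^p` norms over small sets, summable against the Lorentz norm. -/
theorem exists_lorentz_sequence (hn : 1 ≤ n) {p : ℝ} (hp : 1 ≤ p) (hpn : p < n) {l : ℝ}
    (hl0 : 0 < l) (hl1 : l < 1) :
    ∃ C : ℝ, 0 < C ∧ ∀ (B : Set (Eu n)) (h : Eu n → ℝ), AEMeasurable (B.indicator h) →
      MeasurableSet B → ∫⁻ x, ‖B.indicator h x‖ₑ ^ p < ⊤ → lorentzN1 n B h < ⊤ → ∀ t₀, 0 < t₀ →
      t₀ ≤ (volume B).toReal → ∃ H : ℕ → ℝ, (∀ j, 0 ≤ H j) ∧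
        (∀ j A, A ⊆ B → volume A ≤ ENNReal.ofReal (t₀ * l ^ j) →
          ∫⁻ x in A, ENNReal.ofReal (h x) ^ p ≤ ENNReal.ofReal (H j ^ p)) ∧
        ∀ N, ∑ j ∈ Finset.range N, H j * (t₀ * l ^ j) ^ (1 / (n : ℝ) - 1 / p) ≤
          C * (lorentzN1 n B h).toReal := by
  have hp0 : 0 < p := by linarith
  have hn0 : (0:ℝ) < n := by linarith
  set β : ℝ := 1 / p - 1 / n with hβ
  have hβ0 : 0 < β := sub_pos.2 (one_div_lt_one_div_of_lt hp0 hpn)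
  have hlβ0 : 0 < l ^ β := Real.rpow_pos_of_pos hl0 _
  have hlβ1 : l ^ β < 1 := Real.rpow_lt_one hl0.le hl1 hβ0
  set c₂ : ℝ := l ^ (-(1 / (n : ℝ))) / (1 - l) with hc₂
  have hc₂0 : 0 < c₂ := div_pos (Real.rpow_pos_of_pos hl0 _) (by linarith)
  refine ⟨(1 - l ^ β)⁻¹ * c₂, mul_pos (inv_pos.2 (by linarith)) hc₂0, ?_⟩
  intro B h hm mB hfp hlor t₀ ht₀ htB
  set f := B.indicator h with hf
  set T : ℕ → ℝ := fun i => t₀ * l ^ i with hT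
  have hT0 : ∀ i, 0 < T i := fun i => by positivity
  set g : ℕ → ℝ≥0∞ := fun k => ENNReal.ofReal (T k ^ (1 / (n : ℝ)) * rearr n f (T (k + 1)))
    with hg
  have hgsum : ∑' k, g k ≤ ENNReal.ofReal c₂ * lorentzN1 n B h :=
    tsum_rearr_le_lorentz hn hp0 hm hfp ht₀ htB hl0 hl1
  set W : ℕ → ℝ≥0∞ := fun j => ∑' i : ℕ, ENNReal.ofReal
      (T (j + i) ^ (1 / p) * rearr n f (T (j + i + 1))) with hW
  have hterm : ∀ j i, ENNReal.ofReal (T (j + i) ^ (1 / p) * rearr n f (T (j + i + 1))) *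
      ENNReal.ofReal (T j ^ (-β)) = ENNReal.ofReal (l ^ β) ^ i * g (j + i) := fun j i => by
    have hr := rearr_nonneg f (T (j + i + 1))
    rw [hg, ← ENNReal.ofReal_mul (mul_nonneg (Real.rpow_nonneg (hT0 _).le _) hr),
      ← ENNReal.ofReal_pow hlβ0.le, ← ENNReal.ofReal_mul (by positivity)]
    congr 1
    have e1 : T (j + i) = l ^ i * T j := by simp only [hT, pow_add]; ring
    have e2 : T j ^ (-β) = (l ^ β) ^ i * T (j + i) ^ (-β) := by
      rw [e1, Real.mul_rpow (by positivity) (hT0 j).le, ← Real.rpow_natCast (l ^ β),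
        ← Real.rpow_mul hl0.le, ← Real.rpow_natCast l, ← Real.rpow_mul hl0.le, ← mul_assoc,
        ← Real.rpow_add hl0]
      rw [show β * (i : ℝ) + i * -β = 0 by ring]
      simp
    have e3 : T (j + i) ^ (1 / (n : ℝ)) = T (j + i) ^ (1 / p) * T (j + i) ^ (-β) := by
      rw [← Real.rpow_add (hT0 _)]; congr 1; rw [hβ]; ring
    rw [e2, e3]; ring
  have hWsum : ∑' j, W j * ENNReal.ofReal (T j ^ (-β)) ≤
      ENNReal.ofReal ((1 - l ^ β)⁻¹ * c₂) * lorentzN1 n B h := by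
    calc ∑' j, W j * ENNReal.ofReal (T j ^ (-β))
        = ∑' j, ∑' i, ENNReal.ofReal (l ^ β) ^ i * g (j + i) := by
          refine tsum_congr fun j => ?_
          rw [hW, ← ENNReal.tsum_mul_right]
          exact tsum_congr fun i => hterm j i
      _ = ∑' i, ∑' j, ENNReal.ofReal (l ^ β) ^ i * g (j + i) := ENNReal.tsum_comm
      _ ≤ ∑' i, ENNReal.ofReal (l ^ β) ^ i * ∑' k, g k := by
          refine ENNReal.tsum_le_tsum fun i => ?_
          rw [ENNReal.tsum_mul_left]
          refine mul_le_mul_right ?_ _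
          exact ENNReal.tsum_comp_le_tsum_of_injective (add_left_injective i) g
      _ = ENNReal.ofReal (1 - l ^ β)⁻¹ * ∑' k, g k := by
          rw [ENNReal.tsum_mul_right, ENNReal.tsum_geometric,
            ENNReal.ofReal_inv_of_pos (by linarith), ENNReal.ofReal_sub _ hlβ0.le,
            ENNReal.ofReal_one]
      _ ≤ ENNReal.ofReal (1 - l ^ β)⁻¹ * (ENNReal.ofReal c₂ * lorentzN1 n B h) := by gcongr
      _ = _ := by
          rw [← mul_assoc, ← ENNReal.ofReal_mul (inv_nonneg.2 (by linarith))]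
  have hfin : ENNReal.ofReal ((1 - l ^ β)⁻¹ * c₂) * lorentzN1 n B h ≠ ⊤ :=
    ENNReal.mul_ne_top ENNReal.ofReal_ne_top hlor.ne
  have hWfin : ∀ j, W j ≠ ⊤ := fun j hj => by
    have h1 := (ENNReal.le_tsum j).trans hWsum
    rw [hj, ENNReal.top_mul (by simpa using Real.rpow_pos_of_pos (hT0 j) _)] at h1
    exact hfin (top_le_iff.1 h1)
  refine ⟨fun j => (W j).toReal, fun j => ENNReal.toReal_nonneg, fun j A hAB hA => ?_, fun N => ?_⟩
  · simp only
    rw [← ENNReal.ofReal_rpow_of_nonneg ENNReal.toReal_nonneg hp0.le,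
      ENNReal.ofReal_toReal (hWfin j)]
    refine le_trans ?_ (lintegral_rpow_le_tsum_rearr hp hm hfp ht₀ hl0 hl1 j hA)
    have : ∫⁻ x in A, ENNReal.ofReal (h x) ^ p ≤ ∫⁻ x in A, B.indicator (fun x => ‖h x‖ₑ ^ p) x := by
      refine (lintegral_mono fun x => ?_ : ∫⁻ x in A, ENNReal.ofReal (h x) ^ p ≤
        ∫⁻ x in A, ‖h x‖ₑ ^ p).trans (le_of_eq ?_)
      · refine ENNReal.rpow_le_rpow ?_ hp0.le
        rw [← ofReal_norm]
        exact ENNReal.ofReal_le_ofReal (le_abs_self _)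
      · rw [lintegral_indicator mB, Measure.restrict_restrict mB, inter_eq_right.2 hAB]
    refine this.trans (lintegral_mono fun x => ?_)
    by_cases hx : x ∈ B
    · rw [hf, indicator_of_mem hx, indicator_of_mem hx]
    · rw [indicator_of_notMem hx]; exact zero_le
  · have h1 : ENNReal.ofReal (∑ j ∈ Finset.range N, (W j).toReal *
        (t₀ * l ^ j) ^ (1 / (n : ℝ) - 1 / p)) ≤
        ENNReal.ofReal ((1 - l ^ β)⁻¹ * c₂) * lorentzN1 n B h := by
      refine le_trans (le_of_eq ?_) ((ENNReal.sum_le_tsum (Finset.range N)).trans hWsum)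
      rw [ENNReal.ofReal_sum_of_nonneg fun j _ => mul_nonneg ENNReal.toReal_nonneg
        (Real.rpow_nonneg (hT0 j).le _)]
      refine Finset.sum_congr rfl fun j _ => ?_
      rw [ENNReal.ofReal_mul ENNReal.toReal_nonneg, ENNReal.ofReal_toReal (hWfin j), hβ, neg_sub]
    have h2 := ENNReal.toReal_mono hfin h1
    rwa [ENNReal.toReal_mul, ENNReal.toReal_ofReal (Finset.sum_nonneg fun j _ =>
      mul_nonneg ENNReal.toReal_nonneg (Real.rpow_nonneg (hT0 j).le _)),
      ENNReal.toReal_ofReal (mul_nonneg (inv_nonneg.2 (by linarith)) hc₂0.le)] at h2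

theorem lorentzN1_mono {p : ℝ} (hp : 0 < p) {B Ω : Set (Eu n)} {h : Eu n → ℝ} (hB : B ⊆ Ω)
    (hΩ : volume Ω ≠ ⊤) (hf : AEMeasurable (Ω.indicator h))
    (hfp : ∫⁻ x, ‖Ω.indicator h x‖ₑ ^ p < ⊤) : lorentzN1 n B h ≤ lorentzN1 n Ω h := by
  refine (lintegral_mono_set (Ioo_subset_Ioo_right (ENNReal.toReal_mono hΩ (measure_mono hB)))).trans
    (setLIntegral_mono' measurableSet_Ioo fun t ht => ENNReal.ofReal_le_ofReal ?_)
  have ht0 : 0 < t := ht.1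
  have : rearr n (B.indicator h) t ≤ rearr n (Ω.indicator h) t := by
    refine csInf_le_csInf (bddBelow_rearr _ t) (nonempty_rearr hp hf hfp ht0) fun σ hσ =>
      ⟨hσ.1, (measure_mono fun x (hx : σ < |B.indicator h x|) => ?_).trans hσ.2⟩
    change σ < |Ω.indicator h x|
    by_cases hxB : x ∈ B
    · rwa [indicator_of_mem hxB, ← indicator_of_mem (hB hxB) h] at hx
    · rw [indicator_of_notMem hxB, abs_zero] at hx
      exact absurd hx (not_lt.2 hσ.1.le)
  gcongr

end Rearrangement

theorem exists_level_step {n : ℕ} (hn : 0 < n) {p : ℝ} (hp : 1 ≤ p) (hpn : p < n) :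
    ∃ C : ℝ, 0 < C ∧ ∀ (U : Eu n → ℝ) (dU : Eu n → Eu n), Sob (ENNReal.ofReal p) U dU →
      Measurable U → ∀ (y : Eu n) (ρ σ : ℝ), ρ < σ → ∀ k l, 0 ≤ k → k ≤ l →
      ∀ X, 0 ≤ X → ∀ Z, 0 ≤ Z →
      eLpNorm dU (ENNReal.ofReal p) (volume.restrict ({x | k < U x} ∩ cube y σ)) ≤
        ENNReal.ofReal X →
      eLpNorm (fun x => U x - k) (ENNReal.ofReal p)
        (volume.restrict ({x | k < U x} ∩ cube y σ)) ≤ ENNReal.ofReal Z →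
      ENNReal.ofReal (l - k) * volume ({x | l < U x} ∩ cube y ρ) ^ (1 / p - 1 / (n : ℝ)) ≤
        ENNReal.ofReal (C * (X + Z / (σ - ρ))) ∧
      ∀ b, 0 ≤ b → volume ({x | l < U x} ∩ cube y ρ) ≤ ENNReal.ofReal b →
        eLpNorm (fun x => U x - l) (ENNReal.ofReal p)
          (volume.restrict ({x | l < U x} ∩ cube y ρ)) ≤
          ENNReal.ofReal (b ^ (1 / (n : ℝ)) * (C * (X + Z / (σ - ρ)))) := by
  have hp0 : 0 < p := by linarith
  have hn0 : (0 : ℝ) < n := by exact_mod_cast hn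
  have hp1 : 1 ≤ ENNReal.ofReal p := by simpa using hp
  have hw : 0 < 1 / p - 1 / (n : ℝ) := sub_pos.2 (one_div_lt_one_div_of_lt hp0 hpn)
  have hr0 : 0 < 1 / (1 / p - 1 / (n : ℝ)) := by positivity
  have hrw : 1 / (1 / (1 / p - 1 / (n : ℝ))) = 1 / p - 1 / (n : ℝ) := one_div_one_div _
  obtain ⟨C₀, hC₀⟩ := exists_sobolev_const hn hp hr0 hrw
  set w := 1 / p - 1 / (n : ℝ) with hwd
  refine ⟨(C₀ + 1) * (1 + 4 * n), by positivity, ?_⟩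
  intro U dU hU mU y ρ σ hρσ k l hk hkl X hX Z hZ hdU hUk
  have hd : 0 < σ - ρ := sub_pos.2 hρσ
  obtain ⟨ψ, dψ, h1, h2, h3, h4, h5⟩ := exists_cube_cutoff_lipschitz y hρσ
  set A := {x | k < U x} ∩ cube y σ with hA
  have mA : MeasurableSet A := (measurableSet_lt measurable_const mU).inter (measurableSet_cube y σ)
  have mG : MeasurableSet ({x | l < U x} ∩ cube y ρ) :=
    (measurableSet_lt measurable_const mU).inter (measurableSet_cube y ρ)
  have hS := (hU.trunc hp1 ENNReal.ofReal_ne_top hk).mult hp1 ENNReal.ofReal_ne_top h1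
  have hb := hC₀ _ _ hS
  set v : Eu n → ℝ := fun x => ψ x * max (U x - k) 0 with hv
  set D := C₀ + 1 with hD
  have mUk : AEStronglyMeasurable (fun x => U x - k) (volume : Measure (Eu n)) :=
    (mU.sub_const k).aestronglyMeasurable
  have key : eLpNorm v (ENNReal.ofReal (1 / w)) volume ≤
      ENNReal.ofReal ((C₀ + 1) * (1 + 4 * n) * (X + Z / (σ - ρ))) := by
    refine hb.trans ?_
    have e1 : eLpNorm (fun x => ψ x • ({x | k < U x}.indicator dU x) +
        (max (U x - k) 0) • dψ x) (ENNReal.ofReal p) volume ≤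
        eLpNorm (fun x => A.indicator (fun x => ‖dU x‖) x +
          A.indicator (fun x => (4 * n / (σ - ρ)) * (U x - k)) x) (ENNReal.ofReal p) volume := by
      refine eLpNorm_mono_real fun x => ?_
      by_cases hx : x ∈ A
      · have hxk : k < U x := hx.1
        rw [indicator_of_mem hx, indicator_of_mem hx,
          indicator_of_mem (show x ∈ {x | k < U x} from hx.1), max_eq_left (by linarith)]
        refine (norm_add_le _ _).trans (add_le_add ?_ ?_)
        · rw [norm_smul, Real.norm_eq_abs, abs_of_nonneg (h2 x).1]
          exact mul_le_of_le_one_left (norm_nonneg _) (h2 x).2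
        · rw [norm_smul, Real.norm_eq_abs, abs_of_nonneg (by linarith), mul_comm]
          exact mul_le_mul_of_nonneg_right (h5 x) (by linarith)
      · rw [indicator_of_notMem hx, indicator_of_notMem hx]
        have : ψ x • ({x | k < U x}.indicator dU x) + (max (U x - k) 0) • dψ x = 0 := by
          by_cases hxk : k < U x
          · have hx2 : x ∉ cube y σ := fun h => hx ⟨hxk, h⟩
            rw [(h4 x hx2).1, (h4 x hx2).2]; simp
          · rw [indicator_of_notMem (show x ∉ {x | k < U x} from hxk),
              max_eq_right (by linarith)]; simp
        rw [this]; simp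
    have e2 := eLpNorm_add_le (p := ENNReal.ofReal p)
      (hU.memLp_grad.aestronglyMeasurable.norm.indicator mA)
      ((mUk.const_mul (4 * n / (σ - ρ))).indicator mA) hp1
    have e3 : eLpNorm (A.indicator (fun x => ‖dU x‖)) (ENNReal.ofReal p) volume ≤
        ENNReal.ofReal X := by
      rw [eLpNorm_indicator_eq_eLpNorm_restrict mA, eLpNorm_norm]; exact hdU
    have e4 : eLpNorm (A.indicator (fun x => (4 * n / (σ - ρ)) * (U x - k)))
        (ENNReal.ofReal p) volume ≤ ENNReal.ofReal (4 * n / (σ - ρ)) * ENNReal.ofReal Z := by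
      rw [eLpNorm_indicator_eq_eLpNorm_restrict mA]
      have : (fun x => (4 * n / (σ - ρ)) * (U x - k)) =
        (4 * n / (σ - ρ) : ℝ) • (fun x => U x - k) := by ext x; simp
      rw [this, eLpNorm_const_smul]
      refine mul_le_mul' (le_of_eq ?_) hUk
      rw [Real.enorm_eq_ofReal (by positivity)]
    have e5 : eLpNorm (fun x => ψ x • ({x | k < U x}.indicator dU x) +
        (max (U x - k) 0) • dψ x) (ENNReal.ofReal p) volume ≤
        ENNReal.ofReal (X + 4 * n / (σ - ρ) * Z) := by
      rw [ENNReal.ofReal_add hX (by positivity), ENNReal.ofReal_mul (by positivity)]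
      exact e1.trans (e2.trans (add_le_add e3 e4))
    refine (mul_le_mul_right e5 _).trans ?_
    rw [← ENNReal.ofReal_coe_nnreal, ← ENNReal.ofReal_mul (NNReal.coe_nonneg _)]
    refine ENNReal.ofReal_le_ofReal ?_
    rw [mul_assoc]
    have f1 : X + 4 * n / (σ - ρ) * Z ≤ (1 + 4 * n) * (X + Z / (σ - ρ)) := by
      have : 4 * n / (σ - ρ) * Z = 4 * n * (Z / (σ - ρ)) := by ring
      rw [this]
      have g1 : 0 ≤ Z / (σ - ρ) := by positivity
      have g2 : 0 ≤ n * X := by positivity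
      nlinarith
    refine mul_le_mul (by linarith) f1 (by positivity) (by positivity)
  have hmul : ∀ x ∈ {x | l < U x} ∩ cube y ρ, v x = U x - k := fun x hx => by
    have : l < U x := hx.1
    simp only [hv]
    rw [(h3 x hx.2).1, one_mul, max_eq_left (by linarith)]
  refine ⟨?_, ?_⟩
  · refine le_trans ?_ key
    calc ENNReal.ofReal (l - k) * volume ({x | l < U x} ∩ cube y ρ) ^ w
        = eLpNorm (({x | l < U x} ∩ cube y ρ).indicator fun _ => (l - k : ℝ))
            (ENNReal.ofReal (1 / w)) volume := by
          rw [eLpNorm_indicator_const mG (by simpa using hw) (by simp),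
            ENNReal.toReal_ofReal hr0.le, one_div_one_div, Real.enorm_eq_ofReal (by linarith)]
      _ ≤ _ := by
          refine eLpNorm_mono fun x => ?_
          by_cases hx : x ∈ {x | l < U x} ∩ cube y ρ
          · have : l < U x := hx.1
            rw [indicator_of_mem hx, hmul x hx, Real.norm_eq_abs, Real.norm_eq_abs,
              abs_of_nonneg (by linarith), abs_of_nonneg (by linarith)]
            linarith
          · rw [indicator_of_notMem hx]; simp
  · intro b hb0 hbv
    have hw' : 1 / p - w = 1 / (n : ℝ) := by rw [hwd]; ring
    have hpr : p ≤ 1 / w := by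
      rw [le_div_iff₀ hw, hwd]
      have : p * (1 / p - 1 / (n : ℝ)) = 1 - p / n := by field_simp
      rw [this]; have : 0 < p / n := by positivity
      linarith
    have mv : AEStronglyMeasurable v volume := hS.memLp.aestronglyMeasurable
    have e1 := eLpNorm_le_of_support_subset (μ := volume) hp0 hpr (mv.indicator mG) mG
      (fun x hx => indicator_of_notMem hx _)
    rw [one_div_one_div, hw'] at e1
    rw [← eLpNorm_indicator_eq_eLpNorm_restrict mG, mul_comm (b ^ _),
      ENNReal.ofReal_mul (by positivity), ← ENNReal.ofReal_rpow_of_nonneg hb0 (by positivity)]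
    refine le_trans ?_ (e1.trans (mul_le_mul' ((eLpNorm_indicator_le _).trans key)
      (ENNReal.rpow_le_rpow hbv (by positivity))))
    refine eLpNorm_mono fun x => ?_
    by_cases hx : x ∈ {x | l < U x} ∩ cube y ρ
    · have : l < U x := hx.1
      rw [indicator_of_mem hx, indicator_of_mem hx, hmul x hx, Real.norm_eq_abs, Real.norm_eq_abs,
        abs_of_nonneg (by linarith), abs_of_nonneg (by linarith)]
      linarith
    · rw [indicator_of_notMem hx]; simp

theorem eLpNorm_sub_level_mono {n : ℕ} {P : ℝ≥0∞} {U : Eu n → ℝ} (mU : Measurable U)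
    {y : Eu n} {ρ σ k l : ℝ} (hρσ : ρ ≤ σ) (hkl : k ≤ l) :
    eLpNorm (fun x => U x - l) P (volume.restrict ({x | l < U x} ∩ cube y ρ)) ≤
      eLpNorm (fun x => U x - k) P (volume.restrict ({x | k < U x} ∩ cube y σ)) := by
  have mA : MeasurableSet ({x | k < U x} ∩ cube y σ) :=
    (measurableSet_lt measurable_const mU).inter (measurableSet_cube y σ)
  have mG : MeasurableSet ({x | l < U x} ∩ cube y ρ) :=
    (measurableSet_lt measurable_const mU).inter (measurableSet_cube y ρ)
  rw [← eLpNorm_indicator_eq_eLpNorm_restrict mA, ← eLpNorm_indicator_eq_eLpNorm_restrict mG]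
  refine eLpNorm_mono fun x => ?_
  by_cases hx : x ∈ {x | l < U x} ∩ cube y ρ
  · have h1 : l < U x := hx.1
    have h2 : x ∈ {x | k < U x} ∩ cube y σ := ⟨hkl.trans_lt h1, cube_mono hρσ hx.2⟩
    rw [indicator_of_mem hx, indicator_of_mem h2, Real.norm_eq_abs, Real.norm_eq_abs,
      abs_of_nonneg (by linarith), abs_of_nonneg (by linarith)]
    linarith
  · rw [indicator_of_notMem hx]; simp

theorem superlevel_inter_cube_mono {n : ℕ} {U : Eu n → ℝ} {y : Eu n} {ρ σ k l : ℝ}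
    (hρσ : ρ ≤ σ) (hkl : k ≤ l) :
    {x | l < U x} ∩ cube y ρ ⊆ {x | k < U x} ∩ cube y σ :=
  inter_subset_inter (fun _ hx => lt_of_le_of_lt hkl hx) (cube_mono hρσ)

theorem exists_grad_step {n m : ℕ} (hn : n = m + 1) (hm : 1 ≤ m) {p q s L Q : ℝ} (hs : 1 ≤ s)
    (hsp : s < p) (hpq : p < q) (hsq : 1 / s = min (1 / q + 1 / m) 1) (hL : 1 ≤ L) (hQ : 1 ≤ Q) :
    ∃ C : ℝ, 0 < C ∧ ∀ (Ω : Set (Eu n)) (μ : ℝ) (h : Eu n → ℝ) (F : Eu n → Eu n → ℝ)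
      (du : Eu n → Eu n), StrongQMin Ω p q L μ Q h F du → ∀ S, IsCompact S → S ⊆ Ω →
      ∀ (U : Eu n → ℝ) (dU : Eu n → Eu n), Sob (ENNReal.ofReal p) U dU → Measurable U →
      ∀ (y : Eu n) (r : ℝ), 0 < r → cube y r ⊆ S → (∀ x ∈ cube y r, dU x = du x) →
      ∀ N, 0 < N → (∫⁻ x in cube y r, (‖dU x‖ₑ ^ p + ENNReal.ofReal r⁻¹ ^ p * ‖U x‖ₑ ^ p)) ≤
        ENNReal.ofReal (N ^ p) →
      ∀ k, 0 ≤ k → ∀ ρ σ, r / 2 ≤ ρ → ρ < σ → σ ≤ r →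
      ∀ a, 0 < a → volume ({x | k < U x} ∩ cube y σ) ≤ ENNReal.ofReal a →
      ∀ X, 0 ≤ X → ∀ Y, 0 ≤ Y →
      eLpNorm dU (ENNReal.ofReal p) (volume.restrict ({x | k < U x} ∩ cube y σ)) ≤
        ENNReal.ofReal X →
      eLpNorm (fun x => U x - k) (ENNReal.ofReal p)
        (volume.restrict ({x | k < U x} ∩ cube y σ)) ≤ ENNReal.ofReal (r * Y) →
      ∀ J, 0 < J → X + Y ≤ J →
      ∀ H, 0 ≤ H → (∫⁻ x in {x | k < U x} ∩ cube y σ, ENNReal.ofReal (h x) ^ p) ≤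
        ENNReal.ofReal (H ^ p) →
      eLpNorm dU (ENNReal.ofReal p) (volume.restrict ({x | k < U x} ∩ cube y ρ)) ≤
        ENNReal.ofReal (C * (((r / (σ - ρ)) ^ (2 * q + q / s - 1) *
          r ^ (-((m + 1) * q * (1 / s - 1 / q))) * a ^ (q * (1 / s - 1 / p)) *
            N ^ (q - p)) ^ (1 / p) * J + H)) := by
  obtain ⟨C, hC, hcac⟩ := exists_caccioppoli hn hm hs hsp hpq hsq hL hQ
  have hp0 : 0 < p := by linarith
  have hp1 : 1 ≤ p := by linarith
  refine ⟨C ^ (1 / p), by positivity, ?_⟩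
  intro Ω μ h F du hS S hSc hSΩ U dU hU mU y r hr hcube hdu N hN hNb k hk ρ σ hρ hρσ hσ a ha hva
    X hX Y hY hXb hYb J hJ hXY H hH hHb
  set A := {x | k < U x} ∩ cube y σ with hA
  have mA : MeasurableSet A := (measurableSet_lt measurable_const mU).inter (measurableSet_cube y σ)
  have hAc : A ⊆ cube y r := fun x hx => cube_mono hσ hx.2
  have hd : 0 < σ - ρ := sub_pos.2 hρσ
  set M := min J N with hM
  have hM0 : 0 < M := lt_min hJ hN
  have hMb : (∫⁻ x in A, (‖dU x‖ₑ ^ p + ENNReal.ofReal r⁻¹ ^ p * ‖U x - k‖ₑ ^ p)) ≤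
      ENNReal.ofReal (M ^ p) := by
    rcases min_choice J N with h' | h'
    · rw [hM, h', lintegral_add_left' (hU.memLp_grad.aestronglyMeasurable.enorm.pow_const p).restrict,
        lintegral_const_mul' _ _ (by simp [hp0.le]), lintegral_enorm_rpow_eq hp0,
        lintegral_enorm_rpow_eq hp0]
      have e1 : ENNReal.ofReal r⁻¹ ^ p * eLpNorm (fun x => U x - k) (ENNReal.ofReal p)
          (volume.restrict A) ^ p ≤ ENNReal.ofReal (Y ^ p) := by
        rw [← ENNReal.mul_rpow_of_nonneg _ _ hp0.le, ← ENNReal.ofReal_rpow_of_nonneg hY hp0.le]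
        refine ENNReal.rpow_le_rpow ?_ hp0.le
        refine (mul_le_mul_right hYb _).trans (le_of_eq ?_)
        rw [← ENNReal.ofReal_mul (by positivity)]
        congr 1; field_simp
      have e2 : eLpNorm dU (ENNReal.ofReal p) (volume.restrict A) ^ p ≤ ENNReal.ofReal (X ^ p) := by
        rw [← ENNReal.ofReal_rpow_of_nonneg hX hp0.le]
        exact ENNReal.rpow_le_rpow hXb hp0.le
      refine (add_le_add e2 e1).trans ?_
      rw [← ENNReal.ofReal_add (by positivity) (by positivity)]
      refine ENNReal.ofReal_le_ofReal ?_
      exact (Real.add_rpow_le_rpow_add hX hY hp1).trans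
        (Real.rpow_le_rpow (by positivity) hXY hp0.le)
    · rw [hM, h']
      refine le_trans ?_ hNb
      refine le_trans (setLIntegral_mono' mA fun x hx => ?_) (lintegral_mono_set hAc)
      have hkx : k < U x := hx.1
      refine add_le_add le_rfl (mul_le_mul_right (ENNReal.rpow_le_rpow ?_ hp0.le) _)
      rw [Real.enorm_eq_ofReal (by linarith), Real.enorm_eq_ofReal (by linarith)]
      exact ENNReal.ofReal_le_ofReal (by linarith)
  have hfin := hcac Ω μ h F du hS S hSc hSΩ U dU hU mU y r hr hcube hdu k hk ρ σ hρ hρσ hσ a ha hva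
    (M ^ p) (by positivity) hMb (H ^ p) (by positivity) hHb
  rw [lintegral_enorm_rpow_eq hp0] at hfin
  set T := (r / (σ - ρ)) ^ (2 * q + q / s - 1) *
          r ^ (-((m + 1) * q * (1 / s - 1 / q))) * a ^ (q * (1 / s - 1 / p)) with hT
  have hT0 : 0 ≤ T := by positivity
  have hNq : 0 < N ^ (q - p) := by positivity
  rw [← ENNReal.rpow_le_rpow_iff hp0]
  refine hfin.trans ?_
  rw [ENNReal.ofReal_rpow_of_nonneg (by positivity) hp0.le]
  refine ENNReal.ofReal_le_ofReal ?_
  rw [Real.mul_rpow (by positivity) (by positivity), ← Real.rpow_mul hC.le,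
    one_div_mul_cancel hp0.ne', Real.rpow_one]
  refine mul_le_mul_of_nonneg_left ?_ hC.le
  refine le_trans ?_ (Real.add_rpow_le_rpow_add (by positivity) hH hp1)
  refine add_le_add ?_ le_rfl
  rw [Real.mul_rpow (by positivity) hJ.le,
    ← Real.rpow_mul (show 0 ≤ T * N ^ (q - p) by positivity) (1 / p) p,
    one_div_mul_cancel hp0.ne', Real.rpow_one, mul_assoc T]
  refine mul_le_mul_of_nonneg_left ?_ hT0
  rw [← Real.rpow_mul hM0.le, mul_div_cancel₀ _ hp0.ne']
  have e : M ^ q = M ^ (q - p) * M ^ p := by rw [← Real.rpow_add hM0]; ring_nf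
  rw [e]
  exact mul_le_mul (Real.rpow_le_rpow hM0.le (min_le_right _ _) (by linarith))
    (Real.rpow_le_rpow hM0.le (min_le_left _ _) hp0.le) (by positivity) (by positivity)

theorem sum_add_two_mul_eq {y h : ℕ → ℝ} (hy : ∀ j, y (j + 1) = y j / 2 + h j) (N : ℕ) :
    ∑ j ∈ Finset.range N, y j + 2 * y N = 2 * y 0 + 2 * ∑ j ∈ Finset.range N, h j := by
  induction N with
  | zero => simp
  | succ N ih => rw [Finset.sum_range_succ, Finset.sum_range_succ, hy N]; linarith

theorem pow_rpow_mul_geom_le {t₀ l κ θ : ℝ} (ht : 0 < t₀) (hl : 0 < l)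
    (h : (2 : ℝ) ^ κ * l ^ θ ≤ 1) (j : ℕ) :
    ((2 : ℝ) ^ (j + 3)) ^ κ * (t₀ * l ^ j) ^ θ ≤ 8 ^ κ * t₀ ^ θ := by
  have e1 : ((2 : ℝ) ^ (j + 3)) ^ κ = 8 ^ κ * ((2 : ℝ) ^ κ) ^ j := by
    rw [Real.rpow_pow_comm (by norm_num), ← Real.mul_rpow (by norm_num) (by positivity)]
    congr 1; rw [pow_add]; norm_num; ring
  have e2 : (t₀ * l ^ j) ^ θ = t₀ ^ θ * (l ^ θ) ^ j := by
    rw [Real.mul_rpow ht.le (by positivity), Real.rpow_pow_comm hl.le]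
  rw [e1, e2]
  have e3 : ((2 : ℝ) ^ κ * l ^ θ) ^ j ≤ 1 := pow_le_one₀ (by positivity) h
  rw [mul_pow] at e3
  calc 8 ^ κ * ((2 : ℝ) ^ κ) ^ j * (t₀ ^ θ * (l ^ θ) ^ j)
      = (8 ^ κ * t₀ ^ θ) * (((2 : ℝ) ^ κ) ^ j * (l ^ θ) ^ j) := by ring
    _ ≤ _ := mul_le_of_le_one_right (by positivity) e3

theorem measure_le_of_ofReal_mul_rpow_le {α : Type*} [MeasurableSpace α] {ν : Measure α}
    {A : Set α} {w d b t : ℝ} (hw : 0 < w) (hd : 0 < d) (ht : 0 < t)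
    (h : ENNReal.ofReal d * ν A ^ w ≤ ENNReal.ofReal b) (hb : b ≤ d * t ^ w) :
    ν A ≤ ENNReal.ofReal t := by
  rw [← ENNReal.rpow_le_rpow_iff hw, ENNReal.ofReal_rpow_of_pos ht]
  have h2 := h.trans (ENNReal.ofReal_le_ofReal hb)
  rw [ENNReal.ofReal_mul hd.le] at h2
  exact (ENNReal.mul_le_mul_iff_right (by simpa using hd) ENNReal.ofReal_ne_top).1 h2

theorem exists_iteration_bound {n m : ℕ} (hn : n = m + 1) (hm : 1 ≤ m) {p q s L Q : ℝ}
    (hs : 1 ≤ s) (hsp : s < p) (hpq : p < q) (hpn : p < n)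
    (hsq : 1 / s = min (1 / q + 1 / m) 1) (hL : 1 ≤ L) (hQ : 1 ≤ Q) :
    ∃ C c β : ℝ, 0 < C ∧ 0 < c ∧ 0 < β ∧ ∀ (Ω : Set (Eu n)) (μ : ℝ) (h : Eu n → ℝ)
      (F : Eu n → Eu n → ℝ)
      (du : Eu n → Eu n), StrongQMin Ω p q L μ Q h F du → ∀ S, IsCompact S → S ⊆ Ω →
      ∀ (U : Eu n → ℝ) (dU : Eu n → Eu n), Sob (ENNReal.ofReal p) U dU → Measurable U →
      ∀ (y : Eu n) (r : ℝ), 0 < r → cube y r ⊆ S → (∀ x ∈ cube y r, dU x = du x) →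
      AEMeasurable ((cube y r).indicator h) → ∫⁻ x, ‖(cube y r).indicator h x‖ₑ ^ p < ⊤ →
      lorentzN1 n (cube y r) h < ⊤ →
      ∀ N, 0 < N → (∫⁻ x in cube y r, (‖dU x‖ₑ ^ p + ENNReal.ofReal r⁻¹ ^ p * ‖U x‖ₑ ^ p)) ≤
        ENNReal.ofReal (N ^ p) →
      ∀ t₀, 0 < t₀ → t₀ ≤ c * r ^ n →
      t₀ ^ (q * (1 / s - 1 / p)) ≤ β * (r ^ ((m + 1) * q * (1 / s - 1 / q)) * N ^ (p - q)) →
      ∀ᵐ x ∂volume.restrict (cube y (r / 2)), U x ≤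
        C * (N * t₀ ^ (-(1 / p - 1 / (n : ℝ))) + (lorentzN1 n (cube y r) h).toReal) := by
  have hp0 : 0 < p := by linarith
  have hp1 : 1 ≤ p := by linarith
  have hs0 : 0 < s := by linarith
  have hq0 : 0 < q := by linarith
  have hn1 : 1 ≤ n := by omega
  have hn0 : (0 : ℝ) < n := by exact_mod_cast hn1
  have hw : 0 < 1 / p - 1 / (n : ℝ) := sub_pos.2 (one_div_lt_one_div_of_lt hp0 hpn)
  have hε : 0 < 1 / s - 1 / p := sub_pos.2 (one_div_lt_one_div_of_lt hs0 hsp)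
  have hθ : 0 < q * (1 / s - 1 / p) := by positivity
  have hκ : 0 < 2 * q + q / s - 1 := by
    have : 0 < q / s := by positivity
    linarith
  obtain ⟨CS, hCS, hlev⟩ := exists_level_step hn1 hp1 hpn
  obtain ⟨CG, hCG, hgrad⟩ := exists_grad_step hn hm hs hsp hpq hsq hL hQ
  set w := 1 / p - 1 / (n : ℝ) with hwd
  set θ := q * (1 / s - 1 / p) with hθd
  set κ := 2 * q + q / s - 1 with hκd
  set E := ((m : ℝ) + 1) * q * (1 / s - 1 / q) with hEd
  set l : ℝ := 2 ^ (-(n + κ / θ)) with hld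
  have hl0 : 0 < l := by positivity
  have hl1 : l < 1 := Real.rpow_lt_one_of_one_lt_of_neg (by norm_num)
    (by have : 0 < κ / θ := by positivity
        linarith)
  have hlθ : (2 : ℝ) ^ κ * l ^ θ ≤ 1 := by
    rw [hld, ← Real.rpow_mul (by norm_num), ← Real.rpow_add (by norm_num)]
    refine Real.rpow_le_one_of_one_le_of_nonpos (by norm_num) ?_
    have : -(n + κ / θ) * θ = -(n * θ) - κ := by field_simp; ring
    rw [this]
    have : 0 < n * θ := by positivity
    linarith
  have hln : l ^ (1 / (n : ℝ)) ≤ 1 / 2 := by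
    rw [hld, ← Real.rpow_mul (by norm_num)]
    have : (1 / 2 : ℝ) = 2 ^ (-1 : ℝ) := by rw [Real.rpow_neg_one]; norm_num
    rw [this]
    refine Real.rpow_le_rpow_of_exponent_le (by norm_num) ?_
    have : -(n + κ / θ) * (1 / (n : ℝ)) = -1 - κ / θ / n := by field_simp; ring
    rw [this]
    have : 0 < κ / θ / n := by positivity
    linarith
  obtain ⟨CL, hCL, hlor⟩ := exists_lorentz_sequence hn1 hp1 hpn hl0 hl1
  set τ := l ^ w / 2 with hτ
  have hτ0 : 0 < τ := by positivity
  refine ⟨5 * CS + 8 * CS * l ^ (-w) * (4 + 2 * (CG * l ^ (-w) * CL)), min 1 ((τ / (16 * CS)) ^ n),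
    (τ / (2 * CG)) ^ p / 8 ^ κ, by positivity, by positivity, by positivity, ?_⟩
  intro Ω μ h F du hS S hSc hSΩ U dU hU mU y r hr hcube hdu mh hhp hLor N hN hNb t₀ ht₀ htc htβ
  have hNq : 0 < N ^ (q - p) := by positivity
  have htr : t₀ ≤ r ^ n := htc.trans (mul_le_of_le_one_left (by positivity) (min_le_left _ _))
  have htB : t₀ ≤ (volume (cube y r)).toReal := by
    rw [volume_cube, ENNReal.toReal_pow, ENNReal.toReal_ofReal (by positivity)]
    exact htr.trans (pow_le_pow_left₀ hr.le (by linarith) _)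
  have htn : t₀ ^ (1 / (n : ℝ)) ≤ τ / (16 * CS) * r := by
    have : t₀ ≤ (τ / (16 * CS) * r) ^ n := by
      rw [mul_pow]
      exact htc.trans (mul_le_mul_of_nonneg_right (min_le_right _ _) (by positivity))
    refine (Real.rpow_le_rpow ht₀.le this (by positivity)).trans (le_of_eq ?_)
    rw [one_div, Real.pow_rpow_inv_natCast (by positivity) (by omega)]
  obtain ⟨H, hH0, hHA, hHs⟩ := hlor (cube y r) h mh (measurableSet_cube y r) hhp hLor t₀ ht₀ htB
  set t : ℕ → ℝ := fun j => t₀ * l ^ j with htd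
  have ht0 : ∀ j, 0 < t j := fun j => by positivity
  set ρ : ℕ → ℝ := fun j => r / 2 + r / 2 ^ (j + 2) with hρd
  have hρsub : ∀ j, ρ j - ρ (j + 1) = r / 2 ^ (j + 3) := fun j => by
    simp only [hρd, pow_add]; field_simp; ring
  have hρlt : ∀ j, ρ (j + 1) < ρ j := fun j => by
    have : 0 < ρ j - ρ (j + 1) := by rw [hρsub]; positivity
    linarith
  have hρge : ∀ j, r / 2 ≤ ρ j := fun j => by
    have : 0 < r / 2 ^ (j + 2) := by positivity
    simp only [hρd]; linarith
  have hρle : ∀ j, ρ j ≤ r := fun j => by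
    have : r / 2 ^ (j + 2) ≤ r / 2 := by
      refine div_le_div_of_nonneg_left hr.le (by norm_num) ?_
      calc (2 : ℝ) = 2 ^ 1 := by norm_num
        _ ≤ 2 ^ (j + 2) := pow_le_pow_right₀ (by norm_num) (by omega)
    simp only [hρd]; linarith
  set J : ℕ → ℝ := fun j => Nat.rec (2 * N) (fun i a => τ * a + CG * H i) j with hJd
  have hJs : ∀ j, J (j + 1) = τ * J j + CG * H j := fun j => rfl
  have hJz : J 0 = 2 * N := rfl
  have hJ0 : ∀ j, 0 < J j := fun j => by
    induction j with
    | zero => rw [hJz]; positivity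
    | succ j ih => rw [hJs]; have := hH0 j; positivity
  set δ : ℕ → ℝ := fun j => 8 * CS * J j * t (j + 1) ^ (-w) with hδd
  have hδ0 : ∀ j, 0 < δ j := fun j => by
    have := hJ0 j; have := ht0 (j + 1); positivity
  set k : ℕ → ℝ := fun j => 5 * CS * N * t₀ ^ (-w) + ∑ i ∈ Finset.range j, δ i with hkd
  have hks : ∀ j, k (j + 1) = k j + δ j := fun j => by
    simp only [hkd]; rw [Finset.sum_range_succ]; ring
  have hk0 : ∀ j, 0 < k j := fun j => by
    have : 0 ≤ ∑ i ∈ Finset.range j, δ i := Finset.sum_nonneg fun i _ => (hδ0 i).le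
    have : 0 < 5 * CS * N * t₀ ^ (-w) := by positivity
    simp only [hkd]; linarith
  have inv : ∀ j, volume ({x | k j < U x} ∩ cube y (ρ j)) ≤ ENNReal.ofReal (t j) ∧
      ∃ X Y, 0 ≤ X ∧ 0 ≤ Y ∧ X + 2 ^ j * Y ≤ J j ∧
        eLpNorm dU (ENNReal.ofReal p) (volume.restrict ({x | k j < U x} ∩ cube y (ρ j))) ≤
          ENNReal.ofReal X ∧
        eLpNorm (fun x => U x - k j) (ENNReal.ofReal p)
          (volume.restrict ({x | k j < U x} ∩ cube y (ρ j))) ≤ ENNReal.ofReal (r * Y) := by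
    intro j
    induction j with
    | zero =>
      have b1 : eLpNorm dU (ENNReal.ofReal p) (volume.restrict (cube y r)) ≤ ENNReal.ofReal N := by
        rw [← ENNReal.rpow_le_rpow_iff hp0, ← lintegral_enorm_rpow_eq hp0,
          ENNReal.ofReal_rpow_of_nonneg hN.le hp0.le]
        exact (lintegral_mono fun x => le_self_add).trans hNb
      have b2 : eLpNorm U (ENNReal.ofReal p) (volume.restrict (cube y r)) ≤
          ENNReal.ofReal (r * N) := by
        have : ENNReal.ofReal r⁻¹ * eLpNorm U (ENNReal.ofReal p) (volume.restrict (cube y r)) ≤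
            ENNReal.ofReal N := by
          rw [← ENNReal.rpow_le_rpow_iff hp0, ENNReal.mul_rpow_of_nonneg _ _ hp0.le,
            ← lintegral_enorm_rpow_eq hp0, ← lintegral_const_mul' _ _ (by simp [hp0.le]),
            ENNReal.ofReal_rpow_of_nonneg hN.le hp0.le]
          exact (lintegral_mono fun x => le_add_self).trans hNb
        have h2 := mul_le_mul_right this (ENNReal.ofReal r)
        rw [← mul_assoc, ← ENNReal.ofReal_mul hr.le, mul_inv_cancel₀ hr.ne', ENNReal.ofReal_one,
          one_mul, ← ENNReal.ofReal_mul hr.le] at h2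
        exact h2
      have c2 : eLpNorm (fun x => U x - 0) (ENNReal.ofReal p)
          (volume.restrict ({x | 0 < U x} ∩ cube y r)) ≤ ENNReal.ofReal (r * N) := by
        simp only [sub_zero]
        exact (eLpNorm_mono_measure _ (Measure.restrict_mono inter_subset_right le_rfl)).trans b2
      have hsub : {x | k 0 < U x} ∩ cube y (ρ 0) ⊆ {x | 0 < U x} ∩ cube y r :=
        superlevel_inter_cube_mono (hρle 0) (hk0 0).le
      have hρ0 : ρ 0 < r := by simp only [hρd]; linarith
      have hρ0' : r - ρ 0 = r / 4 := by simp only [hρd]; ring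
      refine ⟨?_, N, N, hN.le, hN.le, by rw [hJz]; simp; linarith, ?_, ?_⟩
      · have h1 := (hlev U dU hU mU y (ρ 0) r hρ0 0 (k 0) le_rfl (hk0 0).le N hN.le (r * N)
          (by positivity) ((eLpNorm_mono_measure _
            (Measure.restrict_mono inter_subset_right le_rfl)).trans b1) c2).1
        rw [sub_zero] at h1
        refine measure_le_of_ofReal_mul_rpow_le hw (hk0 0) (ht0 0) h1 (le_of_eq ?_)
        rw [hρ0']
        simp only [hkd, htd, Finset.range_zero, Finset.sum_empty, add_zero, pow_zero, mul_one]
        rw [mul_assoc (5 * CS * N), ← Real.rpow_add ht₀, neg_add_cancel, Real.rpow_zero]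
        field_simp; ring
      · exact (eLpNorm_mono_measure _ (Measure.restrict_mono
          (fun x hx => (hsub hx).2) le_rfl)).trans b1
      · exact (eLpNorm_sub_level_mono mU (hρle 0) (hk0 0).le).trans c2
    | succ j ih =>
      obtain ⟨hv, X, Y, hX, hY, hXY, hXb, hYb⟩ := ih
      have hkl : k j ≤ k (j + 1) := by rw [hks]; linarith [hδ0 j]
      have hsub : {x | k (j + 1) < U x} ∩ cube y (ρ j) ⊆ {x | k j < U x} ∩ cube y (ρ j) :=
        superlevel_inter_cube_mono le_rfl hkl
      have hB : X + r * Y / (ρ j - ρ (j + 1)) ≤ 8 * J j := by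
        rw [hρsub]
        have : r * Y / (r / 2 ^ (j + 3)) = 8 * (2 ^ j * Y) := by
          rw [pow_add]; field_simp; ring
        rw [this]; linarith
      have hB0 : 0 ≤ X + r * Y / (ρ j - ρ (j + 1)) := by rw [hρsub]; positivity
      obtain ⟨g1, g2⟩ := hlev U dU hU mU y (ρ (j + 1)) (ρ j) (hρlt j) (k j) (k (j + 1)) (hk0 j).le
        hkl X hX (r * Y) (by positivity) hXb hYb
      have hvol : volume ({x | k (j + 1) < U x} ∩ cube y (ρ (j + 1))) ≤
          ENNReal.ofReal (t (j + 1)) := by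
        refine measure_le_of_ofReal_mul_rpow_le hw (by rw [hks]; linarith [hδ0 j]) (ht0 (j + 1))
          g1 ?_
        rw [hks, add_sub_cancel_left]
        simp only [hδd]
        rw [mul_assoc (8 * CS * J j), ← Real.rpow_add (ht0 (j + 1)), neg_add_cancel,
          Real.rpow_zero]
        have := mul_le_mul_of_nonneg_left hB hCS.le
        linarith
      have g2' := g2 (t (j + 1)) (ht0 _).le hvol
      have g3 := hgrad Ω μ h F du hS S hSc hSΩ U dU hU mU y r hr hcube hdu N hN hNb (k (j + 1))
        (hk0 _).le (ρ (j + 1)) (ρ j) (hρge _) (hρlt j) (hρle j) (t j) (ht0 j)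
        ((measure_mono hsub).trans hv) X hX Y hY
        ((eLpNorm_mono_measure _ (Measure.restrict_mono hsub le_rfl)).trans hXb)
        ((eLpNorm_sub_level_mono mU le_rfl hkl).trans hYb) (J j) (hJ0 j)
        ((add_le_add le_rfl (le_mul_of_one_le_left hY (one_le_pow₀ (by norm_num)))).trans hXY)
        (H j) (hH0 j) (hHA j _ (fun x hx => cube_mono (hρle j) hx.2)
          ((measure_mono hsub).trans hv))
      rw [hρsub] at g3
      have hdiv : r / (r / 2 ^ (j + 3)) = (2 : ℝ) ^ (j + 3) := by field_simp
      rw [hdiv] at g3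
      set Γ := ((2 : ℝ) ^ (j + 3)) ^ κ * r ^ (-E) * t j ^ θ * N ^ (q - p) with hΓ
      have hΓ0 : 0 ≤ Γ := by have := ht0 j; positivity
      have hΓ1 : Γ ^ (1 / p) ≤ τ / (2 * CG) := by
        have e1 := pow_rpow_mul_geom_le ht₀ hl0 hlθ j
        have e2 : Γ ≤ (τ / (2 * CG)) ^ p := by
          calc Γ = (((2 : ℝ) ^ (j + 3)) ^ κ * t j ^ θ) * (r ^ (-E) * N ^ (q - p)) := by
                rw [hΓ]; ring
            _ ≤ (8 ^ κ * t₀ ^ θ) * (r ^ (-E) * N ^ (q - p)) :=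
                mul_le_mul_of_nonneg_right e1 (by positivity)
            _ ≤ (8 ^ κ * ((τ / (2 * CG)) ^ p / 8 ^ κ * (r ^ E * N ^ (p - q)))) *
                  (r ^ (-E) * N ^ (q - p)) :=
                mul_le_mul_of_nonneg_right (mul_le_mul_of_nonneg_left htβ (by positivity))
                  (by positivity)
            _ = (τ / (2 * CG)) ^ p * ((r ^ E * r ^ (-E)) * (N ^ (p - q) * N ^ (q - p))) := by
                field_simp
            _ = (τ / (2 * CG)) ^ p := by
                rw [← Real.rpow_add hr, ← Real.rpow_add hN]
                simp
        refine (Real.rpow_le_rpow hΓ0 e2 (by positivity)).trans (le_of_eq ?_)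
        rw [← Real.rpow_mul (by positivity), mul_one_div_cancel hp0.ne', Real.rpow_one]
      refine ⟨hvol, CG * (Γ ^ (1 / p) * J j + H j),
        t (j + 1) ^ (1 / (n : ℝ)) * (CS * (X + r * Y / (ρ j - ρ (j + 1)))) / r, ?_, ?_, ?_, g3, ?_⟩
      · have := hJ0 j; have := hH0 j; positivity
      · have := ht0 (j + 1); positivity
      · rw [hJs]
        have f1 : CG * (Γ ^ (1 / p) * J j + H j) ≤ τ / 2 * J j + CG * H j := by
          have : CG * (Γ ^ (1 / p) * J j) ≤ CG * (τ / (2 * CG) * J j) :=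
            mul_le_mul_of_nonneg_left (mul_le_mul_of_nonneg_right hΓ1 (hJ0 j).le) hCG.le
          have e : CG * (τ / (2 * CG) * J j) = τ / 2 * J j := by field_simp
          rw [mul_add]; linarith
        have f2 : 2 ^ (j + 1) * (t (j + 1) ^ (1 / (n : ℝ)) *
            (CS * (X + r * Y / (ρ j - ρ (j + 1)))) / r) ≤ τ / 2 * J j := by
          have e1 : 2 ^ (j + 1) * t (j + 1) ^ (1 / (n : ℝ)) ≤ τ / (16 * CS) * r := by
            have e2 : t (j + 1) ^ (1 / (n : ℝ)) =
                t₀ ^ (1 / (n : ℝ)) * (l ^ (1 / (n : ℝ))) ^ (j + 1) := by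
              simp only [htd]
              rw [Real.mul_rpow ht₀.le (by positivity), Real.rpow_pow_comm hl0.le]
            have e3 : 2 ^ (j + 1) * (l ^ (1 / (n : ℝ))) ^ (j + 1) ≤ 1 := by
              rw [← mul_pow]
              exact pow_le_one₀ (by positivity) (by linarith)
            calc 2 ^ (j + 1) * t (j + 1) ^ (1 / (n : ℝ))
                = t₀ ^ (1 / (n : ℝ)) * (2 ^ (j + 1) * (l ^ (1 / (n : ℝ))) ^ (j + 1)) := by
                  rw [e2]; ring
              _ ≤ t₀ ^ (1 / (n : ℝ)) := mul_le_of_le_one_right (by positivity) e3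
              _ ≤ _ := htn
          calc 2 ^ (j + 1) * (t (j + 1) ^ (1 / (n : ℝ)) *
                (CS * (X + r * Y / (ρ j - ρ (j + 1)))) / r)
              = (2 ^ (j + 1) * t (j + 1) ^ (1 / (n : ℝ))) *
                  (CS * (X + r * Y / (ρ j - ρ (j + 1))) / r) := by ring
            _ ≤ (τ / (16 * CS) * r) * (CS * (8 * J j) / r) := by
                refine mul_le_mul e1 ?_ (by positivity) (by positivity)
                exact div_le_div_of_nonneg_right (mul_le_mul_of_nonneg_left hB hCS.le) hr.le
            _ = τ / 2 * J j := by field_simp; ring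
        linarith
      · rw [mul_div_cancel₀ _ hr.ne']; exact g2'
  set Lo := (lorentzN1 n (cube y r) h).toReal with hLo
  have hLo0 : 0 ≤ Lo := ENNReal.toReal_nonneg
  set K := (5 * CS + 8 * CS * l ^ (-w) * (4 + 2 * (CG * l ^ (-w) * CL))) *
    (N * t₀ ^ (-w) + Lo) with hK
  have hkK : ∀ j, k j ≤ K := by
    intro j
    set yy : ℕ → ℝ := fun i => J i * t i ^ (-w) with hyy
    have hyy0 : ∀ i, 0 ≤ yy i := fun i => by
      have := hJ0 i; have := ht0 i; positivity
    have htw : ∀ i, t (i + 1) ^ (-w) = l ^ (-w) * t i ^ (-w) := fun i => by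
      have : t (i + 1) = l * t i := by simp only [htd, pow_succ]; ring
      rw [this, Real.mul_rpow hl0.le (ht0 i).le]
    have hrec : ∀ i, yy (i + 1) = yy i / 2 + CG * l ^ (-w) * (H i * t i ^ (-w)) := fun i => by
      simp only [hyy]
      rw [htw, hJs, hτ]
      have : l ^ w * l ^ (-w) = 1 := by rw [← Real.rpow_add hl0]; simp
      linear_combination (J i * t i ^ (-w) / 2) * this
    have hsum := sum_add_two_mul_eq hrec j
    rw [← Finset.mul_sum] at hsum
    have hLs := hHs j
    have hwneg : 1 / (n : ℝ) - 1 / p = -w := by rw [hwd]; ring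
    rw [hwneg] at hLs
    have hδs : ∑ i ∈ Finset.range j, δ i = 8 * CS * l ^ (-w) * ∑ i ∈ Finset.range j, yy i := by
      rw [Finset.mul_sum]
      refine Finset.sum_congr rfl fun i _ => ?_
      simp only [hδd, hyy]; rw [htw]; ring
    have hy0 : yy 0 = 2 * (N * t₀ ^ (-w)) := by
      simp only [hyy, htd, hJz, pow_zero, mul_one]; ring
    have hl' : 0 < l ^ (-w) := by positivity
    have s1 : ∑ i ∈ Finset.range j, yy i ≤
        4 * (N * t₀ ^ (-w)) + 2 * (CG * l ^ (-w) * (CL * Lo)) := by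
      have := mul_le_mul_of_nonneg_left hLs (show 0 ≤ CG * l ^ (-w) by positivity)
      have := hyy0 j
      rw [hy0] at hsum
      simp only [htd] at hsum
      linarith
    have hNt : 0 < N * t₀ ^ (-w) := by positivity
    simp only [hkd]
    rw [hδs]
    have s2 := mul_le_mul_of_nonneg_left s1 (show 0 ≤ 8 * CS * l ^ (-w) by positivity)
    have s3 : 4 * (N * t₀ ^ (-w)) + 2 * (CG * l ^ (-w) * (CL * Lo)) ≤
        (4 + 2 * (CG * l ^ (-w) * CL)) * (N * t₀ ^ (-w) + Lo) := by
      have : 0 ≤ 2 * (CG * l ^ (-w) * CL) * (N * t₀ ^ (-w)) := by positivity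
      linarith
    have s4 := mul_le_mul_of_nonneg_left s3 (show 0 ≤ 8 * CS * l ^ (-w) by positivity)
    have s5 : 0 ≤ 5 * CS * Lo := by positivity
    rw [hK]
    linarith
  have hzero : volume ({x | K < U x} ∩ cube y (r / 2)) = 0 := by
    refine le_antisymm ?_ bot_le
    have hlim : Tendsto (fun j => ENNReal.ofReal (t j)) atTop (𝓝 0) := by
      have h1 : Tendsto t atTop (𝓝 0) := by
        have := (tendsto_pow_atTop_nhds_zero_of_lt_one hl0.le hl1).const_mul t₀
        rwa [mul_zero] at this
      have := (ENNReal.continuous_ofReal.tendsto 0).comp h1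
      rwa [ENNReal.ofReal_zero] at this
    refine ge_of_tendsto' hlim fun j => ?_
    exact (measure_mono (superlevel_inter_cube_mono (hρge j) (hkK j))).trans (inv j).1
  rw [ae_restrict_iff' (measurableSet_cube y _)]
  rw [ae_iff]
  refine measure_mono_null (fun x hx => ?_) hzero
  simp only [Classical.not_imp, not_le] at hx
  exact ⟨hx.2, hx.1⟩

theorem exists_cube_bound {n m : ℕ} (hn : n = m + 1) (hm : 1 ≤ m) {p q s L Q : ℝ}
    (hs : 1 ≤ s) (hsp : s < p) (hpq : p < q) (hpn : p < n)
    (hsq : 1 / s = min (1 / q + 1 / m) 1) (hL : 1 ≤ L) (hQ : 1 ≤ Q) :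
    ∃ C : ℝ, 0 < C ∧ ∀ (Ω : Set (Eu n)) (μ : ℝ) (h : Eu n → ℝ) (F : Eu n → Eu n → ℝ)
      (du : Eu n → Eu n), StrongQMin Ω p q L μ Q h F du → ∀ S, IsCompact S → S ⊆ Ω →
      ∀ (U : Eu n → ℝ) (dU : Eu n → Eu n), Sob (ENNReal.ofReal p) U dU → Measurable U →
      ∀ (y : Eu n) (r : ℝ), 0 < r → cube y r ⊆ S → (∀ x ∈ cube y r, dU x = du x) →
      AEMeasurable ((cube y r).indicator h) → ∫⁻ x, ‖(cube y r).indicator h x‖ₑ ^ p < ⊤ →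
      lorentzN1 n (cube y r) h < ⊤ →
      ∀ W, 0 < W → (∫⁻ x in cube y r, (‖dU x‖ₑ ^ p + ENNReal.ofReal r⁻¹ ^ p * ‖U x‖ₑ ^ p)) ≤
        ENNReal.ofReal (W ^ p * r ^ n) →
      ∀ᵐ x ∂volume.restrict (cube y (r / 2)), U x ≤
        C * (r * W + r * W ^ (1 + 1 / (1 / s - 1 / p) * (1 / p - 1 / (n : ℝ)) * (1 - p / q)) +
          (lorentzN1 n (cube y r) h).toReal) := by
  obtain ⟨C, c, β, hC, hc, hβ, hit⟩ := exists_iteration_bound hn hm hs hsp hpq hpn hsq hL hQ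
  have hp0 : 0 < p := by linarith
  have hs0 : 0 < s := by linarith
  have hq0 : 0 < q := by linarith
  have hn0 : (0 : ℝ) < n := by rw [hn]; positivity
  have hw : 0 < 1 / p - 1 / (n : ℝ) := sub_pos.2 (one_div_lt_one_div_of_lt hp0 hpn)
  have hε : 0 < 1 / s - 1 / p := sub_pos.2 (one_div_lt_one_div_of_lt hs0 hsp)
  have hnm : (m : ℝ) + 1 = n := by rw [hn]; push_cast; ring
  rw [hnm] at hit
  have hθ : 0 < q * (1 / s - 1 / p) := by positivity
  set ε := 1 / s - 1 / p with hεd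
  set w := 1 / p - 1 / (n : ℝ) with hwd
  refine ⟨C * (c ^ (-w) + β ^ (-w / (q * ε)) + 1), by positivity, ?_⟩
  intro Ω μ h F du hS S hSc hSΩ U dU hU mU y r hr hcube hdu mh hhp hLor W hW hWb
  set N := W * r ^ ((n : ℝ) / p) with hN
  have hN0 : 0 < N := by positivity
  set b := β * (r ^ (n * q * (1 / s - 1 / q)) * N ^ (p - q)) with hb
  have hb0 : 0 < b := by positivity
  set t₀ := min (c * r ^ n) (b ^ (1 / (q * ε))) with ht
  have ht0 : 0 < t₀ := lt_min (by positivity) (by positivity)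
  have hNp : N ^ p = W ^ p * r ^ n := by
    rw [hN, Real.mul_rpow hW.le (by positivity), ← Real.rpow_mul hr.le, div_mul_cancel₀ _ hp0.ne',
      Real.rpow_natCast]
  have htb : t₀ ^ (q * ε) ≤ b := by
    refine (Real.rpow_le_rpow ht0.le (min_le_right _ _) hθ.le).trans (le_of_eq ?_)
    rw [← Real.rpow_mul hb0.le, one_div_mul_cancel hθ.ne', Real.rpow_one]
  have hmain := hit Ω μ h F du hS S hSc hSΩ U dU hU mU y r hr hcube hdu mh hhp hLor N hN0
    (by rw [hNp]; exact hWb) t₀ ht0 (min_le_left _ _) htb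
  set Lo := (lorentzN1 n (cube y r) h).toReal with hLo
  have hLo0 : 0 ≤ Lo := ENNReal.toReal_nonneg
  have hrn : r ^ n = r ^ (n : ℝ) := (Real.rpow_natCast r n).symm
  have e1 : N * (c * r ^ n) ^ (-w) = c ^ (-w) * (r * W) := by
    rw [hrn, Real.mul_rpow hc.le (by positivity), hN]
    have : r ^ ((n : ℝ) / p) * (r ^ (n : ℝ)) ^ (-w) = r := by
      rw [← Real.rpow_mul hr.le, ← Real.rpow_add hr]
      have : (n : ℝ) / p + n * -w = 1 := by rw [hwd]; field_simp; ring
      rw [this, Real.rpow_one]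
    linear_combination W * c ^ (-w) * this
  have e2 : N * (b ^ (1 / (q * ε))) ^ (-w) =
      β ^ (-w / (q * ε)) * (r * W ^ (1 + 1 / ε * w * (1 - p / q))) := by
    have hεe : 1 / s = ε + 1 / p := by rw [hεd]; ring
    rw [← Real.rpow_mul hb0.le, hb, hN, hεe]
    have hexp : ∀ {x : ℝ}, 0 < x → ∃ z, Real.exp z = x := fun hx => ⟨_, Real.exp_log hx⟩
    have hnw : (1 : ℝ) / n = 1 / p - w := by rw [hwd]; ring
    have hnn : (n : ℝ) = 1 / (1 / p - w) := by rw [← hnw]; simp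
    have hpw : 0 < 1 / p - w := by rw [← hnw]; positivity
    clear_value w ε
    obtain ⟨x, hx⟩ := hexp hr
    obtain ⟨z, hz⟩ := hexp hW
    obtain ⟨v, hv⟩ := hexp hβ
    rw [← hx, ← hz, ← hv]
    simp only [← Real.exp_mul, ← Real.exp_add]
    congr 1
    have hne : 1 - p * w ≠ 0 := by
      have : 1 - p * w = p * (1 / p - w) := by field_simp
      rw [this]; positivity
    rw [hnn]
    have : 1 / (1 / p - w) = p / (1 - p * w) := by
      field_simp
    rw [this]
    field_simp
    ring
  have e3 : t₀ ^ (-w) ≤ (c * r ^ n) ^ (-w) + (b ^ (1 / (q * ε))) ^ (-w) := by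
    rcases min_choice (c * r ^ n) (b ^ (1 / (q * ε))) with h' | h'
    · rw [ht, h']; exact le_add_of_nonneg_right (by positivity)
    · rw [ht, h']; exact le_add_of_nonneg_left (by positivity)
  have e4 := mul_le_mul_of_nonneg_left e3 hN0.le
  rw [mul_add, e1, e2] at e4
  filter_upwards [hmain] with x hx
  refine hx.trans ?_
  rw [mul_assoc C]
  refine mul_le_mul_of_nonneg_left ?_ hC.le
  have hβw : 0 < β ^ (-w / (q * ε)) := by positivity
  have hcw : 0 < c ^ (-w) := by positivity
  set T := r * W ^ (1 + 1 / ε * w * (1 - p / q)) with hT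
  have hT0 : 0 < T := by positivity
  have hrW : 0 < r * W := by positivity
  have : c ^ (-w) * (r * W) + β ^ (-w / (q * ε)) * T + Lo ≤
      (c ^ (-w) + β ^ (-w / (q * ε)) + 1) * (r * W + T + Lo) := by
    have a1 : 0 ≤ c ^ (-w) * (T + Lo) := by positivity
    have a2 : 0 ≤ β ^ (-w / (q * ε)) * (r * W + Lo) := by positivity
    nlinarith
  linarith

theorem StrongQMin.indicator_meas_and_int {n : ℕ} {Ω : Set (Eu n)} {p q L μ Q : ℝ}
    {h : Eu n → ℝ} {F : Eu n → Eu n → ℝ} {du : Eu n → Eu n} (hp : 0 < p)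
    (H : StrongQMin Ω p q L μ Q h F du) (mΩ : MeasurableSet Ω)
    (h0 : ∀ᵐ x ∂volume.restrict Ω, 0 ≤ h x) {B : Set (Eu n)}
    (mB : MeasurableSet B) (hB : B ⊆ Ω) :
    AEMeasurable (B.indicator h) ∧ ∫⁻ x, ‖B.indicator h x‖ₑ ^ p < ⊤ := by
  refine ⟨(aemeasurable_indicator_iff mB).2
    (H.meas_h.mono_measure (Measure.restrict_mono hB le_rfl)), lt_of_le_of_lt ?_ H.h_int⟩
  have e1 : ∀ x, ‖B.indicator h x‖ₑ ^ p ≤ Ω.indicator (fun x => ‖h x‖ₑ ^ p) x := fun x => by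
    by_cases hx : x ∈ B
    · rw [indicator_of_mem hx, indicator_of_mem (hB hx)]
    · rw [indicator_of_notMem hx]; simp [hp]
  refine (lintegral_mono e1).trans ?_
  rw [lintegral_indicator mΩ]
  refine lintegral_mono_ae ?_
  filter_upwards [h0] with x hx
  rw [Real.enorm_eq_ofReal hx]

theorem integral_le_of_rpow_mul_le {V a W p δ : ℝ} (hV : 0 < V) (ha : 0 ≤ a) (hp : 0 < p)
    (h : V ^ (-δ) * (V ^ (-(1 / p)) * a ^ (1 / p)) ≤ W) : a ≤ W ^ p * V * (V ^ δ) ^ p := by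
  have h0 : 0 ≤ V ^ (-δ) * (V ^ (-(1 / p)) * a ^ (1 / p)) := by positivity
  have h1 := Real.rpow_le_rpow h0 h hp.le
  rw [Real.mul_rpow (by positivity) (by positivity), Real.mul_rpow (by positivity) (by positivity),
    ← Real.rpow_mul hV.le (-(1 / p)), ← Real.rpow_mul ha, one_div_mul_cancel hp.ne', neg_mul,
    one_div_mul_cancel hp.ne', Real.rpow_one, Real.rpow_neg_one, Real.rpow_neg hV.le,
    Real.inv_rpow (by positivity)] at h1
  have hX : 0 < (V ^ δ) ^ p := by positivity
  calc a = (((V ^ δ) ^ p)⁻¹ * (V⁻¹ * a)) * (V * (V ^ δ) ^ p) := by field_simp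
    _ ≤ W ^ p * (V * (V ^ δ) ^ p) := mul_le_mul_of_nonneg_right h1 (by positivity)
    _ = _ := by ring

theorem lintegral_le_of_uW1p_le {n : ℕ} (hn : 0 < n) {p : ℝ} (hp : 1 ≤ p) :
    ∃ A : ℝ, 0 < A ∧ ∀ (x₀ : Eu n) (R r : ℝ), 0 < R → r = R / (2 * √n) →
      ∀ (u : Eu n → ℝ) (du : Eu n → Eu n),
      MemLp u (ENNReal.ofReal p) (volume.restrict (ball x₀ R)) →
      MemLp du (ENNReal.ofReal p) (volume.restrict (ball x₀ R)) →
      ∀ W, uW1p n p (ball x₀ R) u du ≤ W →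
      ∫⁻ x in ball x₀ R, (‖du x‖ₑ ^ p + ENNReal.ofReal r⁻¹ ^ p * ‖u x‖ₑ ^ p) ≤
        ENNReal.ofReal ((A * W) ^ p * r ^ n) := by
  have hp0 : 0 < p := by linarith
  have hn0 : (0 : ℝ) < n := by exact_mod_cast hn
  have : Nonempty (Fin n) := ⟨⟨0, hn⟩⟩
  set v := (volume (ball (0 : Eu n) 1)).toReal with hv
  have hv0 : 0 < v := ENNReal.toReal_pos (measure_ball_pos _ _ one_pos).ne' measure_ball_lt_top.ne
  set c := v * (2 * √n) ^ n * (1 + (2 * √n) ^ p * (v ^ (1 / (n : ℝ))) ^ p) with hc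
  have hc0 : 0 < c := by positivity
  refine ⟨c ^ (1 / p), by positivity, ?_⟩
  intro x₀ R r hR hr u du hu hdu W hW
  have hr0 : 0 < r := by rw [hr]; positivity
  set V := (volume (ball x₀ R)).toReal with hVd
  have hV : V = v * R ^ n := by
    rw [hVd, Measure.addHaar_ball volume x₀ hR.le, ENNReal.toReal_mul,
      ENNReal.toReal_ofReal (by positivity), finrank_euclideanSpace_fin]
    ring
  have hV0 : 0 < V := by rw [hV]; positivity
  set a := ∫ x in ball x₀ R, |u x| ^ p with ha
  set b := ∫ x in ball x₀ R, ‖du x‖ ^ p with hb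
  have ha0 : 0 ≤ a := integral_nonneg fun x => by positivity
  have hb0 : 0 ≤ b := integral_nonneg fun x => by positivity
  have hpt : (ENNReal.ofReal p).toReal = p := ENNReal.toReal_ofReal hp0.le
  have ea : ∫⁻ x in ball x₀ R, ‖u x‖ₑ ^ p = ENNReal.ofReal a := by
    have hi := hu.integrable_norm_rpow (by simpa using hp0) ENNReal.ofReal_ne_top
    rw [hpt] at hi
    simp only [← Real.norm_eq_abs] at ha
    rw [ha, ofReal_integral_eq_lintegral_ofReal hi (Eventually.of_forall fun x => by positivity)]
    refine lintegral_congr fun x => ?_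
    rw [← ENNReal.ofReal_rpow_of_nonneg (norm_nonneg _) hp0.le, ofReal_norm]
  have eb : ∫⁻ x in ball x₀ R, ‖du x‖ₑ ^ p = ENNReal.ofReal b := by
    have hi := hdu.integrable_norm_rpow (by simpa using hp0) ENNReal.ofReal_ne_top
    rw [hpt] at hi
    rw [hb, ofReal_integral_eq_lintegral_ofReal hi (Eventually.of_forall fun x => by positivity)]
    refine lintegral_congr fun x => ?_
    rw [← ENNReal.ofReal_rpow_of_nonneg (norm_nonneg _) hp0.le, ofReal_norm]
  have hW' : V ^ (-(1 / (n : ℝ))) * (V ^ (-(1 / p)) * a ^ (1 / p)) +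
    V ^ (-(1 / p)) * b ^ (1 / p) ≤ W := hW
  have hA0 : 0 ≤ V ^ (-(1 / (n : ℝ))) * (V ^ (-(1 / p)) * a ^ (1 / p)) := by positivity
  have hB0 : 0 ≤ V ^ (-(1 / p)) * b ^ (1 / p) := by positivity
  have hW0 : 0 ≤ W := by linarith
  have ba : a ≤ W ^ p * V * (V ^ (1 / (n : ℝ))) ^ p :=
    integral_le_of_rpow_mul_le hV0 ha0 hp0 (by linarith)
  have bb : b ≤ W ^ p * V * (V ^ (0 : ℝ)) ^ p :=
    integral_le_of_rpow_mul_le hV0 hb0 hp0 (by rw [neg_zero, Real.rpow_zero, one_mul]; linarith)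
  rw [Real.rpow_zero, Real.one_rpow, mul_one] at bb
  have mdu : AEMeasurable (fun x => ‖du x‖ₑ ^ p) (volume.restrict (ball x₀ R)) :=
    hdu.aestronglyMeasurable.enorm.pow_const p
  rw [lintegral_add_left' mdu, lintegral_const_mul' _ _ (by simp [hp0.le]), ea, eb,
    ENNReal.ofReal_rpow_of_nonneg (by positivity) hp0.le, ← ENNReal.ofReal_mul (by positivity),
    ← ENNReal.ofReal_add hb0 (by positivity)]
  refine ENNReal.ofReal_le_ofReal ?_
  have eV : V ^ (1 / (n : ℝ)) = v ^ (1 / (n : ℝ)) * R := by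
    rw [hV, Real.mul_rpow hv0.le (by positivity)]
    congr 1
    rw [one_div, Real.pow_rpow_inv_natCast hR.le hn.ne']
  have eR : R = 2 * √n * r := by rw [hr]; field_simp
  have hr1 : r⁻¹ ^ p * R ^ p = (2 * √n) ^ p := by
    rw [← Real.mul_rpow (by positivity) hR.le]
    congr 1; rw [eR]; field_simp
  have e1 : r⁻¹ ^ p * a ≤ W ^ p * V * ((2 * √n) ^ p * (v ^ (1 / (n : ℝ))) ^ p) := by
    refine (mul_le_mul_of_nonneg_left ba (by positivity)).trans (le_of_eq ?_)
    rw [eV, Real.mul_rpow (by positivity) hR.le, ← hr1]; ring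
  have e2 : (c ^ (1 / p) * W) ^ p * r ^ n =
      W ^ p * V * (1 + (2 * √n) ^ p * (v ^ (1 / (n : ℝ))) ^ p) := by
    rw [Real.mul_rpow (by positivity) hW0, ← Real.rpow_mul hc0.le, one_div_mul_cancel hp0.ne',
      Real.rpow_one, hV, hc]
    have : R ^ n = (2 * √n) ^ n * r ^ n := by rw [← mul_pow, ← eR]
    rw [this]; ring
  rw [e2]; linarith

theorem exists_upper_bound {n m : ℕ} (hn : n = m + 1) (hm : 1 ≤ m) {p q s L Q : ℝ}
    (hs : 1 ≤ s) (hsp : s < p) (hpq : p < q) (hpn : p < n)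
    (hsq : 1 / s = min (1 / q + 1 / m) 1) (hL : 1 ≤ L) (hQ : 1 ≤ Q) :
    ∃ C : ℝ, 0 < C ∧ ∀ (Ω : Set (Eu n)), IsOpen Ω → volume Ω ≠ ⊤ →
      ∀ (μ : ℝ) (h : Eu n → ℝ) (F : Eu n → Eu n → ℝ) (u : Eu n → ℝ)
      (du : Eu n → Eu n), StrongQMin Ω p q L μ Q h F du →
      (∀ᵐ x ∂volume.restrict Ω, 0 ≤ h x) → lorentzN1 n Ω h < ⊤ →
      IsWeakGradOn n Ω u du → LocallyIntegrableOn u Ω → LocallyIntegrableOn du Ω →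
      ∀ (x₀ : Eu n) (R : ℝ), 0 < R → closedBall x₀ R ⊆ Ω →
      ∀ᵐ x ∂volume.restrict (ball x₀ (R / 2)), u x ≤
        C * (R * uW1p n p (ball x₀ R) u du + R * uW1p n p (ball x₀ R) u du ^
          (1 + 1 / (1 / s - 1 / p) * (1 / p - 1 / (n : ℝ)) * (1 - p / q)) +
          (lorentzN1 n (ball x₀ R) h).toReal) := by
  have hp0 : 0 < p := by linarith
  have hp1 : 1 ≤ p := by linarith
  have hs0 : 0 < s := by linarith
  have hq0 : 0 < q := by linarith
  have hn1 : 0 < n := by omega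
  have hn0 : (0 : ℝ) < n := by exact_mod_cast hn1
  have hw : 0 < 1 / p - 1 / (n : ℝ) := sub_pos.2 (one_div_lt_one_div_of_lt hp0 hpn)
  have hε : 0 < 1 / s - 1 / p := sub_pos.2 (one_div_lt_one_div_of_lt hs0 hsp)
  have hpq' : 0 < 1 - p / q := sub_pos.2 ((div_lt_one hq0).2 hpq)
  obtain ⟨C, hC, hcube⟩ := exists_cube_bound hn hm hs hsp hpq hpn hsq hL hQ
  obtain ⟨A, hA, hW1⟩ := lintegral_le_of_uW1p_le hn1 hp1
  set γ := 1 + 1 / (1 / s - 1 / p) * (1 / p - 1 / (n : ℝ)) * (1 - p / q) with hγ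
  have hγ0 : 0 < γ := by positivity
  refine ⟨C * (A + A ^ γ + 1), by positivity, ?_⟩
  intro Ω hΩ hΩv μ h F u du H h0 hLor hwg hu hdu x₀ R hR hball
  set W₀ := uW1p n p (ball x₀ R) u du with hW₀
  have hW₀0 : 0 ≤ W₀ := by
    simp only [hW₀, uW1p, uLp]
    have : 0 ≤ ∫ x in ball x₀ R, |u x| ^ p := integral_nonneg fun x => by positivity
    have : 0 ≤ ∫ x in ball x₀ R, ‖du x‖ ^ p := integral_nonneg fun x => by positivity
    positivity
  obtain ⟨δ, hδ, hδs⟩ := (isCompact_closedBall x₀ R).exists_cthickening_subset_open hΩ hball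
  rw [cthickening_closedBall hδ.le hR.le] at hδs
  have hlpd := H.memLp (hs.trans_lt hsp) (isCompact_closedBall x₀ (δ + R)) hδs
  obtain ⟨U, dU, hU, hUe⟩ := exists_sob_eqOn hp1 hwg hu hdu hR (by linarith : R < δ + R) hδs hlpd
  set U' := hU.memLp.aestronglyMeasurable.mk U with hU'
  have hUU' : U =ᵐ[volume] U' := hU.memLp.aestronglyMeasurable.ae_eq_mk
  have mU' : Measurable U' := hU.memLp.aestronglyMeasurable.stronglyMeasurable_mk.measurable
  have hS' : Sob (ENNReal.ofReal p) U' dU := hU.congr hUU' (ae_eq_refl _)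
  have hbΩ : ball x₀ R ⊆ Ω := ball_subset_closedBall.trans hball
  have mu : MemLp u (ENNReal.ofReal p) (volume.restrict (ball x₀ R)) :=
    (hU.memLp.restrict _).ae_eq ((ae_restrict_iff' measurableSet_ball).2
      (Eventually.of_forall fun x hx => (hUe x hx).1))
  have mdu : MemLp du (ENNReal.ofReal p) (volume.restrict (ball x₀ R)) :=
    (hU.memLp_grad.restrict _).ae_eq ((ae_restrict_iff' measurableSet_ball).2
      (Eventually.of_forall fun x hx => (hUe x hx).2))
  set r := R / (2 * √n) with hr
  have hsn : 1 ≤ √(n : ℝ) := Real.one_le_sqrt.2 (by exact_mod_cast hn1)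
  have hr0 : 0 < r := by positivity
  have hrR : r ≤ R := by
    rw [hr]; exact div_le_self hR.le (by linarith)
  have hBfacts := H.indicator_meas_and_int hp0 hΩ.measurableSet h0 measurableSet_ball hbΩ
  have hΩfacts := H.indicator_meas_and_int hp0 hΩ.measurableSet h0 hΩ.measurableSet subset_rfl
  have hLB : lorentzN1 n (ball x₀ R) h < ⊤ :=
    (lorentzN1_mono hp0 hbΩ hΩv hΩfacts.1 hΩfacts.2).trans_lt hLor
  set Lo := (lorentzN1 n (ball x₀ R) h).toReal with hLo
  have hLo0 : 0 ≤ Lo := ENNReal.toReal_nonneg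
  have main : ∀ W, 0 < W → W₀ ≤ W → ∀ᵐ x ∂volume.restrict (ball x₀ (R / 2)), u x ≤
      C * (A + A ^ γ + 1) * (R * W + R * W ^ γ + Lo) := by
    intro W hW hWW
    have hI := hW1 x₀ R r hR rfl u du mu mdu W hWW
    set K := C * (A + A ^ γ + 1) * (R * W + R * W ^ γ + Lo) with hK
    rw [ae_restrict_iff' measurableSet_ball, ae_iff]
    refine measure_null_of_locally_null _ fun y hy => ?_
    simp only [Classical.not_imp, mem_ofPred_eq] at hy
    have hycube : cube y r ⊆ ball x₀ R := fun x hx => by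
      have h1 := dist_lt_of_mem_cube hr0.le hx
      have h2 : √(n : ℝ) * r = R / 2 := by rw [hr]; field_simp
      have h3 := hy.1
      rw [mem_ball] at h3 ⊢
      linarith [dist_triangle x y x₀]
    have mc := measurableSet_cube y r
    have hcf := H.indicator_meas_and_int hp0 hΩ.measurableSet h0 mc (hycube.trans hbΩ)
    have hLc : lorentzN1 n (cube y r) h ≤ lorentzN1 n (ball x₀ R) h :=
      lorentzN1_mono hp0 hycube measure_ball_lt_top.ne hBfacts.1 hBfacts.2
    have hI' : ∫⁻ x in cube y r, (‖dU x‖ₑ ^ p + ENNReal.ofReal r⁻¹ ^ p * ‖U' x‖ₑ ^ p) ≤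
        ENNReal.ofReal ((A * W) ^ p * r ^ n) := by
      refine le_trans (le_trans (le_of_eq ?_) (lintegral_mono_set hycube)) hI
      refine lintegral_congr_ae ?_
      rw [EventuallyEq, ae_restrict_iff' mc]
      filter_upwards [hUU'] with x hx hxc
      rw [← hx, (hUe x (hycube hxc)).1, (hUe x (hycube hxc)).2]
    have hb := hcube Ω μ h F du H (closedBall x₀ R) (isCompact_closedBall _ _) hball U' dU hS' mU'
      y r hr0 (hycube.trans ball_subset_closedBall) (fun x hx => (hUe x (hycube hx)).2) hcf.1 hcf.2
      (hLc.trans_lt hLB) (A * W) (by positivity) hI'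
    refine ⟨cube y (r / 2) ∩ {x | ¬(x ∈ ball x₀ (R / 2) → u x ≤ K)}, ?_, ?_⟩
    · exact inter_mem (mem_nhdsWithin_of_mem_nhds ((isOpen_cube y (r / 2)).mem_nhds
        (ball_subset_cube y _ (mem_ball_self (by positivity))))) self_mem_nhdsWithin
    · rw [ae_restrict_iff' (measurableSet_cube y _)] at hb
      refine measure_mono_null (fun x hx => ?_) (ae_iff.1 (hb.and hUU'))
      intro hcon
      have hxc := hx.1
      have hx2 := hx.2
      simp only [Classical.not_imp, mem_ofPred_eq] at hx2
      refine hx2.2 ?_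
      have h1 := hcon.1 hxc
      rw [← hcon.2, (hUe x (hycube (cube_mono (by linarith) hxc))).1] at h1
      refine h1.trans ?_
      rw [hK, mul_assoc C]
      refine mul_le_mul_of_nonneg_left ?_ hC.le
      have l1 : (lorentzN1 n (cube y r) h).toReal ≤ Lo := ENNReal.toReal_mono hLB.ne hLc
      rw [Real.mul_rpow hA.le hW.le]
      have hWγ : 0 < W ^ γ := by positivity
      have hAγ : 0 < A ^ γ := by positivity
      have m1 : r * (A * W) ≤ A * (R * W) := by
        have := mul_le_mul_of_nonneg_right hrR (show 0 ≤ A * W by positivity)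
        linarith
      have m2 : r * (A ^ γ * W ^ γ) ≤ A ^ γ * (R * W ^ γ) := by
        have := mul_le_mul_of_nonneg_right hrR (show 0 ≤ A ^ γ * W ^ γ by positivity)
        linarith
      have q1 : 0 ≤ A * (R * W ^ γ + Lo) := by positivity
      have q2 : 0 ≤ A ^ γ * (R * W + Lo) := by positivity
      have q3 : 0 ≤ R * W + R * W ^ γ := by positivity
      linarith
  have hall : ∀ᵐ x ∂volume.restrict (ball x₀ (R / 2)), ∀ i : ℕ, u x ≤
      C * (A + A ^ γ + 1) * (R * (W₀ + 1 / ((i : ℝ) + 1)) + R * (W₀ + 1 / ((i : ℝ) + 1)) ^ γ + Lo) :=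
    ae_all_iff.2 fun i => main _ (by positivity) (le_add_of_nonneg_right (by positivity))
  filter_upwards [hall] with x hx
  have hcont : Continuous fun W : ℝ => C * (A + A ^ γ + 1) * (R * W + R * W ^ γ + Lo) := by
    have : Continuous fun W : ℝ => W ^ γ := continuous_id.rpow_const fun _ => Or.inr hγ0.le
    fun_prop
  have hlim : Tendsto (fun i : ℕ => W₀ + 1 / ((i : ℝ) + 1)) atTop (𝓝 W₀) := by
    have := tendsto_one_div_add_atTop_nhds_zero_nat (𝕜 := ℝ)
    simpa using this.const_add W₀
  exact ge_of_tendsto' ((hcont.tendsto W₀).comp hlim) hx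

theorem IsQMinimizer.neg {n : ℕ} {Ω : Set (Eu n)} {f : Eu n → Eu n → ℝ} {Q : ℝ} {u : Eu n → ℝ}
    {du : Eu n → Eu n} (H : IsQMinimizer n Ω f Q u du) :
    IsQMinimizer n Ω (fun x z => f x (-z)) Q (fun x => -u x) (fun x => -du x) := by
  have hneg : ∀ {v : Eu n → ℝ} {dv : Eu n → Eu n}, IsWeakGradOn n Ω v dv →
      IsWeakGradOn n Ω (fun x => -v x) (fun x => -dv x) := by
    intro v dv hv φ h1 h2 h3 i
    have := hv φ h1 h2 h3 i
    simp only [neg_mul, PiLp.neg_apply, integral_neg]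
    rw [this]
  obtain ⟨h1, h2, h3, h4⟩ := H
  refine ⟨hneg h1, h2.neg, h3.neg, ?_⟩
  intro φ dφ k1 k2 k3 k4 k5
  have hts : tsupport (fun x => -φ x) = tsupport φ := by
    have : Function.support (fun x => -φ x) = Function.support φ := Function.support_neg φ
    simp only [tsupport, this]
  have := h4 (fun x => -φ x) (fun x => -dφ x) (hneg k1) k2.neg k3.neg (by rwa [hts])
    (by rwa [hts])
  rw [hts] at this
  simpa [add_comm] using this

end LocalBoundedness

/-- **A priori `L^∞` estimate for `Q`-minimizers (Theorem 3.2, estimate part).**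
For `1 ≤ p < n`, `p < q`, `ε := min{1/q + 1/(n−1), 1} − 1/p > 0` and
`g^{1/(p−1)} ∈ L^{n,1}(Ω)`, there is `c = c(L,n,p,q,Q) ≥ 1` such that every `Q`-minimizer
`u` of `F[u,A] = ∫_A f(x,∇u) dx` satisfies, for every ball `B_R(x₀) ⋐ Ω`,
`‖u‖_{L^∞(B_{R/2})} ≤ c (R‖u‖_{\underline W^{1,p}(B_R)}
  + R‖u‖_{\underline W^{1,p}(B_R)}^{1+(1/ε)(1/p−1/n)(1−p/q)} + ‖g^{1/(p−1)}‖_{L^{n,1}(B_R)})`. -/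
theorem apriori_linfty_estimate
    (n : ℕ) (hn : 2 ≤ n)
    (p q : ℝ) (hp : 1 ≤ p) (hpq : p < q) (hpn : p < (n : ℝ))
    (hε : 0 < min (1 / q + 1 / ((n : ℝ) - 1)) 1 - 1 / p)
    (L Q : ℝ) (hL : 1 ≤ L) (hQ : 1 ≤ Q) :
    ∃ c : ℝ, 1 ≤ c ∧
      ∀ (Ω : Set (EuclideanSpace ℝ (Fin n))),
        IsOpen Ω → IsConnected Ω → Bornology.IsBounded Ω →
        ∀ (g : EuclideanSpace ℝ (Fin n) → ℝ),
          (∀ᵐ x ∂volume.restrict Ω, 0 ≤ g x) →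
          AEMeasurable g (volume.restrict Ω) →
          IntegrableOn (fun x => g x ^ (p / (p - 1))) Ω →
          lorentzN1 n Ω (fun x => g x ^ (1 / (p - 1))) < ⊤ →
        ∀ (f : EuclideanSpace ℝ (Fin n) → EuclideanSpace ℝ (Fin n) → ℝ),
          (∀ z : EuclideanSpace ℝ (Fin n),
            AEMeasurable (fun x => f x z) (volume.restrict Ω)) →
          (∀ᵐ x ∂volume.restrict Ω, Continuous fun z => f x z) →
          (∀ᵐ x ∂volume.restrict Ω, ConvexOn ℝ univ fun z => f x z) →
        ∀ μ : ℝ, 0 ≤ μ →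
          (∀ᵐ x ∂volume.restrict Ω, ∀ z : EuclideanSpace ℝ (Fin n),
            ‖z‖ ^ p - g x ^ (p / (p - 1)) ≤ f x z ∧
              f x z ≤ L * ‖z‖ ^ q + g x ^ (p / (p - 1))) →
          (∀ᵐ x ∂volume.restrict Ω, ∀ z : EuclideanSpace ℝ (Fin n),
            f x (2 • z) ≤ μ + L * f x z) →
        ∀ (u : EuclideanSpace ℝ (Fin n) → ℝ)
          (du : EuclideanSpace ℝ (Fin n) → EuclideanSpace ℝ (Fin n)),
          IsQMinimizer n Ω f Q u du →
        ∀ (x₀ : EuclideanSpace ℝ (Fin n)) (R : ℝ), x₀ ∈ Ω → 0 < R →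
          closedBall x₀ R ⊆ Ω →
          ∀ᵐ x ∂volume.restrict (ball x₀ (R / 2)),
            |u x| ≤ c * (R * uW1p n p (ball x₀ R) u du +
              R * uW1p n p (ball x₀ R) u du ^
                (1 + (1 / (min (1 / q + 1 / ((n : ℝ) - 1)) 1 - 1 / p)) *
                  (1 / p - 1 / (n : ℝ)) * (1 - p / q)) +
              (lorentzN1 n (ball x₀ R) (fun x => g x ^ (1 / (p - 1)))).toReal) := by
  set σ := min (1 / q + 1 / ((n : ℝ) - 1)) 1 with hσ
  have hp0 : 0 < p := by linarith
  have hσ1 : σ ≤ 1 := min_le_right _ _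
  have hσ0 : 0 < σ := by
    have : 0 < 1 / p := by positivity
    linarith
  have hp1 : 1 < p := by
    have : 1 / p < 1 := by linarith
    rwa [div_lt_one hp0] at this
  obtain ⟨m, hm⟩ : ∃ m, n = m + 1 := ⟨n - 1, by omega⟩
  have hnm : (n : ℝ) - 1 = m := by rw [hm]; push_cast; ring
  have hs1 : 1 ≤ 1 / σ := by rw [le_div_iff₀ hσ0]; linarith
  have hsp : 1 / σ < p := by
    rw [div_lt_iff₀ hσ0]
    have : p * (1 / p) < p * σ := mul_lt_mul_of_pos_left (by linarith) hp0
    rwa [mul_one_div_cancel hp0.ne'] at this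
  have hsq : 1 / (1 / σ) = min (1 / q + 1 / (m : ℝ)) 1 := by rw [one_div_one_div, hσ, hnm]
  obtain ⟨C, hC, hmain⟩ := exists_upper_bound hm (by omega) hs1 hsp hpq hpn hsq hL hQ
  rw [one_div_one_div] at hmain
  refine ⟨max C 1, le_max_right _ _, ?_⟩
  intro Ω hΩ _ hΩb g hg0 hgm hgi hlor f hfm hfc hfx μ _ hb hd u du hu x₀ R _ hR hball
  have h0 : ∀ᵐ x ∂volume.restrict Ω, 0 ≤ g x ^ (1 / (p - 1)) := by
    filter_upwards [hg0] with x hx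
    exact Real.rpow_nonneg hx _
  have hΩv : volume Ω ≠ ⊤ := hΩb.measure_lt_top.ne
  have H1 := hu.strongQMin hn hp1 hL hQ hΩb hg0 hgm hgi hfm hfc hfx hb hd
  have H2 := hu.neg.strongQMin hn hp1 hL hQ hΩb hg0 hgm hgi (fun z => hfm (-z))
    (hfc.mono fun x hx => hx.comp continuous_neg)
    (hfx.mono fun x hx => by
      refine ⟨convex_univ, fun z _ w _ a b ha hb' hab => ?_⟩
      have := hx.2 (mem_univ (-z)) (mem_univ (-w)) ha hb' hab
      simpa [neg_add_rev, add_comm] using this)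
    (hb.mono fun x hx z => by simpa using hx (-z))
    (hd.mono fun x hx z => by simpa using hx (-z))
  have b1 := hmain Ω hΩ hΩv μ _ _ u du H1 h0 hlor hu.1 hu.2.1 hu.2.2.1 x₀ R hR hball
  have b2 := hmain Ω hΩ hΩv μ _ _ _ _ H2 h0 hlor hu.neg.1 hu.neg.2.1 hu.neg.2.2.1 x₀ R hR hball
  have hW : uW1p n p (ball x₀ R) (fun x => -u x) (fun x => -du x) =
      uW1p n p (ball x₀ R) u du := by
    simp only [uW1p, uLp, abs_neg, norm_neg]
  rw [hW] at b2
  have hW0 : 0 ≤ uW1p n p (ball x₀ R) u du := by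
    have : 0 ≤ ∫ x in ball x₀ R, |u x| ^ p := integral_nonneg fun x => by positivity
    have : 0 ≤ ∫ x in ball x₀ R, ‖du x‖ ^ p := integral_nonneg fun x => by positivity
    simp only [uW1p, uLp]
    positivity
  filter_upwards [b1, b2] with x h1 h2
  refine (abs_le'.2 ⟨h1, h2⟩).trans (mul_le_mul_of_nonneg_right (le_max_left _ _) ?_)
  positivity
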